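/- Nazarov–Sodin concentration for random spherical harmonics: Let f_n be the random spherical harmonic of degree n, i.e. a centered Gaussian field on the unit sphere S² ⊂ ℝ³ with almost surely continuous sample paths and covariance E[f_n(x) f_n(y)] = P_n(⟨x, y⟩), where P_n is the n-th Legendre polynomial. Let N(f_n) denote the number of nodal domains of f_n, i.e. the number of connected components of {x ∈ S² : f_n(x) ≠ 0}. Then there exists a constant a > 0 such that for every ε > 0 there exist constants C(ε) > 0 and c(ε) > 0, depending only on ε, with P(|N(f_n)/n² − a| > ε) ≤ C(ε) e^{−c(ε) n} for every n. -/

import Mathlib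

open MeasureTheory ProbabilityTheory Polynomial
open scoped RealInnerProductSpace

/-- The `n`-th Legendre polynomial, via the Rodrigues formula
`P_n(t) = (1/(2ⁿ n!)) (d/dt)ⁿ (t² − 1)ⁿ`. -/
noncomputable def legendrePoly (n : ℕ) : Polynomial ℝ :=
  Polynomial.C (1 / ((2 : ℝ) ^ n * (n.factorial : ℝ))) *
    (Polynomial.derivative^[n] ((Polynomial.X ^ 2 - 1) ^ n))

/-- The unit sphere `S² ⊂ ℝ³`. -/
abbrev Sphere2 : Set (EuclideanSpace ℝ (Fin 3)) :=
  Metric.sphere (0 : EuclideanSpace ℝ (Fin 3)) 1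

/-- The number of nodal domains of a function `g` on the sphere: the number of connected
components of `{x ∈ S² : g x ≠ 0}`. -/
noncomputable def sphereNodalCount (g : Sphere2 → ℝ) : ℕ :=
  Nat.card (ConnectedComponents {x : Sphere2 // g x ≠ 0})

/-! ### Gaussian concentration for Lipschitz functions -/

/-- Derivative of a function along the rotation path from `z.1` to `z.2`. -/
theorem hasDerivAt_comp_rotation {E : Type*} [NormedAddCommGroup E] [InnerProductSpace ℝ E]
    {f : E → ℝ} (hf1 : ContDiff ℝ 1 f) (s : ℝ) (z : E × E) (t : ℝ) :
    HasDerivAt (fun t => s * f (Real.cos (Real.pi / 2 * t) • z.1 + Real.sin (Real.pi / 2 * t) • z.2))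
      (s * (Real.pi / 2) * fderiv ℝ f (ContinuousLinearMap.rotation (Real.pi / 2 * t) z).1
        (ContinuousLinearMap.rotation (Real.pi / 2 * t) z).2) t := by
  have hc' : HasDerivAt (fun t => Real.pi / 2 * t) (Real.pi / 2) t := by
    simpa using (hasDerivAt_id t).const_mul (Real.pi / 2)
  have h1 : HasDerivAt
      (fun t => Real.cos (Real.pi / 2 * t) • z.1 + Real.sin (Real.pi / 2 * t) • z.2)
      ((Real.pi / 2) • (-Real.sin (Real.pi / 2 * t) • z.1 + Real.cos (Real.pi / 2 * t) • z.2)) t := by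
    have h := (hc'.cos.smul_const z.1).add (hc'.sin.smul_const z.2)
    rw [mul_comm _ (Real.pi / 2), mul_comm _ (Real.pi / 2), mul_smul, mul_smul, ← smul_add] at h
    exact h
  have h2 := ((hf1.differentiable one_ne_zero _).hasFDerivAt.comp_hasDerivAt t h1).const_mul s
  rw [map_smul, smul_eq_mul, ← mul_assoc] at h2
  exact h2

section GaussianConcentration

variable {E : Type*} [NormedAddCommGroup E] [InnerProductSpace ℝ E] [FiniteDimensional ℝ E]
  [MeasurableSpace E] [BorelSpace E]

theorem map_dual_stdGaussian (L : StrongDual ℝ E) :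
    (stdGaussian E).map L = gaussianReal 0 (‖L‖ ^ 2).toNNReal := by
  rw [IsGaussian.map_eq_gaussianReal L, variance_dual_stdGaussian, integral_strongDual_stdGaussian]

theorem integrable_exp_dual_stdGaussian (L : StrongDual ℝ E) :
    Integrable (fun x => Real.exp (L x)) (stdGaussian E) := by
  have h := integrable_exp_mul_gaussianReal (μ := 0) (v := (‖L‖ ^ 2).toNNReal) 1
  rw [← map_dual_stdGaussian L] at h
  simpa [Function.comp_def] using h.comp_measurable L.continuous.measurable

theorem integral_exp_dual_stdGaussian (L : StrongDual ℝ E) :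
    ∫ x, Real.exp (L x) ∂(stdGaussian E) = Real.exp (‖L‖ ^ 2 / 2) := by
  have h := mgf_gaussianReal (map_dual_stdGaussian L) 1
  simpa [mgf] using h

theorem lintegral_exp_dual_stdGaussian (L : StrongDual ℝ E) :
    ∫⁻ x, ENNReal.ofReal (Real.exp (L x)) ∂(stdGaussian E) =
      ENNReal.ofReal (Real.exp (‖L‖ ^ 2 / 2)) := by
  rw [← ofReal_integral_eq_lintegral_ofReal (integrable_exp_dual_stdGaussian L)
    (ae_of_all _ fun x => (Real.exp_pos _).le), integral_exp_dual_stdGaussian]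

theorem lipschitz_integrable_stdGaussian {f : E → ℝ} {K : NNReal} (hf : LipschitzWith K f) :
    Integrable f (stdGaussian E) := by
  have h1 : Integrable (fun x : E => ‖f 0‖ + K * ‖x‖) (stdGaussian E) :=
    (integrable_const _).add ((IsGaussian.integrable_id (μ := stdGaussian E)).norm.const_mul _)
  refine h1.mono' hf.continuous.aestronglyMeasurable (ae_of_all _ fun x => ?_)
  have := hf.norm_sub_le x 0
  rw [sub_zero] at this
  calc ‖f x‖ = ‖f 0 + (f x - f 0)‖ := by congr 1; ring
    _ ≤ _ := (norm_add_le _ _).trans (by gcongr)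

/-- A Lipschitz function is uniformly approximated by `C¹` functions with the same constant. -/
theorem exists_contDiff_lipschitz_approx {f : E → ℝ} {K : NNReal} (hf : LipschitzWith K f)
    {ε : ℝ} (hε : 0 < ε) :
    ∃ g : E → ℝ, ContDiff ℝ 1 g ∧ LipschitzWith K g ∧ ∀ x, |g x - f x| ≤ K * ε := by
  let φ : ContDiffBump (0 : E) := ⟨ε / 2, ε, half_pos hε, half_lt_self hε⟩
  obtain ⟨μ, hμ⟩ : ∃ μ : Measure E, μ = Measure.addHaar := ⟨_, rfl⟩
  have : μ.IsAddHaarMeasure := hμ ▸ inferInstance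
  let g : E → ℝ := fun x => ∫ t, φ.normed μ t * f (x - t) ∂μ
  have hg : g = (convolution (φ.normed μ) f (ContinuousLinearMap.lsmul ℝ ℝ) μ) := by
    ext x; simp [g, convolution]
  have hφ : Integrable (φ.normed μ) μ := φ.integrable_normed
  have hInt : ∀ x, Integrable (fun t => φ.normed μ t * f (x - t)) μ := fun x =>
    (φ.continuous_normed.mul (hf.continuous.comp (continuous_const.sub continuous_id))).integrable_of_hasCompactSupport
      (φ.hasCompactSupport_normed.mul_right)
  refine ⟨g, ?_, ?_, ?_⟩
  · rw [hg]
    exact (φ.hasCompactSupport_normed (μ := μ)).contDiff_convolution_left _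
      (φ.contDiff_normed (μ := μ))
      (hf.continuous.locallyIntegrable (μ := μ))
  · refine LipschitzWith.of_dist_le_mul fun x y => ?_
    rw [dist_eq_norm, ← integral_sub (hInt x) (hInt y)]
    calc ‖∫ t, (φ.normed μ t * f (x - t) - φ.normed μ t * f (y - t)) ∂μ‖
        ≤ ∫ t, φ.normed μ t * (K * dist x y) ∂μ := by
          refine norm_integral_le_of_norm_le (hφ.mul_const _)
            (ae_of_all _ fun t => ?_)
          rw [← mul_sub, norm_mul, Real.norm_of_nonneg (φ.nonneg_normed t)]
          refine mul_le_mul_of_nonneg_left ?_ (φ.nonneg_normed t)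
          simpa [dist_eq_norm] using hf.dist_le_mul (x - t) (y - t)
      _ = K * dist x y := by
          rw [integral_mul_const, φ.integral_normed, one_mul]
  · intro x
    rw [← Real.dist_eq, hg]
    refine φ.dist_normed_convolution_le (μ := μ) hf.continuous.aestronglyMeasurable fun y hy => ?_
    refine (hf.dist_le_mul y x).trans ?_
    gcongr
    exact (Metric.mem_ball.1 hy).le

theorem lintegral_exp_sub_le_of_contDiff {f : E → ℝ} {K : NNReal} (hf : LipschitzWith K f)
    (hf1 : ContDiff ℝ 1 f) (s : ℝ) :
    ∫⁻ z : E × E, ENNReal.ofReal (Real.exp (s * (f z.2 - f z.1)))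
        ∂((stdGaussian E).prod (stdGaussian E)) ≤
      ENNReal.ofReal (Real.exp ((s * (Real.pi / 2) * K) ^ 2 / 2)) := by
  set μ := (stdGaussian E).prod (stdGaussian E) with hμ
  set ν : Measure ℝ := volume.restrict (Set.Ioc 0 1) with hν
  have : IsProbabilityMeasure ν := ⟨by simp [hν]⟩
  obtain ⟨F, hFd⟩ : ∃ F : E × E → ℝ, F = fun z => s * (Real.pi / 2) * fderiv ℝ f z.1 z.2 :=
    ⟨_, rfl⟩
  have hcd : Continuous fun z : E × E => fderiv ℝ f z.1 z.2 :=
    ((hf1.continuous_fderiv one_ne_zero).comp continuous_fst).clm_apply continuous_snd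
  have hF : Continuous F := hFd ▸ continuous_const.mul hcd
  obtain ⟨r, hr⟩ : ∃ r : ℝ → E × E → E × E,
    r = fun t z => ContinuousLinearMap.rotation (Real.pi / 2 * t) z := ⟨_, rfl⟩
  have hrot : Continuous fun p : ℝ × (E × E) => r p.1 p.2 := by
    have : Continuous fun p : ℝ × (E × E) => (Real.cos (Real.pi / 2 * p.1) • p.2.1 +
      Real.sin (Real.pi / 2 * p.1) • p.2.2,
      -Real.sin (Real.pi / 2 * p.1) • p.2.1 + Real.cos (Real.pi / 2 * p.1) • p.2.2) := by fun_prop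
    rw [hr]
    exact this
  have hFr : Continuous fun p : ℝ × (E × E) => F (r p.1 p.2) :=
    hF.comp hrot
  have hJm : Measurable fun p : ℝ × (E × E) =>
      ENNReal.ofReal (Real.exp (F (r p.1 p.2))) :=
    (ENNReal.continuous_ofReal.comp (Real.continuous_exp.comp hFr)).measurable
  -- the pointwise Jensen bound
  have key : ∀ z : E × E, ENNReal.ofReal (Real.exp (s * (f z.2 - f z.1))) ≤
      ∫⁻ t, ENNReal.ofReal (Real.exp (F (r t z))) ∂ν := by
    intro z
    have hd : ∀ t, HasDerivAt (fun t => s * f (Real.cos (Real.pi / 2 * t) • z.1 + Real.sin (Real.pi / 2 * t) • z.2))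
        (F (r t z)) t := fun t => by
      rw [hFd, hr]; exact hasDerivAt_comp_rotation hf1 s z t
    have hcont : Continuous fun t => F (r t z) :=
      hFr.comp (g := fun p : ℝ × (E × E) => F (r p.1 p.2))
        (Continuous.prodMk_left z)
    have hI : s * (f z.2 - f z.1) = ∫ t, F (r t z) ∂ν := by
      have h1 := intervalIntegral.integral_eq_sub_of_hasDerivAt (a := 0) (b := 1)
        (fun t _ => hd t) (hcont.intervalIntegrable 0 1)
      rw [intervalIntegral.integral_of_le zero_le_one] at h1
      refine Eq.trans ?_ h1.symm
      simp
      ring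
    have hInt : ∀ {h : ℝ → ℝ}, Continuous h → Integrable h ν := fun hh =>
      (hh.integrableOn_Icc (a := 0) (b := 1)).mono_set Set.Ioc_subset_Icc_self
    have hec : Continuous fun t => Real.exp (F (r t z)) := Real.continuous_exp.comp hcont
    rw [hI, ← ofReal_integral_eq_lintegral_ofReal (hInt hec)
      (ae_of_all _ fun x => (Real.exp_pos _).le)]
    refine ENNReal.ofReal_le_ofReal ?_
    have hj := convexOn_exp.map_integral_le (μ := ν)
      (f := fun t => F (r t z)) Real.continuous_exp.continuousOn
      isClosed_univ (ae_of_all _ fun _ => Set.mem_univ _) (hInt hcont)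
      (hInt hec)
    exact hj
  calc _ ≤ ∫⁻ z, ∫⁻ t, ENNReal.ofReal (Real.exp (F (r t z))) ∂ν ∂μ :=
        lintegral_mono key
    _ = ∫⁻ t, ∫⁻ z, ENNReal.ofReal (Real.exp (F (r t z))) ∂μ ∂ν :=
        lintegral_lintegral_swap
          (f := fun z t => ENNReal.ofReal (Real.exp (F (r t z))))
          (hJm.comp measurable_swap).aemeasurable
    _ = ∫⁻ t, ∫⁻ z, ENNReal.ofReal (Real.exp (F z)) ∂μ ∂ν := by
        congr 1
        ext t
        have h0 : (stdGaussian E)[id] = 0 := by simp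
        conv_rhs => rw [hμ, ← IsGaussian.map_rotation_eq_self h0 (Real.pi / 2 * t)]
        rw [lintegral_map (by fun_prop) (by fun_prop), hr]
    _ = ∫⁻ z, ENNReal.ofReal (Real.exp (F z)) ∂μ := by simp
    _ = ∫⁻ x, ∫⁻ y, ENNReal.ofReal (Real.exp (((s * (Real.pi / 2)) • fderiv ℝ f x) y))
          ∂(stdGaussian E) ∂(stdGaussian E) := by
        rw [hμ, lintegral_prod _ (by fun_prop), hFd]
        rfl
    _ ≤ ∫⁻ x : E, ENNReal.ofReal (Real.exp ((s * (Real.pi / 2) * K) ^ 2 / 2)) ∂(stdGaussian E) := by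
        refine lintegral_mono fun x => ?_
        rw [lintegral_exp_dual_stdGaussian]
        refine ENNReal.ofReal_le_ofReal (Real.exp_le_exp.2 ?_)
        rw [norm_smul, mul_pow, mul_pow, Real.norm_eq_abs, sq_abs]
        gcongr
        exact norm_fderiv_le_of_lipschitz ℝ hf
    _ = _ := by simp

theorem lintegral_exp_sub_le_of_lipschitz {f : E → ℝ} {K : NNReal} (hf : LipschitzWith K f)
    (s : ℝ) :
    ∫⁻ z : E × E, ENNReal.ofReal (Real.exp (s * (f z.2 - f z.1)))
        ∂((stdGaussian E).prod (stdGaussian E)) ≤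
      ENNReal.ofReal (Real.exp ((s * (Real.pi / 2) * K) ^ 2 / 2)) := by
  have h : ∀ ε : ℝ, 0 < ε → ∫⁻ z : E × E, ENNReal.ofReal (Real.exp (s * (f z.2 - f z.1)))
        ∂((stdGaussian E).prod (stdGaussian E)) ≤
      ENNReal.ofReal (Real.exp (|s| * (2 * K * ε)) *
        Real.exp ((s * (Real.pi / 2) * K) ^ 2 / 2)) := by
    intro ε hε
    obtain ⟨g, hg1, hgK, hgf⟩ := exists_contDiff_lipschitz_approx hf hε
    rw [ENNReal.ofReal_mul (Real.exp_pos _).le]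
    refine le_trans ?_ (mul_le_mul_right (lintegral_exp_sub_le_of_contDiff hgK hg1 s) _)
    rw [← lintegral_const_mul' _ _ ENNReal.ofReal_ne_top]
    refine lintegral_mono fun z => ?_
    rw [← ENNReal.ofReal_mul (Real.exp_pos _).le, ← Real.exp_add]
    refine ENNReal.ofReal_le_ofReal (Real.exp_le_exp.2 ?_)
    have h1 : s * ((f z.2 - f z.1) - (g z.2 - g z.1)) ≤ |s| * (2 * K * ε) := by
      refine (le_abs_self _).trans ?_
      rw [abs_mul]
      gcongr
      have h2 := hgf z.1
      have h3 := hgf z.2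
      rw [abs_le] at *
      constructor <;> linarith [h2.1, h2.2, h3.1, h3.2]
    linarith
  have ht : Filter.Tendsto (fun ε : ℝ => ENNReal.ofReal (Real.exp (|s| * (2 * K * ε)) *
        Real.exp ((s * (Real.pi / 2) * K) ^ 2 / 2))) (nhdsWithin 0 (Set.Ioi 0))
      (nhds (ENNReal.ofReal (Real.exp ((s * (Real.pi / 2) * K) ^ 2 / 2)))) := by
    refine Filter.Tendsto.mono_left ?_ nhdsWithin_le_nhds
    have : Continuous fun ε : ℝ => ENNReal.ofReal (Real.exp (|s| * (2 * K * ε)) *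
        Real.exp ((s * (Real.pi / 2) * K) ^ 2 / 2)) :=
      ENNReal.continuous_ofReal.comp (by fun_prop)
    simpa using this.tendsto 0
  exact ge_of_tendsto ht (by filter_upwards [self_mem_nhdsWithin] with ε hε using h ε hε)

theorem hasSubgaussianMGF_of_lipschitz {f : E → ℝ} {K : NNReal} (hf : LipschitzWith K f) :
    HasSubgaussianMGF (fun x => f x - ∫ y, f y ∂(stdGaussian E))
      ((Real.pi / 2 * K) ^ 2).toNNReal (stdGaussian E) := by
  set γ := stdGaussian E with hγ
  set m := ∫ y, f y ∂γ with hm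
  have hfi : Integrable f γ := lipschitz_integrable_stdGaussian hf
  have hfm : Measurable f := hf.continuous.measurable
  have main : ∀ s : ℝ, ∫⁻ x, ENNReal.ofReal (Real.exp (s * (f x - m))) ∂γ ≤
      ENNReal.ofReal (Real.exp ((s * (Real.pi / 2) * K) ^ 2 / 2)) := by
    intro s
    have h1 := lintegral_exp_sub_le_of_lipschitz hf s
    have h2 : ∫⁻ z : E × E, ENNReal.ofReal (Real.exp (s * (f z.2 - f z.1))) ∂(γ.prod γ) =
        (∫⁻ x, ENNReal.ofReal (Real.exp (-s * (f x - m))) ∂γ) *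
        ∫⁻ y, ENNReal.ofReal (Real.exp (s * (f y - m))) ∂γ := by
      rw [← lintegral_prod_mul (by fun_prop) (by fun_prop)]
      refine lintegral_congr fun z => ?_
      rw [← ENNReal.ofReal_mul (Real.exp_pos _).le, ← Real.exp_add]
      congr 2; ring
    rw [← hγ, h2] at h1
    have h3 : 1 ≤ ∫⁻ x, ENNReal.ofReal (Real.exp (-s * (f x - m))) ∂γ := by
      have hi : Integrable (fun x => 1 + -s * (f x - m)) γ :=
        (integrable_const _).add ((hfi.sub (integrable_const _)).const_mul _)
      have h4 : ∫ x, (1 + -s * (f x - m)) ∂γ = 1 := by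
        have hi2 : Integrable (fun x => f x - m) γ := hfi.sub (integrable_const _)
        rw [integral_add (integrable_const _) (hi2.const_mul _),
          integral_const_mul, integral_sub hfi (integrable_const _)]
        simp [hm]
      by_cases hE : Integrable (fun x => Real.exp (-s * (f x - m))) γ
      · rw [← ofReal_integral_eq_lintegral_ofReal hE (ae_of_all _ fun x => (Real.exp_pos _).le),
          ENNReal.one_le_ofReal, ← h4]
        exact integral_mono hi hE fun x => by
          simpa [add_comm] using Real.add_one_le_exp (-s * (f x - m))
      · by_contra! hlt
        refine hE ⟨by fun_prop, ?_⟩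
        rw [hasFiniteIntegral_iff_ofReal (ae_of_all _ fun x => (Real.exp_pos _).le)]
        exact hlt.trans ENNReal.one_lt_top
    exact (le_mul_of_one_le_left zero_le h3).trans h1
  have hInt : ∀ s : ℝ, Integrable (fun x => Real.exp (s * (f x - m))) γ := by
    intro s
    refine ⟨by fun_prop, ?_⟩
    rw [hasFiniteIntegral_iff_ofReal (ae_of_all _ fun x => (Real.exp_pos _).le)]
    exact (main s).trans_lt ENNReal.ofReal_lt_top
  refine ⟨hInt, fun s => ?_⟩
  have h := main s
  rw [← ofReal_integral_eq_lintegral_ofReal (hInt s) (ae_of_all _ fun x => (Real.exp_pos _).le),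
    ENNReal.ofReal_le_ofReal_iff (Real.exp_pos _).le] at h
  refine h.trans (le_of_eq ?_)
  rw [Real.coe_toNNReal _ (sq_nonneg _)]
  congr 1; ring

/-- Gaussian concentration for Lipschitz functions. -/
theorem gaussian_lipschitz_concentration {f : E → ℝ} {K : NNReal} (hf : LipschitzWith K f)
    {t : ℝ} (ht : 0 ≤ t) :
    (stdGaussian E).real {x | t ≤ |f x - ∫ y, f y ∂(stdGaussian E)|} ≤
      2 * Real.exp (-t ^ 2 / (2 * (Real.pi / 2 * K) ^ 2)) := by
  have h := hasSubgaussianMGF_of_lipschitz hf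
  have h1 := h.measure_ge_le ht
  have h2 := h.neg.measure_ge_le ht
  rw [Real.coe_toNNReal _ (sq_nonneg _)] at h1 h2
  have : {x | t ≤ |f x - ∫ y, f y ∂(stdGaussian E)|} ⊆
      {x | t ≤ f x - ∫ y, f y ∂(stdGaussian E)} ∪
      {x | t ≤ (-fun x => f x - ∫ y, f y ∂(stdGaussian E)) x} := by
    intro x hx
    simp only [Set.mem_ofPred_eq, le_abs] at hx
    exact hx
  refine (measureReal_mono this).trans ((measureReal_union_le _ _).trans ?_)
  linarith

end GaussianConcentration

/-! ### Counting excursion components inside a set -/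

section Components

variable {X : Type*} [TopologicalSpace X]

/-- A preconnected set meeting `U` but not the frontier of `U` lies in `U`. -/
theorem IsPreconnected.subset_of_disjoint_frontier {K U : Set X} (hK : IsPreconnected K)
    (hKU : (K ∩ U).Nonempty) (hd : Disjoint K (frontier U)) : K ⊆ U := by
  have hcov : K ⊆ interior U ∪ (closure U)ᶜ := fun x hx => by
    by_cases h : x ∈ closure U
    · exact Or.inl (by_contra fun hi => Set.disjoint_left.1 hd hx ⟨h, hi⟩)
    · exact Or.inr h
  obtain ⟨y, hyK, hyU⟩ := hKU
  intro x hx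
  by_contra hxU
  obtain ⟨z, -, hz1, hz2⟩ := hK _ _ isOpen_interior isClosed_closure.isOpen_compl hcov
    ⟨y, hyK, (hcov hyK).resolve_right fun h => h (subset_closure hyU)⟩
    ⟨x, hx, (hcov hx).resolve_left fun h => hxU (interior_subset h)⟩
  exact hz2 (subset_closure (interior_subset hz1))

theorem lt_of_mem_connectedComponentIn {f : X → ℝ} {a : ℝ} {p q : X}
    (h : q ∈ connectedComponentIn {x | a < f x} p) : a < f q :=
  connectedComponentIn_subset {x | a < f x} p h

/-- The connected components of `{-s < f}` contained in `D` on which `f` somewhere exceeds `s`. -/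
def compsIn (f : X → ℝ) (s : ℝ) (D : Set X) : Set (Set X) :=
  {C | C ⊆ D ∧ ∃ p, s < f p ∧ p ∈ C ∧ C = connectedComponentIn {x | -s < f x} p}

theorem compsIn_mono_set (f : X → ℝ) (s : ℝ) {D D' : Set X} (h : D ⊆ D') :
    compsIn f s D ⊆ compsIn f s D' := fun _ hC => ⟨hC.1.trans h, hC.2⟩

theorem compsIn_eq_of_mem {f : X → ℝ} {s : ℝ} {D D' : Set X} {C C' : Set X} (hC : C ∈ compsIn f s D)
    (hC' : C' ∈ compsIn f s D') {x : X} (hx : x ∈ C) (hx' : x ∈ C') : C = C' := by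
  obtain ⟨-, p, -, -, rfl⟩ := hC
  obtain ⟨-, q, -, -, rfl⟩ := hC'
  rw [connectedComponentIn_eq hx, connectedComponentIn_eq hx']

theorem isPreconnected_of_mem_compsIn {f : X → ℝ} {s : ℝ} {D : Set X} {C : Set X}
    (hC : C ∈ compsIn f s D) : IsPreconnected C := by
  obtain ⟨-, p, -, -, rfl⟩ := hC
  exact isPreconnected_connectedComponentIn

theorem subset_of_mem_compsIn {f : X → ℝ} {s : ℝ} {D : Set X} {C : Set X}
    (hC : C ∈ compsIn f s D) : C ⊆ {x | -s < f x} := by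
  obtain ⟨-, p, -, -, rfl⟩ := hC
  exact connectedComponentIn_subset _ _

/-- A connected subset of `{-s < f}` meeting a component lies in the component. -/
theorem subset_of_mem_compsIn_of_isPreconnected {f : X → ℝ} {s : ℝ} {D : Set X} {C K : Set X}
    (hC : C ∈ compsIn f s D) (hK : IsPreconnected K) (hKf : K ⊆ {x | -s < f x}) {x : X}
    (hxK : x ∈ K) (hxC : x ∈ C) : K ⊆ C := by
  obtain ⟨-, p, -, -, rfl⟩ := hC
  rw [connectedComponentIn_eq hxC]
  exact hK.subset_connectedComponentIn hxK hKf

theorem isOpen_of_mem_compsIn [LocallyConnectedSpace X] {f : X → ℝ} (hf : Continuous f) {s : ℝ}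
    {D : Set X} {C : Set X} (hC : C ∈ compsIn f s D) : IsOpen C := by
  obtain ⟨-, p, -, -, rfl⟩ := hC
  exact (isOpen_lt continuous_const hf).connectedComponentIn

theorem mem_of_mem_closure_of_mem_compsIn [LocallyConnectedSpace X] {f : X → ℝ}
    (hf : Continuous f) {s : ℝ} {D : Set X} {C : Set X} (hC : C ∈ compsIn f s D) {q : X}
    (hq : q ∈ closure C) (hqf : -s < f q) : q ∈ C := by
  have hO : IsOpen (connectedComponentIn {x | -s < f x} q) :=
    (isOpen_lt continuous_const hf).connectedComponentIn
  have hqq : q ∈ connectedComponentIn {x | -s < f x} q := mem_connectedComponentIn hqf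
  obtain ⟨y, hy1, hy2⟩ := mem_closure_iff.1 hq _ hO hqq
  exact subset_of_mem_compsIn_of_isPreconnected hC isPreconnected_connectedComponentIn
    (connectedComponentIn_subset _ _) hy1 hy2 hqq

/-- On the frontier of an excursion component the function equals the level. -/
theorem eq_of_mem_frontier_compsIn [LocallyConnectedSpace X] {f : X → ℝ}
    (hf : Continuous f) {s : ℝ} {D : Set X} {C : Set X} (hC : C ∈ compsIn f s D) {q : X}
    (hq : q ∈ frontier C) : f q = -s := by
  have hO := isOpen_of_mem_compsIn hf hC
  rw [hO.frontier_eq] at hq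
  refine le_antisymm (not_lt.1 fun h => hq.2 (mem_of_mem_closure_of_mem_compsIn hf hC hq.1 h)) ?_
  have : closure C ⊆ {x | -s ≤ f x} :=
    closure_minimal (fun x hx => le_of_lt (α := ℝ) (subset_of_mem_compsIn hC hx))
      (isClosed_le continuous_const hf)
  exact this hq.1

/-- Components do not disappear under a small perturbation. -/
theorem encard_compsIn_add_le [LocallyConnectedSpace X] {f g : X → ℝ} (hf : Continuous f)
    {s δ : ℝ} (hs : 0 ≤ s) {D : Set X} (hD : IsClosed D) (h : ∀ x ∈ D, |f x - g x| ≤ δ) :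
    (compsIn f (s + δ) D).encard ≤ (compsIn g s D).encard := by
  have key : ∀ U : compsIn f (s + δ) D, ∃ V ∈ compsIn g s D, V ⊆ U.1 := by
    rintro ⟨U, hU⟩
    obtain ⟨hUD, p, hp, hpU, hUeq⟩ := id hU
    have hgp : s < g p := by have := abs_le.1 (h p (hUD hpU)); linarith
    have hgp' : -s < g p := by linarith
    have hsub : connectedComponentIn {x | -s < g x} p ⊆ U := by
      refine isPreconnected_connectedComponentIn.subset_of_disjoint_frontier
        ⟨p, mem_connectedComponentIn hgp', hpU⟩ (Set.disjoint_left.2 fun q hq1 hq2 => ?_)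
      have hqD : q ∈ D := closure_minimal hUD hD (frontier_subset_closure hq2)
      have h1 := eq_of_mem_frontier_compsIn hf hU hq2
      have h2 := lt_of_mem_connectedComponentIn hq1
      have := abs_le.1 (h q hqD)
      linarith
    exact ⟨_, ⟨hsub.trans hUD, p, hgp, mem_connectedComponentIn hgp', rfl⟩, hsub⟩
  choose V hV hVU using key
  refine Function.Embedding.encard_le ⟨fun U => ⟨V U, hV U⟩, fun U U' hUU' => ?_⟩
  have hVV : V U = V U' := by simpa using hUU'
  obtain ⟨-, p, -, hp, -⟩ := hV U
  exact Subtype.ext (compsIn_eq_of_mem U.2 U'.2 (hVU U hp) (hVU U' (hVV ▸ hp)))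

theorem encard_compsIn_antitone [LocallyConnectedSpace X] {f : X → ℝ} (hf : Continuous f)
    {s s' : ℝ} (hs : 0 ≤ s) (hss : s ≤ s') {D : Set X} (hD : IsClosed D) :
    (compsIn f s' D).encard ≤ (compsIn f s D).encard := by
  have := encard_compsIn_add_le (g := f) (δ := s' - s) hf hs hD (fun x _ => by simpa using hss)
  rwa [add_sub_cancel] at this

/-! ### The Lipschitz counting functional -/

/-- The largest level (truncated at `s₀`) at which there are still `k` components. -/
noncomputable def compLevel (s₀ : ℝ) (k : ℕ) (f : X → ℝ) (D : Set X) : ℝ :=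
  sSup {s | 0 ≤ s ∧ s ≤ s₀ ∧ (s = 0 ∨ (k : ℕ∞) ≤ (compsIn f s D).encard)}

theorem bddAbove_compLevel (s₀ : ℝ) (k : ℕ) (f : X → ℝ) (D : Set X) :
    BddAbove {s | 0 ≤ s ∧ s ≤ s₀ ∧ (s = 0 ∨ (k : ℕ∞) ≤ (compsIn f s D).encard)} :=
  ⟨s₀, fun _ hs => hs.2.1⟩

theorem compLevel_nonneg (s₀ : ℝ) (k : ℕ) (f : X → ℝ) (D : Set X) : 0 ≤ compLevel s₀ k f D :=
  Real.sSup_nonneg fun _ hs => hs.1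

theorem compLevel_le {s₀ : ℝ} (hs₀ : 0 ≤ s₀) (k : ℕ) (f : X → ℝ) (D : Set X) :
    compLevel s₀ k f D ≤ s₀ :=
  csSup_le ⟨0, le_rfl, hs₀, Or.inl rfl⟩ fun _ hs => hs.2.1

theorem compLevel_eq {s₀ : ℝ} (hs₀ : 0 ≤ s₀) {k : ℕ} {f : X → ℝ} {D : Set X}
    (h : (k : ℕ∞) ≤ (compsIn f s₀ D).encard) : compLevel s₀ k f D = s₀ :=
  le_antisymm (compLevel_le hs₀ _ _ _)
    (le_csSup (bddAbove_compLevel s₀ k f D) ⟨hs₀, le_rfl, Or.inr h⟩)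

theorem compLevel_eq_zero [LocallyConnectedSpace X] {s₀ : ℝ} (hs₀ : 0 ≤ s₀) {k : ℕ} {f : X → ℝ}
    (hf : Continuous f) {D : Set X} (hD : IsClosed D)
    (h : (compsIn f 0 D).encard < k) : compLevel s₀ k f D = 0 := by
  refine le_antisymm (csSup_le ⟨0, le_rfl, hs₀, Or.inl rfl⟩ ?_) (compLevel_nonneg _ _ _ _)
  rintro s ⟨h0, -, rfl | hk⟩
  · exact le_rfl
  · exact absurd (hk.trans (encard_compsIn_antitone hf le_rfl h0 hD)) (not_le.2 h)

theorem compLevel_le_add [LocallyConnectedSpace X] {s₀ : ℝ} (hs₀ : 0 ≤ s₀) (k : ℕ) {f g : X → ℝ}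
    (hf : Continuous f) {D : Set X} (hD : IsClosed D) {δ : ℝ} (hδ : 0 ≤ δ)
    (h : ∀ x ∈ D, |f x - g x| ≤ δ) : compLevel s₀ k f D ≤ compLevel s₀ k g D + δ := by
  refine csSup_le ⟨0, le_rfl, hs₀, Or.inl rfl⟩ ?_
  rintro s ⟨h0, hs, hk⟩
  by_cases hsδ : s ≤ δ
  · linarith [compLevel_nonneg s₀ k g D]
  · push Not at hsδ
    have hk' : (k : ℕ∞) ≤ (compsIn f s D).encard := hk.resolve_left (by linarith)
    have h1 : (k : ℕ∞) ≤ (compsIn g (s - δ) D).encard := by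
      refine hk'.trans ?_
      have := encard_compsIn_add_le (s := s - δ) hf (by linarith) hD h
      rwa [sub_add_cancel] at this
    have : s - δ ≤ compLevel s₀ k g D :=
      le_csSup (bddAbove_compLevel s₀ k g D) ⟨by linarith, by linarith, Or.inr h1⟩
    linarith

/-- A Lipschitz functional interpolating between the component counts at levels `0` and `s₀`,
truncated at `T`. -/
noncomputable def softCount (T : ℕ) (s₀ : ℝ) (f : X → ℝ) (D : Set X) : ℝ :=
  ∑ k ∈ Finset.range T, compLevel s₀ (k + 1) f D / s₀

theorem softCount_nonneg (T : ℕ) {s₀ : ℝ} (hs₀ : 0 < s₀) (f : X → ℝ) (D : Set X) :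
    0 ≤ softCount T s₀ f D :=
  Finset.sum_nonneg fun _ _ => div_nonneg (compLevel_nonneg _ _ _ _) hs₀.le

theorem softCount_le (T : ℕ) {s₀ : ℝ} (hs₀ : 0 < s₀) (f : X → ℝ) (D : Set X) :
    softCount T s₀ f D ≤ T := by
  calc softCount T s₀ f D ≤ ∑ k ∈ Finset.range T, (1 : ℝ) :=
        Finset.sum_le_sum fun k _ => (div_le_one hs₀).2 (compLevel_le hs₀.le _ _ _)
    _ = T := by simp

theorem softCount_le_of_encard_le [LocallyConnectedSpace X] (T : ℕ) {s₀ : ℝ} (hs₀ : 0 < s₀)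
    {f : X → ℝ} (hf : Continuous f) {D : Set X} (hD : IsClosed D) {m : ℕ}
    (h : (compsIn f 0 D).encard ≤ m) : softCount T s₀ f D ≤ m := by
  have h1 : ∀ k ∈ Finset.range T, compLevel s₀ (k + 1) f D / s₀ ≤ if k < m then 1 else 0 := by
    intro k _
    split_ifs with hk
    · exact (div_le_one hs₀).2 (compLevel_le hs₀.le _ _ _)
    · rw [compLevel_eq_zero hs₀.le hf hD, zero_div]
      exact h.trans_lt (by exact_mod_cast (by omega : m < k + 1))
  refine (Finset.sum_le_sum h1).trans ?_
  rw [Finset.sum_ite, Finset.sum_const_zero, add_zero, Finset.sum_const, nsmul_eq_mul, mul_one]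
  have : Finset.filter (fun k => k < m) (Finset.range T) ⊆ Finset.range m := by
    intro k; simp
  have := Finset.card_le_card this
  rw [Finset.card_range] at this
  exact_mod_cast this

theorem le_softCount [LocallyConnectedSpace X] {T m : ℕ} (hm : m ≤ T) {s₀ : ℝ} (hs₀ : 0 < s₀)
    {f : X → ℝ} {D : Set X} (h : (m : ℕ∞) ≤ (compsIn f s₀ D).encard) :
    (m : ℝ) ≤ softCount T s₀ f D := by
  calc (m : ℝ) = ∑ k ∈ Finset.range m, (1 : ℝ) := by simp
    _ ≤ ∑ k ∈ Finset.range m, compLevel s₀ (k + 1) f D / s₀ := by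
        refine Finset.sum_le_sum fun k hk => ?_
        rw [compLevel_eq hs₀.le, div_self hs₀.ne']
        refine le_trans ?_ h
        have := Finset.mem_range.1 hk
        exact_mod_cast this
    _ ≤ _ := Finset.sum_le_sum_of_subset_of_nonneg (by simpa using hm)
        fun _ _ _ => div_nonneg (compLevel_nonneg _ _ _ _) hs₀.le

theorem abs_softCount_sub_le [LocallyConnectedSpace X] (T : ℕ) {s₀ : ℝ} (hs₀ : 0 < s₀)
    {f g : X → ℝ} (hf : Continuous f) (hg : Continuous g) {D : Set X} (hD : IsClosed D) {δ : ℝ}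
    (hδ : 0 ≤ δ) (h : ∀ x ∈ D, |f x - g x| ≤ δ) :
    |softCount T s₀ f D - softCount T s₀ g D| ≤ T / s₀ * δ := by
  rw [softCount, softCount, ← Finset.sum_sub_distrib]
  calc _ ≤ ∑ k ∈ Finset.range T, δ / s₀ := by
        refine (Finset.abs_sum_le_sum_abs _ _).trans (Finset.sum_le_sum fun k _ => ?_)
        rw [← sub_div, abs_div, abs_of_pos hs₀]
        gcongr
        rw [abs_le]
        constructor
        · linarith [compLevel_le_add hs₀.le (k + 1) hg hD hδ
            (fun x hx => by rw [abs_sub_comm]; exact h x hx)]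
        · linarith [compLevel_le_add hs₀.le (k + 1) hf hD hδ h]
    _ = T / s₀ * δ := by rw [Finset.sum_const, Finset.card_range, nsmul_eq_mul]; ring

/-! ### Transfer along open embeddings -/

theorem encard_compsIn_comp [LocallyConnectedSpace X] {Y : Type*} [TopologicalSpace Y]
    [LocallyConnectedSpace Y] {f : X → ℝ} (hf : Continuous f) {e : Y → X}
    (he : Topology.IsOpenEmbedding e) {s : ℝ} {D : Set X} (hD : IsClosed D)
    (hDe : D ⊆ Set.range e) :
    (compsIn (f ∘ e) s (e ⁻¹' D)).encard = (compsIn f s D).encard := by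
  have hinj : Function.Injective (Set.image e) := he.injective.image_injective
  rw [← hinj.encard_image]
  congr 1
  ext C
  constructor
  · rintro ⟨V, hV, rfl⟩
    obtain ⟨hVD, p, hp, hpV, -⟩ := id hV
    have hVD' : e '' V ⊆ D := Set.image_subset_iff.2 hVD
    refine ⟨hVD', e p, hp, Set.mem_image_of_mem _ hpV, ?_⟩
    have hpf : -s < f (e p) := subset_of_mem_compsIn hV hpV
    refine Set.Subset.antisymm ?_ ?_
    · refine ((isPreconnected_of_mem_compsIn hV).image e he.continuous.continuousOn).subset_connectedComponentIn
        (Set.mem_image_of_mem _ hpV) ?_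
      rintro _ ⟨y, hy, rfl⟩
      exact subset_of_mem_compsIn hV hy
    · refine isPreconnected_connectedComponentIn.subset_of_disjoint_frontier
        ⟨e p, mem_connectedComponentIn hpf, Set.mem_image_of_mem _ hpV⟩
        (Set.disjoint_left.2 fun q hq1 hq2 => ?_)
      have hqf := lt_of_mem_connectedComponentIn hq1
      have hO : IsOpen (e '' V) :=
        he.isOpenMap _ (isOpen_of_mem_compsIn (hf.comp he.continuous) hV)
      rw [hO.frontier_eq] at hq2
      obtain ⟨y, rfl⟩ := hDe (closure_minimal hVD' hD hq2.1)
      refine hq2.2 (Set.mem_image_of_mem _ ?_)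
      refine mem_of_mem_closure_of_mem_compsIn (hf.comp he.continuous) hV ?_ hqf
      rw [he.toIsInducing.closure_eq_preimage_closure_image]
      exact hq2.1
  · intro hC
    obtain ⟨hCD, p, hp, hpC, hCeq⟩ := id hC
    obtain ⟨q, rfl⟩ := hDe (hCD hpC)
    have himg : e '' (e ⁻¹' C) = C := Set.image_preimage_eq_of_subset (hCD.trans hDe)
    refine ⟨e ⁻¹' C, ⟨Set.preimage_mono hCD, q, hp, hpC, ?_⟩, himg⟩
    have hqf : -s < f (e q) := subset_of_mem_compsIn hC hpC
    refine Set.Subset.antisymm ?_ ?_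
    · refine IsPreconnected.subset_connectedComponentIn ?_ hpC fun y hy =>
        subset_of_mem_compsIn hC hy
      rw [← he.toIsInducing.isPreconnected_image, himg]
      exact isPreconnected_of_mem_compsIn hC
    · rw [← Set.image_subset_iff]
      refine subset_of_mem_compsIn_of_isPreconnected hC
        (isPreconnected_connectedComponentIn.image e he.continuous.continuousOn) ?_
        (Set.mem_image_of_mem _ (mem_connectedComponentIn (F := {x | -s < (f ∘ e) x}) hqf)) hpC
      rintro _ ⟨y, hy, rfl⟩
      exact lt_of_mem_connectedComponentIn (f := f ∘ e) hy

/-! ### Components of the complement of the zero set -/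

theorem compsIn_zero_univ (f : X → ℝ) :
    compsIn f 0 Set.univ = (fun p => connectedComponentIn {x | 0 < f x} p) '' {x | 0 < f x} := by
  ext C
  simp only [compsIn, Set.subset_univ, true_and, neg_zero, Set.mem_ofPred_eq, Set.mem_image]
  constructor
  · rintro ⟨p, hp, -, rfl⟩; exact ⟨p, hp, rfl⟩
  · rintro ⟨p, hp, rfl⟩; exact ⟨p, hp, mem_connectedComponentIn hp, rfl⟩

theorem connectedComponentIn_ne_zero {f : X → ℝ} (hf : Continuous f) {p : X} (hp : 0 < f p) :
    connectedComponentIn {x | f x ≠ 0} p = connectedComponentIn {x | 0 < f x} p := by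
  refine Set.Subset.antisymm ?_
    (connectedComponentIn_mono p fun x (hx : 0 < f x) => hx.ne')
  refine isPreconnected_connectedComponentIn.subset_connectedComponentIn
    (mem_connectedComponentIn hp.ne') fun x hx => ?_
  by_contra hxf
  have hx0 : f x ≠ 0 := connectedComponentIn_subset _ _ hx
  have h2 : (connectedComponentIn {x | f x ≠ 0} p ∩ ({x | 0 < f x} ∩ {x | f x < 0})).Nonempty :=
    isPreconnected_connectedComponentIn {x | 0 < f x} {x | f x < 0}
    (isOpen_lt continuous_const hf) (isOpen_lt hf continuous_const)
    (fun y hy => (lt_or_gt_of_ne (connectedComponentIn_subset _ _ hy)).symm)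
    ⟨p, mem_connectedComponentIn hp.ne', hp⟩ ⟨x, hx, lt_of_le_of_ne (not_lt.1 hxf) hx0⟩
  obtain ⟨y, -, hy1, hy2⟩ := h2
  exact lt_asymm (α := ℝ) hy1 hy2

theorem card_connectedComponents_ne_zero {f : X → ℝ} (hf : Continuous f)
    (h1 : (compsIn f 0 Set.univ).Finite) (h2 : (compsIn (-f) 0 Set.univ).Finite) :
    Nat.card (ConnectedComponents {x : X // f x ≠ 0}) =
      (compsIn f 0 Set.univ).ncard + (compsIn (-f) 0 Set.univ).ncard := by
  let F : Set X := {x | f x ≠ 0}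
  have hU : (fun p => connectedComponentIn F p) '' F =
      compsIn f 0 Set.univ ∪ compsIn (-f) 0 Set.univ := by
    rw [compsIn_zero_univ, compsIn_zero_univ]
    have hn : ∀ p, 0 < (-f) p → connectedComponentIn F p =
        connectedComponentIn {x | 0 < (-f) x} p := fun p hp => by
      rw [← connectedComponentIn_ne_zero hf.neg hp]
      congr 1; ext x; simp [F]
    ext C
    constructor
    · rintro ⟨p, hp, rfl⟩
      rcases lt_or_gt_of_ne (hp : f p ≠ 0) with hp' | hp'
      · have hp'' : 0 < (-f) p := by simpa using hp'
        exact Or.inr ⟨p, hp'', (hn p hp'').symm⟩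
      · exact Or.inl ⟨p, hp', (connectedComponentIn_ne_zero hf hp').symm⟩
    · rintro (⟨p, hp, rfl⟩ | ⟨p, hp, rfl⟩)
      · exact ⟨p, ne_of_gt (α := ℝ) hp, connectedComponentIn_ne_zero hf hp⟩
      · exact ⟨p, fun h => by simp [h] at hp, hn p hp⟩
  have hdisj : Disjoint (compsIn f 0 Set.univ) (compsIn (-f) 0 Set.univ) := by
    rw [Set.disjoint_left]
    intro C hC hC'
    obtain ⟨-, p, hp, hpC, -⟩ := id hC
    have := subset_of_mem_compsIn hC' hpC
    simp at this
    linarith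
  rw [← Set.ncard_union_eq hdisj h1 h2, ← hU, ← Nat.card_coe_set_eq]
  have hlift : ∀ x y : F, connectedComponent x = connectedComponent y ↔
      connectedComponentIn F (x : X) = connectedComponentIn F (y : X) := by
    intro x y
    rw [connectedComponentIn_eq_image x.2, connectedComponentIn_eq_image y.2]
    exact (Set.image_injective.2 Subtype.val_injective).eq_iff.symm
  refine Nat.card_congr (Equiv.ofBijective
    (Quotient.lift (fun x : F => (⟨connectedComponentIn F (x : X), x, x.2, rfl⟩ :
      (fun p => connectedComponentIn F p) '' F))
      fun x y hxy => Subtype.ext ((hlift x y).1 hxy)) ⟨?_, ?_⟩)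
  · intro a b
    induction a using Quotient.inductionOn
    induction b using Quotient.inductionOn
    intro hab
    exact Quotient.sound ((hlift _ _).2 (Subtype.ext_iff.1 hab))
  · rintro ⟨_, p, hp, rfl⟩
    exact ⟨Quotient.mk _ ⟨p, hp⟩, rfl⟩

end Components

/-! ### Polynomials on `ℝ³` and integration over the sphere -/

/-- Euclidean three-space. -/
abbrev E3 := EuclideanSpace ℝ (Fin 3)

/-- Real polynomials in three variables. -/
abbrev Poly3 := MvPolynomial (Fin 3) ℝ

/-- The polynomial function on `ℝ³` attached to a polynomial. -/
noncomputable def ev (p : Poly3) (x : E3) : ℝ := MvPolynomial.eval (fun i => x i) p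

@[simp] lemma ev_add (p q : Poly3) (x : E3) : ev (p + q) x = ev p x + ev q x := by simp [ev]
@[simp] lemma ev_sub (p q : Poly3) (x : E3) : ev (p - q) x = ev p x - ev q x := by simp [ev]
@[simp] lemma ev_neg (p : Poly3) (x : E3) : ev (-p) x = -ev p x := by simp [ev]
@[simp] lemma ev_mul (p q : Poly3) (x : E3) : ev (p * q) x = ev p x * ev q x := by simp [ev]
@[simp] lemma ev_pow (p : Poly3) (k : ℕ) (x : E3) : ev (p ^ k) x = ev p x ^ k := by simp [ev]
@[simp] lemma ev_zero (x : E3) : ev 0 x = 0 := by simp [ev]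
@[simp] lemma ev_one (x : E3) : ev 1 x = 1 := by simp [ev]
@[simp] lemma ev_smul (c : ℝ) (p : Poly3) (x : E3) : ev (c • p) x = c * ev p x := by
  simp [ev]
@[simp] lemma ev_natCast_mul (c : ℕ) (x : E3) : ev (c : Poly3) x = c := by simp [ev]
@[simp] lemma ev_C (c : ℝ) (x : E3) : ev (MvPolynomial.C c) x = c := by simp [ev]
@[simp] lemma ev_X (i : Fin 3) (x : E3) : ev (MvPolynomial.X i) x = x i := by simp [ev]
lemma ev_sum {ι : Type*} (s : Finset ι) (p : ι → Poly3) (x : E3) :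
    ev (∑ i ∈ s, p i) x = ∑ i ∈ s, ev (p i) x := by simp [ev]

@[fun_prop]
lemma continuous_ev (p : Poly3) : Continuous (ev p) := by
  unfold ev
  exact (MvPolynomial.continuous_eval p).comp (by fun_prop)

lemma ev_ext {p q : Poly3} (h : ∀ x, ev p x = ev q x) : p = q :=
  MvPolynomial.funext fun x => by simpa [ev] using h (WithLp.toLp 2 x)

lemma ev_homog {p : Poly3} {m : ℕ} (hp : p.IsHomogeneous m) (c : ℝ) (x : E3) :
    ev p (c • x) = c ^ m * ev p x := by
  simp only [ev, MvPolynomial.eval_eq, Finset.mul_sum]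
  refine Finset.sum_congr rfl fun d hd => ?_
  have h : ∑ i, d i = m := by
    have := hp (MvPolynomial.mem_support_iff.mp hd)
    rw [Finsupp.weight_apply, Finsupp.sum_fintype _ _ (by simp)] at this
    simpa using this
  have h2 : ∏ i ∈ d.support, (c • x) i ^ d i = c ^ m * ∏ i ∈ d.support, x i ^ d i := by
    have : ∀ i, (c • x) i = c * x i := fun i => by simp
    simp only [this, mul_pow, Finset.prod_mul_distrib, Finset.prod_pow_eq_pow_sum]
    rw [← h, Finset.sum_subset (Finset.subset_univ d.support)]
    intro i _ hi; simpa using hi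
  rw [h2]; ring

/-- The line derivative of a polynomial function. -/
lemma hasDerivAt_ev (p : Poly3) (x v : E3) (t : ℝ) :
    HasDerivAt (fun t : ℝ => ev p (x + t • v))
      (∑ i, v i * ev (MvPolynomial.pderiv i p) (x + t • v)) t := by
  induction p using MvPolynomial.induction_on with
  | C a => simpa using hasDerivAt_const t a
  | add p q hp hq =>
    simp only [ev_add, map_add, mul_add, Finset.sum_add_distrib]
    exact hp.add hq
  | mul_X p i hp =>
    have hx : HasDerivAt (fun t : ℝ => ev (MvPolynomial.X i) (x + t • v)) (v i) t := by
      simp only [ev_X, PiLp.add_apply, PiLp.smul_apply, smul_eq_mul]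
      simpa using ((hasDerivAt_id t).mul_const (v i)).const_add (x i)
    have := hp.mul hx
    simp only [ev_mul]
    refine this.congr_deriv ?_
    simp only [Derivation.leibniz, smul_eq_mul, ev_add, ev_mul, mul_add, Finset.sum_add_distrib,
      MvPolynomial.pderiv_X, Finset.sum_mul]
    rw [add_comm]
    congr 1
    · rw [Finset.sum_eq_single i]
      · simp; ring
      · intro j _ hj; simp [hj]
      · simp
    · exact Finset.sum_congr rfl fun j _ => by ring

lemma hasLineDerivAt_ev_single (p : Poly3) (x : E3) (i : Fin 3) :
    HasLineDerivAt ℝ (ev p) (ev (MvPolynomial.pderiv i p) x) x (EuclideanSpace.single i 1) := by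
  have := hasDerivAt_ev p x (EuclideanSpace.single i 1) 0
  unfold HasLineDerivAt
  refine this.congr_deriv ?_
  rw [Finset.sum_eq_single i] <;> simp +contextual

/-! ### Gaussian integrals of homogeneous functions -/

/-- The moment `∫₀^∞ r^{k+2} e^{-r²/2} dr`. -/
noncomputable def radialMoment (k : ℕ) : ℝ :=
  ∫ r in Set.Ioi (0 : ℝ), r ^ 2 * (r ^ k * Real.exp (-r ^ 2 / 2))

lemma radialMoment_eq (k : ℕ) :
    radialMoment k = (1 / 2 : ℝ) ^ (-((k + 2 : ℝ) + 1) / 2) * (1 / 2) *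
      Real.Gamma (((k + 2 : ℝ) + 1) / 2) := by
  have := integral_rpow_mul_exp_neg_mul_rpow (p := 2) (q := k + 2) (b := 1 / 2) (by norm_num)
    (by have : (0 : ℝ) ≤ k := k.cast_nonneg
        linarith) (by norm_num)
  rw [← this, radialMoment]
  refine setIntegral_congr_fun measurableSet_Ioi fun r (hr : 0 < r) => ?_
  have h : r ^ ((k : ℝ) + 2) = r ^ 2 * r ^ k := by
    rw [Real.rpow_add hr, Real.rpow_natCast]; norm_cast; ring
  simp only [h, mul_assoc]
  norm_num
  left; left; ring

lemma radialMoment_pos (k : ℕ) : 0 < radialMoment k := by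
  rw [radialMoment_eq]
  have := Real.Gamma_pos_of_pos (s := ((k + 2 : ℝ) + 1) / 2) (by positivity)
  positivity

lemma radialMoment_add_two (k : ℕ) : radialMoment (k + 2) = (k + 3) * radialMoment k := by
  rw [radialMoment_eq, radialMoment_eq]
  have h : (((k + 2 : ℕ) : ℝ) + 2 + 1) / 2 = ((k + 2 : ℝ) + 1) / 2 + 1 := by push_cast; ring
  have h' : -(((k + 2 : ℕ) : ℝ) + 2 + 1) / 2 = -((k + 2 : ℝ) + 1) / 2 + (-1) := by
    push_cast; ring
  rw [h, h', Real.Gamma_add_one (by positivity), Real.rpow_add (by norm_num), Real.rpow_neg_one]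
  ring

lemma integrableOn_radialMoment (k : ℕ) :
    IntegrableOn (fun r : ℝ => r ^ 2 * (r ^ k * Real.exp (-r ^ 2 / 2))) (Set.Ioi 0) := by
  by_contra h
  have := radialMoment_pos k
  rw [radialMoment, integral_undef h] at this
  exact this.false

lemma integrable_norm_pow_mul_exp (k : ℕ) :
    Integrable (fun x : E3 => ‖x‖ ^ k * Real.exp (-‖x‖ ^ 2 / 2)) := by
  have := (integrable_fun_norm_addHaar (volume : Measure E3)
    (f := fun r => r ^ k * Real.exp (-r ^ 2 / 2))).2
  apply this
  simpa using integrableOn_radialMoment k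

/-- The normalized surface measure of the unit sphere. -/
noncomputable def sphMeasure : Measure Sphere2 :=
  ((volume : Measure E3).toSphere Set.univ)⁻¹ • (volume : Measure E3).toSphere

lemma toSphere_univ_ne_zero : (volume : Measure E3).toSphere Set.univ ≠ 0 := by
  rw [Ne, Measure.measure_univ_eq_zero]; exact Measure.toSphere_ne_zero _

instance : IsProbabilityMeasure sphMeasure :=
  ⟨by
    rw [sphMeasure, Measure.smul_apply, smul_eq_mul,
      ENNReal.inv_mul_cancel toSphere_univ_ne_zero (measure_ne_top _ _)]⟩

instance : Measure.IsOpenPosMeasure sphMeasure := by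
  unfold sphMeasure
  refine ⟨fun U hU hne => ?_⟩
  rw [Measure.smul_apply, smul_eq_mul]
  exact mul_ne_zero (ENNReal.inv_ne_zero.2 (measure_ne_top _ _)) (hU.measure_ne_zero _ hne)

/-- The average over the sphere of a function on `ℝ³`. -/
noncomputable def sphAvg (h : E3 → ℝ) : ℝ := ∫ x : Sphere2, h x ∂sphMeasure

lemma integrable_sphere {h : Sphere2 → ℝ} (hh : Continuous h) : Integrable h sphMeasure :=
  hh.integrable_of_hasCompactSupport (HasCompactSupport.of_compactSpace h)

lemma integral_homog_mul_exp {h : E3 → ℝ} {k : ℕ}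
    (hk : ∀ c : ℝ, 0 < c → ∀ x, h (c • x) = c ^ k * h x) :
    ∫ x, h x * Real.exp (-‖x‖ ^ 2 / 2) =
      (volume : Measure E3).toSphere.real Set.univ * (sphAvg h * radialMoment k) := by
  let μ : Measure E3 := volume
  let w : ℝ → ℝ := fun r => r ^ k * Real.exp (-r ^ 2 / 2)
  have h1 : ∫ x, h x * Real.exp (-‖x‖ ^ 2 / 2) ∂μ =
      ∫ x : ({(0)}ᶜ : Set E3), h x * Real.exp (-‖(x : E3)‖ ^ 2 / 2) ∂(μ.comap (↑)) := by
    rw [integral_subtype_comap (measurableSet_singleton _).compl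
      (fun x : E3 => h x * Real.exp (-‖x‖ ^ 2 / 2)), restrict_compl_singleton]
  have h2 : ∫ x : ({(0)}ᶜ : Set E3), h x * Real.exp (-‖(x : E3)‖ ^ 2 / 2) ∂(μ.comap (↑)) =
      ∫ z, h z.1 * w z.2 ∂(μ.toSphere.prod
        (Measure.volumeIoiPow (Module.finrank ℝ E3 - 1))) := by
    rw [← μ.measurePreserving_homeomorphUnitSphereProd.integral_comp
      (Homeomorph.measurableEmbedding _)]
    refine integral_congr_ae (Filter.Eventually.of_forall fun x => ?_)
    have hx : 0 < ‖(x : E3)‖ := norm_pos_iff.2 x.2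
    simp only [homeomorphUnitSphereProd_apply_fst_coe, homeomorphUnitSphereProd_apply_snd_coe, w]
    rw [hk _ (inv_pos.2 hx), inv_pow]
    field_simp
  have h3 : ∫ r, w r ∂(Measure.volumeIoiPow (Module.finrank ℝ E3 - 1)) = radialMoment k := by
    simp only [Measure.volumeIoiPow, ENNReal.ofReal]
    rw [integral_withDensity_eq_integral_smul,
      integral_subtype_comap measurableSet_Ioi
        fun a ↦ Real.toNNReal (a ^ (Module.finrank ℝ E3 - 1)) • w a]
    · refine setIntegral_congr_fun measurableSet_Ioi fun x hx ↦ ?_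
      simp only [NNReal.smul_def, Real.coe_toNNReal _ (pow_nonneg (le_of_lt hx) _)]
      simp [w]
    · exact (measurable_subtype_coe.pow_const _).real_toNNReal
  rw [h1, h2, integral_prod_mul (fun x : Sphere2 => h x) (fun r : Set.Ioi (0 : ℝ) => w r), h3,
    sphAvg, sphMeasure, integral_smul_measure, Measure.real, ENNReal.toReal_inv, smul_eq_mul]
  have : (μ.toSphere Set.univ).toReal ≠ 0 :=
    ENNReal.toReal_ne_zero.2 ⟨toSphere_univ_ne_zero, measure_ne_top _ _⟩
  change _ = (μ.toSphere Set.univ).toReal * ((μ.toSphere Set.univ).toReal⁻¹ * _ * _)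
  field_simp
  exact mul_comm _ _

/-- A homogeneous continuous function is bounded by a multiple of the power of the norm. -/
lemma exists_abs_le_norm_pow {h : E3 → ℝ} {k : ℕ} (hc : Continuous h)
    (hk : ∀ c : ℝ, 0 < c → ∀ x, h (c • x) = c ^ k * h x) :
    ∃ C, ∀ x, x ≠ 0 → |h x| ≤ C * ‖x‖ ^ k := by
  obtain ⟨C, hC⟩ := (isCompact_sphere (0 : E3) 1).exists_bound_of_continuousOn hc.continuousOn
  refine ⟨C, fun x hx => ?_⟩
  have hx' : 0 < ‖x‖ := norm_pos_iff.2 hx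
  have : x = ‖x‖ • (‖x‖⁻¹ • x) := by rw [smul_smul, mul_inv_cancel₀ hx'.ne', one_smul]
  rw [this, hk _ hx', abs_mul, ← this, abs_of_pos (pow_pos hx' k), mul_comm]
  gcongr
  exact hC _ (by simp [norm_smul, hx'.ne'])

lemma integrable_homog_mul_exp {h : E3 → ℝ} {k : ℕ} (hc : Continuous h)
    (hk : ∀ c : ℝ, 0 < c → ∀ x, h (c • x) = c ^ k * h x) :
    Integrable (fun x => h x * Real.exp (-‖x‖ ^ 2 / 2)) := by
  obtain ⟨C, hC⟩ := exists_abs_le_norm_pow hc hk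
  refine ((integrable_norm_pow_mul_exp k).const_mul C).mono'
    (by fun_prop) ?_
  filter_upwards [Measure.ae_ne volume (0 : E3)] with x hx
  rw [norm_mul, Real.norm_eq_abs, Real.norm_of_nonneg (Real.exp_pos _).le, ← mul_assoc]
  gcongr
  exact hC x hx

lemma hasLineDerivAt_gauss (x v : E3) :
    HasLineDerivAt ℝ (fun x : E3 => Real.exp (-‖x‖ ^ 2 / 2))
      (-⟪x, v⟫ * Real.exp (-‖x‖ ^ 2 / 2)) x v := by
  unfold HasLineDerivAt
  have h1 : HasDerivAt (fun t : ℝ => -‖x + t • v‖ ^ 2 / 2) (-⟪x, v⟫) 0 := by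
    have : HasDerivAt (fun t : ℝ => x + t • v) v 0 := by
      simpa using ((hasDerivAt_id (0 : ℝ)).smul_const v).const_add x
    have := (this.norm_sq.neg).div_const 2
    refine (this.congr_deriv ?_)
    simp; ring
  simpa [mul_comm] using h1.exp

lemma integral_pderiv_mul_exp {q : Poly3} {m : ℕ} (hq : q.IsHomogeneous m) (i : Fin 3) :
    ∫ x, ev (MvPolynomial.pderiv i q) x * Real.exp (-‖x‖ ^ 2 / 2) =
      ∫ x, ev (MvPolynomial.X i * q) x * Real.exp (-‖x‖ ^ 2 / 2) := by
  have hI : ∀ {r : Poly3} {k : ℕ}, r.IsHomogeneous k →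
      Integrable (fun x => ev r x * Real.exp (-‖x‖ ^ 2 / 2)) := fun hr =>
    integrable_homog_mul_exp (continuous_ev _) fun c _ x => ev_homog hr c x
  have e : ∀ x : E3, ⟪x, EuclideanSpace.single i (1 : ℝ)⟫ = x i := fun x => by
    rw [EuclideanSpace.inner_single_right]; simp
  have key := integral_bilinear_hasLineDerivAt_right_eq_neg_left_of_integrable
    (μ := (volume : Measure E3)) (B := ContinuousLinearMap.mul ℝ ℝ)
    (f := ev q) (f' := ev (MvPolynomial.pderiv i q)) (g := fun x => Real.exp (-‖x‖ ^ 2 / 2))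
    (g' := fun x => -⟪x, EuclideanSpace.single i (1 : ℝ)⟫ * Real.exp (-‖x‖ ^ 2 / 2))
    (v := EuclideanSpace.single i 1) ?_ ?_ ?_
    (fun x _ => hasLineDerivAt_ev_single q x i) (fun x _ => hasLineDerivAt_gauss x _)
  · simp only [ContinuousLinearMap.mul_apply', e] at key
    rw [← neg_eq_iff_eq_neg.2 key, ← integral_neg]
    congr 1 with x
    simp; ring
  · simpa using hI (hq.pderiv (i := i))
  · have := (hI ((MvPolynomial.isHomogeneous_X ℝ i).mul hq)).neg
    simp only [ContinuousLinearMap.mul_apply', e]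
    refine this.congr (Filter.Eventually.of_forall fun x => ?_)
    simp; ring
  · simpa using hI hq

/-- Integration by parts on the sphere. -/
lemma sphAvg_pderiv {q : Poly3} {m : ℕ} (hq : q.IsHomogeneous m) (i : Fin 3) :
    sphAvg (ev (MvPolynomial.pderiv i q)) = (m + 2) * sphAvg (ev (MvPolynomial.X i * q)) := by
  have h := integral_pderiv_mul_exp hq i
  have hX := (MvPolynomial.isHomogeneous_X ℝ i).mul hq
  have hpos : (volume : Measure E3).toSphere.real Set.univ ≠ 0 :=
    ENNReal.toReal_ne_zero.2 ⟨toSphere_univ_ne_zero, measure_ne_top _ _⟩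
  rw [integral_homog_mul_exp fun c _ x => ev_homog (hq.pderiv (i := i)) c x,
    integral_homog_mul_exp fun c _ x => ev_homog hX c x] at h
  have h := mul_left_cancel₀ hpos h
  rcases m with _ | m
  · have hC : MvPolynomial.pderiv i q = 0 := by
      rw [MvPolynomial.totalDegree_eq_zero_iff_eq_C.1
        ((MvPolynomial.totalDegree_zero_iff_isHomogeneous _).2 hq)]
      simp
    have h0 : sphAvg (ev (MvPolynomial.pderiv i q)) = 0 := by
      rw [hC]; simp [sphAvg]
    rw [h0, zero_mul, zero_eq_mul] at h
    rw [h0, h.resolve_right (radialMoment_pos _).ne', mul_zero]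
  · have : 1 + (m + 1) = m + 2 := by ring
    rw [this, radialMoment_add_two, Nat.add_sub_cancel] at h
    have hp := (radialMoment_pos m).ne'
    apply mul_right_cancel₀ hp
    rw [h]; push_cast; ring

/-! ### Harmonic polynomials -/

/-- The average of a polynomial over the unit sphere, as a linear form. -/
noncomputable def savg : Poly3 →ₗ[ℝ] ℝ where
  toFun p := sphAvg (ev p)
  map_add' p q := by
    simp only [sphAvg, ev_add]
    exact integral_add (integrable_sphere (by fun_prop)) (integrable_sphere (by fun_prop))
  map_smul' c p := by simp [sphAvg, integral_const_mul]

lemma savg_def (p : Poly3) : savg p = ∫ x : Sphere2, ev p x ∂sphMeasure := rfl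

lemma savg_congr {p q : Poly3} (h : ∀ x : Sphere2, ev p x = ev q x) : savg p = savg q := by
  simp only [savg_def, h]

lemma savg_one : savg 1 = 1 := by simp [savg_def]

lemma savg_mul_self_nonneg (p : Poly3) : 0 ≤ savg (p * p) := by
  rw [savg_def]
  exact integral_nonneg fun x => by simpa using mul_self_nonneg _

lemma savg_pderiv {q : Poly3} {m : ℕ} (hq : q.IsHomogeneous m) (i : Fin 3) :
    savg (MvPolynomial.pderiv i q) = (m + 2) * savg (MvPolynomial.X i * q) := sphAvg_pderiv hq i

/-- The Laplacian of a polynomial. -/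
noncomputable def lap : Poly3 →ₗ[ℝ] Poly3 where
  toFun p := ∑ i, MvPolynomial.pderiv i (MvPolynomial.pderiv i p)
  map_add' p q := by simp [Finset.sum_add_distrib]
  map_smul' c p := by simp [Finset.smul_sum]

lemma lap_apply (p : Poly3) : lap p = ∑ i, MvPolynomial.pderiv i (MvPolynomial.pderiv i p) := rfl

lemma pderiv_comm (i j : Fin 3) (p : Poly3) :
    MvPolynomial.pderiv i (MvPolynomial.pderiv j p) =
      MvPolynomial.pderiv j (MvPolynomial.pderiv i p) := by
  induction p using MvPolynomial.induction_on with
  | C a => simp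
  | add p q hp hq => simp [hp, hq]
  | mul_X p k hp =>
    have : ∀ i j : Fin 3, MvPolynomial.pderiv i (Pi.single (M := fun _ => Poly3) j 1 k) = 0 := by
      intro i j
      by_cases h : k = j
      · subst h; simp
      · simp [h]
    simp only [Derivation.leibniz, MvPolynomial.pderiv_X, map_add, smul_eq_mul, this, hp]
    ring

/-- Homogeneous harmonic polynomials of degree `n`. -/
noncomputable def sphHarm (n : ℕ) : Submodule ℝ Poly3 :=
  MvPolynomial.homogeneousSubmodule (Fin 3) ℝ n ⊓ LinearMap.ker lap

lemma mem_sphHarm {n : ℕ} {p : Poly3} : p ∈ sphHarm n ↔ p.IsHomogeneous n ∧ lap p = 0 := by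
  simp [sphHarm]

lemma pderiv_mem_sphHarm {n : ℕ} {p : Poly3} (hp : p ∈ sphHarm n) (i : Fin 3) :
    MvPolynomial.pderiv i p ∈ sphHarm (n - 1) := by
  rw [mem_sphHarm] at hp ⊢
  refine ⟨hp.1.pderiv, ?_⟩
  have := congrArg (MvPolynomial.pderiv i) hp.2
  rw [lap_apply, map_sum, map_zero] at this
  rw [lap_apply, ← this]
  exact Finset.sum_congr rfl fun j _ => by rw [pderiv_comm j i p, pderiv_comm j i]

lemma pderiv_eq_zero_of_isHomogeneous_zero {q : Poly3} (hq : q.IsHomogeneous 0) (i : Fin 3) :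
    MvPolynomial.pderiv i q = 0 := by
  rw [MvPolynomial.totalDegree_eq_zero_iff_eq_C.1
    ((MvPolynomial.totalDegree_zero_iff_isHomogeneous _).2 hq)]
  simp

lemma euler_savg {n : ℕ} {p : Poly3} (hp : p.IsHomogeneous n) (q : Poly3) :
    (n : ℝ) * savg (p * q) = ∑ i, savg (MvPolynomial.X i * (MvPolynomial.pderiv i p * q)) := by
  have h := hp.sum_X_mul_pderiv
  rw [← map_sum, ← nsmul_eq_mul, ← map_nsmul, ← smul_mul_assoc, ← h, Finset.sum_mul]
  simp only [mul_assoc]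

/-- Integration by parts for a harmonic polynomial against a homogeneous polynomial. -/
lemma savg_harmonic_mul {m k : ℕ} {p q : Poly3} (hp : p ∈ sphHarm m) (hm : m ≠ 0)
    (hq : q.IsHomogeneous k) :
    (m : ℝ) * (m + k + 1) * savg (p * q) =
      ∑ i, savg (MvPolynomial.pderiv i p * MvPolynomial.pderiv i q) := by
  rw [mem_sphHarm] at hp
  obtain ⟨m, rfl⟩ := Nat.exists_eq_succ_of_ne_zero hm
  have h1 : ∀ i, savg (MvPolynomial.X i * (MvPolynomial.pderiv i p * q)) * ((m : ℝ) + k + 2) =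
      savg (MvPolynomial.pderiv i (MvPolynomial.pderiv i p) * q) +
        savg (MvPolynomial.pderiv i p * MvPolynomial.pderiv i q) := by
    intro i
    have hd : (MvPolynomial.pderiv i p * q).IsHomogeneous (m + k) :=
      (hp.1.pderiv (i := i)).mul hq
    have := savg_pderiv hd i
    push_cast at this
    rw [mul_comm, ← this, ← map_add, Derivation.leibniz]
    congr 1
    simp only [smul_eq_mul]; ring
  have h2 : ∑ i, savg (MvPolynomial.pderiv i (MvPolynomial.pderiv i p) * q) = 0 := by
    rw [← map_sum, ← Finset.sum_mul, ← lap_apply, hp.2, zero_mul, map_zero]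
  have h3 := euler_savg hp.1 q
  have h4 := Finset.sum_congr rfl fun i (_ : i ∈ Finset.univ) => h1 i
  rw [← Finset.sum_mul, ← h3, Finset.sum_add_distrib, h2, zero_add] at h4
  rw [← h4]; push_cast; ring

/-- The exact Bernstein identity for spherical harmonics. -/
lemma savg_grad_sq {n : ℕ} {p : Poly3} (hp : p ∈ sphHarm n) :
    ∑ i, savg (MvPolynomial.pderiv i p * MvPolynomial.pderiv i p) =
      n * (2 * n + 1) * savg (p * p) := by
  rcases eq_or_ne n 0 with rfl | hn
  · have := fun i => pderiv_eq_zero_of_isHomogeneous_zero (mem_sphHarm.1 hp).1 i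
    simp [this]
  · rw [← savg_harmonic_mul hp hn (mem_sphHarm.1 hp).1]; ring

lemma savg_mul_eq_zero_of_lt {m k : ℕ} {p q : Poly3} (hp : p ∈ sphHarm m)
    (hq : q.IsHomogeneous k) (h : k < m) : savg (p * q) = 0 := by
  induction k generalizing m p q with
  | zero =>
    have := savg_harmonic_mul hp (by omega) hq
    simp only [pderiv_eq_zero_of_isHomogeneous_zero hq, mul_zero, map_zero,
      Finset.sum_const_zero] at this
    have h' : (m : ℝ) ≠ 0 := by exact_mod_cast (by omega : m ≠ 0)
    have : (m : ℝ) * (m + (0 : ℕ) + 1) ≠ 0 := by positivity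
    simp_all
  | succ k ih =>
    have := savg_harmonic_mul hp (by omega) hq
    rw [Finset.sum_eq_zero fun i _ =>
      ih (pderiv_mem_sphHarm hp i) (hq.pderiv (i := i)) (by omega)] at this
    have h' : (m : ℝ) ≠ 0 := by exact_mod_cast (by omega : m ≠ 0)
    have : (m : ℝ) * (m + (k + 1 : ℕ) + 1) ≠ 0 := by positivity
    simp_all

/-! ### Zonal harmonics -/

/-- The linear form `x ↦ ⟨x, y⟩` as a polynomial. -/
noncomputable def lin (y : E3) : Poly3 := ∑ i, MvPolynomial.C (y i) * MvPolynomial.X i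

/-- The polynomial `|x|²`. -/
noncomputable def nsq : Poly3 := ∑ i, MvPolynomial.X i ^ 2

@[simp] lemma ev_lin (y x : E3) : ev (lin y) x = ⟪x, y⟫ := by
  simp [lin, ev_sum, PiLp.inner_apply]

@[simp] lemma ev_nsq (x : E3) : ev nsq x = ‖x‖ ^ 2 := by
  simp [nsq, ev_sum, EuclideanSpace.norm_sq_eq]

lemma lin_isHomogeneous (y : E3) : (lin y).IsHomogeneous 1 :=
  MvPolynomial.IsHomogeneous.sum _ _ _ fun _ _ => MvPolynomial.isHomogeneous_C_mul_X _ _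

lemma nsq_isHomogeneous : nsq.IsHomogeneous 2 :=
  MvPolynomial.IsHomogeneous.sum _ _ _ fun _ _ => MvPolynomial.isHomogeneous_X_pow _ _

@[simp] lemma pderiv_lin (i : Fin 3) (y : E3) :
    MvPolynomial.pderiv i (lin y) = MvPolynomial.C (y i) := by
  rw [lin, map_sum, Finset.sum_eq_single i]
  · simp [Derivation.leibniz]
  · intro j _ hj; simp [Derivation.leibniz, hj]
  · simp

@[simp] lemma pderiv_nsq (i : Fin 3) : MvPolynomial.pderiv i nsq = 2 * MvPolynomial.X i := by
  rw [nsq, map_sum, Finset.sum_eq_single i]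
  · simp [Derivation.leibniz_pow]
  · intro j _ hj; simp [Derivation.leibniz_pow, hj]
  · simp

lemma lap_lin_pow_mul_nsq_pow {y : E3} (hy : ‖y‖ = 1) (j k : ℕ) :
    lap (lin y ^ j * nsq ^ k) = ((j * (j - 1) : ℝ)) • (lin y ^ (j - 2) * nsq ^ k) +
      ((2 * k * (2 * j + 2 * k + 1) : ℝ)) • (lin y ^ j * nsq ^ (k - 1)) := by
  have hC : ∑ i, MvPolynomial.C (y i) ^ 2 = (1 : Poly3) := by
    rw [← map_one MvPolynomial.C, ← one_pow 2, ← hy, EuclideanSpace.norm_sq_eq, map_sum]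
    simp
  have hX : ∑ i, (MvPolynomial.X i : Poly3) ^ 2 = nsq := rfl
  have hL : ∑ i, MvPolynomial.C (y i) * (MvPolynomial.X i : Poly3) = lin y := rfl
  rw [Fin.sum_univ_three] at hC hX hL
  rw [lap_apply, Fin.sum_univ_three]
  simp only [Derivation.leibniz, Derivation.leibniz_pow, pderiv_lin, pderiv_nsq, smul_eq_mul,
    map_add, MvPolynomial.pderiv_X_self, MvPolynomial.pderiv_C, map_mul, mul_zero,
    nsmul_eq_mul, Derivation.map_natCast, MvPolynomial.smul_eq_C_mul]
  have h2 : ∀ i : Fin 3, MvPolynomial.pderiv i (2 : Poly3) = 0 := fun i => by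
    simpa using (MvPolynomial.pderiv i : Derivation ℝ Poly3 Poly3).map_natCast 2
  simp only [h2]
  have e : ∀ j, j + 1 + 1 - 2 = j := fun j => rfl
  obtain _ | _ | j := j <;> obtain _ | _ | k := k <;>
    simp only [e, Nat.cast_zero, Nat.cast_add, Nat.cast_one, map_add, map_sub, map_one,
      map_ofNat, map_natCast, MvPolynomial.C_0, zero_add, Nat.zero_sub,
      Nat.sub_self, pow_zero, pow_one, Nat.reduceSub, Nat.add_one_sub_one]
  · ring
  · ring
  · linear_combination (4 * (k + 2) * (k + 1) * nsq ^ k : Poly3) * hX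
  · ring
  · linear_combination (4 : Poly3) * hL
  · linear_combination (4 * (k + 2) * (k + 1) * nsq ^ k * lin y : Poly3) * hX +
      (4 * (k + 2) * nsq ^ (k + 1) : Poly3) * hL
  · linear_combination ((j + 2) * (j + 1) * lin y ^ j : Poly3) * hC
  · linear_combination ((j + 2) * (j + 1) * lin y ^ j * nsq : Poly3) * hC +
      (4 * (j + 2) * lin y ^ (j + 1) : Poly3) * hL
  · linear_combination ((j + 2) * (j + 1) * lin y ^ j * nsq ^ (k + 2) : Poly3) * hC +
      (4 * (j + 2) * (k + 2) * lin y ^ (j + 1) * nsq ^ (k + 1) : Poly3) * hL +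
      (4 * (k + 2) * (k + 1) * nsq ^ k * lin y ^ (j + 2) : Poly3) * hX

lemma savg_mul_nsq_pow (p : Poly3) (k : ℕ) : savg (p * nsq ^ k) = savg p :=
  savg_congr fun x => by simp

/-- Harmonic polynomials integrate against powers of `⟨x, y⟩` to multiples of their value. -/
lemma savg_mul_lin_pow {n : ℕ} {p : Poly3} (hp : p ∈ sphHarm n) (y : E3) :
    savg (p * lin y ^ n) * (2 * n + 1).factorial = 2 ^ n * n.factorial ^ 2 * ev p y := by
  induction n generalizing p with
  | zero =>
    have h1 := mem_sphHarm.1 hp |>.1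
    rw [MvPolynomial.totalDegree_eq_zero_iff_eq_C.1
      ((MvPolynomial.totalDegree_zero_iff_isHomogeneous _).2 h1)]
    simp [savg_def]
  | succ n ih =>
    have hl : (lin y ^ (n + 1)).IsHomogeneous (n + 1) := by
      simpa using (lin_isHomogeneous y).pow (n + 1)
    have h1 := savg_harmonic_mul hp (by omega) hl
    have h2 : ∀ i, savg (MvPolynomial.pderiv i p * MvPolynomial.pderiv i (lin y ^ (n + 1))) *
        (2 * n + 1).factorial = (n + 1) * (2 ^ n * n.factorial ^ 2) *
        ev (MvPolynomial.X i * MvPolynomial.pderiv i p) y := by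
      intro i
      have : MvPolynomial.pderiv i p * MvPolynomial.pderiv i (lin y ^ (n + 1)) =
          ((n + 1 : ℝ) * y i) • (MvPolynomial.pderiv i p * lin y ^ n) := by
        rw [Derivation.leibniz_pow, pderiv_lin, MvPolynomial.smul_eq_C_mul]
        simp only [smul_eq_mul, nsmul_eq_mul, Nat.add_sub_cancel, map_mul, map_add, map_natCast,
          map_one]
        push_cast; ring
      rw [this, map_smul, smul_eq_mul, mul_assoc, ih (pderiv_mem_sphHarm hp i), ev_mul, ev_X]
      ring
    have h3 : ∑ i, ev (MvPolynomial.X i * MvPolynomial.pderiv i p) y = (n + 1) * ev p y := by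
      rw [← ev_sum, (mem_sphHarm.1 hp).1.sum_X_mul_pderiv, ← Nat.cast_smul_eq_nsmul ℝ, ev_smul]
      push_cast; ring
    have h4 := congrArg (· * ((2 * n + 1).factorial : ℝ)) h1
    simp only [Finset.sum_mul, h2, ← Finset.mul_sum, h3] at h4
    have h5 : (2 * (n + 1) + 1).factorial = (2 * n + 3) * ((2 * n + 2) * (2 * n + 1).factorial) := by
      rw [← Nat.factorial_succ (2 * n + 1), ← Nat.factorial_succ (2 * n + 2)]
      congr 1
    have hn : (n : ℝ) + 1 ≠ 0 := by positivity
    rw [h5, Nat.factorial_succ n]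
    push_cast at h4 ⊢
    apply mul_left_cancel₀ hn
    linear_combination (2 * n + 2 : ℝ) * h4

/-- The coefficient of `t ^ (n - 2 k)` in the Legendre polynomial. -/
noncomputable def legCoeff (n k : ℕ) : ℝ :=
  (-1) ^ k * (2 * n - 2 * k).factorial /
    (2 ^ n * k.factorial * (n - k).factorial * (n - 2 * k).factorial)

lemma legCoeff_succ {n k : ℕ} (h : 2 * k + 2 ≤ n) :
    legCoeff n (k + 1) * (2 * (k + 1) * (2 * n - 2 * k - 1)) =
      -(legCoeff n k * ((n - 2 * k) * (n - 2 * k - 1))) := by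
  obtain ⟨m, rfl⟩ := Nat.exists_eq_add_of_le h
  have e1 : 2 * (2 * k + 2 + m) - 2 * (k + 1) = 2 * k + 2 + 2 * m := by omega
  have e2 : 2 * k + 2 + m - (k + 1) = k + m + 1 := by omega
  have e3 : 2 * k + 2 + m - 2 * (k + 1) = m := by omega
  have e4 : 2 * (2 * k + 2 + m) - 2 * k = (2 * k + 2 + 2 * m) + 1 + 1 := by omega
  have e5 : 2 * k + 2 + m - k = (k + m + 1) + 1 := by omega
  have e6 : 2 * k + 2 + m - 2 * k = m + 1 + 1 := by omega
  rw [legCoeff, legCoeff, e1, e2, e3, e4, e5, e6, Nat.factorial_succ (2 * k + 2 + 2 * m + 1),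
    Nat.factorial_succ (2 * k + 2 + 2 * m), Nat.factorial_succ (k + m + 1),
    Nat.factorial_succ (m + 1), Nat.factorial_succ m, Nat.factorial_succ k]
  have f1 : (m.factorial : ℝ) ≠ 0 := by positivity
  have f2 : (k.factorial : ℝ) ≠ 0 := by positivity
  have f3 : ((k + m + 1).factorial : ℝ) ≠ 0 := by positivity
  push_cast
  field_simp
  ring

lemma legendrePoly_eq_sum (n : ℕ) : legendrePoly n =
    ∑ k ∈ Finset.range (n / 2 + 1), Polynomial.C (legCoeff n k) * Polynomial.X ^ (n - 2 * k) := by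
  have h1 : (Polynomial.X ^ 2 - 1 : ℝ[X]) ^ n = ∑ k ∈ Finset.range (n + 1),
      Polynomial.C ((-1) ^ k * (n.choose k : ℝ)) * Polynomial.X ^ (2 * (n - k)) := by
    rw [sub_eq_neg_add, add_pow]
    refine Finset.sum_congr rfl fun k _ => ?_
    simp only [map_mul, map_pow, map_neg, map_one, map_natCast, ← pow_mul]
    ring
  rw [legendrePoly, h1, Polynomial.iterate_derivative_sum, Finset.mul_sum]
  symm
  rw [← Finset.sum_subset (Finset.range_subset_range.2 (by omega : n / 2 + 1 ≤ n + 1))]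
  · refine Finset.sum_congr rfl fun k hk => ?_
    have hk : 2 * k ≤ n := by have := Finset.mem_range.1 hk; omega
    rw [Polynomial.iterate_derivative_C_mul, Polynomial.iterate_derivative_X_pow_eq_C_mul,
      ← mul_assoc, ← mul_assoc, ← map_mul, ← map_mul]
    congr 2
    · have e : 2 * (n - k) = (n - 2 * k) + n := by omega
      have h2 := Nat.factorial_mul_descFactorial (n := 2 * (n - k)) (k := n) (by omega)
      have h3 := Nat.choose_mul_factorial_mul_factorial (n := n) (k := k) (by omega)
      rw [show 2 * (n - k) - n = n - 2 * k by omega] at h2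
      rw [legCoeff, show 2 * n - 2 * k = 2 * (n - k) by omega, ← h2, ← h3]
      have : (n.choose k : ℝ) ≠ 0 := by
        exact_mod_cast (Nat.choose_pos (by omega : k ≤ n)).ne'
      push_cast
      field_simp
    · omega
  · intro k hk₁ hk
    have hk₁ := Finset.mem_range.1 hk₁
    have hk : n < 2 * k := by have := Finset.mem_range.not.1 hk; omega
    rw [Polynomial.iterate_derivative_C_mul, Polynomial.iterate_derivative_X_pow_eq_C_mul,
      Nat.descFactorial_eq_zero_iff_lt.2 (by omega)]
    simp

/-- The zonal harmonic of degree `n` with pole `y`. -/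
noncomputable def zonal (n : ℕ) (y : E3) : Poly3 :=
  ∑ k ∈ Finset.range (n / 2 + 1), legCoeff n k • (lin y ^ (n - 2 * k) * nsq ^ k)

lemma ev_zonal (n : ℕ) (y : E3) {x : E3} (hx : ‖x‖ = 1) :
    ev (zonal n y) x = (legendrePoly n).eval ⟪x, y⟫ := by
  simp [zonal, ev_sum, legendrePoly_eq_sum, Polynomial.eval_finsetSum, hx]

lemma zonal_mem_sphHarm (n : ℕ) {y : E3} (hy : ‖y‖ = 1) : zonal n y ∈ sphHarm n := by
  rw [mem_sphHarm]
  constructor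
  · refine MvPolynomial.IsHomogeneous.sum _ _ _ fun k hk => ?_
    have hk : 2 * k ≤ n := by have := Finset.mem_range.1 hk; omega
    have := ((lin_isHomogeneous y).pow (n - 2 * k)).mul (nsq_isHomogeneous.pow k)
    rw [show 1 * (n - 2 * k) + 2 * k = n by omega] at this
    rw [MvPolynomial.smul_eq_C_mul]
    simpa using (MvPolynomial.isHomogeneous_C (Fin 3) (legCoeff n k)).mul this
  · rw [zonal, map_sum]
    simp only [map_smul, lap_lin_pow_mul_nsq_pow hy, smul_add, smul_smul,
      Finset.sum_add_distrib]
    have hlast : n - 2 * (n / 2) = 0 ∨ n - 2 * (n / 2) = 1 := by omega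
    rw [Finset.sum_range_succ, Finset.sum_range_succ']
    have h0 : (((n - 2 * (n / 2) : ℕ) : ℝ) * (((n - 2 * (n / 2) : ℕ) : ℝ) - 1)) = 0 := by
      rcases hlast with h | h <;> simp [h]
    rw [h0]
    simp only [mul_zero, zero_smul, add_zero, Nat.cast_zero, zero_mul]
    rw [← Finset.sum_add_distrib]
    refine Finset.sum_eq_zero fun k hk => ?_
    have hk : 2 * k + 2 ≤ n := by have := Finset.mem_range.1 hk; omega
    rw [Nat.add_sub_cancel, Nat.sub_sub, show 2 * k + 2 = 2 * (k + 1) by ring, ← add_smul]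
    convert zero_smul ℝ _ using 2
    have := legCoeff_succ hk
    rw [Nat.cast_sub (by omega), Nat.cast_sub (by omega)]
    push_cast
    linear_combination this

/-- The reproducing property of zonal harmonics. -/
lemma savg_mul_zonal {n : ℕ} {p : Poly3} (hp : p ∈ sphHarm n) (y : E3) :
    (2 * n + 1) * savg (p * zonal n y) = ev p y := by
  rw [zonal, Finset.mul_sum, map_sum, Finset.sum_range_succ', Finset.sum_eq_zero, zero_add]
  · have h := savg_mul_lin_pow hp y
    have e : p * legCoeff n 0 • (lin y ^ (n - 2 * 0) * nsq ^ 0) =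
      legCoeff n 0 • (p * lin y ^ n) := by simp
    rw [e, map_smul, smul_eq_mul, legCoeff]
    rw [Nat.factorial_succ] at h
    have f1 : ((2 * n).factorial : ℝ) ≠ 0 := by positivity
    have f2 : (n.factorial : ℝ) ≠ 0 := by positivity
    push_cast at h
    simp only [pow_zero, mul_zero, Nat.sub_zero, Nat.factorial_zero, Nat.cast_one]
    field_simp
    linear_combination h
  · intro k hk
    have hk : 2 * (k + 1) ≤ n := by have := Finset.mem_range.1 hk; omega
    have hl : (lin y ^ (n - 2 * (k + 1))).IsHomogeneous (n - 2 * (k + 1)) := by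
      simpa using (lin_isHomogeneous y).pow (n - 2 * (k + 1))
    rw [mul_smul_comm, map_smul, ← mul_assoc, savg_mul_nsq_pow,
      savg_mul_eq_zero_of_lt hp hl (by omega), smul_zero]

/-! ### The law of one coordinate on the sphere -/

lemma savg_lin_pow_add_two {y : E3} (hy : ‖y‖ = 1) (m : ℕ) :
    savg (lin y ^ (m + 2)) * (m + 3) = (m + 1) * savg (lin y ^ m) := by
  have hl : (lin y ^ (m + 1)).IsHomogeneous (m + 1) := by
    simpa using (lin_isHomogeneous y).pow (m + 1)
  have h1 : ∀ i, y i * savg (MvPolynomial.pderiv i (lin y ^ (m + 1))) =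
      (m + 3) * savg (MvPolynomial.C (y i) * MvPolynomial.X i * lin y ^ (m + 1)) := by
    intro i
    rw [savg_pderiv hl, mul_assoc, ← MvPolynomial.smul_eq_C_mul, map_smul, smul_eq_mul]
    push_cast; ring
  have h2 : ∀ i, y i * savg (MvPolynomial.pderiv i (lin y ^ (m + 1))) =
      y i ^ 2 * ((m + 1) * savg (lin y ^ m)) := by
    intro i
    have : MvPolynomial.pderiv i (lin y ^ (m + 1)) = ((m + 1 : ℝ) * y i) • lin y ^ m := by
      rw [Derivation.leibniz_pow, pderiv_lin, MvPolynomial.smul_eq_C_mul]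
      simp only [smul_eq_mul, nsmul_eq_mul, Nat.add_sub_cancel, map_mul, map_add, map_natCast,
        map_one]
      push_cast; ring
    rw [this, map_smul, smul_eq_mul]; ring
  have h3 := Finset.sum_congr rfl fun i (_ : i ∈ Finset.univ) => (h1 i).symm.trans (h2 i)
  rw [← Finset.mul_sum, ← map_sum, ← Finset.sum_mul, ← Finset.sum_mul] at h3
  have h4 : ∑ i, y i ^ 2 = 1 := by
    have := EuclideanSpace.norm_sq_eq y
    simpa [hy] using this.symm
  rw [h4, one_mul] at h3
  rw [← h3, pow_succ' (lin y) (m + 1), mul_comm]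
  rfl

lemma savg_lin {y : E3} : savg (lin y) = 0 := by
  have h := savg_pderiv (m := 0) (MvPolynomial.isHomogeneous_one (Fin 3) ℝ)
  simp only [MvPolynomial.pderiv_one, map_zero, mul_one, Nat.cast_zero, zero_add] at h
  have h' : ∀ i, savg (MvPolynomial.X i) = 0 := fun i => by have := h i; linarith
  rw [lin, map_sum]
  simp [← MvPolynomial.smul_eq_C_mul, h']

lemma savg_lin_pow {y : E3} (hy : ‖y‖ = 1) (m : ℕ) :
    savg (lin y ^ m) = (1 / 2) * ∫ t in (-1 : ℝ)..1, t ^ m := by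
  induction m using Nat.twoStepInduction with
  | zero => norm_num [savg_one]
  | one => simp [savg_lin]
  | more m ih _ =>
    have h := savg_lin_pow_add_two hy m
    rw [ih, integral_pow] at h
    rw [integral_pow]
    have h3 : (m : ℝ) + 3 ≠ 0 := by positivity
    have h1 : (m : ℝ) + 1 ≠ 0 := by positivity
    apply mul_right_cancel₀ h3
    rw [h]
    push_cast
    rw [show (m : ℝ) + 2 + 1 = m + 3 by ring]
    field_simp
    ring

lemma integral_eval_inner {y : E3} (hy : ‖y‖ = 1) (p : ℝ[X]) :
    ∫ x : Sphere2, p.eval ⟪(x : E3), y⟫ ∂sphMeasure =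
      (1 / 2) * ∫ t in (-1 : ℝ)..1, p.eval t := by
  induction p using Polynomial.induction_on' with
  | add p q hp hq =>
    simp only [Polynomial.eval_add]
    rw [integral_add (integrable_sphere (by fun_prop)) (integrable_sphere (by fun_prop)),
      intervalIntegral.integral_add (Continuous.intervalIntegrable (by fun_prop) _ _)
        (Continuous.intervalIntegrable (by fun_prop) _ _), hp, hq]
    ring
  | monomial n a =>
    have := savg_lin_pow hy n
    simp only [savg_def, ev_pow, ev_lin] at this
    simp only [Polynomial.eval_monomial, intervalIntegral.integral_const_mul, integral_const_mul,
      this]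
    ring

lemma abs_inner_sphere_le {y : E3} (hy : ‖y‖ = 1) (x : Sphere2) : |⟪(x : E3), y⟫| ≤ 1 := by
  have := abs_real_inner_le_norm (x : E3) y
  simpa [hy] using this

lemma integral_continuous_inner {y : E3} (hy : ‖y‖ = 1) {g : ℝ → ℝ} (hg : Continuous g) :
    ∫ x : Sphere2, g ⟪(x : E3), y⟫ ∂sphMeasure = (1 / 2) * ∫ t in (-1 : ℝ)..1, g t := by
  refine eq_of_forall_dist_le fun ε hε => ?_
  rw [Real.dist_eq]
  obtain ⟨p, hp⟩ := exists_polynomial_near_of_continuousOn (-1) 1 g hg.continuousOn (ε / 2)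
    (by positivity)
  have h1 : |∫ x : Sphere2, g ⟪(x : E3), y⟫ ∂sphMeasure -
      ∫ x : Sphere2, p.eval ⟪(x : E3), y⟫ ∂sphMeasure| ≤ ε / 2 := by
    rw [← integral_sub (integrable_sphere (by fun_prop)) (integrable_sphere (by fun_prop))]
    have h0 : (ε / 2) * sphMeasure.real Set.univ = ε / 2 := by rw [probReal_univ, mul_one]
    rw [← h0, ← Real.norm_eq_abs]
    refine norm_integral_le_of_norm_le_const (Filter.Eventually.of_forall fun x => ?_)
    rw [Real.norm_eq_abs, abs_sub_comm]
    exact (hp _ (abs_le.1 (abs_inner_sphere_le hy x))).le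
  have h2 : |(∫ t in (-1 : ℝ)..1, p.eval t) - ∫ t in (-1 : ℝ)..1, g t| ≤ ε := by
    rw [← intervalIntegral.integral_sub (Continuous.intervalIntegrable (by fun_prop) _ _)
      (Continuous.intervalIntegrable (by fun_prop) _ _)]
    have := intervalIntegral.norm_integral_le_of_norm_le_const (a := -1) (b := (1 : ℝ))
      (f := fun t => p.eval t - g t) (C := ε / 2) fun x hx => by
        rw [Set.uIoc_of_le (by norm_num)] at hx
        exact (hp x ⟨hx.1.le, hx.2⟩).le
    rw [Real.norm_eq_abs] at this
    norm_num at this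
    linarith
  rw [integral_eval_inner hy] at h1
  rw [abs_le] at *
  constructor <;> linarith [h1.1, h1.2, h2.1, h2.2]

lemma map_inner_sphMeasure {y : E3} (hy : ‖y‖ = 1) :
    sphMeasure.map (fun x : Sphere2 => ⟪(x : E3), y⟫) =
      (2⁻¹ : ENNReal) • volume.restrict (Set.Ioc (-1 : ℝ) 1) := by
  have hc : Continuous (fun x : Sphere2 => ⟪(x : E3), y⟫) := by fun_prop
  have := Measure.isProbabilityMeasure_map (μ := sphMeasure) hc.measurable.aemeasurable
  have : IsFiniteMeasure ((2⁻¹ : ENNReal) • volume.restrict (Set.Ioc (-1 : ℝ) 1)) :=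
    Measure.smul_finite _ (by simp)
  refine ext_of_forall_integral_eq_of_IsFiniteMeasure fun g => ?_
  rw [integral_map hc.measurable.aemeasurable g.continuous.aestronglyMeasurable,
    integral_continuous_inner hy g.continuous, integral_smul_measure,
    intervalIntegral.integral_of_le (by norm_num)]
  simp

/-- Archimedes' formula for the area of spherical caps. -/
lemma sphMeasure_closedBall (y : Sphere2) {r : ℝ} (h0 : 0 ≤ r) (h2 : r ≤ 2) :
    sphMeasure.real (Metric.closedBall y r) = r ^ 2 / 4 := by
  have hy : ‖(y : E3)‖ = 1 := by simp
  have hc : Continuous (fun x : Sphere2 => ⟪(x : E3), (y : E3)⟫) := by fun_prop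
  have h : Metric.closedBall y r =
      (fun x : Sphere2 => ⟪(x : E3), (y : E3)⟫) ⁻¹' (Set.Ici (1 - r ^ 2 / 2)) := by
    ext x
    have hx : ‖(x : E3)‖ = 1 := by simp
    have hs := norm_sub_sq_real (x : E3) y
    rw [hx, hy] at hs
    simp only [Metric.mem_closedBall, Subtype.dist_eq, dist_eq_norm, Set.mem_preimage,
      Set.mem_Ici]
    rw [← sq_le_sq₀ (norm_nonneg _) h0]
    constructor <;> intro h <;> linarith
  rw [h, Measure.real, ← Measure.map_apply hc.measurable measurableSet_Ici,
    map_inner_sphMeasure hy, Measure.smul_apply, Measure.restrict_apply measurableSet_Ici]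
  have h1 : volume (Set.Ici (1 - r ^ 2 / 2) ∩ Set.Ioc (-1 : ℝ) 1) = ENNReal.ofReal (r ^ 2 / 2) := by
    apply le_antisymm
    · refine (measure_mono (t := Set.Icc (1 - r ^ 2 / 2) 1) fun t ht => ⟨ht.1, ht.2.2⟩).trans ?_
      rw [Real.volume_Icc]; simp
    · refine le_trans ?_ (measure_mono (s := Set.Ioc (1 - r ^ 2 / 2) 1) fun t ht =>
        ⟨ht.1.le, lt_of_le_of_lt (by nlinarith) ht.1, ht.2⟩)
      rw [Real.volume_Ioc]; simp
  rw [h1, smul_eq_mul, ENNReal.toReal_mul, ENNReal.toReal_ofReal (by positivity)]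
  simp; ring

/-! ### Values of Legendre polynomials -/

lemma legendrePoly_eval_one_sub (n : ℕ) (t : ℝ) : (legendrePoly n).eval (1 - 2 * t) =
    ∑ k ∈ Finset.range (n + 1), (-1) ^ k * (n.choose k : ℝ) * ((n + k).choose n) * t ^ k := by
  let l : ℝ[X] := 1 - Polynomial.C 2 * Polynomial.X
  have hcomp : ∀ (k : ℕ) (p : ℝ[X]), Polynomial.derivative^[k] (p.comp l) =
      Polynomial.C ((-2) ^ k) * (Polynomial.derivative^[k] p).comp l := by
    intro k
    induction k with
    | zero => intro p; simp
    | succ k ih =>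
      intro p
      rw [Function.iterate_succ_apply', ih, Polynomial.derivative_C_mul,
        Polynomial.derivative_comp, Function.iterate_succ_apply']
      simp only [l, Polynomial.derivative_sub, Polynomial.derivative_one,
        Polynomial.derivative_C_mul, Polynomial.derivative_X, pow_succ, map_mul, map_neg]
      ring
  have h1 := hcomp n ((Polynomial.X ^ 2 - 1) ^ n)
  have h2 : ((Polynomial.X ^ 2 - 1 : ℝ[X]) ^ n).comp l = Polynomial.C ((-4) ^ n) *
      (Polynomial.X ^ n * (1 - Polynomial.X) ^ n) := by
    rw [map_pow, ← mul_pow, ← mul_pow]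
    simp only [Polynomial.pow_comp, Polynomial.sub_comp, Polynomial.X_comp, Polynomial.one_comp, l]
    congr 1
    simp only [map_neg, map_ofNat]
    ring
  have h3 := congrArg (Polynomial.map (Int.castRingHom ℝ)) (factorial_mul_shiftedLegendre_eq n)
  rw [← Polynomial.iterate_derivative_map] at h3
  simp only [Polynomial.map_mul, Polynomial.map_pow, Polynomial.map_sub, Polynomial.map_one,
    Polynomial.map_X, Polynomial.map_natCast] at h3
  rw [h2, Polynomial.iterate_derivative_C_mul, ← h3] at h1
  have h4 := congrArg (Polynomial.eval t) h1
  have hl : l.eval t = 1 - 2 * t := by simp [l]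
  rw [Polynomial.eval_mul, Polynomial.eval_mul, Polynomial.eval_mul, Polynomial.eval_comp, hl,
    Polynomial.eval_C, Polynomial.eval_C, Polynomial.eval_natCast] at h4
  have h5 : (Polynomial.map (Int.castRingHom ℝ) (shiftedLegendre n)).eval t =
      ∑ k ∈ Finset.range (n + 1),
        (-1) ^ k * (n.choose k : ℝ) * ((n + k).choose n) * t ^ k := by
    simp [shiftedLegendre, Polynomial.map_sum, Polynomial.eval_finsetSum]
  rw [h5] at h4
  rw [legendrePoly, Polynomial.eval_mul, Polynomial.eval_C]
  have hf : (n.factorial : ℝ) ≠ 0 := by positivity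
  rw [show (-4 : ℝ) ^ n = (-2) ^ n * 2 ^ n by rw [← mul_pow]; norm_num, mul_assoc] at h4
  have h6 := mul_left_cancel₀ (by positivity : ((-2 : ℝ) ^ n) ≠ 0) h4
  rw [← h6]
  field_simp

lemma legendrePoly_eval_one (n : ℕ) : (legendrePoly n).eval 1 = 1 := by
  have := legendrePoly_eval_one_sub n 0
  rw [mul_zero, sub_zero] at this
  rw [this, Finset.sum_range_succ']
  simp

lemma choose_mul_choose_eq_prod (n k : ℕ) :
    (n.choose k : ℝ) * ((n + k).choose n) =
      (∏ j ∈ Finset.range k, ((n : ℝ) - j) * (n + 1 + j)) / (k.factorial : ℝ) ^ 2 := by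
  induction k with
  | zero => simp
  | succ k ih =>
    have h1 : (n.choose (k + 1) : ℝ) * (k + 1) = n.choose k * ((n : ℝ) - k) := by
      rcases le_or_gt k n with h | h
      · rw [← Nat.cast_sub h]; exact_mod_cast Nat.choose_succ_right_eq n k
      · rw [Nat.choose_eq_zero_of_lt h, Nat.choose_eq_zero_of_lt (by omega)]; simp
    have h2 : ((n + (k + 1)).choose n : ℝ) * (k + 1) = (n + k).choose n * (n + 1 + k) := by
      have := Nat.add_one_mul_choose_eq (n + k) k
      rw [← add_assoc, Nat.choose_symm_of_eq_add (show n + k + 1 = n + (k + 1) by ring),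
        Nat.choose_symm_add]
      have h' : ((n + k + 1 : ℕ) : ℝ) * ((n + k).choose k : ℝ) =
        ((n + k + 1).choose (k + 1) : ℝ) * ((k + 1 : ℕ) : ℝ) := by exact_mod_cast this
      push_cast at h'
      linear_combination -h'
    rw [Finset.prod_range_succ, Nat.factorial_succ]
    rw [eq_div_iff (by positivity)] at ih
    rw [eq_div_iff (by positivity)]
    push_cast
    linear_combination ((n + (k + 1)).choose n : ℝ) * (k + 1) * (k.factorial) ^ 2 * h1 +
      n.choose k * ((n : ℝ) - k) * (k.factorial) ^ 2 * h2 + ((n : ℝ) - k) * (n + 1 + k) * ih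

/-- The Mehler–Heine limit of Legendre polynomials. -/
lemma tendsto_legendrePoly_eval {t : ℕ → ℝ} {τ : ℝ}
    (ht : Filter.Tendsto (fun n : ℕ => (n : ℝ) ^ 2 * t n) Filter.atTop (nhds τ)) :
    Filter.Tendsto (fun n => (legendrePoly n).eval (1 - 2 * t n)) Filter.atTop
      (nhds (∑' k : ℕ, (-τ) ^ k / (k.factorial : ℝ) ^ 2)) := by
  have e : ∀ n, (legendrePoly n).eval (1 - 2 * t n) =
      ∑' k : ℕ, (∏ j ∈ Finset.range k, -(((n : ℝ) - j) * (n + 1 + j) * t n)) /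
        (k.factorial : ℝ) ^ 2 := by
    intro n
    rw [legendrePoly_eval_one_sub, tsum_eq_sum (s := Finset.range (n + 1))]
    · refine Finset.sum_congr rfl fun k _ => ?_
      rw [mul_assoc _ (n.choose k : ℝ), choose_mul_choose_eq_prod]
      rw [Finset.prod_congr rfl fun (j : ℕ) _ => show -(((n : ℝ) - j) * (n + 1 + j) * t n) =
        (-1) * (((n : ℝ) - j) * (n + 1 + j)) * t n by ring]
      simp only [Finset.prod_mul_distrib, Finset.prod_const, Finset.card_range]
      ring
    · intro k hk
      have hk : n < k := by have := Finset.mem_range.not.1 hk; omega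
      rw [Finset.prod_eq_zero (Finset.mem_range.2 hk) (by simp), zero_div]
  simp only [e]
  refine tendsto_tsum_of_dominated_convergence (bound := fun k : ℕ =>
    (2 * (|τ| + 1)) ^ k / (k.factorial : ℝ)) (Real.summable_pow_div_factorial _) ?_ ?_
  · intro k
    refine Filter.Tendsto.div_const ?_ _
    have : (-τ) ^ k = ∏ j ∈ Finset.range k, -τ := by simp
    rw [this]
    refine tendsto_finsetProd _ fun j _ => ?_
    have hinv : Filter.Tendsto (fun n : ℕ => (1 : ℝ) / n) Filter.atTop (nhds 0) :=
      tendsto_one_div_atTop_nhds_zero_nat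
    have h1 : Filter.Tendsto (fun n : ℕ => -((1 - j * ((1 : ℝ) / n)) *
        (1 + (1 + j) * ((1 : ℝ) / n)) * ((n : ℝ) ^ 2 * t n))) Filter.atTop
        (nhds (-((1 - j * 0) * (1 + (1 + j) * 0) * τ))) :=
      (((tendsto_const_nhds.sub (hinv.const_mul _)).mul
        (tendsto_const_nhds.add (hinv.const_mul _))).mul ht).neg
    simp only [mul_zero, sub_zero, add_zero, one_mul] at h1
    refine h1.congr' ?_
    filter_upwards [Filter.eventually_ge_atTop 1] with n hn
    have : (n : ℝ) ≠ 0 := by positivity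
    field_simp
    ring
  · have h1 : ∀ᶠ n : ℕ in Filter.atTop, |(n : ℝ) ^ 2 * t n| < |τ| + 1 :=
      ht.abs.eventually_lt_const (by linarith)
    filter_upwards [h1, Filter.eventually_ge_atTop 1] with n hn hn1 k
    have hn1' : (1 : ℝ) ≤ n := by exact_mod_cast hn1
    rw [norm_div, norm_prod, norm_pow, Real.norm_natCast]
    have hnum : ∏ j ∈ Finset.range k, ‖-(((n : ℝ) - j) * (n + 1 + j) * t n)‖ ≤
        (2 * (|τ| + 1)) ^ k := by
      rcases lt_or_ge n k with hk | hk
      · rw [Finset.prod_eq_zero (Finset.mem_range.2 hk) (by simp)]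
        positivity
      · rw [← Finset.card_range k, ← Finset.prod_const, Finset.card_range]
        refine Finset.prod_le_prod (fun _ _ => norm_nonneg _) fun j hj => ?_
        have hj : (j : ℝ) < n := by
          exact_mod_cast (Finset.mem_range.1 hj).trans_le hk
        have hj0 : (0 : ℝ) ≤ j := j.cast_nonneg
        rw [norm_neg, Real.norm_eq_abs, abs_mul, abs_of_nonneg (by nlinarith)]
        rw [abs_mul, abs_of_nonneg (by positivity)] at hn
        have : ((n : ℝ) - j) * (n + 1 + j) ≤ 2 * n ^ 2 := by nlinarith
        nlinarith [abs_nonneg (t n)]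
    have hk1 : (1 : ℝ) ≤ k.factorial := by exact_mod_cast k.factorial_pos
    calc _ ≤ (2 * (|τ| + 1)) ^ k / (k.factorial : ℝ) ^ 2 := by gcongr
      _ ≤ _ := by
        apply div_le_div_of_nonneg_left (by positivity) (by positivity)
        nlinarith

/-! ### An isometric model of the space of spherical harmonics -/

lemma ev_eq_zero_of_sphere {n : ℕ} {p : Poly3} (hp : p.IsHomogeneous n)
    (h : ∀ x : Sphere2, ev p x = 0) : p = 0 := by
  refine ev_ext fun x => ?_
  rw [ev_zero]
  by_cases hx : x = 0
  · obtain ⟨y⟩ : Nonempty Sphere2 := (NormedSpace.sphere_nonempty.2 zero_le_one).to_subtype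
    have h0 := ev_homog hp 0 (y : E3)
    rw [h, mul_zero, zero_smul] at h0
    rw [hx, h0]
  · have h1 : ‖x‖ ≠ 0 := norm_ne_zero_iff.2 hx
    have h2 := ev_homog hp ‖x‖ (‖x‖⁻¹ • x)
    rw [smul_smul, mul_inv_cancel₀ h1, one_smul] at h2
    rw [h2, h ⟨‖x‖⁻¹ • x, by simp [norm_smul, h1]⟩, mul_zero]

lemma eq_zero_of_savg_mul_self {n : ℕ} {p : Poly3} (hp : p.IsHomogeneous n)
    (h : savg (p * p) = 0) : p = 0 := by
  refine ev_eq_zero_of_sphere hp ?_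
  rw [savg_def] at h
  have hc : Continuous fun x : Sphere2 => ev (p * p) x := by fun_prop
  have h1 := (integral_eq_zero_iff_of_nonneg (fun x : Sphere2 => by
    simpa using mul_self_nonneg (ev p x)) (integrable_sphere hc)).1 h
  have h2 := Continuous.ae_eq_iff_eq sphMeasure hc continuous_zero |>.1 h1
  intro x
  simpa using congrFun h2 x

instance finiteDimensional_sphHarm (n : ℕ) : FiniteDimensional ℝ (sphHarm n) := by
  have : FiniteDimensional ℝ (MvPolynomial.homogeneousSubmodule (Fin 3) ℝ n) :=
    Module.Finite.iff_fg.2 (MvPolynomial.homogeneousSubmodule_fg (Fin 3) ℝ n)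
  exact Submodule.finiteDimensional_of_le (S₂ := MvPolynomial.homogeneousSubmodule (Fin 3) ℝ n)
    fun p hp => (mem_sphHarm.1 hp).1

/-- A parametrization of the spherical harmonics of degree `n` by Euclidean space, isometric for
`(2n+1)` times the inner product of `L²(σ)`. -/
structure HarmModel (n d : ℕ) where
  /-- The parametrization. -/
  Φ : EuclideanSpace ℝ (Fin d) →ₗ[ℝ] Poly3
  mem : ∀ ξ, Φ ξ ∈ sphHarm n
  surj : ∀ p ∈ sphHarm n, ∃ ξ, Φ ξ = p
  inner_eq : ∀ ξ η, ⟪ξ, η⟫ = (2 * n + 1) * savg (Φ ξ * Φ η)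

theorem exists_harmModel (n : ℕ) : ∃ d, Nonempty (HarmModel n d) := by
  let core : InnerProductSpace.Core ℝ (sphHarm n) :=
    { inner := fun p q => (2 * n + 1) * savg (p * q)
      conj_inner_symm := fun p q => by simp [mul_comm]
      re_inner_nonneg := fun p => by
        have := savg_mul_self_nonneg (p : Poly3)
        simp only [RCLike.re_to_real]
        positivity
      add_left := fun p q r => by simp [add_mul, mul_add]
      smul_left := fun p q r => by simp; ring
      definite := fun p h => by
        have h0 : (2 * n + 1 : ℝ) ≠ 0 := by positivity
        have := (mul_eq_zero.1 h).resolve_left h0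
        exact Subtype.ext (eq_zero_of_savg_mul_self (mem_sphHarm.1 p.2).1 this) }
  let _ : NormedAddCommGroup (sphHarm n) := core.toNormedAddCommGroup
  let _ : InnerProductSpace ℝ (sphHarm n) := InnerProductSpace.ofCore core.toCore
  let b := (stdOrthonormalBasis ℝ (sphHarm n)).repr
  refine ⟨_, ⟨(sphHarm n).subtype ∘ₗ b.symm.toLinearEquiv.toLinearMap, fun ξ => (b.symm ξ).2,
    fun p hp => ⟨b ⟨p, hp⟩, by simp⟩, fun ξ η => ?_⟩⟩
  rw [← b.symm.inner_map_map]
  rfl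

namespace HarmModel

variable {n d : ℕ} (M : HarmModel n d)

/-- The vector representing the evaluation at a point. -/
noncomputable def feat (x : E3) : EuclideanSpace ℝ (Fin d) :=
  WithLp.toLp 2 fun j => ev (M.Φ (EuclideanSpace.single j 1)) x

lemma ev_eq_inner (ξ : EuclideanSpace ℝ (Fin d)) (x : E3) : ev (M.Φ ξ) x = ⟪ξ, M.feat x⟫ := by
  have h : ξ = ∑ j, ξ j • EuclideanSpace.single j (1 : ℝ) := by
    ext i; simp [Finset.sum_apply, Pi.single_apply]
  conv_lhs => rw [h]
  rw [map_sum, ev_sum]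
  simp only [map_smul, ev_smul, feat, PiLp.inner_apply]
  refine Finset.sum_congr rfl fun i _ => ?_
  simp [mul_comm]

@[fun_prop]
lemma continuous_feat : Continuous M.feat := by
  unfold feat
  fun_prop

lemma norm_sq (ξ : EuclideanSpace ℝ (Fin d)) :
    ‖ξ‖ ^ 2 = (2 * n + 1) * savg (M.Φ ξ * M.Φ ξ) := by
  rw [← real_inner_self_eq_norm_sq, M.inner_eq]

lemma map_feat {y : E3} (hy : ‖y‖ = 1) : M.Φ (M.feat y) = zonal n y := by
  obtain ⟨ζ, hζ⟩ := M.surj _ (zonal_mem_sphHarm n hy)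
  have : ζ = M.feat y := ext_inner_left ℝ fun ξ => by
    rw [M.inner_eq, hζ, savg_mul_zonal (M.mem ξ), M.ev_eq_inner]
  rw [← this, hζ]

lemma inner_feat {x y : E3} (hx : ‖x‖ = 1) (hy : ‖y‖ = 1) :
    ⟪M.feat x, M.feat y⟫ = (legendrePoly n).eval ⟪x, y⟫ := by
  rw [← M.ev_eq_inner, M.map_feat hx, ev_zonal n x hy, real_inner_comm]

lemma norm_feat {x : E3} (hx : ‖x‖ = 1) : ‖M.feat x‖ = 1 := by
  have h := M.inner_feat hx hx
  rw [real_inner_self_eq_norm_sq, real_inner_self_eq_norm_sq, hx, one_pow,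
    legendrePoly_eval_one] at h
  exact (pow_eq_one_iff_of_nonneg (norm_nonneg _) two_ne_zero).1 h

/-- A spherical harmonic vanishing against every feature vector vanishes. -/
lemma eq_zero_of_inner_feat {ξ : EuclideanSpace ℝ (Fin d)}
    (h : ∀ x : Sphere2, ⟪ξ, M.feat x⟫ = 0) : ξ = 0 := by
  have : M.Φ ξ = 0 := ev_eq_zero_of_sphere (mem_sphHarm.1 (M.mem ξ)).1 fun x => by
    rw [M.ev_eq_inner, h]
  have h2 := M.norm_sq ξ
  rw [this] at h2
  simpa using h2

lemma continuous_ev_model : Continuous fun q : EuclideanSpace ℝ (Fin d) × E3 =>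
    ev (M.Φ q.1) q.2 := by
  simp only [M.ev_eq_inner]
  fun_prop

end HarmModel

/-! ### Gaussian estimates -/

section Gauss

variable {E : Type*} [NormedAddCommGroup E] [InnerProductSpace ℝ E] [FiniteDimensional ℝ E]
  [MeasurableSpace E] [BorelSpace E]

lemma map_inner_stdGaussian (v : E) :
    (stdGaussian E).map (fun ξ => ⟪ξ, v⟫) = gaussianReal 0 (‖v‖ ^ 2).toNNReal := by
  have := map_dual_stdGaussian (innerSL ℝ v)
  rw [innerSL_apply_norm] at this
  rw [← this]
  congr 1
  ext ξ
  simp [real_inner_comm]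

lemma integral_inner_sq_stdGaussian (v : E) :
    ∫ ξ, ⟪ξ, v⟫ ^ 2 ∂stdGaussian E = ‖v‖ ^ 2 := by
  have h := variance_id_gaussianReal (μ := 0) (v := (‖v‖ ^ 2).toNNReal)
  rw [variance_of_integral_eq_zero (by fun_prop) (by simp), ← map_inner_stdGaussian,
    integral_map (by fun_prop) (by fun_prop)] at h
  simpa using h

lemma integrable_inner_sq_stdGaussian (v : E) :
    Integrable (fun ξ => ⟪ξ, v⟫ ^ 2) (stdGaussian E) := by
  have h : MemLp id 2 (gaussianReal 0 (‖v‖ ^ 2).toNNReal) := memLp_id_gaussianReal 2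
  rw [← map_inner_stdGaussian, memLp_map_measure_iff (by fun_prop) (by fun_prop)] at h
  exact h.integrable_sq

lemma gaussianReal_Icc_le (a : ℝ) : gaussianReal 0 1 (Set.Icc (-a) a) ≤ ENNReal.ofReal (2 * a) := by
  rw [gaussianReal_apply 0 one_ne_zero]
  calc ∫⁻ x in Set.Icc (-a) a, gaussianPDF 0 1 x ≤ ∫⁻ x in Set.Icc (-a) a, 1 := by
        refine lintegral_mono fun x => ?_
        rw [gaussianPDF, ← ENNReal.ofReal_one]
        refine ENNReal.ofReal_le_ofReal ?_
        rw [gaussianPDFReal]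
        have h1 : (√(2 * Real.pi * ((1 : NNReal) : ℝ)))⁻¹ ≤ 1 := by
          refine inv_le_one_of_one_le₀ (Real.one_le_sqrt.2 ?_)
          have := Real.pi_gt_three
          simp; linarith
        have h2 : Real.exp (-(x - 0) ^ 2 / (2 * ((1 : NNReal) : ℝ))) ≤ 1 := by
          rw [Real.exp_le_one_iff]
          exact div_nonpos_of_nonpos_of_nonneg (neg_nonpos.2 (sq_nonneg _)) (by positivity)
        calc _ ≤ (1 : ℝ) * 1 := by gcongr
          _ = 1 := one_mul 1
    _ = ENNReal.ofReal (2 * a) := by simp [two_mul]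

/-- Small ball estimate for two independent coordinates of a standard Gaussian vector. -/
lemma stdGaussian_small_ball {u v : E} (hu : ‖u‖ = 1) (hv : ‖v‖ = 1) (huv : ⟪u, v⟫ = 0)
    (a b : ℝ) : stdGaussian E {ξ | |⟪ξ, u⟫| ≤ a ∧ |⟪ξ, v⟫| ≤ b} ≤
      ENNReal.ofReal (2 * a) * ENNReal.ofReal (2 * b) := by
  let L : E →L[ℝ] EuclideanSpace ℝ (Fin 2) :=
    (EuclideanSpace.equiv (Fin 2) ℝ).symm.toContinuousLinearMap ∘L
      ContinuousLinearMap.pi ![innerSL ℝ u, innerSL ℝ v]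
  have hL0 : ∀ ξ, L ξ 0 = ⟪ξ, u⟫ := fun ξ => by simp [L, real_inner_comm]
  have hL1 : ∀ ξ, L ξ 1 = ⟪ξ, v⟫ := fun ξ => by simp [L, real_inner_comm]
  have hmap : (stdGaussian E).map L = stdGaussian (EuclideanSpace ℝ (Fin 2)) := by
    refine Measure.ext_of_charFun (funext fun t => ?_)
    have h1 : charFun ((stdGaussian E).map L) t = charFun (stdGaussian E) (t 0 • u + t 1 • v) := by
      rw [charFun_apply, charFun_apply, integral_map (by fun_prop) (by fun_prop)]
      refine integral_congr_ae (Filter.Eventually.of_forall fun ξ => ?_)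
      simp [PiLp.inner_apply, Fin.sum_univ_two, hL0, hL1, inner_add_right, inner_smul_right]
    rw [h1, charFun_stdGaussian, charFun_stdGaussian]
    congr 3
    have : ‖t 0 • u + t 1 • v‖ ^ 2 = ‖t‖ ^ 2 := by
      rw [norm_add_sq_real, EuclideanSpace.norm_sq_eq, Fin.sum_univ_two]
      simp [norm_smul, hu, hv, inner_smul_left, inner_smul_right, huv]
    exact_mod_cast this
  have hset : {ξ : E | |⟪ξ, u⟫| ≤ a ∧ |⟪ξ, v⟫| ≤ b} =
      L ⁻¹' ((WithLp.ofLp : EuclideanSpace ℝ (Fin 2) → _) ⁻¹'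
        Set.univ.pi ![Set.Icc (-a) a, Set.Icc (-b) b]) := by
    ext ξ
    simp [← hL0, ← hL1, abs_le, Set.mem_pi]
  have hms : MeasurableSet (Set.univ.pi ![Set.Icc (-a) a, Set.Icc (-b) b]) := by
    refine MeasurableSet.univ_pi fun i => ?_
    fin_cases i <;> exact measurableSet_Icc
  rw [hset, ← Measure.map_apply (by fun_prop) (hms.preimage (by fun_prop)), hmap,
    ← map_pi_eq_stdGaussian, Measure.map_apply (by fun_prop) (hms.preimage (by fun_prop)),
    ← Set.preimage_comp]
  change Measure.pi _ (Set.univ.pi _) ≤ _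
  rw [Measure.pi_pi, Fin.prod_univ_two]
  exact mul_le_mul' (gaussianReal_Icc_le a) (gaussianReal_Icc_le b)

end Gauss

/-! ### A local norm controlling a spherical harmonic near a point -/

/-- The sum of the absolute values of all partial derivatives of order `k`. -/
noncomputable def derivSum : ℕ → Poly3 → E3 → ℝ
  | 0, p, x => |ev p x|
  | k + 1, p, x => ∑ i, derivSum k (MvPolynomial.pderiv i p) x

lemma derivSum_nonneg (k : ℕ) (p : Poly3) (x : E3) : 0 ≤ derivSum k p x := by
  induction k generalizing p with
  | zero => exact abs_nonneg _
  | succ k ih => exact Finset.sum_nonneg fun i _ => ih _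

lemma continuous_derivSum_linear {d : ℕ} (k : ℕ) (Φ : EuclideanSpace ℝ (Fin d) →ₗ[ℝ] Poly3) :
    Continuous fun q : EuclideanSpace ℝ (Fin d) × E3 => derivSum k (Φ q.1) q.2 := by
  induction k generalizing Φ with
  | zero =>
    have h : ∀ (ξ : EuclideanSpace ℝ (Fin d)) (x : E3),
        ev (Φ ξ) x = ∑ j, ξ j * ev (Φ (EuclideanSpace.single j 1)) x := by
      intro ξ x
      have h : ξ = ∑ j, ξ j • EuclideanSpace.single j (1 : ℝ) := by
        ext i; simp [Finset.sum_apply, Pi.single_apply]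
      conv_lhs => rw [h]
      rw [map_sum, ev_sum]
      simp
    have e : (fun q : EuclideanSpace ℝ (Fin d) × E3 => derivSum 0 (Φ q.1) q.2) =
        fun q => |∑ j, q.1 j * ev (Φ (EuclideanSpace.single j 1)) q.2| := by
      funext q
      rw [← h]; rfl
    rw [e]
    fun_prop
  | succ k ih =>
    simp only [derivSum]
    exact continuous_finsetSum _ fun i _ => ih ((MvPolynomial.pderiv i).toLinearMap ∘ₗ Φ)

@[fun_prop]
lemma continuous_derivSum (k : ℕ) (p : Poly3) : Continuous (derivSum k p) := by
  induction k generalizing p with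
  | zero =>
    have : derivSum 0 p = fun x => |ev p x| := rfl
    rw [this]; fun_prop
  | succ k ih =>
    have : derivSum (k + 1) p = fun x => ∑ i, derivSum k (MvPolynomial.pderiv i p) x := rfl
    rw [this]; exact continuous_finsetSum _ fun i _ => ih _

lemma integral_abs_le_sqrt_savg (p : Poly3) :
    ∫ x : Sphere2, |ev p x| ∂sphMeasure ≤ √(savg (p * p)) := by
  refine Real.le_sqrt_of_sq_le ?_
  set m := ∫ x : Sphere2, |ev p x| ∂sphMeasure
  have h : 0 ≤ ∫ x : Sphere2, (|ev p x| - m) ^ 2 ∂sphMeasure := integral_nonneg fun x => sq_nonneg _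
  have e : ∀ x : Sphere2, (|ev p x| - m) ^ 2 = ev (p * p) x - 2 * m * |ev p x| + m ^ 2 := by
    intro x; rw [ev_mul, ← abs_mul_abs_self (ev p x)]; ring
  simp only [e] at h
  rw [integral_add (integrable_sphere (by fun_prop)) (integrable_sphere (by fun_prop)),
    integral_sub (integrable_sphere (by fun_prop)) (integrable_sphere (by fun_prop)),
    integral_const_mul, integral_const, probReal_univ, one_smul, ← savg_def] at h
  change 0 ≤ savg (p * p) - 2 * m * m + m ^ 2 at h
  linarith

lemma sum_sqrt_savg_pderiv_le {n : ℕ} {p : Poly3} (hp : p ∈ sphHarm n) :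
    ∑ i, √(savg (MvPolynomial.pderiv i p * MvPolynomial.pderiv i p)) ≤
      3 * n * √(savg (p * p)) := by
  refine abs_le_of_sq_le_sq' ?_ (by positivity) |>.2
  have h2 := savg_grad_sq hp
  have h3 := fun i : Fin 3 => Real.sq_sqrt (savg_mul_self_nonneg (MvPolynomial.pderiv i p))
  have h4 := Real.sq_sqrt (savg_mul_self_nonneg p)
  have h5 := savg_mul_self_nonneg p
  rw [Fin.sum_univ_three] at h2 ⊢
  have h30 := h3 0
  have h31 := h3 1
  have h32 := h3 2
  clear h3
  have h6 : (n : ℝ) * (2 * n + 1) * savg (p * p) ≤ 3 * n ^ 2 * savg (p * p) := by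
    refine mul_le_mul_of_nonneg_right ?_ h5
    rcases n.eq_zero_or_pos with rfl | h
    · simp
    · have : (1 : ℝ) ≤ n := by exact_mod_cast h
      nlinarith
  set a := √(savg (MvPolynomial.pderiv 0 p * MvPolynomial.pderiv 0 p))
  set b := √(savg (MvPolynomial.pderiv 1 p * MvPolynomial.pderiv 1 p))
  set c := √(savg (MvPolynomial.pderiv 2 p * MvPolynomial.pderiv 2 p))
  rw [mul_pow, h4]
  nlinarith [sq_nonneg (a - b), sq_nonneg (a - c), sq_nonneg (b - c)]

lemma integral_derivSum_le {n : ℕ} {p : Poly3} (hp : p ∈ sphHarm n) (k : ℕ) :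
    ∫ x : Sphere2, derivSum k p x ∂sphMeasure ≤ (3 * n) ^ k * √(savg (p * p)) := by
  induction k generalizing p n with
  | zero => simpa [derivSum] using integral_abs_le_sqrt_savg p
  | succ k ih =>
    simp only [derivSum]
    rw [integral_finsetSum _ fun i _ => integrable_sphere (by fun_prop)]
    calc ∑ i, ∫ x : Sphere2, derivSum k (MvPolynomial.pderiv i p) x ∂sphMeasure
        ≤ ∑ i, (3 * n) ^ k * √(savg (MvPolynomial.pderiv i p * MvPolynomial.pderiv i p)) := by
          refine Finset.sum_le_sum fun i _ => (ih (pderiv_mem_sphHarm hp i)).trans ?_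
          have : ((n - 1 : ℕ) : ℝ) ≤ n := by exact_mod_cast n.sub_le 1
          gcongr
      _ ≤ (3 * n) ^ k * (3 * n * √(savg (p * p))) := by
          rw [← Finset.mul_sum]
          exact mul_le_mul_of_nonneg_left (sum_sqrt_savg_pderiv_le hp) (by positivity)
      _ = _ := by ring

/-- The truncated Taylor majorant of a polynomial. -/
noncomputable def taylorMaj (K : ℕ) (a : ℝ) (p : Poly3) (x : E3) : ℝ :=
  ∑ k ∈ Finset.range K, a ^ k / k.factorial * derivSum k p x

lemma taylorMaj_nonneg (K : ℕ) {a : ℝ} (ha : 0 ≤ a) (p : Poly3) (x : E3) :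
    0 ≤ taylorMaj K a p x :=
  Finset.sum_nonneg fun k _ => mul_nonneg (by positivity) (derivSum_nonneg _ _ _)

lemma taylorMaj_mono (K : ℕ) {a b : ℝ} (ha : 0 ≤ a) (hab : a ≤ b) (p : Poly3) (x : E3) :
    taylorMaj K a p x ≤ taylorMaj K b p x :=
  Finset.sum_le_sum fun k _ => by
    have := derivSum_nonneg k p x
    gcongr

lemma sum_taylorMaj_pderiv (K : ℕ) (a : ℝ) (p : Poly3) (x : E3) :
    ∑ i, taylorMaj K a (MvPolynomial.pderiv i p) x =
      ∑ k ∈ Finset.range K, a ^ k / k.factorial * derivSum (k + 1) p x := by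
  simp only [taylorMaj, derivSum, Finset.mul_sum]
  exact Finset.sum_comm

lemma taylorMaj_pderiv_le (K : ℕ) {a : ℝ} (ha : 0 ≤ a) (p : Poly3) (x : E3) (i : Fin 3) :
    a * taylorMaj K a (MvPolynomial.pderiv i p) x ≤ taylorMaj (K + 1) (2 * a) p x := by
  have h1 : taylorMaj K a (MvPolynomial.pderiv i p) x ≤
      ∑ k ∈ Finset.range K, a ^ k / k.factorial * derivSum (k + 1) p x := by
    rw [← sum_taylorMaj_pderiv]
    exact Finset.single_le_sum (f := fun i => taylorMaj K a (MvPolynomial.pderiv i p) x)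
      (fun i _ => taylorMaj_nonneg K ha _ _) (Finset.mem_univ i)
  refine (mul_le_mul_of_nonneg_left h1 ha).trans ?_
  rw [taylorMaj, Finset.sum_range_succ', Finset.mul_sum]
  refine (Finset.sum_le_sum fun k _ => ?_).trans
    (le_add_of_nonneg_right (mul_nonneg (by positivity) (derivSum_nonneg _ _ _)))
  rw [← mul_assoc]
  refine mul_le_mul_of_nonneg_right ?_ (derivSum_nonneg _ _ _)
  rw [mul_pow, Nat.factorial_succ, Nat.cast_mul, ← mul_div_assoc,
    div_le_div_iff₀ (by positivity) (by positivity)]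
  have h2 : ((k + 1 : ℕ) : ℝ) ≤ 2 ^ (k + 1) := by exact_mod_cast (Nat.lt_two_pow_self).le
  calc a * a ^ k * (((k + 1 : ℕ) : ℝ) * k.factorial)
      = a ^ (k + 1) * k.factorial * ((k + 1 : ℕ) : ℝ) := by ring
    _ ≤ a ^ (k + 1) * k.factorial * 2 ^ (k + 1) := by gcongr
    _ = _ := by ring

lemma abs_coord_le_norm (y : E3) (i : Fin 3) : |y i| ≤ ‖y‖ := by
  simpa using PiLp.norm_apply_le y i

lemma abs_ev_add_le_taylorMaj {m K : ℕ} (hmK : m < K) {p : Poly3} (hp : p.IsHomogeneous m)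
    {a : ℝ} (x Y : E3) (hY : ‖Y‖ ≤ a) : |ev p (x + Y)| ≤ taylorMaj K a p x := by
  induction K generalizing m p a Y with
  | zero => omega
  | succ K ih =>
    have ha : 0 ≤ a := (norm_nonneg _).trans hY
    have key := image_norm_le_of_norm_deriv_right_le_deriv_boundary (a := 0) (b := 1)
      (f := fun t : ℝ => ev p (x + t • Y))
      (f' := fun t => ∑ i, Y i * ev (MvPolynomial.pderiv i p) (x + t • Y))
      (B := fun t => taylorMaj (K + 1) (t * a) p x)
      (B' := fun t => a * ∑ i, taylorMaj K (t * a) (MvPolynomial.pderiv i p) x)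
      (fun t _ => (hasDerivAt_ev p x Y t).continuousAt.continuousWithinAt)
      (fun t _ => (hasDerivAt_ev p x Y t).hasDerivWithinAt) ?_ ?_ ?_
    · simpa using key (Set.right_mem_Icc.2 zero_le_one)
    · simp only [taylorMaj, zero_mul, zero_smul, add_zero]
      rw [Finset.sum_range_succ']
      simp [derivSum]
    · intro t
      rw [sum_taylorMaj_pderiv]
      simp only [taylorMaj]
      simp_rw [Finset.sum_range_succ' _ K]
      rw [← add_zero (a * _), Finset.mul_sum]
      refine HasDerivAt.add ?_ (by simpa using hasDerivAt_const t _)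
      refine HasDerivAt.fun_sum fun k _ => ?_
      have h1 : HasDerivAt (fun t : ℝ => (t * a) ^ (k + 1)) 
          (((k + 1 : ℕ) : ℝ) * (t * a) ^ k * a) t := by
        simpa using ((hasDerivAt_id t).mul_const a).fun_pow (k + 1)
      have h2 := (h1.div_const ((k + 1).factorial : ℝ)).mul_const (derivSum (k + 1) p x)
      refine h2.congr_deriv ?_
      rw [Nat.factorial_succ, Nat.cast_mul]
      have : ((k + 1 : ℕ) : ℝ) ≠ 0 := by positivity
      field_simp
    · intro t ht
      rw [Finset.mul_sum, Real.norm_eq_abs]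
      refine (Finset.abs_sum_le_sum_abs _ _).trans (Finset.sum_le_sum fun i _ => ?_)
      rw [abs_mul]
      refine mul_le_mul ((abs_coord_le_norm Y i).trans hY) ?_ (abs_nonneg _) ha
      rcases m.eq_zero_or_pos with rfl | hm
      · rw [pderiv_eq_zero_of_isHomogeneous_zero hp]
        simpa using taylorMaj_nonneg K (mul_nonneg ht.1 ha) 0 x
      · refine ih (m := m - 1) (by omega) hp.pderiv (t • Y) ?_
        rw [norm_smul, Real.norm_eq_abs, abs_of_nonneg ht.1]
        exact mul_le_mul_of_nonneg_left hY ht.1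

/-- A norm controlling a harmonic polynomial of degree `n` and its derivatives at distance
`A / n` from a point. -/
noncomputable def locNorm (n : ℕ) (A : ℝ) (p : Poly3) (x : E3) : ℝ :=
  taylorMaj (n + 1) (4 * (A / n)) p x

section locNorm

variable {n : ℕ} {A : ℝ} {p : Poly3}

lemma locNorm_nonneg (n : ℕ) (hA : 0 ≤ A) (p : Poly3) (x : E3) : 0 ≤ locNorm n A p x :=
  taylorMaj_nonneg _ (by positivity) _ _

lemma continuous_locNorm (n : ℕ) (A : ℝ) (p : Poly3) : Continuous (locNorm n A p) := by
  unfold locNorm taylorMaj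
  exact continuous_finsetSum _ fun k _ => (continuous_derivSum k p).const_mul _

lemma continuous_locNorm_linear {d : ℕ} (n : ℕ) (A : ℝ)
    (Φ : EuclideanSpace ℝ (Fin d) →ₗ[ℝ] Poly3) :
    Continuous fun q : EuclideanSpace ℝ (Fin d) × E3 => locNorm n A (Φ q.1) q.2 := by
  unfold locNorm taylorMaj
  exact continuous_finsetSum _ fun k _ => (continuous_derivSum_linear k Φ).const_mul _

lemma abs_ev_le_locNorm (hp : p ∈ sphHarm n) {x y : E3} (hy : ‖y - x‖ ≤ A / n) :
    |ev p y| ≤ locNorm n A p x := by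
  have hA : 0 ≤ A / n := (norm_nonneg _).trans hy
  have := abs_ev_add_le_taylorMaj n.lt_succ_self (mem_sphHarm.1 hp).1 x (y - x) hy
  rw [add_sub_cancel] at this
  exact this.trans (taylorMaj_mono _ hA (by linarith) _ _)

lemma abs_ev_pderiv_le_locNorm (hn : 1 ≤ n) (hA : 1 ≤ A) (hp : p ∈ sphHarm n) {x y : E3}
    (hy : ‖y - x‖ ≤ A / n) (i : Fin 3) :
    |ev (MvPolynomial.pderiv i p) y| ≤ n * locNorm n A p x := by
  have hn' : (1 : ℝ) ≤ n := by exact_mod_cast hn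
  have hA0 : 0 ≤ A / n := by positivity
  have h1 := abs_ev_add_le_taylorMaj (K := n) (by omega)
    (mem_sphHarm.1 (pderiv_mem_sphHarm hp i)).1 x (y - x) hy
  rw [add_sub_cancel] at h1
  have h2 := taylorMaj_pderiv_le n hA0 p x i
  have h3 : taylorMaj (n + 1) (2 * (A / n)) p x ≤ locNorm n A p x :=
    taylorMaj_mono _ (by positivity) (by linarith) _ _
  have h4 : 1 / (n : ℝ) * |ev (MvPolynomial.pderiv i p) y| ≤ locNorm n A p x := by
    refine le_trans ?_ (h2.trans h3)
    gcongr
  calc |ev (MvPolynomial.pderiv i p) y|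
      = n * (1 / (n : ℝ) * |ev (MvPolynomial.pderiv i p) y|) := by field_simp
    _ ≤ _ := by gcongr

lemma abs_ev_pderiv_pderiv_le_locNorm (hn : 1 ≤ n) (hA : 1 ≤ A) (hp : p ∈ sphHarm n) {x y : E3}
    (hy : ‖y - x‖ ≤ A / n) (i j : Fin 3) :
    |ev (MvPolynomial.pderiv i (MvPolynomial.pderiv j p)) y| ≤ n ^ 2 * locNorm n A p x := by
  rcases Nat.lt_or_ge n 2 with h | hn2
  · obtain rfl : n = 1 := by omega
    have h1 := (mem_sphHarm.1 (pderiv_mem_sphHarm hp j)).1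
    rw [pderiv_eq_zero_of_isHomogeneous_zero h1, ev_zero, abs_zero]
    have := locNorm_nonneg 1 (zero_le_one.trans hA) p x
    positivity
  have hn' : (1 : ℝ) ≤ n := by exact_mod_cast hn
  have hA0 : 0 ≤ A / n := by positivity
  have h1 := abs_ev_add_le_taylorMaj (K := n - 1) (by omega)
    (mem_sphHarm.1 (pderiv_mem_sphHarm (pderiv_mem_sphHarm hp j) i)).1 x (y - x) hy
  rw [add_sub_cancel] at h1
  have h2 := taylorMaj_pderiv_le (n - 1) hA0 (MvPolynomial.pderiv j p) x i
  rw [Nat.sub_add_cancel hn] at h2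
  have h3 := taylorMaj_pderiv_le n (a := 2 * (A / n)) (by positivity) p x j
  rw [show 2 * (2 * (A / (n : ℝ))) = 4 * (A / n) by ring] at h3
  have h4 : 1 / (n : ℝ) * |ev (MvPolynomial.pderiv i (MvPolynomial.pderiv j p)) y| ≤
      taylorMaj n (2 * (A / n)) (MvPolynomial.pderiv j p) x := by
    refine le_trans ?_ h2
    gcongr
  have h5 : 1 / (n : ℝ) * (1 / (n : ℝ) *
      |ev (MvPolynomial.pderiv i (MvPolynomial.pderiv j p)) y|) ≤ locNorm n A p x := by
    refine le_trans ?_ h3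
    refine mul_le_mul ?_ h4 (by positivity) (by positivity)
    rw [← mul_div_assoc]
    gcongr
    linarith
  calc |ev (MvPolynomial.pderiv i (MvPolynomial.pderiv j p)) y|
      = n ^ 2 * (1 / (n : ℝ) * (1 / (n : ℝ) *
        |ev (MvPolynomial.pderiv i (MvPolynomial.pderiv j p)) y|)) := by field_simp
    _ ≤ _ := by gcongr

/-- A polynomial with bounded partial derivatives is Lipschitz on convex sets. -/
lemma abs_ev_sub_le {q : Poly3} {s : Set E3} (hs : Convex ℝ s) {B : ℝ}
    (hB : ∀ z ∈ s, ∀ i, |ev (MvPolynomial.pderiv i q) z| ≤ B) {y z : E3} (hy : y ∈ s) (hz : z ∈ s) :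
    |ev q y - ev q z| ≤ 3 * B * ‖y - z‖ := by
  have := Convex.norm_image_sub_le_of_norm_hasDerivWithin_le (s := Set.Icc (0 : ℝ) 1)
    (f := fun t : ℝ => ev q (z + t • (y - z)))
    (f' := fun t => ∑ i, (y - z) i * ev (MvPolynomial.pderiv i q) (z + t • (y - z)))
    (C := 3 * B * ‖y - z‖) (fun t _ => (hasDerivAt_ev q z (y - z) t).hasDerivWithinAt) ?_
    (convex_Icc 0 1) (Set.left_mem_Icc.2 zero_le_one) (Set.right_mem_Icc.2 zero_le_one)
  · simpa using this
  · intro t ht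
    have hmem : z + t • (y - z) ∈ s := hs.add_smul_sub_mem hz hy ht
    rw [Real.norm_eq_abs]
    refine (Finset.abs_sum_le_sum_abs _ _).trans ?_
    calc ∑ i, |(y - z) i * ev (MvPolynomial.pderiv i q) (z + t • (y - z))|
        ≤ ∑ i : Fin 3, ‖y - z‖ * B := by
          refine Finset.sum_le_sum fun i _ => ?_
          rw [abs_mul]
          exact mul_le_mul (abs_coord_le_norm _ i) (hB _ hmem i) (abs_nonneg _) (norm_nonneg _)
      _ = 3 * B * ‖y - z‖ := by simp; ring

lemma abs_ev_sub_le_locNorm (hn : 1 ≤ n) (hA : 1 ≤ A) (hp : p ∈ sphHarm n) {x y z : E3}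
    (hy : ‖y - x‖ ≤ A / n) (hz : ‖z - x‖ ≤ A / n) :
    |ev p y - ev p z| ≤ 3 * (n * locNorm n A p x) * ‖y - z‖ :=
  abs_ev_sub_le (convex_closedBall x (A / n))
    (fun w hw i => abs_ev_pderiv_le_locNorm hn hA hp (by simpa [dist_eq_norm] using hw) i)
    (by simpa [dist_eq_norm] using hy) (by simpa [dist_eq_norm] using hz)

lemma integral_locNorm_le (hn : 1 ≤ n) (hA : 0 ≤ A) (hp : p ∈ sphHarm n) :
    ∫ x : Sphere2, locNorm n A p x ∂sphMeasure ≤ Real.exp (12 * A) * √(savg (p * p)) := by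
  have hn' : (n : ℝ) ≠ 0 := by positivity
  simp only [locNorm, taylorMaj]
  rw [integral_finsetSum _ fun k _ => integrable_sphere (by fun_prop)]
  calc ∑ k ∈ Finset.range (n + 1), ∫ x : Sphere2, (4 * (A / n)) ^ k / k.factorial *
        derivSum k p x ∂sphMeasure
      ≤ ∑ k ∈ Finset.range (n + 1), (12 * A) ^ k / k.factorial * √(savg (p * p)) := by
        refine Finset.sum_le_sum fun k _ => ?_
        rw [integral_const_mul]
        refine (mul_le_mul_of_nonneg_left (integral_derivSum_le hp k) (by positivity)).trans ?_
        rw [show (12 * A) = 4 * (A / n) * (3 * n) by field_simp; ring, mul_pow _ (3 * (n : ℝ))]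
        exact le_of_eq (by ring)
    _ ≤ _ := by
        rw [← Finset.sum_mul]
        exact mul_le_mul_of_nonneg_right (Real.sum_le_exp_of_nonneg (by positivity) _)
          (Real.sqrt_nonneg _)

end locNorm

namespace HarmModel

variable {n d : ℕ} (M : HarmModel n d)

lemma sqrt_savg_eq (ξ : EuclideanSpace ℝ (Fin d)) :
    √(savg (M.Φ ξ * M.Φ ξ)) = ‖ξ‖ / √(2 * n + 1) := by
  have h : savg (M.Φ ξ * M.Φ ξ) = (‖ξ‖ / √(2 * n + 1)) ^ 2 := by
    rw [div_pow, M.norm_sq, Real.sq_sqrt (by positivity)]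
    field_simp
  rw [h, Real.sqrt_sq (by positivity)]

lemma integral_sqrt_savg_le :
    Integrable (fun ξ => √(savg (M.Φ ξ * M.Φ ξ))) (stdGaussian (EuclideanSpace ℝ (Fin d))) ∧
    ∫ ξ, √(savg (M.Φ ξ * M.Φ ξ)) ∂stdGaussian (EuclideanSpace ℝ (Fin d)) ≤ 1 := by
  set γ := stdGaussian (EuclideanSpace ℝ (Fin d))
  have hprod : Integrable (fun q : EuclideanSpace ℝ (Fin d) × Sphere2 =>
      ev (M.Φ q.1) q.2 ^ 2) (γ.prod sphMeasure) := by
    have hc : Continuous (fun q : EuclideanSpace ℝ (Fin d) × Sphere2 => ev (M.Φ q.1) q.2 ^ 2) :=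
      (M.continuous_ev_model.comp (continuous_fst.prodMk
        (continuous_subtype_val.comp continuous_snd))).pow 2
    refine (integrable_prod_iff' hc.aestronglyMeasurable).2 ⟨?_, ?_⟩
    · refine Filter.Eventually.of_forall fun x => ?_
      simp only [M.ev_eq_inner]
      exact integrable_inner_sq_stdGaussian _
    · simp only [M.ev_eq_inner, norm_pow, Real.norm_eq_abs, sq_abs]
      simp only [γ, integral_inner_sq_stdGaussian]
      refine integrable_sphere ?_
      fun_prop
  have hsq : ∫ ξ, savg (M.Φ ξ * M.Φ ξ) ∂γ = 1 := by
    simp only [savg_def, ev_mul]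
    simp only [← sq]
    rw [integral_integral_swap hprod]
    simp only [M.ev_eq_inner, γ, integral_inner_sq_stdGaussian]
    have : ∀ x : Sphere2, ‖M.feat x‖ ^ 2 = 1 := fun x => by
      rw [M.norm_feat (by simp), one_pow]
    simp [this]
  have hInt : Integrable (fun ξ => savg (M.Φ ξ * M.Φ ξ)) γ := by
    by_contra h
    rw [integral_undef h] at hsq
    exact zero_ne_one hsq
  have hle : ∀ ξ, √(savg (M.Φ ξ * M.Φ ξ)) ≤ (1 + savg (M.Φ ξ * M.Φ ξ)) / 2 := fun ξ => by
    have h1 := Real.sq_sqrt (savg_mul_self_nonneg (M.Φ ξ))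
    nlinarith [sq_nonneg (√(savg (M.Φ ξ * M.Φ ξ)) - 1)]
  have hint2 : Integrable (fun ξ => (1 + savg (M.Φ ξ * M.Φ ξ)) / 2) γ :=
    ((integrable_const 1).add hInt).div_const 2
  have hint3 : Integrable (fun ξ => √(savg (M.Φ ξ * M.Φ ξ))) γ := by
    refine hint2.mono' ?_ (Filter.Eventually.of_forall fun ξ => ?_)
    · simp only [M.sqrt_savg_eq]
      fun_prop
    · rw [Real.norm_eq_abs, abs_of_nonneg (Real.sqrt_nonneg _)]
      exact hle ξ
  refine ⟨hint3, (integral_mono hint3 hint2 hle).trans ?_⟩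
  rw [integral_div, integral_add (integrable_const 1) hInt, hsq]
  simp [γ]

end HarmModel

/-! ### Stability of excursion components under small perturbations -/

section StabilityTopology

variable {X : Type*} [TopologicalSpace X] [LocallyConnectedSpace X] [Nonempty X]

/-- A push map `st`, moving points of the thin set `G` into the positive set without changing
positive components, makes positive components in `D` stable. -/
theorem encard_compsIn_zero_le_of_push {f : X → ℝ} (hf : Continuous f) {s : ℝ} (hs : 0 < s)
    {D D' G : Set X} (hDD : D ⊆ D') (hD' : IsClosed D') (hG : IsOpen G) {st : X → X}
    (hst : ContinuousOn st G) (hpos : ∀ x ∈ G, 0 < f (st x))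
    (hcomp : ∀ x ∈ G, 0 < f x → st x ∈ connectedComponentIn {y | 0 < f y} x)
    (hback : ∀ x ∈ G, st x ∈ D → x ∈ D')
    (hcov : ∀ x, -s < f x → f x ≤ 0 → x ∉ G → x ∉ D')
    (hmax : ∀ C ∈ compsIn f 0 D, ∃ p ∈ C, s < f p) :
    (compsIn f 0 D).encard ≤ (compsIn f s D').encard := by
  have hzero : {y : X | -(0 : ℝ) < f y} = {y | 0 < f y} := by simp
  have hcompsub : ∀ C ∈ compsIn f 0 D, ∀ x, x ∈ C →
      C = connectedComponentIn {y | 0 < f y} x := by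
    rintro C ⟨-, p, -, -, rfl⟩ x hx
    rw [hzero] at hx ⊢
    exact connectedComponentIn_eq hx
  have key : ∀ C ∈ compsIn f 0 D, ∀ p ∈ C, s < f p →
      connectedComponentIn {y | -s < f y} p ⊆ D' ∧
      ∀ x ∈ connectedComponentIn {y | -s < f y} p, 0 < f x → x ∈ C := by
    intro C hC p hp hsp
    have hCopen : IsOpen C := isOpen_of_mem_compsIn hf hC
    have hCpos : ∀ x ∈ C, 0 < f x := fun x hx => by
      simpa using subset_of_mem_compsIn hC hx
    have hCD : C ⊆ D := hC.1
    have hBiff : ∀ x ∈ G, 0 < f x → (x ∈ C ↔ st x ∈ C) := by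
      intro x hxG hx0
      have h1 := hcomp x hxG hx0
      constructor
      · intro hx
        rw [hcompsub C hC x hx]; exact h1
      · intro hx
        rw [hcompsub C hC _ hx, ← connectedComponentIn_eq h1]
        exact mem_connectedComponentIn hx0
    have hCc : IsOpen ({x | 0 < f x} \ C) := by
      have : {x | 0 < f x} \ C = {x | 0 < f x} \ closure C := by
        ext x
        constructor
        · rintro ⟨h0, hx⟩
          refine ⟨h0, fun hcl => hx ?_⟩
          exact mem_of_mem_closure_of_mem_compsIn hf hC hcl (by simpa using h0)
        · rintro ⟨h0, hx⟩
          exact ⟨h0, fun h => hx (subset_closure h)⟩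
      rw [this]
      exact (isOpen_lt continuous_const hf).sdiff isClosed_closure
    obtain ⟨W1, hW1⟩ : ∃ W1, W1 = C ∪ (G ∩ st ⁻¹' C) := ⟨_, rfl⟩
    obtain ⟨W2, hW2⟩ : ∃ W2, W2 = ({x | 0 < f x} \ C) ∪ (G ∩ st ⁻¹' ({x | 0 < f x} \ C)) ∪ D'ᶜ :=
      ⟨_, rfl⟩
    have ho1 : IsOpen W1 := hW1 ▸ hCopen.union (hst.isOpen_inter_preimage hG hCopen)
    have ho2 : IsOpen W2 :=
      hW2 ▸ (hCc.union (hst.isOpen_inter_preimage hG hCc)).union hD'.isOpen_compl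
    have hdisj : Disjoint W1 W2 := by
      rw [Set.disjoint_left]
      intro x h1 h2
      rw [hW1] at h1
      rw [hW2] at h2
      rcases h1 with h1 | ⟨h1G, h1⟩ <;> rcases h2 with (⟨h2, h2'⟩ | ⟨h2G, h2, h2'⟩) | h2
      · exact h2' h1
      · exact h2' ((hBiff x h2G (hCpos x h1)).1 h1)
      · exact h2 (hDD (hCD h1))
      · exact h2' ((hBiff x h1G h2).2 h1)
      · exact h2' h1
      · exact h2 (hback x h1G (hCD h1))
    have hsub : connectedComponentIn {y | -s < f y} p ⊆ W1 := by
      refine IsPreconnected.subset_left_of_subset_union ho1 ho2 hdisj ?_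
        ⟨p, mem_connectedComponentIn (by show -s < f p; linarith), ?_⟩
        isPreconnected_connectedComponentIn
      · intro x hx
        have hxs : -s < f x := lt_of_mem_connectedComponentIn hx
        rw [hW1, hW2]
        by_cases hxC : x ∈ C
        · exact Or.inl (Or.inl hxC)
        by_cases h0 : 0 < f x
        · exact Or.inr (Or.inl (Or.inl ⟨h0, hxC⟩))
        by_cases hxG : x ∈ G
        · by_cases hsC : st x ∈ C
          · exact Or.inl (Or.inr ⟨hxG, hsC⟩)
          · exact Or.inr (Or.inl (Or.inr ⟨hxG, hpos x hxG, hsC⟩))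
        · exact Or.inr (Or.inr (hcov x hxs (not_lt.1 h0) hxG))
      · rw [hW1]; exact Or.inl hp
    refine ⟨fun x hx => ?_, fun x hx h0 => ?_⟩
    · have := hsub hx
      rw [hW1] at this
      rcases this with h | ⟨hG', h⟩
      · exact hDD (hCD h)
      · exact hback x hG' (hCD h)
    · have := hsub hx
      rw [hW1] at this
      rcases this with h | ⟨hG', h⟩
      · exact h
      · exact (hBiff x hG' h0).2 h
  choose! P hPC hPs using hmax
  refine Set.encard_le_encard_of_injOn (f := fun C => connectedComponentIn {y | -s < f y} (P C))
    ?_ ?_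
  · intro C hC
    exact ⟨(key C hC _ (hPC C hC) (hPs C hC)).1, P C, hPs C hC,
      mem_connectedComponentIn (by show -s < f (P C); linarith [hPs C hC]), rfl⟩
  · intro C hC C' hC' h
    have h1 : P C ∈ connectedComponentIn {y | -s < f y} (P C') := by
      have h' : connectedComponentIn {y | -s < f y} (P C) =
        connectedComponentIn {y | -s < f y} (P C') := h
      rw [← h']
      exact mem_connectedComponentIn (by show -s < f (P C); linarith [hPs C hC])
    exact compsIn_eq_of_mem hC hC' (hPC C hC)
      ((key C' hC' _ (hPC C' hC') (hPs C' hC')).2 _ h1 (by linarith [hPs C hC]))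

end StabilityTopology

instance : Fact (Module.finrank ℝ E3 = 2 + 1) := ⟨by simp⟩

instance : LocallyConnectedSpace Sphere2 :=
  ChartedSpace.locallyConnectedSpace (EuclideanSpace ℝ (Fin 2)) Sphere2

instance : Nonempty Sphere2 := by
  obtain ⟨x, hx⟩ := NormedSpace.sphere_nonempty (E := E3) (x := 0) (r := 1) |>.2 zero_le_one
  exact ⟨⟨x, hx⟩⟩

/-- Radial projection to the sphere. -/
noncomputable def nrm (z : E3) : Sphere2 := by
  classical
  exact if h : z ≠ 0 then ⟨‖z‖⁻¹ • z, by simp [Sphere2, norm_smul, h]⟩ else Classical.arbitrary _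

lemma coe_nrm {z : E3} (h : z ≠ 0) : (nrm z : E3) = ‖z‖⁻¹ • z := by simp [nrm, h]

lemma norm_sphere (x : Sphere2) : ‖(x : E3)‖ = 1 :=
  mem_sphere_zero_iff_norm.1 x.2

lemma nrm_coe (x : Sphere2) : nrm x = x := by
  have h : (x : E3) ≠ 0 := by
    intro h; have := norm_sphere x; simp [h] at this
  apply Subtype.ext
  rw [coe_nrm h, norm_sphere]; simp

lemma continuousOn_nrm : ContinuousOn nrm {z | z ≠ 0} := by
  rw [Topology.IsInducing.subtypeVal.continuousOn_iff]
  have : ContinuousOn (fun z : E3 => ‖z‖⁻¹ • z) {z | z ≠ 0} := by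
    refine ContinuousOn.smul (ContinuousOn.inv₀ continuous_norm.continuousOn ?_) continuousOn_id
    intro z hz
    exact norm_ne_zero_iff.2 hz
  exact this.congr fun z hz => coe_nrm hz

lemma ev_nrm {p : Poly3} {n : ℕ} (hp : p.IsHomogeneous n) {z : E3} (h : z ≠ 0) :
    ev p z = ‖z‖ ^ n * ev p (nrm z) := by
  rw [coe_nrm h, ev_homog hp, ← mul_assoc, ← mul_pow, mul_inv_cancel₀ (norm_ne_zero_iff.2 h)]
  simp

lemma dist_nrm_le {z : E3} (h : z ≠ 0) (x : Sphere2) : dist (nrm z) x ≤ 2 * ‖z - x‖ := by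
  rw [Subtype.dist_eq, dist_eq_norm, coe_nrm h]
  have h1 : ‖‖z‖⁻¹ • z - z‖ ≤ ‖z - x‖ := by
    have : ‖z‖⁻¹ • z - z = (‖z‖⁻¹ - 1) • z := by module
    have h2 : |‖z‖⁻¹ - 1| * ‖z‖ = |1 - ‖z‖| := by
      rw [← abs_norm z, ← abs_mul, abs_norm, sub_mul, inv_mul_cancel₀ (norm_ne_zero_iff.2 h),
        one_mul]
    rw [this, norm_smul, Real.norm_eq_abs, h2, norm_sub_rev, ← norm_sphere x]
    exact abs_norm_sub_norm_le (x : E3) z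
  calc ‖‖z‖⁻¹ • z - x‖ = ‖(‖z‖⁻¹ • z - z) + (z - x)‖ := by congr 1; abel
    _ ≤ _ := norm_add_le _ _
    _ ≤ _ := by linarith

/-- The gradient of a polynomial function. -/
noncomputable def grad (p : Poly3) (x : E3) : E3 :=
  WithLp.toLp 2 fun i => ev (MvPolynomial.pderiv i p) x

@[simp] lemma grad_apply (p : Poly3) (x : E3) (i : Fin 3) :
    grad p x i = ev (MvPolynomial.pderiv i p) x := rfl

@[fun_prop]
lemma continuous_grad (p : Poly3) : Continuous (grad p) := by
  unfold grad
  fun_prop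

lemma inner_grad (p : Poly3) (x v : E3) :
    ⟪grad p x, v⟫ = ∑ i, v i * ev (MvPolynomial.pderiv i p) x := by
  simp [PiLp.inner_apply]

lemma inner_grad_self {p : Poly3} {n : ℕ} (hp : p.IsHomogeneous n) (x : E3) :
    ⟪grad p x, x⟫ = n * ev p x := by
  rw [inner_grad]
  have := congrArg (fun q => ev q x) hp.sum_X_mul_pderiv
  simpa [ev_sum] using this

/-- The tangential part of the gradient of a homogeneous polynomial of degree `n`. -/
noncomputable def tgrad (n : ℕ) (p : Poly3) (x : E3) : E3 := grad p x - (n * ev p x) • x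

@[fun_prop]
lemma continuous_tgrad (n : ℕ) (p : Poly3) : Continuous (tgrad n p) := by
  unfold tgrad
  fun_prop

section
variable {n : ℕ} {p : Poly3}

lemma inner_tgrad_self (hp : p.IsHomogeneous n) (x : Sphere2) : ⟪tgrad n p x, (x : E3)⟫ = 0 := by
  rw [tgrad, inner_sub_left, inner_grad_self hp, real_inner_smul_left,
    real_inner_self_eq_norm_sq, norm_sphere]
  ring

lemma norm_grad_sq (hp : p.IsHomogeneous n) (x : Sphere2) :
    ‖grad p x‖ ^ 2 = ‖tgrad n p x‖ ^ 2 + (n * ev p x) ^ 2 := by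
  have : grad p x = tgrad n p x + (n * ev p x) • (x : E3) := by rw [tgrad]; abel
  rw [this, norm_add_sq_real, real_inner_smul_right, inner_tgrad_self hp, norm_smul, norm_sphere,
    Real.norm_eq_abs, mul_one, sq_abs]
  ring

lemma inner_grad_tgrad (hp : p.IsHomogeneous n) (x : Sphere2) :
    ⟪grad p x, tgrad n p x⟫ = ‖tgrad n p x‖ ^ 2 := by
  have : grad p x = tgrad n p x + (n * ev p x) • (x : E3) := by rw [tgrad]; abel
  rw [this, inner_add_left, real_inner_smul_left,
    real_inner_comm _ (x : E3), inner_tgrad_self hp, real_inner_self_eq_norm_sq]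
  ring


lemma norm_add_smul_sq (x : Sphere2) {v : E3} (hv : ‖v‖ = 1) (hxv : ⟪v, (x : E3)⟫ = 0) (t : ℝ) :
    ‖(x : E3) + t • v‖ ^ 2 = 1 + t ^ 2 := by
  rw [norm_add_sq_real, real_inner_smul_right, real_inner_comm, hxv, norm_smul, norm_sphere, hv,
    Real.norm_eq_abs, mul_one, sq_abs]
  ring

lemma add_smul_ne_zero (x : Sphere2) {v : E3} (hv : ‖v‖ = 1) (hxv : ⟪v, (x : E3)⟫ = 0) (t : ℝ) :
    (x : E3) + t • v ≠ 0 := by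
  intro h
  have := norm_add_smul_sq x hv hxv t
  rw [h] at this
  simp at this
  nlinarith [sq_nonneg t]

end

section
variable {n : ℕ} {p : Poly3}

/-- The unit tangent direction of steepest ascent. -/
noncomputable def updir (n : ℕ) (p : Poly3) (x : E3) : E3 := ‖tgrad n p x‖⁻¹ • tgrad n p x

lemma norm_updir {x : E3} (h : tgrad n p x ≠ 0) : ‖updir n p x‖ = 1 := by
  rw [updir, norm_smul, norm_inv, norm_norm, inv_mul_cancel₀ (norm_ne_zero_iff.2 h)]

lemma inner_updir (hp : p.IsHomogeneous n) (x : Sphere2) : ⟪updir n p x, (x : E3)⟫ = 0 := by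
  rw [updir, real_inner_smul_left, inner_tgrad_self hp, mul_zero]

lemma inner_grad_updir (hp : p.IsHomogeneous n) (x : Sphere2) :
    ⟪grad p x, updir n p x⟫ = ‖tgrad n p x‖ := by
  rw [updir, real_inner_smul_right, inner_grad_tgrad hp]
  by_cases h : ‖tgrad n p x‖ = 0
  · simp [h]
  · field_simp

lemma le_norm_tgrad (hp : p.IsHomogeneous n) {x : Sphere2} {α β : ℝ} (hβ : 0 < β)
    (hαβ : α ≤ β / 2) (hf : |ev p x| < α) (hg : β * n ≤ ‖grad p x‖) :
    β * n / 2 ≤ ‖tgrad n p x‖ := by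
  have h := norm_grad_sq hp x
  have h1 : (n * ev p x) ^ 2 ≤ (β * n / 2) ^ 2 := by
    rw [mul_pow, ← sq_abs (ev p x)]
    have h0 : |ev p x| ^ 2 ≤ (β / 2) ^ 2 := by
      gcongr; linarith
    nlinarith [sq_nonneg (n : ℝ)]
  have hn : (0 : ℝ) ≤ n := Nat.cast_nonneg n
  have h2 : (β * n) ^ 2 ≤ ‖grad p x‖ ^ 2 := by gcongr
  refine le_of_sq_le_sq ?_ (norm_nonneg _)
  nlinarith [sq_nonneg (β * n)]

/-- Along the direction of steepest ascent the polynomial grows linearly. -/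
lemma le_ev_add_updir (hn : 1 ≤ n) (hp : p.IsHomogeneous n) {x x₀ : Sphere2} {R β M τ : ℝ}
    (hM : 0 ≤ M) (hτ1 : τ ≤ 1) (hτ : 9 * M * τ ≤ β / 4) 
    (h2 : ∀ y : E3, ‖y - x₀‖ ≤ (R + 2) / n → ∀ i j,
      |ev (MvPolynomial.pderiv i (MvPolynomial.pderiv j p)) y| ≤ M * n ^ 2)
    (hx : dist x x₀ ≤ (R + 1) / n) (hg : β * n / 2 ≤ ‖tgrad n p x‖) (h0 : tgrad n p x ≠ 0)
    {t : ℝ} (ht : t ∈ Set.Icc 0 (τ / n)) :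
    ev p x + β * n / 4 * t ≤ ev p (x + t • updir n p x) := by
  have hn' : (0 : ℝ) < n := by exact_mod_cast hn
  obtain ⟨v, hv⟩ : ∃ v, v = updir n p x := ⟨_, rfl⟩
  have hv1 : ‖v‖ = 1 := hv ▸ norm_updir h0
  rw [← hv]
  have hconv : Convex ℝ (Metric.closedBall (x₀ : E3) ((R + 2) / n)) := convex_closedBall _ _
  have hxx : ‖(x : E3) - x₀‖ ≤ (R + 1) / n := by rwa [← dist_eq_norm]
  have hball : ∀ u ∈ Set.Icc 0 (τ / n), (x : E3) + u • v ∈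
      Metric.closedBall (x₀ : E3) ((R + 2) / n) := by
    intro u hu
    rw [Metric.mem_closedBall, dist_eq_norm]
    calc ‖(x : E3) + u • v - x₀‖ = ‖((x : E3) - x₀) + u • v‖ := by congr 1; abel
      _ ≤ (R + 1) / n + u := by
        refine (norm_add_le _ _).trans (add_le_add hxx ?_)
        rw [norm_smul, hv1, Real.norm_eq_abs, abs_of_nonneg hu.1, mul_one]
      _ ≤ (R + 1) / n + 1 / n := by
        gcongr; exact hu.2.trans (by gcongr)
      _ = _ := by ring
  have hx0 : (x : E3) ∈ Metric.closedBall (x₀ : E3) ((R + 2) / n) := by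
    have := hball 0 ⟨le_rfl, ht.1.trans ht.2⟩
    simpa using this
  have hder : ∀ u ∈ Set.Icc 0 (τ / n),
      β * n / 4 ≤ ∑ i, v i * ev (MvPolynomial.pderiv i p) (x + u • v) := by
    intro u hu
    have e0 : ∑ i, v i * ev (MvPolynomial.pderiv i p) x = ‖tgrad n p x‖ := by
      rw [← inner_grad, hv, inner_grad_updir hp]
    have e1 : |∑ i, v i * ev (MvPolynomial.pderiv i p) (x + u • v) -
        ∑ i, v i * ev (MvPolynomial.pderiv i p) x| ≤ 9 * M * n ^ 2 * u := by
      rw [← Finset.sum_sub_distrib]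
      refine (Finset.abs_sum_le_sum_abs _ _).trans ?_
      calc ∑ i, |v i * ev (MvPolynomial.pderiv i p) (x + u • v) -
            v i * ev (MvPolynomial.pderiv i p) x| ≤ ∑ i : Fin 3, 1 * (3 * (M * n ^ 2) * u) := by
            refine Finset.sum_le_sum fun i _ => ?_
            rw [← mul_sub, abs_mul]
            refine mul_le_mul ((abs_coord_le_norm v i).trans hv1.le) ?_ (abs_nonneg _) zero_le_one
            have := abs_ev_sub_le hconv (q := MvPolynomial.pderiv i p) (B := M * n ^ 2)
              (fun z hz j => h2 z (by rwa [Metric.mem_closedBall, dist_eq_norm] at hz) j i)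
              (hball u hu) hx0
            rwa [add_sub_cancel_left, norm_smul, hv1, Real.norm_eq_abs, abs_of_nonneg hu.1,
              mul_one] at this
        _ = _ := by simp; ring
    have e2 : 9 * M * n ^ 2 * u ≤ β * n / 4 := by
      calc 9 * M * n ^ 2 * u ≤ 9 * M * n ^ 2 * (τ / n) := by gcongr; exact hu.2
        _ = 9 * M * τ * n := by field_simp
        _ ≤ β / 4 * n := by gcongr
        _ = _ := by ring
    have := (abs_le.1 e1).1
    rw [e0] at this
    linarith
  have hmv := Convex.mul_sub_le_image_sub_of_le_deriv (convex_Icc 0 (τ / n))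
    (f := fun u : ℝ => ev p (x + u • v)) 
    (fun u _ => (hasDerivAt_ev p x v u).continuousAt.continuousWithinAt)
    (fun u _ => (hasDerivAt_ev p x v u).differentiableAt.differentiableWithinAt)
    (C := β * n / 4)
    (fun u hu => by rw [(hasDerivAt_ev p x v u).deriv]; exact hder u (interior_subset hu))
    0 ⟨le_rfl, ht.1.trans ht.2⟩ t ht ht.1
  simp only [zero_smul, add_zero, sub_zero] at hmv
  linarith

/-- A local maximum of a homogeneous polynomial on the sphere with nonzero value is a critical
point. -/
lemma tgrad_eq_zero_of_isLocalMax (hp : p.IsHomogeneous n) {x : Sphere2}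
    (hmax : IsLocalMax (fun y : Sphere2 => ev p y) x) (hx : 0 < ev p x) : tgrad n p x = 0 := by
  by_contra h0
  obtain ⟨v, hv⟩ : ∃ v, v = updir n p x := ⟨_, rfl⟩
  have hv1 : ‖v‖ = 1 := hv ▸ norm_updir h0
  have hvx : ⟪v, (x : E3)⟫ = 0 := hv ▸ inner_updir hp x
  have hcont : ContinuousAt (fun t : ℝ => nrm (x + t • v)) 0 := by
    refine ContinuousAt.comp (g := nrm) (f := fun t : ℝ => (x : E3) + t • v) ?_ (by fun_prop)
    exact continuousOn_nrm.continuousAt (isOpen_ne.mem_nhds (add_smul_ne_zero x hv1 hvx 0))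
  have hn0 : nrm ((x : E3) + (0 : ℝ) • v) = x := by simp [nrm_coe]
  have hpos : ∀ᶠ y in nhds x, 0 < ev p ((y : Sphere2) : E3) :=
    (continuous_ev p |>.comp continuous_subtype_val).continuousAt.eventually_const_lt hx
  have hev : ∀ᶠ t in nhds (0 : ℝ), ev p (nrm ((x : E3) + t • v)) ≤ ev p x ∧
      0 < ev p (nrm ((x : E3) + t • v)) := by
    have := hmax.and hpos
    rw [← hn0] at this
    have := hcont.eventually this
    simpa [nrm_coe] using this
  have hlm : IsLocalMax (fun t : ℝ => ev p (x + t • v) ^ 2 - ev p x ^ 2 * (1 + t ^ 2) ^ n) 0 := by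
    filter_upwards [hev] with t ht
    rw [ev_nrm hp (add_smul_ne_zero x hv1 hvx t), mul_pow, ← pow_mul, mul_comm n, pow_mul,
      norm_add_smul_sq x hv1 hvx]
    have : ev p (nrm ((x : E3) + t • v)) ^ 2 ≤ ev p x ^ 2 := by
      gcongr
      · exact ht.2.le
      · exact ht.1
    have h3 : 0 ≤ (1 + t ^ 2) ^ n := by positivity
    simp only [zero_smul, add_zero]
    norm_num
    nlinarith
  have hd : HasDerivAt (fun t : ℝ => ev p (x + t • v) ^ 2 - ev p x ^ 2 * (1 + t ^ 2) ^ n)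
      (2 * ev p x * ‖tgrad n p x‖) 0 := by
    have h1 := (hasDerivAt_ev p x v 0).fun_pow 2
    have h2 := (((hasDerivAt_pow 2 (0 : ℝ)).const_add 1).fun_pow n).const_mul (ev p x ^ 2)
    refine (h1.sub h2).congr_deriv ?_
    have e0 : ∑ i, v i * ev (MvPolynomial.pderiv i p) x = ‖tgrad n p x‖ := by
      rw [← inner_grad, hv, inner_grad_updir hp]
    simp [e0]
  have := hlm.hasDerivAt_eq_zero hd
  have h3 : 0 < ‖tgrad n p x‖ := norm_pos_iff.2 h0
  have : 0 < 2 * ev p x * ‖tgrad n p x‖ := by positivity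
  linarith

end

section
variable {n : ℕ} {p : Poly3}

/-- Quantitative stability: without almost-critical almost-zeros nearby, positive components in a
cap remain distinct components of a slightly lower excursion set in a slightly larger cap. -/
theorem encard_compsIn_zero_le (hn : 1 ≤ n) (hp : p.IsHomogeneous n) {x₀ : Sphere2}
    {R α β M τ s : ℝ} (hM : 0 ≤ M) (hαβ : α ≤ β / 2) (hτ0 : 0 < τ)
    (hτ1 : τ < 1 / 2) (hτ : 9 * M * τ ≤ β / 4) (hs0 : 0 < s) (hsα : s < α) (hsβ : s < β * τ / 4)
    (h1 : ∀ y : Sphere2, dist y x₀ ≤ (R + 1) / n → |ev p y| < α → β * n ≤ ‖grad p y‖)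
    (h2 : ∀ y : E3, ‖y - x₀‖ ≤ (R + 2) / n → ∀ i j,
      |ev (MvPolynomial.pderiv i (MvPolynomial.pderiv j p)) y| ≤ M * n ^ 2) :
    (compsIn (fun y : Sphere2 => ev p y) 0 (Metric.closedBall x₀ (R / n))).encard ≤
      (compsIn (fun y : Sphere2 => ev p y) s
        (Metric.closedBall x₀ ((R + 2 * τ) / n))).encard := by
  have hn' : (0 : ℝ) < n := by exact_mod_cast hn
  have hβ : 0 < β := by linarith
  have hf : Continuous fun y : Sphere2 => ev p y := by fun_prop
  have hτn : (0 : ℝ) ≤ τ / n := by positivity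
  have htg : ∀ x : Sphere2, dist x x₀ ≤ (R + 1) / n → |ev p x| < α →
      β * n / 2 ≤ ‖tgrad n p x‖ := fun x hx hfx => le_norm_tgrad hp hβ hαβ hfx (h1 x hx hfx)
  have htg0 : ∀ x : Sphere2, dist x x₀ ≤ (R + 1) / n → |ev p x| < α → tgrad n p x ≠ 0 := by
    intro x hx hfx h0
    have := htg x hx hfx
    rw [h0, norm_zero] at this
    have : 0 < β * n / 2 := by positivity
    linarith
  have hgrow : ∀ x : Sphere2, dist x x₀ ≤ (R + 1) / n → |ev p x| < α →
      ∀ t ∈ Set.Icc 0 (τ / n), ev p x + β * n / 4 * t ≤ ev p (x + t • updir n p x) :=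
    fun x hx hfx t ht => le_ev_add_updir hn hp hM (by linarith) hτ h2 hx (htg x hx hfx)
      (htg0 x hx hfx) ht
  have hne : ∀ x : Sphere2, dist x x₀ ≤ (R + 1) / n → |ev p x| < α →
      ∀ t : ℝ, (x : E3) + t • updir n p x ≠ 0 := fun x hx hfx t =>
    add_smul_ne_zero x (norm_updir (htg0 x hx hfx)) (inner_updir hp x) t
  have hposn : ∀ z : E3, z ≠ 0 → 0 < ev p z → 0 < ev p (nrm z) := by
    intro z hz h
    rw [ev_nrm hp hz] at h
    exact pos_of_mul_pos_right h (by positivity)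
  have hdist : ∀ x : Sphere2, dist x x₀ ≤ (R + 1) / n → |ev p x| < α →
      dist (nrm ((x : E3) + (τ / n) • updir n p x)) x ≤ 2 * τ / n := by
    intro x hx hfx
    refine (dist_nrm_le (hne x hx hfx _) x).trans ?_
    rw [add_sub_cancel_left, norm_smul, norm_updir (htg0 x hx hfx), Real.norm_eq_abs,
      abs_of_nonneg hτn]
    apply le_of_eq; ring
  refine encard_compsIn_zero_le_of_push hf hs0
    (G := {x : Sphere2 | dist x x₀ < (R + 1) / n ∧ |ev p x| < s})
    (st := fun x => nrm ((x : E3) + (τ / n) • updir n p x))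
    (Metric.closedBall_subset_closedBall (by gcongr; linarith)) Metric.isClosed_closedBall
    ?_ ?_ ?_ ?_ ?_ ?_ ?_
  · exact (isOpen_lt (f := fun x : Sphere2 => dist x x₀) (by fun_prop) continuous_const).inter
      (isOpen_lt (f := fun x : Sphere2 => |ev p x|) (by fun_prop) continuous_const)
  · rintro x ⟨hx, hfx⟩
    have hfx' := hfx.trans hsα
    refine ContinuousAt.continuousWithinAt ?_
    refine ContinuousAt.comp (g := nrm)
      (f := fun x : Sphere2 => (x : E3) + (τ / n) • updir n p x) ?_ ?_
    · exact continuousOn_nrm.continuousAt (isOpen_ne.mem_nhds (hne x hx.le hfx' _))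
    · unfold updir
      have hc : ContinuousAt (fun x : Sphere2 => tgrad n p x) x := by fun_prop
      have hi := (hc.norm.inv₀ (norm_ne_zero_iff.2 (htg0 x hx.le hfx'))).smul hc
      exact continuous_subtype_val.continuousAt.add (hi.const_smul (τ / (n : ℝ)))
  · rintro x ⟨hx, hfx⟩
    have hfx' := hfx.trans hsα
    refine hposn _ (hne x hx.le hfx' _) ?_
    have := hgrow x hx.le hfx' (τ / n) ⟨hτn, le_rfl⟩
    have e : β * n / 4 * (τ / n) = β * τ / 4 := by field_simp
    have := (abs_lt.1 hfx).1
    linarith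
  · rintro x ⟨hx, hfx⟩ h0
    have hfx' := hfx.trans hsα
    have hcont : ContinuousOn (fun t : ℝ => nrm ((x : E3) + t • updir n p x))
        (Set.Icc 0 (τ / n)) := by
      refine ContinuousOn.comp (g := nrm) (t := {z | z ≠ 0}) continuousOn_nrm (by fun_prop) ?_
      exact fun t _ => hne x hx.le hfx' t
    have hpre := isPreconnected_Icc.image _ hcont
    refine hpre.subset_connectedComponentIn (x := x) ⟨0, ⟨le_rfl, hτn⟩, by simp [nrm_coe]⟩ ?_
      ⟨τ / n, ⟨hτn, le_rfl⟩, rfl⟩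
    rintro _ ⟨t, ht, rfl⟩
    refine hposn _ (hne x hx.le hfx' _) ?_
    have := hgrow x hx.le hfx' t ht
    have h3 : 0 ≤ β * n / 4 * t := mul_nonneg (by positivity) ht.1
    have h0' : 0 < ev p x := h0
    linarith
  · rintro x ⟨hx, hfx⟩ hD
    have hfx' := hfx.trans hsα
    rw [Metric.mem_closedBall] at hD ⊢
    have := dist_triangle x (nrm ((x : E3) + (τ / n) • updir n p x)) x₀
    rw [dist_comm x (nrm _)] at this
    have h3 := hdist x hx.le hfx'
    calc dist x x₀ ≤ 2 * τ / n + R / n := by linarith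
      _ = _ := by ring
  · intro x hx1 hx2 hxG hxD
    refine hxG ⟨?_, abs_lt.2 ⟨hx1, by linarith⟩⟩
    rw [Metric.mem_closedBall] at hxD
    refine hxD.trans_lt ?_
    gcongr; linarith
  · intro C hC
    have hCD := hC.1
    obtain ⟨-, p₀, hp0, hpC, -⟩ := id hC
    obtain ⟨q, hqC, hq⟩ := (isClosed_closure (s := C)).isCompact.exists_isMaxOn
      ⟨p₀, subset_closure hpC⟩ hf.continuousOn
    have hq0 : 0 < ev p q := lt_of_lt_of_le hp0 (hq (subset_closure hpC))
    have hqC' : q ∈ C := mem_of_mem_closure_of_mem_compsIn hf hC hqC (by simpa using hq0)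
    refine ⟨q, hqC', ?_⟩
    by_contra hqs
    have hqα : |ev p q| < α := by rw [abs_of_pos hq0]; linarith
    have hqx : dist q x₀ ≤ (R + 1) / n := (hCD hqC').trans (by gcongr; linarith)
    refine htg0 q hqx hqα (tgrad_eq_zero_of_isLocalMax hp ?_ hq0)
    filter_upwards [(isOpen_of_mem_compsIn hf hC).mem_nhds hqC'] with y hy
    exact hq (subset_closure hy)

end

/-! ### Derivatives of the feature map -/

lemma hasDerivAt_legendrePoly_one (n : ℕ) :
    HasDerivAt (fun t => (legendrePoly n).eval t) (n * (n + 1) / 2) 1 := by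
  have h1 := (legendrePoly n).hasDerivAt 1
  have h2 : HasDerivAt (fun t : ℝ => (legendrePoly n).eval (1 - 2 * t)) (-(n * (n + 1))) 0 := by
    have : (fun t : ℝ => (legendrePoly n).eval (1 - 2 * t)) = fun t => ∑ k ∈ Finset.range (n + 1),
        (-1) ^ k * (n.choose k : ℝ) * ((n + k).choose n) * t ^ k :=
      funext fun t => legendrePoly_eval_one_sub n t
    rw [this]
    refine (HasDerivAt.fun_sum fun k _ => (hasDerivAt_pow k (0 : ℝ)).const_mul _).congr_deriv ?_
    rw [Finset.sum_eq_single 1]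
    · simp
    · intro k _ hk
      rcases Nat.lt_or_gt_of_ne hk with h | h
      · interval_cases k; simp
      · rw [zero_pow (by omega)]; simp
    · intro h
      have : n = 0 := by simp at h; omega
      subst this; simp
  have h3 : HasDerivAt (fun t : ℝ => (legendrePoly n).eval (1 - 2 * t))
      ((legendrePoly n).derivative.eval 1 * (-2)) 0 := by
    have hl : HasDerivAt (fun t : ℝ => 1 - 2 * t) (-2) 0 := by
      simpa using ((hasDerivAt_id (0 : ℝ)).const_mul 2).const_sub 1
    have h1' : HasDerivAt (fun t => (legendrePoly n).eval t)
      ((legendrePoly n).derivative.eval 1) (1 - 2 * 0) := by simpa using h1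
    exact h1'.comp (0 : ℝ) hl
  have := h3.unique h2
  exact h1.congr_deriv (by linarith)

namespace HarmModel

variable {n d : ℕ} (M : HarmModel n d)

/-- The derivative of the feature map at `y` in direction `e`. -/
noncomputable def dfeat (y e : E3) : EuclideanSpace ℝ (Fin d) :=
  WithLp.toLp 2 fun i => ∑ j, e j * ev (MvPolynomial.pderiv j (M.Φ (EuclideanSpace.single i 1))) y

lemma hasDerivAt_feat (y e : E3) :
    HasDerivAt (fun t : ℝ => M.feat (y + t • e)) (M.dfeat y e) 0 := by
  have h : HasDerivAt (fun t : ℝ => fun i => ev (M.Φ (EuclideanSpace.single i 1)) (y + t • e))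
      (fun i => ∑ j, e j * ev (MvPolynomial.pderiv j (M.Φ (EuclideanSpace.single i 1))) y) 0 := by
    rw [hasDerivAt_pi]
    intro i
    simpa using hasDerivAt_ev (M.Φ (EuclideanSpace.single i 1)) y e 0
  exact (PiLp.continuousLinearEquiv 2 ℝ (fun _ : Fin d => ℝ)).symm.hasFDerivAt.comp_hasDerivAt 0 h

lemma inner_dfeat (ξ : EuclideanSpace ℝ (Fin d)) (y e : E3) :
    ⟪ξ, M.dfeat y e⟫ = ⟪grad (M.Φ ξ) y, e⟫ := by
  have h1 : HasDerivAt (fun t : ℝ => ⟪ξ, M.feat (y + t • e)⟫) ⟪ξ, M.dfeat y e⟫ 0 := by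
    simpa using (hasDerivAt_const (0 : ℝ) ξ).inner ℝ (M.hasDerivAt_feat y e)
  have h2 : HasDerivAt (fun t : ℝ => ⟪ξ, M.feat (y + t • e)⟫) ⟪grad (M.Φ ξ) y, e⟫ 0 := by
    simp only [← M.ev_eq_inner, inner_grad]
    simpa using hasDerivAt_ev (M.Φ ξ) y e 0
  exact h1.unique h2

lemma feat_smul (c : ℝ) (x : E3) : M.feat (c • x) = c ^ n • M.feat x :=
  ext_inner_left ℝ fun ξ => by
    rw [← M.ev_eq_inner, ev_homog (mem_sphHarm.1 (M.mem ξ)).1, M.ev_eq_inner,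
      real_inner_smul_right]

lemma dfeat_aux {y : E3} {e : E3} (hy : ‖y‖ = 1) (he : ‖e‖ = 1) (hye : ⟪y, e⟫ = 0) :
    ⟪M.feat y, M.dfeat y e⟫ = 0 ∧ ‖M.dfeat y e‖ ^ 2 = n * (n + 1) / 2 := by
  have hs : ∀ t : ℝ, ‖y + t • e‖ = √(1 + t ^ 2) := by
    intro t
    rw [eq_comm, Real.sqrt_eq_iff_mul_self_eq (by positivity) (norm_nonneg _), ← sq,
      norm_add_sq_real, real_inner_smul_right, hye, norm_smul, hy, he, Real.norm_eq_abs, mul_one,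
      sq_abs]
    ring
  have hs0 : ∀ t : ℝ, √(1 + t ^ 2) ≠ 0 := fun t => by positivity
  obtain ⟨x, hx⟩ : ∃ x : ℝ → E3, x = fun t => (√(1 + t ^ 2))⁻¹ • (y + t • e) := ⟨_, rfl⟩
  have hx1 : ∀ t, ‖x t‖ = 1 := fun t => by
    rw [hx]
    simp only [norm_smul, hs t, norm_inv, Real.norm_eq_abs, abs_of_nonneg (Real.sqrt_nonneg _)]
    exact inv_mul_cancel₀ (hs0 t)
  have hx0 : x 0 = y := by simp [hx]
  obtain ⟨G, hG⟩ : ∃ G : ℝ → EuclideanSpace ℝ (Fin d), G = fun t => M.feat (x t) := ⟨_, rfl⟩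
  have hsd : HasDerivAt (fun s : ℝ => (√(1 + s))⁻¹) (-1 / 2) 0 := by
    have h1 : HasDerivAt (fun s : ℝ => 1 + s) 1 0 := (hasDerivAt_id (0 : ℝ)).const_add 1
    have h2 := (h1.sqrt (by norm_num)).fun_inv (by norm_num)
    refine h2.congr_deriv ?_
    norm_num
  have hr : HasDerivAt (fun t : ℝ => (√(1 + t ^ 2))⁻¹) 0 0 := by
    have h2 : HasDerivAt (fun t : ℝ => t ^ 2) 0 0 := by simpa using hasDerivAt_pow 2 (0 : ℝ)
    have hsd' : HasDerivAt (fun s : ℝ => (√(1 + s))⁻¹) (-1 / 2) ((0 : ℝ) ^ 2) := by simpa using hsd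
    simpa [Function.comp_def] using HasDerivAt.comp (h := fun t : ℝ => t ^ 2) (0 : ℝ) hsd' h2
  have hGd : HasDerivAt G (M.dfeat y e) 0 := by
    have h := (hr.fun_pow n).fun_smul (M.hasDerivAt_feat y e)
    rw [hG, hx]
    simp only [M.feat_smul]
    refine h.congr_deriv ?_
    simp
  have hG1 : ∀ t, ⟪G t, G t⟫ = 1 := fun t => by
    rw [hG, real_inner_self_eq_norm_sq, M.norm_feat (hx1 t), one_pow]
  have hG0 : G 0 = M.feat y := by rw [hG]; simp only [hx0]
  constructor
  · have h1 := hGd.inner ℝ hGd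
    simp only [hG1] at h1
    have h2 := h1.unique (hasDerivAt_const 0 1)
    rw [hG0, real_inner_comm (M.feat y)] at h2
    rw [real_inner_comm] at h2
    linarith [real_inner_comm (M.feat y) (M.dfeat y e)]
  · have h1 := (hasDerivAt_iff_tendsto_slope.1 hGd).norm.pow 2
    have hsq : ∀ t : ℝ, ‖slope G 0 t‖ ^ 2 =
        -2 * ((t ^ 2)⁻¹ * ((legendrePoly n).eval (√(1 + t ^ 2))⁻¹ - 1)) := by
      intro t
      have hin : ⟪G t, G 0⟫ = (legendrePoly n).eval (√(1 + t ^ 2))⁻¹ := by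
        rw [hG]
        simp only
        rw [M.inner_feat (hx1 t) (hx1 0), hx0, hx]
        simp only
        rw [real_inner_smul_left, inner_add_left, real_inner_smul_left, real_inner_comm y e, hye,
          real_inner_self_eq_norm_sq, hy]
        simp
      rw [slope_def_module, norm_smul, mul_pow, norm_sub_sq_real, hin, ← real_inner_self_eq_norm_sq (G t),
        ← real_inner_self_eq_norm_sq (G 0), hG1, hG1, sub_zero, norm_inv, Real.norm_eq_abs, inv_pow,
        sq_abs]
      ring
    simp only [hsq] at h1
    have hP : HasDerivAt (fun s : ℝ => (legendrePoly n).eval (√(1 + s))⁻¹)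
        (n * (n + 1) / 2 * (-1 / 2)) 0 := by
      have h3 : HasDerivAt (fun t => (legendrePoly n).eval t) (n * (n + 1) / 2)
        ((√(1 + (0 : ℝ)))⁻¹) := by simpa using hasDerivAt_legendrePoly_one n
      exact h3.comp (0 : ℝ) hsd
    have h4 := hasDerivAt_iff_tendsto_slope.1 hP
    have h5 : Filter.Tendsto (fun t : ℝ => t ^ 2) (nhdsWithin 0 {0}ᶜ) (nhdsWithin 0 {0}ᶜ) := by
      refine tendsto_nhdsWithin_iff.2 ⟨?_, ?_⟩
      · refine tendsto_nhdsWithin_of_tendsto_nhds ?_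
        have : ContinuousAt (fun t : ℝ => t ^ 2) 0 := by fun_prop
        simpa [ContinuousAt] using this
      · filter_upwards [self_mem_nhdsWithin] with t ht
        simpa using ht
    have h6 := (h4.comp h5).const_mul (-2)
    refine tendsto_nhds_unique h1 ?_
    have e1 : (-2 : ℝ) * (n * (n + 1) / 2 * (-1 / 2)) = n * (n + 1) / 2 := by ring
    rw [e1] at h6
    refine h6.congr fun t => ?_
    simp only [Function.comp, slope_def_module, sub_zero, add_zero, Real.sqrt_one, inv_one,
      legendrePoly_eval_one, smul_eq_mul]

end HarmModel

/-! ### The instability functional -/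

lemma exists_unit_orthogonal (y : E3) : ∃ e : E3, ‖e‖ = 1 ∧ ⟪y, e⟫ = 0 := by
  have h1 : Module.finrank ℝ (ℝ ∙ y) ≤ 1 := by
    simpa using finrank_span_le_card (R := ℝ) ({y} : Set E3)
  have h2 := Submodule.finrank_add_finrank_orthogonal (ℝ ∙ y)
  have h3 : Module.finrank ℝ E3 = 3 := by simp
  have : Nontrivial (ℝ ∙ y)ᗮ := Module.nontrivial_of_finrank_pos (R := ℝ) (by omega)
  obtain ⟨w, hw⟩ := exists_ne (0 : (ℝ ∙ y)ᗮ)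
  have hw' : (w : E3) ≠ 0 := fun h => hw (Subtype.ext h)
  refine ⟨‖(w : E3)‖⁻¹ • (w : E3), ?_, ?_⟩
  · rw [norm_smul, norm_inv, norm_norm, inv_mul_cancel₀ (norm_ne_zero_iff.2 hw')]
  · rw [real_inner_smul_right, Submodule.mem_orthogonal_singleton_iff_inner_right.1 w.2, mul_zero]

lemma HarmModel.small_value_and_grad {n d : ℕ} (M : HarmModel n d) (hn : 1 ≤ n) (y : Sphere2)
    (a : ℝ) {b : ℝ} (hb : 0 ≤ b) : stdGaussian (EuclideanSpace ℝ (Fin d))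
      {ξ | |ev (M.Φ ξ) y| ≤ a ∧ ‖grad (M.Φ ξ) y‖ ≤ b * n} ≤
      ENNReal.ofReal (2 * a) * ENNReal.ofReal (4 * b) := by
  have hn' : (1 : ℝ) ≤ n := by exact_mod_cast hn
  obtain ⟨e, he, hye⟩ := exists_unit_orthogonal (y : E3)
  obtain ⟨ho, hq⟩ := M.dfeat_aux (norm_sphere y) he hye
  obtain ⟨w, hw⟩ : ∃ w, w = M.dfeat y e := ⟨_, rfl⟩
  rw [← hw] at ho hq
  have hwn : (n : ℝ) / 2 ≤ ‖w‖ := by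
    refine le_of_sq_le_sq ?_ (norm_nonneg _)
    rw [hq]; nlinarith
  have hw0 : 0 < ‖w‖ := by linarith
  refine le_trans (measure_mono ?_) ((stdGaussian_small_ball (M.norm_feat (norm_sphere y))
    (v := ‖w‖⁻¹ • w) (by rw [norm_smul, norm_inv, norm_norm, inv_mul_cancel₀ hw0.ne'])
    (by rw [real_inner_smul_right, ho, mul_zero]) a (2 * b)).trans_eq (by ring_nf))
  rintro ξ ⟨h1, h2⟩
  refine ⟨by rwa [← M.ev_eq_inner], ?_⟩
  rw [real_inner_smul_right, abs_mul, abs_of_pos (inv_pos.2 hw0), inv_mul_le_iff₀ hw0, hw,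
    M.inner_dfeat, ← hw]
  calc |⟪grad (M.Φ ξ) y, e⟫| ≤ ‖grad (M.Φ ξ) y‖ * ‖e‖ := abs_real_inner_le_norm _ _
    _ ≤ b * n := by rw [he, mul_one]; exact h2
    _ ≤ ‖w‖ * (2 * b) := by nlinarith

/-- A cutoff detecting points where both the value and the gradient are small. -/
noncomputable def kap (n : ℕ) (a b : ℝ) (p : Poly3) (y : E3) : ℝ :=
  max 0 (min 1 (2 - max (|ev p y| / a) (‖grad p y‖ / (b * n))))

lemma kap_nonneg (n : ℕ) (a b : ℝ) (p : Poly3) (y : E3) : 0 ≤ kap n a b p y := le_max_left _ _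

lemma kap_le_one (n : ℕ) (a b : ℝ) (p : Poly3) (y : E3) : kap n a b p y ≤ 1 :=
  max_le zero_le_one (min_le_left _ _)

@[fun_prop]
lemma continuous_kap (n : ℕ) (a b : ℝ) (p : Poly3) : Continuous (kap n a b p) := by
  unfold kap
  fun_prop

section
variable {n : ℕ} {a b : ℝ} {p : Poly3} {y : E3}

lemma kap_eq_one (hn : 1 ≤ n) (ha : 0 < a) (hb : 0 < b) (h1 : |ev p y| ≤ a)
    (h2 : ‖grad p y‖ ≤ b * n) : kap n a b p y = 1 := by
  have hn' : (0 : ℝ) < n := by exact_mod_cast hn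
  have h3 : max (|ev p y| / a) (‖grad p y‖ / (b * n)) ≤ 1 :=
    max_le ((div_le_one ha).2 h1) ((div_le_one (by positivity)).2 h2)
  unfold kap
  rw [min_eq_left (by linarith), max_eq_right zero_le_one]

lemma of_kap_ne_zero (hn : 1 ≤ n) (ha : 0 < a) (hb : 0 < b) (h : kap n a b p y ≠ 0) :
    |ev p y| ≤ 2 * a ∧ ‖grad p y‖ ≤ 2 * b * n := by
  have hn' : (0 : ℝ) < n := by exact_mod_cast hn
  have h3 : max (|ev p y| / a) (‖grad p y‖ / (b * n)) ≤ 2 := by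
    by_contra h4
    rw [not_le] at h4
    exact h (max_eq_left ((min_le_right _ _).trans (by linarith)))
  have h4 := (le_max_left _ _).trans h3
  have h5 := (le_max_right _ _).trans h3
  rw [div_le_iff₀ ha] at h4
  rw [div_le_iff₀ (by positivity)] at h5
  exact ⟨h4, by linarith⟩

lemma grad_sub (p q : Poly3) (y : E3) : grad (p - q) y = grad p y - grad q y := by
  ext i; simp

lemma norm_le_sum_abs (v : E3) : ‖v‖ ≤ ∑ i, |v i| := by
  rw [EuclideanSpace.norm_eq, Real.sqrt_le_left (Finset.sum_nonneg fun i _ => abs_nonneg _)]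
  simp only [Real.norm_eq_abs, Fin.sum_univ_three]
  nlinarith [abs_nonneg (v 0), abs_nonneg (v 1), abs_nonneg (v 2),
    mul_nonneg (abs_nonneg (v 0)) (abs_nonneg (v 1)),
    mul_nonneg (abs_nonneg (v 0)) (abs_nonneg (v 2)),
    mul_nonneg (abs_nonneg (v 1)) (abs_nonneg (v 2))]

lemma abs_kap_sub_le (ha : 0 < a) (hb : 0 < b) (p q : Poly3) :
    |kap n a b p y - kap n a b q y| ≤ |ev (p - q) y| / a +
      (∑ i, |ev (MvPolynomial.pderiv i (p - q)) y|) / (b * n) := by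
  have hclamp : ∀ s t : ℝ, |max 0 (min 1 (2 - s)) - max 0 (min 1 (2 - t))| ≤ |s - t| := by
    intro s t
    rw [max_comm 0, max_comm 0]
    refine (abs_max_sub_max_le_abs _ _ _).trans ?_
    rw [abs_sub_comm s t]
    refine (abs_min_sub_min_le_max _ _ _ _).trans ?_
    rw [sub_self, abs_zero, max_eq_right (abs_nonneg _)]
    apply le_of_eq; congr 1; ring
  refine (hclamp _ _).trans ((abs_max_sub_max_le_max _ _ _ _).trans (max_le ?_ ?_))
  · rw [← sub_div, abs_div, abs_of_pos ha, ev_sub]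
    refine le_add_of_le_of_nonneg ?_ (by positivity)
    exact div_le_div_of_nonneg_right (abs_abs_sub_abs_le_abs_sub _ _) ha.le
  · rw [← sub_div, abs_div, abs_of_nonneg (show 0 ≤ b * n by positivity)]
    refine le_add_of_nonneg_of_le (by positivity) ?_
    gcongr
    refine (abs_norm_sub_norm_le _ _).trans ?_
    rw [← grad_sub]
    exact norm_le_sum_abs _

lemma derivSum_le_add (k : ℕ) (p q : Poly3) (x : E3) :
    derivSum k p x ≤ derivSum k q x + derivSum k (p - q) x := by
  induction k generalizing p q with
  | zero =>
    simp only [derivSum, ev_sub]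
    linarith [abs_sub_abs_le_abs_sub (ev p x) (ev q x)]
  | succ k ih =>
    simp only [derivSum]
    rw [← Finset.sum_add_distrib]
    refine Finset.sum_le_sum fun i _ => ?_
    rw [map_sub]
    exact ih _ _

lemma locNorm_le_add {A : ℝ} (hA : 0 ≤ A) (p q : Poly3) (x : E3) :
    locNorm n A p x ≤ locNorm n A q x + locNorm n A (p - q) x := by
  unfold locNorm taylorMaj
  rw [← Finset.sum_add_distrib]
  refine Finset.sum_le_sum fun k _ => ?_
  have := derivSum_le_add k p q x
  rw [← mul_add]
  gcongr

lemma locNorm_neg {A : ℝ} (p : Poly3) (x : E3) : locNorm n A (-p) x = locNorm n A p x := by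
  unfold locNorm taylorMaj
  have : ∀ k (p : Poly3), derivSum k (-p) x = derivSum k p x := by
    intro k
    induction k with
    | zero => intro p; simp [derivSum]
    | succ k ih => intro p; simp [derivSum, map_neg, ih]
  simp only [this]

lemma abs_locNorm_sub_le {A : ℝ} (hA : 0 ≤ A) (p q : Poly3) (x : E3) :
    |locNorm n A p x - locNorm n A q x| ≤ locNorm n A (p - q) x := by
  rw [abs_le]
  have h1 := locNorm_le_add (n := n) hA p q x
  have h2 := locNorm_le_add (n := n) hA q p x
  rw [← neg_sub, locNorm_neg] at h2
  constructor <;> linarith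

end

/-- A smooth functional bounding the measure of the set of unstable centers. -/
noncomputable def unstab (n : ℕ) (c a b A L : ℝ) (p : Poly3) : ℝ :=
  c * ∫ y : Sphere2, kap n a b p y ∂sphMeasure + (∫ y : Sphere2, locNorm n A p y ∂sphMeasure) / L

lemma sphMeasure_closedBall_le (y : Sphere2) {r : ℝ} (h0 : 0 ≤ r) :
    sphMeasure.real (Metric.closedBall y r) ≤ r ^ 2 / 4 := by
  by_cases h2 : r ≤ 2
  · exact (sphMeasure_closedBall y h0 h2).le
  · exact measureReal_le_one.trans (by nlinarith)

namespace HarmModel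

variable {n d : ℕ} (H : HarmModel n d) {c a b A L : ℝ}

lemma abs_unstab_sub_le (hn : 1 ≤ n) (hc : 0 ≤ c) (ha : 0 < a) (hb : 0 < b) (hA : 0 ≤ A)
    (hL : 0 < L) (ξ η : EuclideanSpace ℝ (Fin d)) :
    |unstab n c a b A L (H.Φ ξ) - unstab n c a b A L (H.Φ η)| ≤
      (c * (1 / a + 3 / b) + Real.exp (12 * A) / L) * (‖ξ - η‖ / √(2 * n + 1)) := by
  have hn' : (0 : ℝ) < n := by exact_mod_cast hn
  obtain ⟨q, hq⟩ : ∃ q, q = H.Φ (ξ - η) := ⟨_, rfl⟩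
  have hqq : H.Φ ξ - H.Φ η = q := by rw [hq, map_sub]
  have hqm : q ∈ sphHarm n := hq ▸ H.mem _
  have hsq : √(savg (q * q)) = ‖ξ - η‖ / √(2 * n + 1) := by rw [hq, H.sqrt_savg_eq]
  have h1 : |∫ y : Sphere2, kap n a b (H.Φ ξ) y ∂sphMeasure -
      ∫ y : Sphere2, kap n a b (H.Φ η) y ∂sphMeasure| ≤ (1 / a + 3 / b) * √(savg (q * q)) := by
    rw [← integral_sub (integrable_sphere (by fun_prop)) (integrable_sphere (by fun_prop))]
    refine abs_integral_le_integral_abs.trans ?_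
    calc ∫ y : Sphere2, |kap n a b (H.Φ ξ) y - kap n a b (H.Φ η) y| ∂sphMeasure
        ≤ ∫ y : Sphere2, (|ev q y| / a + (∑ i, |ev (MvPolynomial.pderiv i q) y|) / (b * n))
            ∂sphMeasure := by
          refine integral_mono (integrable_sphere (by fun_prop)) (integrable_sphere (by fun_prop))
            fun y => ?_
          have := abs_kap_sub_le (n := n) (y := (y : E3)) ha hb (H.Φ ξ) (H.Φ η)
          rwa [hqq] at this
      _ = (∫ y : Sphere2, |ev q y| ∂sphMeasure) / a +
          (∑ i, ∫ y : Sphere2, |ev (MvPolynomial.pderiv i q) y| ∂sphMeasure) / (b * n) := by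
          rw [integral_add (integrable_sphere (by fun_prop)) (integrable_sphere (by fun_prop)),
            integral_div, integral_div,
            integral_finsetSum _ fun i _ => integrable_sphere (by fun_prop)]
      _ ≤ √(savg (q * q)) / a + (3 * n * √(savg (q * q))) / (b * n) := by
          gcongr
          · exact integral_abs_le_sqrt_savg q
          · exact (Finset.sum_le_sum fun i _ => integral_abs_le_sqrt_savg _).trans
              (sum_sqrt_savg_pderiv_le hqm)
      _ = _ := by field_simp
  have h2 : |∫ y : Sphere2, locNorm n A (H.Φ ξ) y ∂sphMeasure -
      ∫ y : Sphere2, locNorm n A (H.Φ η) y ∂sphMeasure| ≤ Real.exp (12 * A) * √(savg (q * q)) := by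
    have hi : ∀ p, Integrable (fun y : Sphere2 => locNorm n A p y) sphMeasure := fun p =>
      integrable_sphere ((continuous_locNorm n A p).comp continuous_subtype_val)
    rw [← integral_sub (hi _) (hi _)]
    refine abs_integral_le_integral_abs.trans ?_
    refine le_trans (integral_mono ((hi _).sub (hi _)).abs (hi q) fun y => ?_)
      (integral_locNorm_le hn hA hqm)
    have := abs_locNorm_sub_le (n := n) hA (H.Φ ξ) (H.Φ η) (y : E3)
    rwa [hqq] at this
  rw [← hsq]
  unfold unstab
  rw [show ∀ u v w z : ℝ, c * u + v / L - (c * w + z / L) = c * (u - w) + (v - z) / L by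
    intro u v w z; ring]
  refine (abs_add_le _ _).trans ?_
  rw [abs_mul, abs_div, abs_of_nonneg hc, abs_of_pos hL]
  calc _ ≤ c * ((1 / a + 3 / b) * √(savg (q * q))) + (Real.exp (12 * A) * √(savg (q * q))) / L := by
        gcongr
    _ = _ := by ring

lemma continuous_kap_model : Continuous fun q : EuclideanSpace ℝ (Fin d) × Sphere2 =>
    kap n a b (H.Φ q.1) q.2 := by
  have h1 : Continuous fun q : EuclideanSpace ℝ (Fin d) × Sphere2 => ev (H.Φ q.1) q.2 := by
    simp only [H.ev_eq_inner]; fun_prop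
  have h2 : Continuous fun q : EuclideanSpace ℝ (Fin d) × Sphere2 => grad (H.Φ q.1) q.2 := by
    unfold grad
    refine (PiLp.continuous_toLp 2 _).comp (continuous_pi fun i => ?_)
    have : ∀ q : EuclideanSpace ℝ (Fin d) × Sphere2, ev (MvPolynomial.pderiv i (H.Φ q.1)) q.2 =
        ⟪q.1, H.dfeat q.2 (EuclideanSpace.single i 1)⟫ := by
      intro q
      rw [H.inner_dfeat, inner_grad]
      simp
    simp only [this]
    refine continuous_fst.inner ?_
    unfold dfeat
    fun_prop
  unfold kap
  fun_prop

lemma integral_kap_le (hn : 1 ≤ n) (ha : 0 < a) (hb : 0 < b) (y : Sphere2) :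
    ∫ ξ, kap n a b (H.Φ ξ) y ∂stdGaussian (EuclideanSpace ℝ (Fin d)) ≤ 32 * a * b := by
  have hmeas : MeasurableSet {ξ : EuclideanSpace ℝ (Fin d) |
      |ev (H.Φ ξ) y| ≤ 2 * a ∧ ‖grad (H.Φ ξ) y‖ ≤ 2 * b * n} := by
    have h1 : Continuous fun ξ => ev (H.Φ ξ) y := by simp only [H.ev_eq_inner]; fun_prop
    have h2 : Continuous fun ξ => grad (H.Φ ξ) y := by
      unfold grad
      refine (PiLp.continuous_toLp 2 _).comp (continuous_pi fun i => ?_)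
      have : ∀ ξ, ev (MvPolynomial.pderiv i (H.Φ ξ)) y =
          ⟪ξ, H.dfeat y (EuclideanSpace.single i 1)⟫ := by
        intro ξ
        rw [H.inner_dfeat, inner_grad]
        simp
      simp only [this]
      fun_prop
    exact ((isClosed_le (f := fun ξ => |ev (H.Φ ξ) y|) h1.abs continuous_const).inter
      (isClosed_le (f := fun ξ => ‖grad (H.Φ ξ) y‖) h2.norm continuous_const)).measurableSet
  calc ∫ ξ, kap n a b (H.Φ ξ) y ∂stdGaussian (EuclideanSpace ℝ (Fin d))
      ≤ ∫ ξ, Set.indicator {ξ : EuclideanSpace ℝ (Fin d) |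
      |ev (H.Φ ξ) y| ≤ 2 * a ∧ ‖grad (H.Φ ξ) y‖ ≤ 2 * b * n} (fun _ => (1 : ℝ)) ξ
        ∂stdGaussian (EuclideanSpace ℝ (Fin d)) := by
        refine integral_mono_of_nonneg (Filter.Eventually.of_forall fun ξ => kap_nonneg _ _ _ _ _)
          ((integrable_const 1).indicator hmeas) (Filter.Eventually.of_forall fun ξ => ?_)
        by_cases h : kap n a b (H.Φ ξ) y = 0
        · simp only [h]
          exact Set.indicator_nonneg (fun _ _ => zero_le_one) _
        · simp only
          rw [Set.indicator_of_mem (show ξ ∈ _ from of_kap_ne_zero hn ha hb h)]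
          exact kap_le_one _ _ _ _ _
    _ = (stdGaussian (EuclideanSpace ℝ (Fin d))).real {ξ : EuclideanSpace ℝ (Fin d) |
      |ev (H.Φ ξ) y| ≤ 2 * a ∧ ‖grad (H.Φ ξ) y‖ ≤ 2 * b * n} := by
        rw [integral_indicator hmeas]; simp
    _ ≤ 32 * a * b := by
        refine ENNReal.toReal_le_of_le_ofReal (by positivity) ?_
        refine (H.small_value_and_grad hn y (2 * a) (b := 2 * b) (by positivity)).trans ?_
        rw [← ENNReal.ofReal_mul (by positivity)]
        exact ENNReal.ofReal_le_ofReal (by nlinarith)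

lemma continuous_locNorm_model (n' : ℕ) (A : ℝ) :
    Continuous fun q : EuclideanSpace ℝ (Fin d) × Sphere2 => locNorm n' A (H.Φ q.1) q.2 :=
  (continuous_locNorm_linear n' A H.Φ).comp
    (continuous_fst.prodMk (continuous_subtype_val.comp continuous_snd))

lemma integrable_integral_locNorm (hn : 1 ≤ n) (hA : 0 ≤ A) :
    Integrable (fun ξ => ∫ y : Sphere2, locNorm n A (H.Φ ξ) y ∂sphMeasure)
      (stdGaussian (EuclideanSpace ℝ (Fin d))) := by
  refine (H.integral_sqrt_savg_le.1.const_mul (Real.exp (12 * A))).mono'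
    (H.continuous_locNorm_model n A).stronglyMeasurable.integral_prod_right.aestronglyMeasurable
    (Filter.Eventually.of_forall fun ξ => ?_)
  have h0 : 0 ≤ ∫ y : Sphere2, locNorm n A (H.Φ ξ) y ∂sphMeasure :=
    integral_nonneg fun y => locNorm_nonneg n hA _ _
  rw [Real.norm_eq_abs, abs_of_nonneg h0]
  exact integral_locNorm_le hn hA (H.mem ξ)

lemma integral_integral_locNorm_le (hn : 1 ≤ n) (hA : 0 ≤ A) :
    ∫ ξ, ∫ y : Sphere2, locNorm n A (H.Φ ξ) y ∂sphMeasure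
      ∂stdGaussian (EuclideanSpace ℝ (Fin d)) ≤ Real.exp (12 * A) := by
  obtain ⟨hs, hs1⟩ := H.integral_sqrt_savg_le
  calc _ ≤ ∫ ξ, Real.exp (12 * A) * √(savg (H.Φ ξ * H.Φ ξ))
          ∂stdGaussian (EuclideanSpace ℝ (Fin d)) :=
        integral_mono (H.integrable_integral_locNorm hn hA) (hs.const_mul _) fun ξ =>
          integral_locNorm_le hn hA (H.mem ξ)
    _ ≤ Real.exp (12 * A) * 1 := by
        rw [integral_const_mul]; gcongr
    _ = _ := mul_one _

lemma integrable_locNorm_prod (hn : 1 ≤ n) (hA : 0 ≤ A) :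
    Integrable (fun q : EuclideanSpace ℝ (Fin d) × Sphere2 => locNorm n A (H.Φ q.1) q.2)
      ((stdGaussian (EuclideanSpace ℝ (Fin d))).prod sphMeasure) := by
  refine (integrable_prod_iff (H.continuous_locNorm_model n A).aestronglyMeasurable).2
    ⟨Filter.Eventually.of_forall fun ξ => integrable_sphere ?_, ?_⟩
  · exact (continuous_locNorm n A (H.Φ ξ)).comp continuous_subtype_val
  · refine (H.integrable_integral_locNorm hn hA).congr (Filter.Eventually.of_forall fun ξ => ?_)
    exact integral_congr_ae (Filter.Eventually.of_forall fun y =>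
      (Real.norm_of_nonneg (locNorm_nonneg n hA _ _)).symm)

lemma integral_unstab_le (hn : 1 ≤ n) (hc : 0 ≤ c) (ha : 0 < a) (hb : 0 < b) (hA : 0 ≤ A)
    (hL : 0 < L) : ∫ ξ, unstab n c a b A L (H.Φ ξ) ∂stdGaussian (EuclideanSpace ℝ (Fin d)) ≤
      c * (32 * a * b) + Real.exp (12 * A) / L := by
  obtain ⟨γ, hγ⟩ : ∃ γ, γ = stdGaussian (EuclideanSpace ℝ (Fin d)) := ⟨_, rfl⟩
  have : IsProbabilityMeasure γ := hγ ▸ inferInstance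
  rw [← hγ]
  have hk : Integrable (fun q : EuclideanSpace ℝ (Fin d) × Sphere2 => kap n a b (H.Φ q.1) q.2)
      (γ.prod sphMeasure) := by
    refine Integrable.of_bound H.continuous_kap_model.aestronglyMeasurable 1
      (Filter.Eventually.of_forall fun q => ?_)
    rw [Real.norm_eq_abs, abs_of_nonneg (kap_nonneg _ _ _ _ _)]
    exact kap_le_one _ _ _ _ _
  have h1 : Integrable (fun ξ => ∫ y : Sphere2, kap n a b (H.Φ ξ) y ∂sphMeasure) γ :=
    hk.integral_prod_left
  have h1' : ∫ ξ, ∫ y : Sphere2, kap n a b (H.Φ ξ) y ∂sphMeasure ∂γ ≤ 32 * a * b := by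
    rw [integral_integral_swap hk]
    calc ∫ y : Sphere2, ∫ ξ, kap n a b (H.Φ ξ) y ∂γ ∂sphMeasure
        ≤ ∫ y : Sphere2, 32 * a * b ∂sphMeasure := by
          refine integral_mono hk.integral_prod_right (integrable_const _) fun y => ?_
          simp only [hγ]
          exact H.integral_kap_le hn ha hb y
      _ = 32 * a * b := by simp
  have h2 := H.integrable_integral_locNorm hn hA
  have h2' := H.integral_integral_locNorm_le hn hA
  rw [← hγ] at h2 h2'
  unfold unstab
  rw [integral_add (h1.const_mul c) (h2.div_const L), integral_const_mul, integral_div]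
  gcongr

end HarmModel

section
variable {n : ℕ} {p : Poly3}

/-- If a point is an almost critical almost zero then so are all nearby points. -/
lemma kap_eq_one_of_near (hn : 1 ≤ n) {δ L : ℝ} (hδ0 : 0 < δ) (hL : 0 ≤ L)
    {y z : E3} (hyz : ‖z - y‖ ≤ δ / n) (h1 : |ev p y| ≤ δ ^ 2) (h2 : ‖grad p y‖ ≤ δ * n)
    (h3 : ∀ w : E3, ‖w - y‖ ≤ δ / n → ∀ i j,
      |ev (MvPolynomial.pderiv i (MvPolynomial.pderiv j p)) w| ≤ L * n ^ 2) :
    kap n ((4 + 9 * L) * δ ^ 2) ((1 + 9 * L) * δ) p z = 1 := by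
  have hn' : (0 : ℝ) < n := by exact_mod_cast hn
  have hconv : Convex ℝ (Metric.closedBall y (δ / n)) := convex_closedBall _ _
  have hmem : ∀ w, ‖w - y‖ ≤ δ / n → w ∈ Metric.closedBall y (δ / n) := fun w hw => by
    rwa [Metric.mem_closedBall, dist_eq_norm]
  have hy : y ∈ Metric.closedBall y (δ / n) := Metric.mem_closedBall_self (by positivity)
  have hd : ∀ i, ∀ w ∈ Metric.closedBall y (δ / n),
      |ev (MvPolynomial.pderiv i p) w - ev (MvPolynomial.pderiv i p) y| ≤ 3 * L * δ * n := by
    intro i w hw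
    have hw' : ‖w - y‖ ≤ δ / n := by rwa [Metric.mem_closedBall, dist_eq_norm] at hw
    refine (abs_ev_sub_le hconv (B := L * n ^ 2) (fun v hv j => h3 v
      (by rwa [Metric.mem_closedBall, dist_eq_norm] at hv) j i) hw hy).trans ?_
    calc 3 * (L * n ^ 2) * ‖w - y‖ ≤ 3 * (L * n ^ 2) * (δ / n) := by gcongr
      _ = _ := by field_simp
  have hdb : ∀ i, ∀ w ∈ Metric.closedBall y (δ / n),
      |ev (MvPolynomial.pderiv i p) w| ≤ (1 + 3 * L) * δ * n := by
    intro w i hw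
    have e1 := hd w i hw
    have e2 := (abs_coord_le_norm (grad p y) w).trans h2
    rw [grad_apply] at e2
    have := abs_sub_abs_le_abs_sub (ev (MvPolynomial.pderiv w p) i) (ev (MvPolynomial.pderiv w p) y)
    nlinarith
  refine kap_eq_one hn (by positivity) (by positivity) ?_ ?_
  · have := abs_ev_sub_le hconv (q := p) (fun v hv j => hdb j v hv) (hmem z hyz) hy
    have h4 : 3 * ((1 + 3 * L) * δ * n) * ‖z - y‖ ≤ 3 * ((1 + 3 * L) * δ * n) * (δ / n) := by
      gcongr
    have h5 : 3 * ((1 + 3 * L) * δ * n) * (δ / n) = 3 * (1 + 3 * L) * δ ^ 2 := by field_simp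
    have := abs_sub_abs_le_abs_sub (ev p z) (ev p y)
    nlinarith
  · calc ‖grad p z‖ = ‖grad p y + (grad p z - grad p y)‖ := by congr 1; abel
      _ ≤ δ * n + ∑ i : Fin 3, 3 * L * δ * n := by
        refine (norm_add_le _ _).trans (add_le_add h2 ((norm_le_sum_abs _).trans ?_))
        exact Finset.sum_le_sum fun i _ => hd i z (hmem z hyz)
      _ = _ := by simp; ring

/-- A pointwise majorant of the indicator of unstable centers. -/
noncomputable def chi (n : ℕ) (R δ a b A L : ℝ) (p : Poly3) (x : Sphere2) : ℝ :=
  4 * n ^ 2 / δ ^ 2 * ∫ y in Metric.closedBall x ((R + 2) / n), kap n a b p y ∂sphMeasure +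
    locNorm n A p x / L

lemma chi_nonneg {R δ a b A L : ℝ} (hA : 0 ≤ A) (hL : 0 ≤ L) (x : Sphere2) :
    0 ≤ chi n R δ a b A L p x := by
  unfold chi
  have h1 : 0 ≤ ∫ y in Metric.closedBall x ((R + 2) / n), kap n a b p y ∂sphMeasure :=
    integral_nonneg fun y => kap_nonneg _ _ _ _ _
  have h2 := locNorm_nonneg n hA p x
  positivity

theorem compsIn_stable_or_one_le_chi (hn : 1 ≤ n) (hp : p ∈ sphHarm n) {R δ L s : ℝ}
    (hR : 0 ≤ R) (hδ0 : 0 < δ) (hδ1 : δ ≤ 1) (hL : 1 ≤ L) (hs0 : 0 < s)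
    (hs : s < δ ^ 2 / (144 * L)) (x : Sphere2) :
    (compsIn (fun y : Sphere2 => ev p y) 0 (Metric.closedBall x (R / n))).encard ≤
      (compsIn (fun y : Sphere2 => ev p y) s (Metric.closedBall x ((R + 1) / n))).encard ∨
    1 ≤ chi n R δ ((4 + 9 * L) * δ ^ 2) ((1 + 9 * L) * δ) (R + 2) L p x := by
  have hn' : (0 : ℝ) < n := by exact_mod_cast hn
  have hn1 : (1 : ℝ) ≤ n := by exact_mod_cast hn
  have hkint : 0 ≤ ∫ y in Metric.closedBall x ((R + 2) / n),
      kap n ((4 + 9 * L) * δ ^ 2) ((1 + 9 * L) * δ) p y ∂sphMeasure :=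
    integral_nonneg fun y => kap_nonneg _ _ _ _ _
  by_cases hloc : L ≤ locNorm n (R + 2) p x
  · right
    have : 1 ≤ locNorm n (R + 2) p x / L := (one_le_div (by linarith)).2 hloc
    unfold chi
    have h0 : 0 ≤ 4 * (n : ℝ) ^ 2 / δ ^ 2 := by positivity
    nlinarith [mul_nonneg h0 hkint]
  rw [not_le] at hloc
  have h2 : ∀ y : E3, ‖y - x‖ ≤ (R + 2) / n → ∀ i j,
      |ev (MvPolynomial.pderiv i (MvPolynomial.pderiv j p)) y| ≤ L * n ^ 2 := by
    intro y hy i j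
    refine (abs_ev_pderiv_pderiv_le_locNorm hn (by linarith) hp hy i j).trans ?_
    rw [mul_comm]
    gcongr
  by_cases h1 : ∀ y : Sphere2, dist y x ≤ (R + 1) / n → |ev p y| < δ ^ 2 / 2 →
      δ * n ≤ ‖grad p y‖
  · left
    have hsL : s * (144 * L) < δ ^ 2 := by rwa [lt_div_iff₀ (by positivity)] at hs
    refine (encard_compsIn_zero_le hn (mem_sphHarm.1 hp).1 (M := L) (τ := δ / (36 * L))
      (by linarith) ?_ (by positivity) ?_ ?_ hs0 ?_ ?_ h1 h2).trans
      (Set.encard_le_encard (compsIn_mono_set _ _ (Metric.closedBall_subset_closedBall ?_)))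
    · nlinarith
    · rw [div_lt_iff₀ (by positivity)]; linarith
    · apply le_of_eq; field_simp; norm_num
    · nlinarith
    · rw [mul_div_assoc', div_div, lt_div_iff₀ (by positivity)]; nlinarith
    · gcongr
      rw [mul_div_assoc', div_le_iff₀ (by positivity)]; linarith
  · right
    push Not at h1
    obtain ⟨y, hyx, hy1, hy2⟩ := h1
    have hyx' : ‖(y : E3) - x‖ ≤ (R + 1) / n := by rwa [← dist_eq_norm]
    have hk : ∀ z : Sphere2, dist z y ≤ δ / n →
        kap n ((4 + 9 * L) * δ ^ 2) ((1 + 9 * L) * δ) p z = 1 := by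
      intro z hz
      refine kap_eq_one_of_near hn hδ0 (by linarith) (by rwa [← dist_eq_norm])
        (hy1.le.trans (by nlinarith [sq_nonneg δ])) hy2.le fun w hw => h2 w ?_
      calc ‖w - x‖ ≤ ‖w - y‖ + ‖(y : E3) - x‖ := norm_sub_le_norm_sub_add_norm_sub _ _ _
        _ ≤ 1 / n + (R + 1) / n := by
          refine add_le_add (hw.trans ?_) hyx'
          gcongr
        _ = _ := by ring
    have hsub : Metric.closedBall y (δ / n) ⊆ Metric.closedBall x ((R + 2) / n) := by
      refine Metric.closedBall_subset_closedBall' ?_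
      calc δ / n + dist y x ≤ 1 / n + (R + 1) / n := by gcongr
        _ = _ := by ring
    have hInt : Integrable (fun y : Sphere2 =>
        kap n ((4 + 9 * L) * δ ^ 2) ((1 + 9 * L) * δ) p y) sphMeasure :=
      integrable_sphere (by fun_prop)
    have h5 : δ ^ 2 / (4 * n ^ 2) ≤ ∫ y in Metric.closedBall x ((R + 2) / n),
        kap n ((4 + 9 * L) * δ ^ 2) ((1 + 9 * L) * δ) p y ∂sphMeasure := by
      calc δ ^ 2 / (4 * n ^ 2) = sphMeasure.real (Metric.closedBall y (δ / n)) := by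
            rw [sphMeasure_closedBall y (by positivity)]
            · field_simp
            · rw [div_le_iff₀ hn']; linarith
        _ = ∫ y in Metric.closedBall y (δ / n),
              kap n ((4 + 9 * L) * δ ^ 2) ((1 + 9 * L) * δ) p y ∂sphMeasure := by
            rw [setIntegral_congr_fun Metric.isClosed_closedBall.measurableSet
              (g := fun _ => (1 : ℝ)) fun z hz => hk z hz]
            simp
        _ ≤ _ := setIntegral_mono_set hInt.integrableOn
            (Filter.Eventually.of_forall fun z => kap_nonneg _ _ _ _ _)
            hsub.eventuallyLE
    have h6 : 0 ≤ locNorm n (R + 2) p x / L :=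
      div_nonneg (locNorm_nonneg n (by linarith) p x) (by linarith)
    have h7 : 1 ≤ 4 * n ^ 2 / δ ^ 2 * ∫ y in Metric.closedBall x ((R + 2) / n),
        kap n ((4 + 9 * L) * δ ^ 2) ((1 + 9 * L) * δ) p y ∂sphMeasure := by
      calc 1 = 4 * n ^ 2 / δ ^ 2 * (δ ^ 2 / (4 * n ^ 2)) := by field_simp
        _ ≤ _ := by gcongr
    unfold chi
    linarith

lemma measurableSet_dist_le (r : ℝ) :
    MeasurableSet {q : Sphere2 × Sphere2 | dist q.2 q.1 ≤ r} :=
  (isClosed_le (by fun_prop) continuous_const).measurableSet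

/-- Averaging over caps. -/
lemma integral_integral_closedBall {r : ℝ} {h : Sphere2 → ℝ} (hh : Continuous h) :
    Integrable (fun x => ∫ y in Metric.closedBall x r, h y ∂sphMeasure) sphMeasure ∧
    ∫ x, ∫ y in Metric.closedBall x r, h y ∂sphMeasure ∂sphMeasure =
      ∫ y, sphMeasure.real (Metric.closedBall y r) * h y ∂sphMeasure := by
  have hi : Integrable (fun q : Sphere2 × Sphere2 =>
      Set.indicator {q : Sphere2 × Sphere2 | dist q.2 q.1 ≤ r} (fun q => h q.2) q)
      (sphMeasure.prod sphMeasure) :=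
    ((integrable_sphere hh).comp_snd sphMeasure).indicator (measurableSet_dist_le r)
  have e1 : ∀ x, ∫ y in Metric.closedBall x r, h y ∂sphMeasure =
      ∫ y, Set.indicator {q : Sphere2 × Sphere2 | dist q.2 q.1 ≤ r} (fun q => h q.2) (x, y)
        ∂sphMeasure := fun x => by
    rw [← integral_indicator Metric.isClosed_closedBall.measurableSet]
    rfl
  simp only [e1]
  refine ⟨hi.integral_prod_left, ?_⟩
  rw [integral_integral_swap hi]
  refine integral_congr_ae (Filter.Eventually.of_forall fun y => ?_)
  have e2 : (fun x => Set.indicator {q : Sphere2 × Sphere2 | dist q.2 q.1 ≤ r}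
      (fun q => h q.2) (x, y)) = Set.indicator (Metric.closedBall y r) fun _ => h y := by
    ext x
    simp [Set.indicator, dist_comm]
  simp only [e2]
  rw [integral_indicator Metric.isClosed_closedBall.measurableSet]
  simp

lemma integral_chi_le (hn : 1 ≤ n) {R δ a b A L : ℝ} (hR : 0 ≤ R) (hδ : 0 < δ) :
    Integrable (chi n R δ a b A L p) sphMeasure ∧
    ∫ x, chi n R δ a b A L p x ∂sphMeasure ≤ unstab n ((R + 2) ^ 2 / δ ^ 2) a b A L p := by
  have hn' : (0 : ℝ) < n := by exact_mod_cast hn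
  obtain ⟨h1, h2⟩ := integral_integral_closedBall (r := (R + 2) / n)
    (h := fun y : Sphere2 => kap n a b p y) (by fun_prop)
  have h3 : Integrable (fun x : Sphere2 => locNorm n A p x / L) sphMeasure :=
    integrable_sphere (((continuous_locNorm n A p).comp continuous_subtype_val).div_const L)
  refine ⟨(h1.const_mul _).add h3, ?_⟩
  unfold chi unstab
  rw [integral_add (h1.const_mul _) h3, integral_const_mul, integral_div, h2]
  gcongr ?_ + _
  rw [← integral_const_mul, ← integral_const_mul]
  refine integral_mono_of_nonneg (Filter.Eventually.of_forall fun y => ?_)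
    ((integrable_sphere (by fun_prop)).const_mul _) (Filter.Eventually.of_forall fun y => ?_)
  · have := kap_nonneg n a b p y
    positivity
  · have h4 := kap_nonneg n a b p y
    have h5 := sphMeasure_closedBall_le y (r := (R + 2) / n) (by positivity)
    calc 4 * (n : ℝ) ^ 2 / δ ^ 2 * (sphMeasure.real (Metric.closedBall y ((R + 2) / n)) *
          kap n a b p y) ≤ 4 * (n : ℝ) ^ 2 / δ ^ 2 * (((R + 2) / n) ^ 2 / 4 * kap n a b p y) := by
          gcongr
      _ = (R + 2) ^ 2 / δ ^ 2 * kap n a b p y := by field_simp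

end

/-! ### Large components -/

section Large

/-- Components of the positivity set visited by a curve along which the sign is given by a
polynomial. -/
theorem encard_compsIn_meet_curve_le {X : Type*} [TopologicalSpace X] {f : X → ℝ} {γ : ℝ → X}
    (hγ : Continuous γ) {q : ℝ[X]} {m : ℕ} (hq : q.natDegree ≤ m)
    (h : ∀ u, 0 < f (γ u) ↔ 0 < q.eval u) (D : Set X) :
    {C ∈ compsIn f 0 D | ∃ u, γ u ∈ C}.encard ≤ m + 1 := by
  classical
  choose! U hU using fun C (hC : C ∈ {C ∈ compsIn f 0 D | ∃ u, γ u ∈ C}) => hC.2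
  have hpos : ∀ C ∈ {C ∈ compsIn f 0 D | ∃ u, γ u ∈ C}, 0 < q.eval (U C) := fun C hC =>
    (h _).1 (by simpa using subset_of_mem_compsIn hC.1 (hU C hC))
  let cnt : Set X → ℕ := fun C => (q.roots.toFinset.filter (· < U C)).card
  have key : ∀ C ∈ {C ∈ compsIn f 0 D | ∃ u, γ u ∈ C}, ∀ C' ∈ {C ∈ compsIn f 0 D | ∃ u, γ u ∈ C},
      C ≠ C' → U C ≤ U C' → cnt C < cnt C' := by
    intro C hC C' hC' hne hle
    have hex : ∃ v ∈ Set.Icc (U C) (U C'), q.eval v ≤ 0 := by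
      by_contra! hcon
      refine hne (compsIn_eq_of_mem hC.1 hC'.1 (x := γ (U C')) ?_ (hU C' hC'))
      refine subset_of_mem_compsIn_of_isPreconnected hC.1
        ((isPreconnected_Icc (a := U C) (b := U C')).image γ hγ.continuousOn) ?_
        (Set.mem_image_of_mem γ (Set.left_mem_Icc.2 hle)) (hU C hC)
        (Set.mem_image_of_mem γ (Set.right_mem_Icc.2 hle))
      rintro _ ⟨v, hv, rfl⟩
      simpa using (h v).2 (hcon v hv)
    obtain ⟨v, hv, hv0⟩ := hex
    obtain ⟨w, hw, hw0⟩ : (0 : ℝ) ∈ (fun u => q.eval u) '' Set.Icc (U C) v :=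
      intermediate_value_Icc' hv.1 q.continuous.continuousOn ⟨hv0, (hpos C hC).le⟩
    have hq0 : q ≠ 0 := by
      rintro rfl
      simpa using hpos C hC
    have hwC : U C ≤ w := hw.1
    have hwC' : w < U C' := lt_of_le_of_ne (hw.2.trans hv.2) (by
      rintro rfl
      exact (hpos C' hC').ne' hw0)
    refine Finset.card_lt_card ⟨fun z hz => ?_, fun hsub => ?_⟩
    · simp only [Finset.mem_filter] at hz ⊢
      exact ⟨hz.1, hz.2.trans_le hle⟩
    · have := hsub (show w ∈ q.roots.toFinset.filter (· < U C') by
        simp [hq0, hwC']; exact hw0)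
      simp only [Finset.mem_filter] at this
      exact absurd this.2 (not_lt.2 hwC)
  have hinj : Set.InjOn cnt {C ∈ compsIn f 0 D | ∃ u, γ u ∈ C} := by
    intro C hC C' hC' he
    by_contra hne
    rcases le_total (U C) (U C') with hle | hle
    · exact (key C hC C' hC' hne hle).ne he
    · exact (key C' hC' C hC (Ne.symm hne) hle).ne he.symm
  have hmaps : Set.MapsTo cnt {C ∈ compsIn f 0 D | ∃ u, γ u ∈ C} (Finset.range (m + 1)) := by
    intro C _
    simp only [Finset.coe_range, Set.mem_Iio]
    have h1 : cnt C ≤ q.roots.toFinset.card := Finset.card_filter_le _ _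
    have h2 := q.roots.toFinset_card_le
    have h3 := q.card_roots'
    omega
  refine (Set.encard_le_encard_of_injOn hmaps hinj).trans ?_
  rw [Set.encard_coe_eq_coe_finsetCard]
  simp

lemma encard_compsIn_mem_le {X : Type*} [TopologicalSpace X] (f : X → ℝ) (D : Set X) (x : X) :
    {C ∈ compsIn f 0 D | x ∈ C}.encard ≤ 1 := by
  rw [Set.encard_le_one_iff]
  exact fun C C' hC hC' => compsIn_eq_of_mem hC.1 hC'.1 hC.2 hC'.2

/-- Components meeting a coordinate circle. -/
theorem encard_compsIn_meet_circle_le {n : ℕ} {p : Poly3} (hp : p.IsHomogeneous n) (i : Fin 3)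
    {t : ℝ} (ht : t ^ 2 ≤ 1) (D : Set Sphere2) :
    {C ∈ compsIn (fun y : Sphere2 => ev p y) 0 D | ∃ z ∈ C, (z : E3) i = t}.encard ≤ 2 * n + 2 := by
  set r := √(1 - t ^ 2) with hr
  have hr0 : 0 ≤ r := Real.sqrt_nonneg _
  have hr2 : r ^ 2 = 1 - t ^ 2 := Real.sq_sqrt (by linarith)
  let w : ℝ → ℝ → E3 := fun c s => WithLp.toLp 2 fun j => if j = i then t else if j = i + 1 then
    r * c else r * s
  have hw : ∀ c s, c ^ 2 + s ^ 2 = 1 → ‖w c s‖ = 1 := by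
    intro c s hcs
    have : ‖w c s‖ ^ 2 = 1 := by
      rw [EuclideanSpace.real_norm_sq_eq, Fin.sum_univ_three]
      have : t ^ 2 + (r * c) ^ 2 + (r * s) ^ 2 = 1 := by linear_combination hr2 * (c ^2 + s^2) + (1 - t^2) * hcs
      fin_cases i <;> simp [w] <;> linarith
    nlinarith [norm_nonneg (w c s)]
  have hu : ∀ u : ℝ, 0 < 1 + u ^ 2 := fun u => by positivity
  have hcs : ∀ u : ℝ, ((1 - u ^ 2) / (1 + u ^ 2)) ^ 2 + (2 * u / (1 + u ^ 2)) ^ 2 = 1 := fun u => by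
    have := (hu u).ne'
    field_simp
    ring
  let γ : ℝ → Sphere2 := fun u => ⟨w ((1 - u ^ 2) / (1 + u ^ 2)) (2 * u / (1 + u ^ 2)), by
    simpa using hw _ _ (hcs u)⟩
  have hγ : Continuous γ := by
    refine Continuous.subtype_mk ?_ _
    refine (PiLp.continuous_toLp 2 _).comp (continuous_pi fun j => ?_)
    have h1 : ∀ u : ℝ, 1 + u ^ 2 ≠ 0 := fun u => (hu u).ne'
    split_ifs
    · fun_prop
    · fun_prop (disch := exact h1)
    · fun_prop (disch := exact h1)
  let Q : Fin 3 → ℝ[X] := fun j => if j = i then C t * (1 + X ^ 2) else if j = i + 1 then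
    C r * (1 - X ^ 2) else C r * (2 * X)
  have hQ : ∀ j, (Q j).natDegree ≤ 2 := by
    intro j
    simp only [Q]
    split_ifs <;> compute_degree!
  have hQe : ∀ u, (MvPolynomial.aeval Q p).eval u = (1 + u ^ 2) ^ n * ev p (γ u) := by
    intro u
    rw [← ev_homog hp]
    have h1 := (hu u).ne'
    have : (MvPolynomial.aeval Q p).eval u = MvPolynomial.eval (fun j => (Q j).eval u) p := by
      rw [← Polynomial.coe_evalRingHom, MvPolynomial.aeval_def, MvPolynomial.hom_eval₂,
        MvPolynomial.eval, MvPolynomial.coe_eval₂Hom]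
      congr 1
      ext x
      simp
    rw [this, ev]
    congr 2
    funext j
    simp only [Q, γ, w, PiLp.smul_apply, smul_eq_mul]
    split_ifs <;> simp <;> field_simp
  have hdeg : (MvPolynomial.aeval Q p).natDegree ≤ n * 2 :=
    MvPolynomial.aeval_natDegree_le p hp.totalDegree_le Q hQ
  have h1 := encard_compsIn_meet_curve_le (f := fun y : Sphere2 => ev p y) hγ hdeg (fun u => by
    rw [hQe]
    exact (mul_pos_iff_of_pos_left (pow_pos (hu u) n)).symm) D
  let a : Sphere2 := ⟨w (-1) 0, by simpa using hw (-1) 0 (by norm_num)⟩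
  have h2 := encard_compsIn_mem_le (fun y : Sphere2 => ev p y) D a
  have hsub : {C ∈ compsIn (fun y : Sphere2 => ev p y) 0 D | ∃ z ∈ C, (z : E3) i = t} ⊆
      {C ∈ compsIn (fun y : Sphere2 => ev p y) 0 D | ∃ u, γ u ∈ C} ∪
      {C ∈ compsIn (fun y : Sphere2 => ev p y) 0 D | a ∈ C} := by
    rintro C ⟨hC, z, hzC, hz⟩
    have hz1 : (z : E3) i ^ 2 + (z : E3) (i + 1) ^ 2 + (z : E3) (i + 2) ^ 2 = 1 := by
      have : ‖(z : E3)‖ ^ 2 = 1 := by rw [norm_sphere]; norm_num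
      rw [EuclideanSpace.real_norm_sq_eq, Fin.sum_univ_three] at this
      fin_cases i <;> simp <;> linarith
    have hrs : (z : E3) (i + 1) ^ 2 + (z : E3) (i + 2) ^ 2 = r ^ 2 := by rw [hr2, ← hz]; linarith
    have hext : ∀ v : E3, v i = t → v (i + 1) = (z : E3) (i + 1) → v (i + 2) = (z : E3) (i + 2) →
        v = z := by
      intro v h1 h2 h3
      rw [← hz] at h1
      ext j
      fin_cases i <;> fin_cases j <;> simp at h1 h2 h3 ⊢ <;> assumption
    have hne1 : i + 1 ≠ i := by fin_cases i <;> decide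
    have hne2 : i + 2 ≠ i := by fin_cases i <;> decide
    have hne3 : i + 2 ≠ i + 1 := by fin_cases i <;> decide
    by_cases hb : (z : E3) (i + 1) = -r
    · right
      refine ⟨hC, ?_⟩
      have : a = z := Subtype.ext (hext _ (by simp [a, w]) (by simp [a, w, hne1, hb]) (by
        simp only [a, w, hne2, hne3, if_false, mul_zero]
        rw [hb] at hrs
        symm
        exact pow_eq_zero_iff two_ne_zero |>.1 (by linarith)))
      rwa [this]
    · left
      refine ⟨hC, (z : E3) (i + 2) / (r + (z : E3) (i + 1)), ?_⟩
      have hne : r + (z : E3) (i + 1) ≠ 0 := fun h => hb (by linarith)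
      have hr' : r ≠ 0 := by
        rintro h0
        rw [h0] at hrs
        apply hb
        rw [h0, neg_zero]
        nlinarith [sq_nonneg ((z : E3) (i + 1)), sq_nonneg ((z : E3) (i + 2))]
      have e1 : 1 + ((z : E3) (i + 2) / (r + (z : E3) (i + 1))) ^ 2 =
          2 * r / (r + (z : E3) (i + 1)) := by
        field_simp
        linear_combination hrs
      have e2 : 1 - ((z : E3) (i + 2) / (r + (z : E3) (i + 1))) ^ 2 =
          2 * (z : E3) (i + 1) / (r + (z : E3) (i + 1)) := by
        field_simp
        linear_combination -hrs
      have : γ ((z : E3) (i + 2) / (r + (z : E3) (i + 1))) = z := by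
        refine Subtype.ext (hext _ (by simp [γ, w]) ?_ ?_)
        · simp only [γ, w, hne1, if_false, if_true, e1, e2]
          field_simp
        · simp only [γ, w, hne2, hne3, if_false, e1]
          field_simp
      rwa [this]
  calc _ ≤ _ := Set.encard_le_encard hsub
    _ ≤ _ := Set.encard_union_le _ _
    _ ≤ ((n * 2 : ℕ) + 1) + 1 := add_le_add h1 h2
    _ = _ := by push_cast; ring

/-- The number of components of diameter greater than `ρ / n`. -/
theorem encard_large_compsIn_le {n : ℕ} (hn : 1 ≤ n) {p : Poly3} (hp : p.IsHomogeneous n)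
    {ρ : ℝ} (hρ : 0 < ρ) (D : Set Sphere2) :
    {C ∈ compsIn (fun y : Sphere2 => ev p y) 0 D | ∃ x ∈ C, ∃ y ∈ C, ρ / n < dist x y}.encard ≤
      (3 * (⌊4 * n / ρ⌋₊ + 1) * (2 * n + 2) : ℕ) := by
  have hn' : (0 : ℝ) < n := by exact_mod_cast hn
  set h := ρ / (2 * n) with hh
  have h0 : 0 < h := by positivity
  set m := ⌊4 * n / ρ⌋₊ + 1
  have hsub : {C ∈ compsIn (fun y : Sphere2 => ev p y) 0 D | ∃ x ∈ C, ∃ y ∈ C, ρ / n < dist x y} ⊆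
      ⋃ ij : Fin 3 × Fin m, {C ∈ compsIn (fun y : Sphere2 => ev p y) 0 D |
        ∃ z ∈ C, (z : E3) ij.1 = -1 + ij.2 * h ∧ (-1 + (ij.2 : ℝ) * h) ^ 2 ≤ 1} := by
    rintro C ⟨hC, x, hx, y, hy, hxy⟩
    obtain ⟨i, hi⟩ : ∃ i, h < |(x : E3) i - (y : E3) i| := by
      by_contra! hcon
      have : dist x y ^ 2 ≤ 3 * h ^ 2 := by
        rw [Subtype.dist_eq, dist_eq_norm, EuclideanSpace.real_norm_sq_eq]
        calc _ ≤ ∑ i : Fin 3, h ^ 2 := Finset.sum_le_sum fun i _ =>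
              sq_le_sq' (neg_le_of_abs_le (hcon i)) (le_of_abs_le (hcon i))
          _ = _ := by simp
      have h2 : ρ / n = 2 * h := by rw [hh]; field_simp
      rw [h2] at hxy
      nlinarith
    wlog hlt : (x : E3) i < (y : E3) i generalizing x y
    · refine this y hy x hx (by rwa [dist_comm]) (by rwa [abs_sub_comm]) ?_
      refine lt_of_le_of_ne (not_lt.1 hlt) fun he => ?_
      rw [he, sub_self, abs_zero] at hi
      linarith
    rw [abs_sub_comm, abs_of_pos (by linarith)] at hi
    have hx1 := abs_le.1 ((abs_coord_le_norm (x : E3) i).trans (norm_sphere x).le)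
    have hy1 := abs_le.1 ((abs_coord_le_norm (y : E3) i).trans (norm_sphere y).le)
    set j := ⌊((y : E3) i + 1) / h⌋₊ with hj
    have hj1 : (j : ℝ) * h ≤ (y : E3) i + 1 := by
      rw [← le_div_iff₀ h0]
      exact Nat.floor_le (div_nonneg (by linarith) h0.le)
    have hj2 : (y : E3) i + 1 < (j + 1) * h := by
      rw [← div_lt_iff₀ h0]
      exact Nat.lt_floor_add_one _
    have hjm : j < m := by
      refine Nat.lt_succ_of_le (Nat.floor_le_floor ?_)
      rw [hh, div_div_eq_mul_div]
      rw [div_le_div_iff_of_pos_right hρ]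
      nlinarith
    obtain ⟨z, hz, hzi⟩ : -1 + (j : ℝ) * h ∈ (fun z : Sphere2 => (z : E3) i) '' C :=
      (isPreconnected_of_mem_compsIn hC).intermediate_value hx hy
        (f := fun z : Sphere2 => (z : E3) i) (by fun_prop) ⟨by linarith, by linarith⟩
    have hz1 := abs_le.1 ((abs_coord_le_norm (z : E3) i).trans (norm_sphere z).le)
    refine Set.mem_iUnion.2 ⟨(i, ⟨j, hjm⟩), hC, z, hz, hzi, ?_⟩
    rw [← show (z : E3) i = -1 + (j : ℝ) * h from hzi]
    nlinarith
  refine (Set.encard_le_encard hsub).trans ((Set.encard_iUnion_le_of_fintype _).trans ?_)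
  have : ∀ ij : Fin 3 × Fin m, {C ∈ compsIn (fun y : Sphere2 => ev p y) 0 D |
        ∃ z ∈ C, (z : E3) ij.1 = -1 + ij.2 * h ∧ (-1 + (ij.2 : ℝ) * h) ^ 2 ≤ 1}.encard ≤
        (2 * n + 2 : ℕ) := by
    intro ij
    by_cases hb : (-1 + (ij.2 : ℝ) * h) ^ 2 ≤ 1
    · refine (Set.encard_le_encard ?_).trans
        ((encard_compsIn_meet_circle_le hp ij.1 hb D).trans (by simp))
      rintro C ⟨hC, z, hz, hzi, -⟩
      exact ⟨hC, z, hz, hzi⟩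
    · refine (Set.encard_le_encard (t := ∅) ?_).trans (by simp)
      rintro C ⟨hC, z, hz, hzi, hb'⟩
      exact absurd hb' hb
  refine (Finset.sum_le_sum fun ij _ => this ij).trans ?_
  have hc : Fintype.card (Fin 3 × Fin m) = 3 * m := by simp
  rw [Finset.sum_const, Finset.card_univ, hc, nsmul_eq_mul]
  exact_mod_cast le_rfl

end Large

/-! ### Subharmonicity of the cube of a harmonic polynomial on a nodal cone -/

section Subharmonic

lemma exists_abs_ev_le_exp (Q : Poly3) : ∃ C : ℝ, 0 ≤ C ∧ ∃ k : ℕ, ∀ x, |ev Q x| ≤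
    C * Real.exp (k * ‖x‖) := by
  induction Q using MvPolynomial.induction_on with
  | C a => exact ⟨|a|, abs_nonneg _, 0, fun x => by simp [ev]⟩
  | add p q hp hq =>
    obtain ⟨C, hC, k, h⟩ := hp
    obtain ⟨C', hC', k', h'⟩ := hq
    refine ⟨C + C', by positivity, k + k', fun x => ?_⟩
    rw [ev_add, add_mul]
    refine (abs_add_le _ _).trans (add_le_add ((h x).trans ?_) ((h' x).trans ?_))
    · gcongr
      linarith [(Nat.cast_nonneg k' : (0 : ℝ) ≤ k')]
    · gcongr
      linarith [(Nat.cast_nonneg k : (0 : ℝ) ≤ k)]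
  | mul_X p i hp =>
    obtain ⟨C, hC, k, h⟩ := hp
    refine ⟨C, hC, k + 1, fun x => ?_⟩
    rw [ev_mul, abs_mul]
    have h1 : |ev (MvPolynomial.X i) x| ≤ Real.exp ‖x‖ := by
      have : ev (MvPolynomial.X i) x = x i := by simp [ev]
      rw [this]
      refine (abs_coord_le_norm x i).trans ?_
      linarith [Real.add_one_le_exp ‖x‖]
    calc _ ≤ C * Real.exp (k * ‖x‖) * Real.exp ‖x‖ := by gcongr; exact h x
      _ = _ := by rw [mul_assoc, ← Real.exp_add]; push_cast; ring_nf

lemma integrable_exp_norm_mul_gauss (a : ℝ) :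
    Integrable (fun x : E3 => Real.exp (a * ‖x‖) * Real.exp (-‖x‖ ^ 2 / 2)) := by
  have h := ((GaussianFourier.integrable_cexp_neg_mul_sq_norm_add (V := E3) (b := (1 / 4 : ℂ))
    (by norm_num) 0 0).norm).const_mul (Real.exp (a ^ 2))
  refine h.mono' (by fun_prop) (Filter.Eventually.of_forall fun x => ?_)
  rw [Complex.norm_exp, ← Real.exp_add, ← Real.exp_add, Real.norm_of_nonneg (Real.exp_pos _).le]
  refine Real.exp_le_exp.2 ?_
  have : ((-(1 / 4 : ℂ) * (‖x‖ : ℂ) ^ 2 + 0 * (⟪(0 : E3), x⟫ : ℂ))).re = -(1 / 4) * ‖x‖ ^ 2 := by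
    rw [zero_mul, add_zero, ← Complex.ofReal_pow]
    have : (-(1 / 4 : ℂ)) = ((-(1 / 4) : ℝ) : ℂ) := by push_cast; ring
    rw [this, ← Complex.ofReal_mul, Complex.ofReal_re]
  rw [this]
  nlinarith [sq_nonneg (‖x‖ / 2 - a)]

/-- Gaussian integration by parts. -/
lemma integral_lineDeriv_mul_gauss {h h' : E3 → ℝ} {v : E3}
    (hd : ∀ x, HasLineDerivAt ℝ h (h' x) x v)
    (h1 : Integrable fun x => h' x * Real.exp (-‖x‖ ^ 2 / 2))
    (h2 : Integrable fun x => ⟪x, v⟫ * h x * Real.exp (-‖x‖ ^ 2 / 2))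
    (h3 : Integrable fun x => h x * Real.exp (-‖x‖ ^ 2 / 2)) :
    ∫ x, h' x * Real.exp (-‖x‖ ^ 2 / 2) = ∫ x, ⟪x, v⟫ * h x * Real.exp (-‖x‖ ^ 2 / 2) := by
  have key := integral_bilinear_hasLineDerivAt_right_eq_neg_left_of_integrable
    (μ := (volume : Measure E3)) (B := ContinuousLinearMap.mul ℝ ℝ)
    (f := h) (f' := h') (g := fun x => Real.exp (-‖x‖ ^ 2 / 2))
    (g' := fun x => -⟪x, v⟫ * Real.exp (-‖x‖ ^ 2 / 2))
    (v := v) ?_ ?_ ?_ (fun x _ => hd x) (fun x _ => hasLineDerivAt_gauss x _)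
  · simp only [ContinuousLinearMap.mul_apply'] at key
    rw [← neg_eq_iff_eq_neg.2 key, ← integral_neg]
    congr 1 with x
    ring
  · simpa using h1
  · simp only [ContinuousLinearMap.mul_apply']
    refine h2.neg.congr (Filter.Eventually.of_forall fun x => ?_)
    simp; ring
  · simpa using h3

variable {F : Poly3} {K : Set E3}

lemma hasDerivAt_indicator_ev (hK : ∀ z, ev F z ≠ 0 → ∀ᶠ w in nhds z, (w ∈ K ↔ z ∈ K))
    (H : Poly3) (y v : E3) (t : ℝ) :
    HasDerivAt (fun t : ℝ => K.indicator (ev (F * F * H)) (y + t • v))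
      (∑ i, v i * K.indicator (ev (MvPolynomial.pderiv i (F * F * H))) (y + t • v)) t := by
  classical
  have hd := hasDerivAt_ev (F * F * H) y v t
  have hcont : Continuous fun t : ℝ => y + t • v := by fun_prop
  by_cases h0 : ev F (y + t • v) = 0
  · have hz : ∀ i, ev (MvPolynomial.pderiv i (F * F * H)) (y + t • v) = 0 := fun i => by
      simp [h0]
    simp only [hz, mul_zero, Finset.sum_const_zero] at hd
    have e : ∀ i, v i * K.indicator (ev (MvPolynomial.pderiv i (F * F * H))) (y + t • v) = 0 :=
      fun i => by rw [Set.indicator_apply, hz, ite_self, mul_zero]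
    rw [Finset.sum_congr rfl fun i _ => e i, Finset.sum_const_zero]
    rw [hasDerivAt_iff_isLittleO] at hd ⊢
    refine Asymptotics.IsBigO.trans_isLittleO (Asymptotics.IsBigO.of_bound 1
      (Filter.Eventually.of_forall fun t' => ?_)) hd
    have e1 : ev (F * F * H) (y + t • v) = 0 := by simp [h0]
    simp only [Set.indicator_apply, e1, ite_self, sub_zero, smul_zero, one_mul]
    split_ifs
    · exact le_rfl
    · rw [norm_zero]; exact norm_nonneg _
  · have hev := hcont.continuousAt.eventually (hK _ h0)
    by_cases hmem : y + t • v ∈ K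
    · simp only [Set.indicator_of_mem hmem]
      refine hd.congr_of_eventuallyEq ?_
      filter_upwards [hev] with t' ht'
      exact Set.indicator_of_mem (ht'.2 hmem) _
    · simp only [Set.indicator_of_notMem hmem, mul_zero, Finset.sum_const_zero]
      refine (hasDerivAt_const t (0 : ℝ)).congr_of_eventuallyEq ?_
      filter_upwards [hev] with t' ht'
      exact Set.indicator_of_notMem (fun h => hmem (ht'.1 h)) _

lemma measurable_indicator_comp (hKm : MeasurableSet K) (Q : Poly3) (q : E3) (s : ℝ) :
    Measurable fun z : E3 => K.indicator (ev Q) (q + s • z) :=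
  ((continuous_ev Q).measurable.indicator hKm).comp (by fun_prop)

lemma abs_indicator_comp_le (K : Set E3) (Q : Poly3) (q : E3) : ∃ C : ℝ, 0 ≤ C ∧ ∃ k : ℝ,
    ∀ s : ℝ, |s| ≤ 2 → ∀ z : E3, |K.indicator (ev Q) (q + s • z)| ≤ C * Real.exp (k * ‖z‖) := by
  obtain ⟨C, hC, k, h⟩ := exists_abs_ev_le_exp Q
  refine ⟨C * Real.exp (k * ‖q‖), by positivity, k * 2, fun s hs z => ?_⟩
  have h1 : ‖q + s • z‖ ≤ ‖q‖ + 2 * ‖z‖ := (norm_add_le _ _).trans (by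
    rw [norm_smul, Real.norm_eq_abs]; gcongr)
  calc |K.indicator (ev Q) (q + s • z)| ≤ |ev Q (q + s • z)| := by
        rw [← Real.norm_eq_abs, ← Real.norm_eq_abs]; exact norm_indicator_le_norm_self _ _
    _ ≤ C * Real.exp (k * (‖q‖ + 2 * ‖z‖)) := (h _).trans (by gcongr)
    _ = _ := by rw [mul_assoc, ← Real.exp_add]; ring_nf

lemma integrable_indicator_comp (hKm : MeasurableSet K) (Q : Poly3) (q : E3) {s : ℝ}
    (hs : |s| ≤ 2) :
    Integrable fun z : E3 => K.indicator (ev Q) (q + s • z) * Real.exp (-‖z‖ ^ 2 / 2) := by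
  obtain ⟨C, -, k, h⟩ := abs_indicator_comp_le K Q q
  refine ((integrable_exp_norm_mul_gauss k).const_mul C).mono'
    ((measurable_indicator_comp hKm Q q s).mul (by fun_prop)).aestronglyMeasurable
    (Filter.Eventually.of_forall fun z => ?_)
  rw [norm_mul, Real.norm_of_nonneg (Real.exp_pos _).le, ← mul_assoc]
  gcongr
  exact h s hs z

lemma integrable_coord_mul_indicator_comp (hKm : MeasurableSet K) (Q : Poly3) (q : E3) (i : Fin 3)
    {s : ℝ} (hs : |s| ≤ 2) : Integrable fun z : E3 =>
      z i * K.indicator (ev Q) (q + s • z) * Real.exp (-‖z‖ ^ 2 / 2) := by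
  obtain ⟨C, hC, k, h⟩ := abs_indicator_comp_le K Q q
  refine ((integrable_exp_norm_mul_gauss (1 + k)).const_mul C).mono'
    (((Measurable.mul (by fun_prop) (measurable_indicator_comp hKm Q q s))).mul
      (by fun_prop)).aestronglyMeasurable (Filter.Eventually.of_forall fun z => ?_)
  rw [norm_mul, norm_mul, Real.norm_of_nonneg (Real.exp_pos _).le, ← mul_assoc]
  refine mul_le_mul_of_nonneg_right ?_ (Real.exp_pos _).le
  calc |z i| * |K.indicator (ev Q) (q + s • z)| ≤ Real.exp ‖z‖ * (C * Real.exp (k * ‖z‖)) := by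
        gcongr
        · exact (abs_coord_le_norm z i).trans (by linarith [Real.add_one_le_exp ‖z‖])
        · exact h s hs z
    _ = _ := by rw [mul_left_comm, ← Real.exp_add]; ring_nf

/-- Gaussian averages of `1_K F ^ 3` are at least the value at the center. -/
theorem indicator_cube_mul_le (hKm : MeasurableSet K)
    (hK : ∀ z, ev F z ≠ 0 → ∀ᶠ w in nhds z, (w ∈ K ↔ z ∈ K)) (hF : lap F = 0)
    (hpos : ∀ z ∈ K, 0 ≤ ev F z) (q : E3) {s : ℝ} (hs0 : 0 ≤ s) (hs1 : s ≤ 1) :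
    K.indicator (ev (F * F * F)) q * ∫ z : E3, Real.exp (-‖z‖ ^ 2 / 2) ≤
      ∫ z : E3, K.indicator (ev (F * F * F)) (q + s • z) * Real.exp (-‖z‖ ^ 2 / 2) := by
  set A : ℝ → ℝ := fun s => ∫ z : E3, K.indicator (ev (F * F * F)) (q + s • z) *
    Real.exp (-‖z‖ ^ 2 / 2) with hA
  set D : Fin 3 → Poly3 := fun i => MvPolynomial.pderiv i (F * F * F) with hD
  have hDe : ∀ i, D i = F * F * (3 * MvPolynomial.pderiv i F) := fun i => by
    simp only [hD, Derivation.leibniz, smul_eq_mul]; ring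
  set A' : ℝ → ℝ := fun s => ∫ z : E3, (∑ i, z i * K.indicator (ev (D i)) (q + s • z)) *
    Real.exp (-‖z‖ ^ 2 / 2) with hA'
  have hder : ∀ s, |s| ≤ 1 → HasDerivAt A (A' s) s := by
    intro s hs
    choose C hC k h using fun i => abs_indicator_comp_le K (D i) q
    refine (hasDerivAt_integral_of_dominated_loc_of_deriv_le (μ := volume)
      (F := fun s (z : E3) => K.indicator (ev (F * F * F)) (q + s • z) * Real.exp (-‖z‖ ^ 2 / 2))
      (F' := fun s (z : E3) => (∑ i, z i * K.indicator (ev (D i)) (q + s • z)) *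
        Real.exp (-‖z‖ ^ 2 / 2))
      (bound := fun z => ∑ i, C i * (Real.exp ((1 + k i) * ‖z‖) * Real.exp (-‖z‖ ^ 2 / 2)))
      (Metric.ball_mem_nhds s one_pos) ?_ ?_ ?_ ?_ ?_ ?_).2
    · exact Filter.Eventually.of_forall fun s =>
        ((measurable_indicator_comp hKm _ q s).mul (by fun_prop)).aestronglyMeasurable
    · exact integrable_indicator_comp hKm _ q (by linarith)
    · refine (Measurable.mul (Finset.measurable_fun_sum _ fun i _ => Measurable.mul (by fun_prop)
        (measurable_indicator_comp hKm _ q s)) (by fun_prop)).aestronglyMeasurable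
    · refine Filter.Eventually.of_forall fun z s' hs' => ?_
      have hs2 : |s'| ≤ 2 := by
        have := abs_sub_abs_le_abs_sub s' s
        rw [Metric.mem_ball, Real.dist_eq] at hs'
        linarith
      rw [norm_mul, Real.norm_of_nonneg (Real.exp_pos _).le]
      simp only [← mul_assoc, ← Finset.sum_mul]
      gcongr
      refine (norm_sum_le _ _).trans (Finset.sum_le_sum fun i _ => ?_)
      rw [norm_mul]
      calc |z i| * |K.indicator (ev (D i)) (q + s' • z)|
          ≤ Real.exp ‖z‖ * (C i * Real.exp (k i * ‖z‖)) := by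
            gcongr
            · exact (abs_coord_le_norm z i).trans (by linarith [Real.add_one_le_exp ‖z‖])
            · exact h i s' hs2 z
        _ = _ := by rw [mul_left_comm, ← Real.exp_add]; ring_nf
    · exact integrable_finsetSum _ fun i _ => (integrable_exp_norm_mul_gauss _).const_mul _
    · refine Filter.Eventually.of_forall fun z s' _ => ?_
      exact (hasDerivAt_indicator_ev hK F q z s').mul_const _
  have hnonneg : ∀ s, 0 ≤ s → s ≤ 1 → 0 ≤ A' s := by
    intro s hs0 hs1
    have hs2 : |s| ≤ 2 := by rw [abs_of_nonneg hs0]; linarith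
    have hI : ∀ i, Integrable fun z : E3 =>
        (s * K.indicator (ev (MvPolynomial.pderiv i (D i))) (q + s • z)) *
          Real.exp (-‖z‖ ^ 2 / 2) := fun i => by
      simpa only [mul_assoc] using
        (integrable_indicator_comp hKm (MvPolynomial.pderiv i (D i)) q hs2).const_mul s
    have e : ∀ i, ∫ z : E3, z i * K.indicator (ev (D i)) (q + s • z) * Real.exp (-‖z‖ ^ 2 / 2) =
        ∫ z : E3, (s * K.indicator (ev (MvPolynomial.pderiv i (D i))) (q + s • z)) *
          Real.exp (-‖z‖ ^ 2 / 2) := by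
      intro i
      have ei : ∀ x : E3, ⟪x, EuclideanSpace.single i (1 : ℝ)⟫ = x i := fun x => by
        rw [EuclideanSpace.inner_single_right]; simp
      rw [integral_lineDeriv_mul_gauss (h := fun z => K.indicator (ev (D i)) (q + s • z))
        (v := EuclideanSpace.single i 1) ?_ (hI i) ?_ (integrable_indicator_comp hKm _ q hs2)]
      · refine integral_congr_ae (Filter.Eventually.of_forall fun z => ?_)
        simp only [ei]
      · intro z
        unfold HasLineDerivAt
        have h1 := hasDerivAt_indicator_ev hK (3 * MvPolynomial.pderiv i F) (q + s • z)
          (s • EuclideanSpace.single i 1) 0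
        rw [← hDe] at h1
        refine (h1.congr_deriv ?_).congr_of_eventuallyEq
          (Filter.Eventually.of_forall fun t => ?_)
        · simp only [zero_smul, add_zero, PiLp.smul_apply, smul_eq_mul]
          rw [Finset.sum_eq_single i]
          · simp
          · intro j _ hj; simp [hj]
          · simp
        · simp only [smul_add, smul_comm s t, add_assoc]
      · simpa only [ei] using integrable_coord_mul_indicator_comp hKm (D i) q i hs2
    have : A' s = ∫ z : E3, (∑ i, s * K.indicator (ev (MvPolynomial.pderiv i (D i))) (q + s • z)) *
        Real.exp (-‖z‖ ^ 2 / 2) := by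
      simp only [hA', Finset.sum_mul]
      rw [integral_finsetSum _ fun i _ => hI i, integral_finsetSum _ fun i _ =>
        integrable_coord_mul_indicator_comp hKm (D i) q i hs2]
      exact Finset.sum_congr rfl fun i _ => e i
    rw [this]
    refine integral_nonneg fun z => mul_nonneg ?_ (Real.exp_pos _).le
    rw [← Finset.mul_sum]
    refine mul_nonneg hs0 ?_
    by_cases hm : q + s • z ∈ K
    · simp only [Set.indicator_of_mem hm]
      rw [← ev_sum]
      have e2 : ∑ i, MvPolynomial.pderiv i (D i) =
          6 * F * (∑ i, MvPolynomial.pderiv i F * MvPolynomial.pderiv i F) +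
            3 * F * F * lap F := by
        rw [lap_apply, Finset.mul_sum, Finset.mul_sum, ← Finset.sum_add_distrib]
        refine Finset.sum_congr rfl fun i _ => ?_
        have h3 : MvPolynomial.pderiv i (3 : Poly3) = 0 := by
          rw [show (3 : Poly3) = MvPolynomial.C 3 from (map_ofNat MvPolynomial.C 3).symm, MvPolynomial.pderiv_C]
        rw [hDe]
        simp only [Derivation.leibniz, smul_eq_mul, h3]
        ring
      rw [e2, hF, mul_zero, add_zero, ev_mul, ev_mul, ev_sum]
      have h6 : ev (6 : Poly3) (q + s • z) = 6 := by
        rw [ev, map_ofNat]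
      rw [h6]
      refine mul_nonneg (mul_nonneg (by norm_num) (hpos _ hm)) (Finset.sum_nonneg fun i _ => ?_)
      rw [ev_mul]
      exact mul_self_nonneg _
    · simp [Set.indicator_of_notMem hm]
  have hmono : MonotoneOn A (Set.Icc 0 1) := by
    refine monotoneOn_of_deriv_nonneg (convex_Icc 0 1) (fun t ht => ?_) (fun t ht => ?_)
      fun t ht => ?_
    · exact (hder t (by rw [abs_of_nonneg ht.1]; exact ht.2)).continuousAt.continuousWithinAt
    · rw [interior_Icc] at ht
      exact (hder t (by rw [abs_of_pos ht.1]; exact ht.2.le)).differentiableAt.differentiableWithinAt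
    · rw [interior_Icc] at ht
      rw [(hder t (by rw [abs_of_pos ht.1]; exact ht.2.le)).deriv]
      exact hnonneg t ht.1.le ht.2.le
  have := hmono (Set.left_mem_Icc.2 zero_le_one) ⟨hs0, hs1⟩ hs0
  simpa only [hA, zero_smul, add_zero, integral_const_mul] using this

end Subharmonic

/-! ### Local bound for the number of components -/

section LocalCount

lemma exists_volume_lower_bound : ∃ L : ℝ, 0 ≤ L ∧ ∃ c : ℝ, 0 < c ∧ ∀ S : Set E3, MeasurableSet S →
    ∫ z : E3, Real.exp (-‖z‖ ^ 2 / 2) ≤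
      ∫ z : E3, S.indicator (fun z => Real.exp (3 * ‖z‖) * Real.exp (-‖z‖ ^ 2 / 2)) z →
    c ≤ volume.real (S ∩ Metric.closedBall 0 L) := by
  set Z := ∫ z : E3, Real.exp (-‖z‖ ^ 2 / 2) with hZ
  set G := ∫ z : E3, Real.exp (4 * ‖z‖) * Real.exp (-‖z‖ ^ 2 / 2) with hG
  have hI0 : Integrable fun z : E3 => Real.exp (-‖z‖ ^ 2 / 2) := by
    simpa using integrable_exp_norm_mul_gauss 0
  have hZ0 : 0 < Z := integral_exp_pos hI0
  have hG0 : 0 ≤ G := integral_nonneg fun z => by positivity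
  refine ⟨2 * G / Z, by positivity, Z / (2 * Real.exp 5), by positivity, fun S hS hle => ?_⟩
  set L := 2 * G / Z with hL
  have hLG : Real.exp (-L) * G ≤ Z / 2 := by
    have h1 : L ≤ Real.exp L := by linarith [Real.add_one_le_exp L]
    rw [Real.exp_neg, inv_mul_le_iff₀ (Real.exp_pos _)]
    calc G = L * (Z / 2) := by rw [hL]; field_simp
      _ ≤ _ := by gcongr
  have hBm : MeasurableSet (S ∩ Metric.closedBall (0 : E3) L) :=
    hS.inter Metric.isClosed_closedBall.measurableSet
  have hfin : volume (S ∩ Metric.closedBall (0 : E3) L) ≠ ⊤ :=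
    ((measure_mono Set.inter_subset_right).trans_lt measure_closedBall_lt_top).ne
  have hpt : ∀ z : E3, S.indicator (fun z => Real.exp (3 * ‖z‖) * Real.exp (-‖z‖ ^ 2 / 2)) z ≤
      (S ∩ Metric.closedBall (0 : E3) L).indicator (fun _ => Real.exp 5) z +
        Real.exp (-L) * (Real.exp (4 * ‖z‖) * Real.exp (-‖z‖ ^ 2 / 2)) := by
    intro z
    by_cases hz : z ∈ S
    · rw [Set.indicator_of_mem hz]
      by_cases hzL : z ∈ Metric.closedBall (0 : E3) L
      · rw [Set.indicator_of_mem (Set.mem_inter hz hzL), ← Real.exp_add]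
        have : Real.exp (3 * ‖z‖ + -‖z‖ ^ 2 / 2) ≤ Real.exp 5 :=
          Real.exp_le_exp.2 (by nlinarith [sq_nonneg (‖z‖ - 3)])
        linarith [show 0 ≤ Real.exp (-L) * (Real.exp (4 * ‖z‖) * Real.exp (-‖z‖ ^ 2 / 2)) by
          positivity]
      · rw [Set.indicator_of_notMem fun h => hzL h.2, zero_add, ← mul_assoc, ← Real.exp_add (-L)]
        rw [mem_closedBall_zero_iff, not_le] at hzL
        refine mul_le_mul_of_nonneg_right (Real.exp_le_exp.2 ?_) (Real.exp_pos _).le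
        linarith
    · rw [Set.indicator_of_notMem hz]
      exact add_nonneg (Set.indicator_nonneg (fun _ _ => (Real.exp_pos _).le) _) (by positivity)
  have hI1 := (integrable_exp_norm_mul_gauss 3).indicator hS
  have hI2 : Integrable ((S ∩ Metric.closedBall (0 : E3) L).indicator fun _ => Real.exp 5) :=
    (integrable_indicator_iff hBm).2 (integrableOn_const hfin)
  have hI3 := (integrable_exp_norm_mul_gauss 4).const_mul (Real.exp (-L))
  have h1 := integral_mono hI1 (hI2.add hI3) hpt
  rw [integral_add' hI2 hI3, integral_indicator_const _ hBm, integral_const_mul, smul_eq_mul] at h1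
  rw [div_le_iff₀ (by positivity)]
  linarith

/-- The punctured cone over a subset of the sphere. -/
def cone (C : Set Sphere2) : Set E3 := {z | z ≠ 0 ∧ nrm z ∈ C}

lemma isOpen_cone {C : Set Sphere2} (hC : IsOpen C) : IsOpen (cone C) :=
  continuousOn_nrm.isOpen_inter_preimage isOpen_ne hC

variable {n : ℕ} {p : Poly3}

lemma continuous_ev_sphere (p : Poly3) : Continuous fun y : Sphere2 => ev p y := by fun_prop

lemma eventually_mem_cone_iff (hn : 1 ≤ n) (hp : p.IsHomogeneous n) {C D : Set Sphere2}
    (hC : C ∈ compsIn (fun y : Sphere2 => ev p y) 0 D) (z : E3) (hz : ev p z ≠ 0) :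
    ∀ᶠ w in nhds z, (w ∈ cone C ↔ z ∈ cone C) := by
  have hz0 : z ≠ 0 := by
    rintro rfl
    apply hz
    have := ev_homog hp 0 0
    rwa [zero_smul, zero_pow (by omega), zero_mul] at this
  by_cases hzC : z ∈ cone C
  · filter_upwards [(isOpen_cone (isOpen_of_mem_compsIn (continuous_ev_sphere p) hC)).mem_nhds hzC]
      with w hw
    simp [hw, hzC]
  · have hcl : nrm z ∉ closure C := by
      intro hcl
      have h0 : ev p (nrm z) ≠ 0 := by
        intro h0
        rw [ev_nrm hp hz0, h0, mul_zero] at hz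
        exact hz rfl
      have hge : 0 ≤ ev p (nrm z) := by
        have : closure C ⊆ {x : Sphere2 | 0 ≤ ev p x} :=
          closure_minimal (fun x hx => by
            have := subset_of_mem_compsIn hC hx
            simp only [neg_zero] at this
            exact le_of_lt (α := ℝ) this)
          (isClosed_le continuous_const (continuous_ev_sphere p))
        exact this hcl
      exact hzC ⟨hz0, mem_of_mem_closure_of_mem_compsIn (continuous_ev_sphere p) hC hcl
        (by simpa using lt_of_le_of_ne hge h0.symm)⟩
    have h1 := continuousOn_nrm.continuousAt (isOpen_ne.mem_nhds hz0)
    filter_upwards [h1.eventually (isClosed_closure.isOpen_compl.mem_nhds hcl)] with w hw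
    exact iff_of_false (fun h => hw (subset_closure h.2)) hzC

/-- A component occupies a definite volume at scale `1 / n` around one of its points. -/
theorem exists_volume_cone : ∃ L : ℝ, 0 ≤ L ∧ ∃ c : ℝ, 0 < c ∧ ∀ {n : ℕ} {p : Poly3}, 1 ≤ n →
    p ∈ sphHarm n → ∀ {C D : Set Sphere2}, C ∈ compsIn (fun y : Sphere2 => ev p y) 0 D →
    ∃ q ∈ C, c ≤ volume.real
      ({z : E3 | (q : E3) + (n : ℝ)⁻¹ • z ∈ cone C} ∩ Metric.closedBall 0 L) := by
  obtain ⟨L, hL, c, hc, h⟩ := exists_volume_lower_bound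
  refine ⟨L, hL, c, hc, fun {n p} hn hp C D hC => ?_⟩
  obtain ⟨hph, hpl⟩ := mem_sphHarm.1 hp
  have hn' : (0 : ℝ) < n := by exact_mod_cast hn
  have hCpos : ∀ x ∈ C, 0 < ev p x := fun x hx => by
    simpa using subset_of_mem_compsIn hC hx
  obtain ⟨x0, hx0⟩ : C.Nonempty := by
    obtain ⟨-, x0, -, hx0, -⟩ := hC
    exact ⟨x0, hx0⟩
  obtain ⟨q, hq, hmax⟩ := (isClosed_closure (s := C)).isCompact.exists_isMaxOn
    ⟨x0, subset_closure hx0⟩ (continuous_ev_sphere p).continuousOn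
  have hq0 : 0 < ev p q := (hCpos x0 hx0).trans_le (hmax (subset_closure hx0))
  have hqC : q ∈ C := mem_of_mem_closure_of_mem_compsIn (continuous_ev_sphere p) hC hq
    (by simpa using hq0)
  refine ⟨q, hqC, ?_⟩
  have hopen := isOpen_cone (isOpen_of_mem_compsIn (continuous_ev_sphere p) hC)
  have hcont : Continuous fun z : E3 => (q : E3) + (n : ℝ)⁻¹ • z := by fun_prop
  have hS : MeasurableSet {z : E3 | (q : E3) + (n : ℝ)⁻¹ • z ∈ cone C} :=
    (hopen.preimage hcont).measurableSet
  refine h _ hS ?_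
  have hconepos : ∀ z ∈ cone C, 0 ≤ ev p z := fun z hz => by
    rw [ev_nrm hph hz.1]
    exact mul_nonneg (by positivity) (hCpos _ hz.2).le
  have hn1 : (n : ℝ)⁻¹ ≤ 1 := inv_le_one_of_one_le₀ (by exact_mod_cast hn)
  have key := indicator_cube_mul_le hopen.measurableSet
    (fun z hz => eventually_mem_cone_iff hn hph hC z hz) hpl hconepos (q : E3)
    (inv_nonneg.2 hn'.le) hn1
  have hq1 : (q : E3) ∈ cone C := by
    refine ⟨fun h => ?_, by rwa [nrm_coe]⟩
    have := norm_sphere q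
    rw [h, norm_zero] at this
    exact zero_ne_one this
  rw [Set.indicator_of_mem hq1] at key
  have hM : 0 < ev (p * p * p) q := by simp only [ev_mul]; positivity
  refine le_of_mul_le_mul_left (key.trans ?_) hM
  rw [← integral_const_mul]
  refine integral_mono (integrable_indicator_comp hopen.measurableSet _ _
    (by rw [abs_of_pos (inv_pos.2 hn')]; linarith))
    (((integrable_exp_norm_mul_gauss 3).indicator hS).const_mul _) fun z => ?_
  by_cases hz : (q : E3) + (n : ℝ)⁻¹ • z ∈ cone C
  · have hz' : z ∈ {z : E3 | (q : E3) + (n : ℝ)⁻¹ • z ∈ cone C} := hz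
    simp only [Set.indicator_of_mem hz, Set.indicator_of_mem hz']
    rw [← mul_assoc]
    refine mul_le_mul_of_nonneg_right ?_ (Real.exp_pos _).le
    have h1 : ev p ((q : E3) + (n : ℝ)⁻¹ • z) ≤ Real.exp ‖z‖ * ev p q := by
      rw [ev_nrm hph hz.1]
      refine mul_le_mul ?_ (hmax (subset_closure hz.2)) (hCpos _ hz.2).le (Real.exp_pos _).le
      have h2 : ‖(q : E3) + (n : ℝ)⁻¹ • z‖ ≤ Real.exp ((n : ℝ)⁻¹ * ‖z‖) := by
        refine (norm_add_le _ _).trans ?_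
        rw [norm_sphere, norm_smul, Real.norm_of_nonneg (by positivity)]
        linarith [Real.add_one_le_exp ((n : ℝ)⁻¹ * ‖z‖)]
      refine (pow_le_pow_left₀ (norm_nonneg _) h2 n).trans (le_of_eq ?_)
      rw [← Real.exp_nat_mul]
      congr 1
      field_simp
    have h0 := hconepos _ hz
    have h3 : ev (p * p * p) ((q : E3) + (n : ℝ)⁻¹ • z) =
      ev p ((q : E3) + (n : ℝ)⁻¹ • z) ^ 3 := by simp only [ev_mul]; ring
    rw [h3]
    refine (pow_le_pow_left₀ h0 h1 3).trans (le_of_eq ?_)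
    rw [mul_pow, ← Real.exp_nat_mul]
    simp only [ev_mul]
    push_cast
    ring
  · have hz' : z ∉ {z : E3 | (q : E3) + (n : ℝ)⁻¹ • z ∈ cone C} := hz
    simp only [Set.indicator_of_notMem hz, Set.indicator_of_notMem hz', zero_mul, mul_zero, le_refl]

/-- The number of components in a disc of radius `R / n` is bounded in terms of `R` only. -/
theorem exists_encard_compsIn_le : ∃ T : ℝ → ℕ, ∀ {n : ℕ} {p : Poly3}, 1 ≤ n → p ∈ sphHarm n →
    ∀ (R : ℝ) (x : Sphere2),
      (compsIn (fun y : Sphere2 => ev p y) 0 (Metric.closedBall x (R / n))).encard ≤ T R := by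
  obtain ⟨L, hL, c, hc, h⟩ := exists_volume_cone
  refine ⟨fun R => ⌊volume.real (Metric.closedBall (0 : E3) (L + R)) / c⌋₊,
    fun {n p} hn hp R x => ?_⟩
  have hn' : (0 : ℝ) < n := by exact_mod_cast hn
  set B := Metric.closedBall (0 : E3) (L + R)
  by_contra! hlt
  obtain ⟨t, hts, ht⟩ := Set.exists_subset_encard_eq (Order.add_one_le_of_lt hlt)
  have htf : t.Finite := Set.finite_of_encard_eq_coe (k := ⌊volume.real B / c⌋₊ + 1)
    (by rw [ht]; rfl)
  lift t to Finset (Set Sphere2) using htf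
  have htc : t.card = ⌊volume.real B / c⌋₊ + 1 := by
    rw [Set.encard_coe_eq_coe_finsetCard] at ht
    exact_mod_cast ht
  let S : Set Sphere2 → Set E3 := fun C => {z : E3 | (x : E3) + (n : ℝ)⁻¹ • z ∈ cone C} ∩ B
  have hcont : Continuous fun z : E3 => (x : E3) + (n : ℝ)⁻¹ • z := by fun_prop
  have hSm : ∀ C ∈ t, MeasurableSet (S C) := fun C hC =>
    (((isOpen_cone (isOpen_of_mem_compsIn (continuous_ev_sphere p) (hts hC))).preimage
      hcont).measurableSet).inter Metric.isClosed_closedBall.measurableSet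
  have hBfin : volume B ≠ ⊤ := measure_closedBall_lt_top.ne
  have hSc : ∀ C ∈ t, c ≤ volume.real (S C) := by
    intro C hC
    obtain ⟨q, hqC, hq⟩ := h hn hp (hts hC)
    refine hq.trans ?_
    set v : E3 := (n : ℝ) • ((q : E3) - x)
    have hv : ‖v‖ ≤ R := by
      have := (hts hC).1 hqC
      rw [Metric.mem_closedBall, Subtype.dist_eq, dist_eq_norm, le_div_iff₀ hn'] at this
      rw [norm_smul, Real.norm_of_nonneg hn'.le, mul_comm]
      exact this
    have hpre : volume.real ((fun z : E3 => z + v) ⁻¹' S C) = volume.real (S C) := by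
      simp only [Measure.real, measure_preimage_add_right]
    rw [← hpre]
    refine measureReal_mono ?_ ?_
    · rintro z ⟨hz, hzL⟩
      refine ⟨?_, ?_⟩
      · have e : (x : E3) + (n : ℝ)⁻¹ • (z + v) = (q : E3) + (n : ℝ)⁻¹ • z := by
          simp only [v, smul_add, smul_smul, inv_mul_cancel₀ hn'.ne', one_smul]
          abel
        show (x : E3) + (n : ℝ)⁻¹ • (z + v) ∈ cone C
        rwa [e]
      · rw [mem_closedBall_zero_iff] at hzL ⊢
        exact (norm_add_le _ _).trans (add_le_add hzL hv)
    · rw [measure_preimage_add_right]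
      exact ((measure_mono Set.inter_subset_right).trans_lt hBfin.lt_top).ne
  have hdisj : (t : Set (Set Sphere2)).PairwiseDisjoint S := by
    intro C hC C' hC' hne
    refine Set.disjoint_left.2 fun z hz hz' => hne ?_
    exact compsIn_eq_of_mem (hts hC) (hts hC') hz.1.2 hz'.1.2
  have h1 : ∑ C ∈ t, volume.real (S C) ≤ volume.real B := by
    rw [← measureReal_biUnion_finset hdisj hSm fun C _ =>
      ((measure_mono Set.inter_subset_right).trans_lt hBfin.lt_top).ne]
    exact measureReal_mono (Set.iUnion₂_subset fun C _ => Set.inter_subset_right) hBfin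
  have h2 : (t.card : ℝ) * c ≤ volume.real B := by
    refine le_trans ?_ h1
    rw [← nsmul_eq_mul]
    exact Finset.card_nsmul_le_sum _ _ _ hSc
  rw [← le_div_iff₀ hc, htc] at h2
  push_cast at h2
  linarith [Nat.lt_floor_add_one (volume.real B / c)]

lemma finite_compsIn_zero (hn : 1 ≤ n) (hp : p ∈ sphHarm n) (D : Set Sphere2) :
    (compsIn (fun y : Sphere2 => ev p y) 0 D).Finite := by
  obtain ⟨T, hT⟩ := exists_encard_compsIn_le
  have hn' : (n : ℝ) ≠ 0 := by positivity
  obtain ⟨x⟩ : Nonempty Sphere2 := inferInstance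
  refine Set.Finite.subset (Set.finite_of_encard_le_coe (hT hn hp (2 * n) x))
    (compsIn_mono_set _ _ fun y _ => ?_)
  rw [Metric.mem_closedBall, mul_div_assoc, div_self hn', mul_one, Subtype.dist_eq, dist_eq_norm]
  refine (norm_sub_le _ _).trans ?_
  rw [norm_sphere, norm_sphere]
  norm_num

end LocalCount

/-! ### The averaged cap count -/

section CapMeasurability

lemma measurableSet_le_encard_compsIn {X : Type*} [MetricSpace X] [MeasurableSpace X]
    [BorelSpace X] {f : X → ℝ} {s : ℝ} (hfin : (compsIn f s Set.univ).Finite) (k : ℕ∞) (r : ℝ) :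
    MeasurableSet {x : X | k ≤ (compsIn f s (Metric.closedBall x r)).encard} := by
  have : {x : X | k ≤ (compsIn f s (Metric.closedBall x r)).encard} =
      ⋃ G ∈ {G : Set (Set X) | G ⊆ compsIn f s Set.univ ∧ k ≤ G.encard},
        ⋂ C ∈ G, ⋂ y ∈ C, Metric.closedBall y r := by
    ext x
    simp only [Set.mem_ofPred_eq, Set.mem_iUnion, Set.mem_iInter, exists_prop]
    constructor
    · intro h
      refine ⟨_, ⟨compsIn_mono_set f s (Set.subset_univ _), h⟩, fun C hC y hy => ?_⟩
      exact Metric.mem_closedBall_comm.1 (hC.1 hy)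
    · rintro ⟨G, ⟨hG, hk⟩, h⟩
      refine hk.trans (Set.encard_le_encard fun C hC => ⟨fun y hy => ?_, (hG hC).2⟩)
      exact Metric.mem_closedBall_comm.1 (h C hC y hy)
  rw [this]
  refine Set.Finite.measurableSet_biUnion (hfin.finite_subsets.subset fun G hG => hG.1)
    fun G _ => IsClosed.measurableSet ?_
  exact isClosed_biInter fun C _ => isClosed_biInter fun y _ => Metric.isClosed_closedBall

lemma measurable_compLevel_closedBall {X : Type*} [MetricSpace X] [LocallyConnectedSpace X]
    [MeasurableSpace X] [BorelSpace X] {f : X → ℝ} (hf : Continuous f)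
    (hfin : ∀ s, 0 ≤ s → (compsIn f s Set.univ).Finite) (s₀ : ℝ) (k : ℕ) (r : ℝ) :
    Measurable fun x : X => compLevel s₀ k f (Metric.closedBall x r) := by
  refine measurable_of_Ioi fun a => ?_
  rcases lt_or_ge a 0 with ha | ha
  · have : (fun x : X => compLevel s₀ k f (Metric.closedBall x r)) ⁻¹' Set.Ioi a = Set.univ :=
      Set.eq_univ_of_forall fun x => ha.trans_le (compLevel_nonneg _ _ _ _)
    rw [this]
    exact MeasurableSet.univ
  · have : (fun x : X => compLevel s₀ k f (Metric.closedBall x r)) ⁻¹' Set.Ioi a =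
        ⋃ q ∈ {q : ℚ | a < q ∧ (q : ℝ) ≤ s₀},
          {x : X | (k : ℕ∞) ≤ (compsIn f q (Metric.closedBall x r)).encard} := by
      ext x
      simp only [Set.mem_preimage, Set.mem_Ioi, Set.mem_iUnion, Set.mem_ofPred_eq, exists_prop]
      constructor
      · intro h
        by_cases hs₀ : 0 ≤ s₀
        · obtain ⟨s, ⟨h0, hs, hk⟩, has⟩ := exists_lt_of_lt_csSup
            (⟨0, le_rfl, hs₀, Or.inl rfl⟩ : Set.Nonempty {s : ℝ | 0 ≤ s ∧ s ≤ s₀ ∧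
              (s = 0 ∨ (k : ℕ∞) ≤ (compsIn f s (Metric.closedBall x r)).encard)}) h
          obtain ⟨q, hq1, hq2⟩ := exists_rat_btwn has
          refine ⟨q, ⟨hq1, hq2.le.trans hs⟩, ?_⟩
          rcases hk with rfl | hk
          · linarith
          · exact hk.trans (encard_compsIn_antitone hf (ha.trans hq1.le) hq2.le
              Metric.isClosed_closedBall)
        · exfalso
          have : compLevel s₀ k f (Metric.closedBall x r) = 0 := by
            unfold compLevel
            convert Real.sSup_empty
            refine Set.eq_empty_of_forall_notMem fun s hs => hs₀ (hs.1.trans hs.2.1)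
          rw [this] at h
          exact absurd h (not_lt.2 ha)
      · rintro ⟨q, ⟨hq1, hq2⟩, hk⟩
        exact hq1.trans_le (le_csSup (bddAbove_compLevel s₀ k f _)
          ⟨ha.trans hq1.le, hq2, Or.inr hk⟩)
    rw [this]
    refine MeasurableSet.biUnion (Set.to_countable _) fun q hq => ?_
    exact measurableSet_le_encard_compsIn (hfin q (ha.trans hq.1.le)) _ _

end CapMeasurability

/-- The soft count of positive components of `p` in the cap of radius `R / n` about `x`. -/
noncomputable def capCount (n : ℕ) (R : ℝ) (T : ℕ) (s : ℝ) (p : Poly3) (x : Sphere2) : ℝ :=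
  softCount T s (fun y : Sphere2 => ev p y) (Metric.closedBall x (R / n))

/-- The mean of `capCount` over the sphere. -/
noncomputable def meanCapCount (n : ℕ) (R : ℝ) (T : ℕ) (s : ℝ) (p : Poly3) : ℝ :=
  ∫ x, capCount n R T s p x ∂sphMeasure

section CapCount

variable {n : ℕ} {R s : ℝ} {T : ℕ} {p q : Poly3}

lemma finite_compsIn (hn : 1 ≤ n) (hp : p ∈ sphHarm n) (hs : 0 ≤ s) (D : Set Sphere2) :
    (compsIn (fun y : Sphere2 => ev p y) s D).Finite := by
  have h := finite_compsIn_zero hn hp Set.univ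
  refine Set.Finite.subset ?_ (compsIn_mono_set _ s (Set.subset_univ D))
  rw [← Set.encard_lt_top_iff] at h ⊢
  exact (encard_compsIn_antitone (continuous_ev_sphere p) le_rfl hs isClosed_univ).trans_lt h

lemma measurable_capCount (hn : 1 ≤ n) (hp : p ∈ sphHarm n) (R : ℝ) (T : ℕ) (s : ℝ) :
    Measurable (capCount n R T s p) := by
  unfold capCount softCount
  exact Finset.measurable_fun_sum _ fun k _ => (measurable_compLevel_closedBall
    (continuous_ev_sphere p) (fun s hs => finite_compsIn hn hp hs _) _ _ _).div_const _

lemma capCount_nonneg (hs : 0 < s) (n : ℕ) (R : ℝ) (T : ℕ) (p : Poly3) (x : Sphere2) :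
    0 ≤ capCount n R T s p x := softCount_nonneg T hs _ _

lemma capCount_le (hs : 0 < s) (n : ℕ) (R : ℝ) (T : ℕ) (p : Poly3) (x : Sphere2) :
    capCount n R T s p x ≤ T := softCount_le T hs _ _

lemma integrable_capCount (hn : 1 ≤ n) (hp : p ∈ sphHarm n) (hs : 0 < s) (R : ℝ) (T : ℕ) :
    Integrable (capCount n R T s p) sphMeasure := by
  refine Integrable.of_bound (measurable_capCount hn hp R T s).aestronglyMeasurable T
    (Filter.Eventually.of_forall fun x => ?_)
  rw [Real.norm_eq_abs, abs_of_nonneg (capCount_nonneg hs _ _ _ _ _)]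
  exact capCount_le hs _ _ _ _ _

lemma meanCapCount_nonneg (hs : 0 < s) (n : ℕ) (R : ℝ) (T : ℕ) (p : Poly3) :
    0 ≤ meanCapCount n R T s p := integral_nonneg fun x => capCount_nonneg hs n R T p x

lemma meanCapCount_le (hn : 1 ≤ n) (hp : p ∈ sphHarm n) (hs : 0 < s) (R : ℝ) (T : ℕ) :
    meanCapCount n R T s p ≤ T := by
  refine (integral_mono (integrable_capCount hn hp hs R T) (integrable_const (T : ℝ))
    fun x => capCount_le hs n R T p x).trans (by simp)

lemma abs_capCount_sub_le {A : ℝ} (hs : 0 < s) (hR : 0 ≤ R) (hRA : R ≤ A) (T : ℕ)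
    (hpq : p - q ∈ sphHarm n) (x : Sphere2) :
    |capCount n R T s p x - capCount n R T s q x| ≤ T / s * locNorm n A (p - q) x := by
  refine abs_softCount_sub_le T hs (continuous_ev_sphere p) (continuous_ev_sphere q)
    Metric.isClosed_closedBall (locNorm_nonneg n (hR.trans hRA) _ _) fun y hy => ?_
  have := abs_ev_le_locNorm (A := A) hpq (x := (x : E3)) (y := (y : E3)) (by
    rw [Metric.mem_closedBall, Subtype.dist_eq, dist_eq_norm] at hy
    exact hy.trans (by gcongr))
  simpa using this

namespace HarmModel

variable {d : ℕ} (H : HarmModel n d)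

lemma abs_ev_sub_le_norm (ξ η : EuclideanSpace ℝ (Fin d)) (y : Sphere2) :
    |ev (H.Φ ξ) y - ev (H.Φ η) y| ≤ ‖ξ - η‖ := by
  rw [H.ev_eq_inner, H.ev_eq_inner, ← inner_sub_left]
  refine (abs_real_inner_le_norm _ _).trans ?_
  rw [H.norm_feat (norm_sphere y), mul_one]

lemma abs_capCount_sub_le_norm (hs : 0 < s) (R : ℝ) (T : ℕ) (ξ η : EuclideanSpace ℝ (Fin d))
    (x : Sphere2) : |capCount n R T s (H.Φ ξ) x - capCount n R T s (H.Φ η) x| ≤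
      T / s * ‖ξ - η‖ :=
  abs_softCount_sub_le T hs (continuous_ev_sphere _) (continuous_ev_sphere _)
    Metric.isClosed_closedBall (norm_nonneg _) fun y _ => H.abs_ev_sub_le_norm ξ η y

lemma continuous_capCount (hs : 0 < s) (R : ℝ) (T : ℕ) (x : Sphere2) :
    Continuous fun ξ => capCount n R T s (H.Φ ξ) x := by
  have : LipschitzWith (Real.toNNReal (T / s)) fun ξ => capCount n R T s (H.Φ ξ) x := by
    refine LipschitzWith.of_dist_le_mul fun ξ η => ?_
    rw [Real.dist_eq, dist_eq_norm, Real.coe_toNNReal _ (by positivity)]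
    exact H.abs_capCount_sub_le_norm hs R T ξ η x
  exact this.continuous

lemma integrable_capCount_prod (hn : 1 ≤ n) (hs : 0 < s) (R : ℝ) (T : ℕ)
    (γ : Measure (EuclideanSpace ℝ (Fin d))) [IsProbabilityMeasure γ] :
    Integrable (fun z : EuclideanSpace ℝ (Fin d) × Sphere2 => capCount n R T s (H.Φ z.1) z.2)
      (γ.prod sphMeasure) := by
  have hm : StronglyMeasurable (Function.uncurry fun (ξ : EuclideanSpace ℝ (Fin d))
      (x : Sphere2) => capCount n R T s (H.Φ ξ) x) :=
    stronglyMeasurable_uncurry_of_continuous_of_stronglyMeasurable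
      (fun x => H.continuous_capCount hs R T x)
      (fun ξ => (measurable_capCount hn (H.mem ξ) R T s).stronglyMeasurable)
  refine Integrable.of_bound hm.aestronglyMeasurable T (Filter.Eventually.of_forall fun z => ?_)
  rw [Real.norm_eq_abs]
  exact (abs_of_nonneg (capCount_nonneg hs _ _ _ _ _)).le.trans (capCount_le hs _ _ _ _ _)

lemma integral_meanCapCount (hn : 1 ≤ n) (hs : 0 < s) (R : ℝ) (T : ℕ)
    (γ : Measure (EuclideanSpace ℝ (Fin d))) [IsProbabilityMeasure γ] :
    ∫ ξ, meanCapCount n R T s (H.Φ ξ) ∂γ =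
      ∫ x, ∫ ξ, capCount n R T s (H.Φ ξ) x ∂γ ∂sphMeasure :=
  integral_integral_swap (H.integrable_capCount_prod hn hs R T γ)

lemma abs_meanCapCount_sub_le (hn : 1 ≤ n) (hs : 0 < s) (hR : 0 ≤ R) (T : ℕ)
    (ξ η : EuclideanSpace ℝ (Fin d)) :
    |meanCapCount n R T s (H.Φ ξ) - meanCapCount n R T s (H.Φ η)| ≤
      T / s * Real.exp (12 * R) * (‖ξ - η‖ / √(2 * n + 1)) := by
  unfold meanCapCount
  rw [← integral_sub (integrable_capCount hn (H.mem ξ) hs R T)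
    (integrable_capCount hn (H.mem η) hs R T), ← H.sqrt_savg_eq]
  have hmem : H.Φ ξ - H.Φ η ∈ sphHarm n := Submodule.sub_mem _ (H.mem ξ) (H.mem η)
  have hc := continuous_locNorm n R (H.Φ ξ - H.Φ η)
  rw [← Real.norm_eq_abs]
  refine (norm_integral_le_of_norm_le (integrable_sphere
    (h := fun x : Sphere2 => T / s * locNorm n R (H.Φ ξ - H.Φ η) x) (by fun_prop))
    (Filter.Eventually.of_forall fun x => abs_capCount_sub_le hs hR le_rfl T hmem x)).trans ?_
  rw [integral_const_mul, mul_assoc, map_sub]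
  gcongr
  rw [← map_sub] at hmem ⊢
  exact integral_locNorm_le hn hR hmem

lemma lipschitzWith_meanCapCount (hn : 1 ≤ n) (hs : 0 < s) (hR : 0 ≤ R) (T : ℕ) :
    LipschitzWith (Real.toNNReal (T / s * Real.exp (12 * R) / √(2 * n + 1)))
      fun ξ => meanCapCount n R T s (H.Φ ξ) := by
  refine LipschitzWith.of_dist_le_mul fun ξ η => ?_
  rw [Real.dist_eq, dist_eq_norm, Real.coe_toNNReal _ (by positivity)]
  exact (H.abs_meanCapCount_sub_le hn hs hR T ξ η).trans (by rw [mul_div_assoc', mul_div_right_comm])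

end HarmModel

end CapCount

/-! ### Comparing the number of components with the averaged cap count -/

/-- The number of connected components of `{0 < p}` on the sphere. -/
noncomputable def posCount (p : Poly3) : ℕ := (compsIn (fun y : Sphere2 => ev p y) 0 Set.univ).ncard

section Sandwich

variable {n : ℕ} {R s : ℝ} {T : ℕ} {p : Poly3}

lemma nonempty_of_mem_compsIn {X : Type*} [TopologicalSpace X] {f : X → ℝ} {s : ℝ} {D C : Set X}
    (hC : C ∈ compsIn f s D) : C.Nonempty := by
  obtain ⟨-, p, -, hp, -⟩ := hC
  exact ⟨p, hp⟩

lemma exists_point_selector (X : Type*) [Nonempty X] :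
    ∃ pt : Set X → X, ∀ C : Set X, C.Nonempty → pt C ∈ C := by
  classical
  refine ⟨fun C => if h : C.Nonempty then h.some else Classical.arbitrary X, fun C hC => ?_⟩
  simp only [dif_pos hC]
  exact hC.some_mem

lemma integral_sum_indicator_closedBall {ι : Type*} (G : Finset ι) (y : ι → Sphere2) (r : ℝ) :
    Integrable (fun x => ∑ i ∈ G, (Metric.closedBall (y i) r).indicator (fun _ => (1 : ℝ)) x)
      sphMeasure ∧
    ∫ x, ∑ i ∈ G, (Metric.closedBall (y i) r).indicator (fun _ => (1 : ℝ)) x ∂sphMeasure =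
      ∑ i ∈ G, sphMeasure.real (Metric.closedBall (y i) r) := by
  have hi : ∀ i ∈ G, Integrable ((Metric.closedBall (y i) r).indicator (fun _ => (1 : ℝ)))
      sphMeasure := fun i _ =>
    (integrable_const (1 : ℝ)).indicator Metric.isClosed_closedBall.measurableSet
  refine ⟨integrable_finsetSum G hi, ?_⟩
  rw [integral_finsetSum G hi]
  refine Finset.sum_congr rfl fun i _ => ?_
  rw [integral_indicator_const _ Metric.isClosed_closedBall.measurableSet]
  simp

theorem meanCapCount_le_posCount (hn : 1 ≤ n) (hp : p ∈ sphHarm n) (hs : 0 < s) (hR : 0 ≤ R)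
    (T : ℕ) : meanCapCount n R T s p ≤ posCount p * ((R / n) ^ 2 / 4) := by
  classical
  obtain ⟨pt, hpt⟩ := exists_point_selector Sphere2
  have hfin := finite_compsIn_zero hn hp Set.univ
  set G := hfin.toFinset with hG
  obtain ⟨h1, h2⟩ := integral_sum_indicator_closedBall G pt (R / n)
  have hcard : posCount p = G.card := Set.ncard_eq_toFinset_card _ hfin
  calc meanCapCount n R T s p
      ≤ ∫ x, ∑ C ∈ G, (Metric.closedBall (pt C) (R / n)).indicator (fun _ => (1 : ℝ)) x
          ∂sphMeasure := by
        refine integral_mono (integrable_capCount hn hp hs R T) h1 fun x => ?_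
        have hcnt : (compsIn (fun y : Sphere2 => ev p y) 0 (Metric.closedBall x (R / n))).encard ≤
            ((G.filter fun C => pt C ∈ Metric.closedBall x (R / n)).card : ℕ) := by
          rw [← Set.encard_coe_eq_coe_finsetCard]
          refine Set.encard_le_encard fun C hC => ?_
          rw [Finset.coe_filter]
          exact ⟨hfin.mem_toFinset.2 (compsIn_mono_set _ _ (Set.subset_univ _) hC),
            hC.1 (hpt C (nonempty_of_mem_compsIn hC))⟩
        refine (softCount_le_of_encard_le T hs (continuous_ev_sphere p)
          Metric.isClosed_closedBall hcnt).trans (le_of_eq ?_)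
        rw [Finset.card_filter, Nat.cast_sum]
        refine Finset.sum_congr rfl fun C _ => ?_
        rw [Set.indicator_apply, Metric.mem_closedBall_comm]
        simp
    _ = ∑ C ∈ G, sphMeasure.real (Metric.closedBall (pt C) (R / n)) := h2
    _ ≤ ∑ C ∈ G, (R / n) ^ 2 / 4 :=
        Finset.sum_le_sum fun C _ => sphMeasure_closedBall_le _ (by positivity)
    _ = _ := by rw [Finset.sum_const, nsmul_eq_mul, hcard]

theorem posCount_le (hn : 1 ≤ n) (hp : p ∈ sphHarm n) {ρ : ℝ} (hρ : 0 < ρ) (hR : 0 < R)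
    (hRn : R ≤ 2 * n) {g : Sphere2 → ℝ} (hg : Integrable g sphMeasure)
    (h : ∀ x (m : ℕ), (m : ℕ∞) ≤ (compsIn (fun y : Sphere2 => ev p y) 0
      (Metric.closedBall x ((R + ρ) / n))).encard → (m : ℝ) ≤ g x) :
    (posCount p : ℝ) ≤ 3 * (4 * n / ρ + 1) * (2 * n + 2) +
      4 * n ^ 2 / R ^ 2 * ∫ x, g x ∂sphMeasure := by
  classical
  have hn' : (0 : ℝ) < n := by exact_mod_cast hn
  obtain ⟨pt, hpt⟩ := exists_point_selector Sphere2
  have hfin := finite_compsIn_zero hn hp Set.univ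
  set G := hfin.toFinset with hG
  have hmem : ∀ {C}, C ∈ G ↔ C ∈ compsIn (fun y : Sphere2 => ev p y) 0 Set.univ :=
    hfin.mem_toFinset
  have hcard : posCount p = G.card := Set.ncard_eq_toFinset_card _ hfin
  set big : Set Sphere2 → Prop := fun C => ∃ x ∈ C, ∃ y ∈ C, ρ / n < dist x y with hbig
  have hlarge : (G.filter big).card ≤ 3 * (⌊4 * n / ρ⌋₊ + 1) * (2 * n + 2) := by
    have h3 := encard_large_compsIn_le hn (mem_sphHarm.1 hp).1 hρ Set.univ
    have h4 : ((G.filter big : Finset (Set Sphere2)) : Set (Set Sphere2)).encard ≤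
        (3 * (⌊4 * n / ρ⌋₊ + 1) * (2 * n + 2) : ℕ) := by
      refine le_trans (Set.encard_le_encard fun C hC => ?_) h3
      rw [Finset.coe_filter] at hC
      exact ⟨hmem.1 hC.1, hC.2⟩
    rw [Set.encard_coe_eq_coe_finsetCard] at h4
    exact_mod_cast h4
  have hlarge' : ((G.filter big).card : ℝ) ≤ 3 * (4 * n / ρ + 1) * (2 * n + 2) := by
    calc ((G.filter big).card : ℝ) ≤ (3 * (⌊4 * n / ρ⌋₊ + 1) * (2 * n + 2) : ℕ) := by
          exact_mod_cast hlarge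
      _ = 3 * ((⌊4 * n / ρ⌋₊ : ℝ) + 1) * (2 * n + 2) := by push_cast; ring
      _ ≤ _ := by
          gcongr
          exact Nat.floor_le (by positivity)
  set S := G.filter fun C => ¬ big C with hS
  obtain ⟨h1, h2⟩ := integral_sum_indicator_closedBall S pt (R / n)
  have hsmall : (S.card : ℝ) * ((R / n) ^ 2 / 4) ≤ ∫ x, g x ∂sphMeasure := by
    calc (S.card : ℝ) * ((R / n) ^ 2 / 4)
        = ∑ C ∈ S, sphMeasure.real (Metric.closedBall (pt C) (R / n)) := by
          rw [← nsmul_eq_mul, ← Finset.sum_const]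
          refine Finset.sum_congr rfl fun C _ => ?_
          rw [sphMeasure_closedBall _ (by positivity)]
          rw [div_le_iff₀ hn']
          exact hRn
      _ = ∫ x, ∑ C ∈ S, (Metric.closedBall (pt C) (R / n)).indicator (fun _ => (1 : ℝ)) x
          ∂sphMeasure := h2.symm
      _ ≤ _ := by
          refine integral_mono h1 hg fun x => ?_
          have hsum : ∑ C ∈ S, (Metric.closedBall (pt C) (R / n)).indicator (fun _ => (1 : ℝ)) x =
              ((S.filter fun C => pt C ∈ Metric.closedBall x (R / n)).card : ℝ) := by
            rw [Finset.card_filter, Nat.cast_sum]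
            refine Finset.sum_congr rfl fun C _ => ?_
            rw [Set.indicator_apply, Metric.mem_closedBall_comm]
            simp
          refine hsum.le.trans (h x _ ?_)
          rw [← Set.encard_coe_eq_coe_finsetCard]
          refine Set.encard_le_encard fun C hC => ?_
          rw [Finset.coe_filter] at hC
          obtain ⟨hCS, hCx⟩ := hC
          rw [hS, Finset.mem_filter] at hCS
          have hCG := hmem.1 hCS.1
          refine ⟨fun y hy => ?_, hCG.2⟩
          have hsm := hCS.2
          simp only [hbig, not_exists, not_and, not_lt] at hsm
          have := hsm y hy (pt C) (hpt C (nonempty_of_mem_compsIn hCG))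
          rw [Metric.mem_closedBall] at hCx ⊢
          calc dist y x ≤ dist y (pt C) + dist (pt C) x := dist_triangle _ _ _
            _ ≤ ρ / n + R / n := add_le_add this hCx
            _ = (R + ρ) / n := by ring
  have htot : (posCount p : ℝ) = (G.filter big).card + S.card := by
    rw [hcard, ← Finset.card_filter_add_card_filter_not (s := G) big]
    push_cast
    rfl
  have : (S.card : ℝ) ≤ 4 * n ^ 2 / R ^ 2 * ∫ x, g x ∂sphMeasure := by
    rw [div_mul_eq_mul_div, le_div_iff₀ (by positivity)]
    have := mul_le_mul_of_nonneg_left hsmall (by positivity : (0 : ℝ) ≤ 4 * n ^ 2)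
    calc (S.card : ℝ) * R ^ 2 = 4 * n ^ 2 * ((S.card : ℝ) * ((R / n) ^ 2 / 4)) := by field_simp
      _ ≤ _ := this
  rw [htot]
  exact add_le_add hlarge' this

theorem posCount_le_meanCapCount (hn : 1 ≤ n) (hp : p ∈ sphHarm n) {ρ δ L : ℝ} (hρ : 0 < ρ)
    (hR : 0 < R) (hRn : R ≤ 2 * n)
    (hT : ∀ x : Sphere2, (compsIn (fun y : Sphere2 => ev p y) 0
      (Metric.closedBall x ((R + ρ) / n))).encard ≤ T)
    (hδ0 : 0 < δ) (hδ1 : δ ≤ 1) (hL : 1 ≤ L) (hs0 : 0 < s) (hs : s < δ ^ 2 / (144 * L)) :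
    (posCount p : ℝ) ≤ 3 * (4 * n / ρ + 1) * (2 * n + 2) +
      4 * n ^ 2 / R ^ 2 * (meanCapCount n (R + ρ + 1) T s p +
        T * unstab n ((R + ρ + 2) ^ 2 / δ ^ 2) ((4 + 9 * L) * δ ^ 2) ((1 + 9 * L) * δ)
          (R + ρ + 2) L p) := by
  obtain ⟨hc1, hc2⟩ := integral_chi_le (n := n) (p := p) hn (R := R + ρ) (δ := δ)
    (a := (4 + 9 * L) * δ ^ 2) (b := (1 + 9 * L) * δ) (A := R + ρ + 2) (L := L)
    (by positivity) hδ0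
  have hi := integrable_capCount hn hp hs0 (R + ρ + 1) T
  refine (posCount_le hn hp hρ hR hRn (hi.add (hc1.const_mul (T : ℝ))) fun x m hm => ?_).trans ?_
  · have hmT : m ≤ T := by exact_mod_cast hm.trans (hT x)
    have hchi := chi_nonneg (n := n) (R := R + ρ) (δ := δ) (a := (4 + 9 * L) * δ ^ 2)
      (b := (1 + 9 * L) * δ) (A := R + ρ + 2) (L := L) (p := p) (by positivity) (by linarith) x
    have hcap := capCount_nonneg hs0 n (R + ρ + 1) T p x
    simp only [Pi.add_apply]
    rcases compsIn_stable_or_one_le_chi hn hp (R := R + ρ) (by positivity) hδ0 hδ1 hL hs0 hs x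
      with h | h
    · have := le_softCount hmT hs0 (hm.trans h)
      unfold capCount
      nlinarith [mul_nonneg (Nat.cast_nonneg (α := ℝ) T) hchi]
    · have : (m : ℝ) ≤ T := by exact_mod_cast hmT
      nlinarith [mul_le_mul_of_nonneg_left h (Nat.cast_nonneg (α := ℝ) T)]
  · gcongr
    simp only [Pi.add_apply]
    rw [integral_add hi (hc1.const_mul _), integral_const_mul]
    exact add_le_add le_rfl (mul_le_mul_of_nonneg_left hc2 (Nat.cast_nonneg _))

theorem exists_posCount_le : ∃ C : ℝ, 0 < C ∧ ∀ {n : ℕ} {p : Poly3}, 1 ≤ n → p ∈ sphHarm n →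
    (posCount p : ℝ) ≤ C * n ^ 2 := by
  obtain ⟨T, hT⟩ := exists_encard_compsIn_le
  refine ⟨60 + 4 * T (1 + 1), by positivity, fun {n p} hn hp => ?_⟩
  have hn1 : (1 : ℝ) ≤ n := by exact_mod_cast hn
  have := posCount_le hn hp (R := 1) one_pos one_pos (by linarith)
    (integrable_const (T (1 + 1) : ℝ)) fun x m hm => by exact_mod_cast hm.trans (hT hn hp _ x)
  refine this.trans ?_
  simp only [integral_const, probReal_univ, smul_eq_mul, one_mul, one_pow, div_one]
  nlinarith

end Sandwich

/-! ### Concentration of the number of components in the harmonic model -/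

section ModelConcentration

lemma exists_concentration_rate {C t : ℝ} (hC : 0 < C) (ht : 0 < t) :
    ∃ c : ℝ, 0 < c ∧ ∀ (n d : ℕ) (f : EuclideanSpace ℝ (Fin d) → ℝ),
      (∀ ξ η, |f ξ - f η| ≤ C * (‖ξ - η‖ / √(2 * n + 1))) →
      (stdGaussian (EuclideanSpace ℝ (Fin d))).real
        {ξ | t ≤ |f ξ - ∫ η, f η ∂stdGaussian (EuclideanSpace ℝ (Fin d))|} ≤
          2 * Real.exp (-c * n) := by
  have hpi := Real.pi_pos
  refine ⟨t ^ 2 / ((Real.pi / 2) ^ 2 * C ^ 2), by positivity, fun n d f hf => ?_⟩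
  have hL : LipschitzWith (Real.toNNReal (C / √(2 * n + 1))) f := by
    refine LipschitzWith.of_dist_le_mul fun ξ η => ?_
    rw [Real.dist_eq, dist_eq_norm, Real.coe_toNNReal _ (by positivity)]
    exact (hf ξ η).trans (by rw [mul_div_assoc', mul_div_right_comm])
  refine (gaussian_lipschitz_concentration hL ht.le).trans ?_
  rw [Real.coe_toNNReal _ (by positivity)]
  refine mul_le_mul_of_nonneg_left (Real.exp_le_exp.2 ?_) zero_le_two
  have h : (Real.pi / 2 * (C / √(2 * n + 1))) ^ 2 = (Real.pi / 2) ^ 2 * C ^ 2 / (2 * n + 1) := by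
    rw [mul_pow, div_pow C, Real.sq_sqrt (by positivity), mul_div_assoc']
  rw [h, show -t ^ 2 / (2 * ((Real.pi / 2) ^ 2 * C ^ 2 / (2 * n + 1))) =
    -(t ^ 2 / ((Real.pi / 2) ^ 2 * C ^ 2)) * (n + 1 / 2) by field_simp]
  have : 0 ≤ t ^ 2 / ((Real.pi / 2) ^ 2 * C ^ 2) := by positivity
  nlinarith

set_option maxHeartbeats 1000000 in
/-- For fixed parameters the normalized count is exponentially concentrated around the
normalized expected cap count. -/
theorem exists_posCount_concentration {ε : ℝ} (hε : 0 < ε) :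
    ∃ R : ℝ, 0 < R ∧ ∃ (T : ℕ) (s : ℝ), 0 < s ∧ ∃ c : ℝ, 0 < c ∧ ∃ n₀ : ℕ, 1 ≤ n₀ ∧
      ∀ (n d : ℕ) (H : HarmModel n d), n₀ ≤ n →
        (stdGaussian (EuclideanSpace ℝ (Fin d))).real
          {ξ | ε < |(posCount (H.Φ ξ) : ℝ) / n ^ 2 - 4 / R ^ 2 *
            ∫ η, meanCapCount n R T s (H.Φ η) ∂stdGaussian (EuclideanSpace ℝ (Fin d))|} ≤
        4 * Real.exp (-c * n) := by
  obtain ⟨C₀, hC₀, hcount⟩ := exists_posCount_le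
  obtain ⟨Tl, hTl⟩ := exists_encard_compsIn_le
  obtain ⟨ρ, hρ, hρε⟩ : ∃ ρ : ℝ, 0 < ρ ∧ 48 / ρ = ε / 6 :=
    ⟨288 / ε, by positivity, by field_simp; norm_num⟩
  obtain ⟨R, hR, hRε⟩ : ∃ R : ℝ, 0 < R ∧ (((R + ρ + 1) / R) ^ 2 - 1) * C₀ ≤ ε / 6 := by
    refine ⟨(ρ + 1) * (1 + 18 * C₀ / ε), by positivity, ?_⟩
    set R := (ρ + 1) * (1 + 18 * C₀ / ε) with hRdef
    have hR : 0 < R := by positivity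
    have h1 : (R + ρ + 1) / R = 1 + (ρ + 1) / R := by field_simp; ring
    have h2 : (ρ + 1) / R = 1 / (1 + 18 * C₀ / ε) := by rw [hRdef]; field_simp
    have h3 : 1 / (1 + 18 * C₀ / ε) ≤ 1 := by
      rw [div_le_one (by positivity)]
      have : 0 ≤ 18 * C₀ / ε := by positivity
      linarith
    have h4 : 3 * (1 / (1 + 18 * C₀ / ε)) * C₀ ≤ ε / 6 := by
      rw [show 3 * (1 / (1 + 18 * C₀ / ε)) * C₀ = 3 * C₀ / (1 + 18 * C₀ / ε) by ring,
        div_le_iff₀ (by positivity)]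
      have : ε / 6 * (18 * C₀ / ε) = 3 * C₀ := by field_simp; norm_num
      nlinarith
    rw [h1, h2]
    refine le_trans (mul_le_mul_of_nonneg_right ?_ hC₀.le) h4
    have : 0 ≤ 1 / (1 + 18 * C₀ / ε) := by positivity
    nlinarith
  obtain ⟨T, hT⟩ : ∃ m : ℕ, m = Tl (R + ρ) := ⟨_, rfl⟩
  obtain ⟨A, hA⟩ : ∃ x : ℝ, x = R + ρ + 2 := ⟨_, rfl⟩
  have hApos : 0 < A := by rw [hA]; positivity
  obtain ⟨L, hL, hLε⟩ : ∃ L : ℝ, 1 ≤ L ∧ 4 * T / R ^ 2 * (Real.exp (12 * A) / L) ≤ ε / 12 := by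
    refine ⟨1 + 4 * T / R ^ 2 * Real.exp (12 * A) * 12 / ε, ?_, ?_⟩
    · have : 0 ≤ 4 * T / R ^ 2 * Real.exp (12 * A) * 12 / ε := by positivity
      linarith
    · rw [mul_div_assoc', div_le_iff₀ (by positivity), mul_add (ε / 12), mul_one]
      have : ε / 12 * (4 * T / R ^ 2 * Real.exp (12 * A) * 12 / ε) =
        4 * T / R ^ 2 * Real.exp (12 * A) := by field_simp
      rw [this]
      linarith
  obtain ⟨δ, hδ0, hδ1, hδε⟩ : ∃ δ : ℝ, 0 < δ ∧ δ ≤ 1 ∧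
      4 * T / R ^ 2 * (32 * A ^ 2 * (4 + 9 * L) * (1 + 9 * L) * δ) ≤ ε / 12 := by
    set B := 4 * T / R ^ 2 * (32 * A ^ 2 * (4 + 9 * L) * (1 + 9 * L)) * 12 / ε with hB
    have hB0 : 0 ≤ B := by positivity
    refine ⟨1 / (1 + B), by positivity, ?_, ?_⟩
    · rw [div_le_one (by positivity)]
      linarith
    · have : 4 * T / R ^ 2 * (32 * A ^ 2 * (4 + 9 * L) * (1 + 9 * L) * (1 / (1 + B))) =
          (ε / 12 * B) / (1 + B) := by
        rw [hB]
        field_simp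
      rw [this, div_le_iff₀ (by positivity)]
      nlinarith
  obtain ⟨a, ha⟩ : ∃ x : ℝ, x = (4 + 9 * L) * δ ^ 2 := ⟨_, rfl⟩
  obtain ⟨b, hb⟩ : ∃ x : ℝ, x = (1 + 9 * L) * δ := ⟨_, rfl⟩
  obtain ⟨c₁, hc₁⟩ : ∃ x : ℝ, x = A ^ 2 / δ ^ 2 := ⟨_, rfl⟩
  have ha0 : 0 < a := by rw [ha]; positivity
  have hb0 : 0 < b := by rw [hb]; positivity
  have hc₁0 : 0 < c₁ := by rw [hc₁]; positivity
  obtain ⟨s, hs⟩ : ∃ x : ℝ, x = δ ^ 2 / (288 * L) := ⟨_, rfl⟩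
  have hs0 : 0 < s := by rw [hs]; positivity
  have hs1 : s < δ ^ 2 / (144 * L) := by
    rw [hs]
    refine div_lt_div_of_pos_left (by positivity) (by positivity) (by linarith)
  obtain ⟨R₁, hR₁⟩ : ∃ x : ℝ, x = R + ρ + 1 := ⟨_, rfl⟩
  rw [← hR₁] at hRε
  have hR₁0 : 0 < R₁ := by rw [hR₁]; positivity
  obtain ⟨tS, htS, htSε⟩ : ∃ t : ℝ, 0 < t ∧ 4 / R₁ ^ 2 * t = ε / 6 :=
    ⟨ε / 6 * (R₁ ^ 2 / 4), by positivity, by field_simp⟩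
  obtain ⟨tX, htX, htXε⟩ : ∃ t : ℝ, 0 < t ∧ 4 * T / R ^ 2 * t ≤ ε / 6 := by
    refine ⟨ε / 6 * (R ^ 2 / (4 * (T + 1))), by positivity, ?_⟩
    have : 4 * T / R ^ 2 * (ε / 6 * (R ^ 2 / (4 * (T + 1)))) = ε / 6 * (T / (T + 1)) := by
      field_simp
    rw [this]
    refine mul_le_of_le_one_right (by positivity) ?_
    rw [div_le_one (by positivity)]
    linarith
  obtain ⟨cS, hcS, hcS'⟩ := exists_concentration_rate
    (C := T / s * Real.exp (12 * R₁) + 1) (t := tS) (by positivity) htS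
  obtain ⟨cX, hcX, hcX'⟩ := exists_concentration_rate
    (C := c₁ * (1 / a + 3 / b) + Real.exp (12 * A) / L) (t := tX) (by positivity) htX
  obtain ⟨n₀, hn₀⟩ := exists_nat_ge (max R (72 / ε))
  refine ⟨R₁, hR₁0, T, s, hs0, min cS cX, lt_min hcS hcX, n₀ + 1, by omega, fun n d H hn => ?_⟩
  have hn1 : 1 ≤ n := by omega
  have hn' : (0 : ℝ) < n := by exact_mod_cast hn1
  have hnn : (n₀ : ℝ) ≤ n := by exact_mod_cast (by omega : n₀ ≤ n)
  have hnR : R ≤ n := (le_max_left _ _).trans (hn₀.trans hnn)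
  have hnε : 12 / (n : ℝ) ≤ ε / 6 := by
    have : 72 / ε ≤ n := (le_max_right _ _).trans (hn₀.trans hnn)
    rw [div_le_iff₀ hε] at this
    rw [div_le_iff₀ hn']
    linarith
  set γ := stdGaussian (EuclideanSpace ℝ (Fin d)) with hγ
  set S : EuclideanSpace ℝ (Fin d) → ℝ := fun ξ => meanCapCount n R₁ T s (H.Φ ξ) with hS
  set X : EuclideanSpace ℝ (Fin d) → ℝ := fun ξ => unstab n c₁ a b A L (H.Φ ξ) with hX
  have hPS := hcS' n d S fun ξ η => (H.abs_meanCapCount_sub_le hn1 hs0 hR₁0.le T ξ η).trans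
    (mul_le_mul_of_nonneg_right (by linarith) (by positivity))
  have hPX := hcX' n d X fun ξ η => H.abs_unstab_sub_le hn1 hc₁0.le ha0 hb0 hApos.le
    (by linarith) ξ η
  have hEX : ∫ η, X η ∂γ ≤ c₁ * (32 * a * b) + Real.exp (12 * A) / L :=
    H.integral_unstab_le hn1 hc₁0.le ha0 hb0 hApos.le (by linarith)
  have hsub : {ξ | ε < |(posCount (H.Φ ξ) : ℝ) / n ^ 2 - 4 / R₁ ^ 2 * ∫ η, S η ∂γ|} ⊆
      {ξ | tS ≤ |S ξ - ∫ η, S η ∂γ|} ∪ {ξ | tX ≤ |X ξ - ∫ η, X η ∂γ|} := by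
    intro ξ hξ
    by_contra hcon
    simp only [Set.mem_union, Set.mem_ofPred_eq, not_or, not_le] at hcon
    obtain ⟨h1, h2⟩ := hcon
    refine absurd hξ ?_
    simp only [Set.mem_ofPred_eq, not_lt]
    obtain ⟨h1a, h1b⟩ := abs_lt.1 h1
    obtain ⟨h2a, h2b⟩ := abs_lt.1 h2
    have hlow := meanCapCount_le_posCount (R := R₁) hn1 (H.mem ξ) hs0 hR₁0.le T
    have hup := posCount_le_meanCapCount (T := T) hn1 (H.mem ξ) hρ hR (by linarith)
      (fun x => hT ▸ hTl hn1 (H.mem ξ) _ x) hδ0 hδ1 hL hs0 hs1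
    have hC := hcount hn1 (H.mem ξ)
    set N : ℝ := (posCount (H.Φ ξ) : ℝ) with hN
    change S ξ ≤ _ at hlow
    rw [← hA, ← ha, ← hb, ← hc₁, ← hR₁] at hup
    change N ≤ _ + 4 * n ^ 2 / R ^ 2 * (S ξ + T * X ξ) at hup
    have hlow' : 4 / R₁ ^ 2 * S ξ ≤ N / n ^ 2 := by
      rw [div_mul_eq_mul_div, div_le_div_iff₀ (by positivity) (by positivity)]
      have := mul_le_mul_of_nonneg_left hlow (by positivity : (0 : ℝ) ≤ 4 * n ^ 2)
      have e : 4 * (n : ℝ) ^ 2 * (N * ((R₁ / n) ^ 2 / 4)) = N * R₁ ^ 2 := by field_simp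
      linarith
    have hC' : N / n ^ 2 ≤ C₀ := by
      rw [div_le_iff₀ (by positivity)]
      exact hC
    have hup' : N / n ^ 2 ≤ 48 / ρ + 12 / n + 4 / R ^ 2 * (S ξ + T * X ξ) := by
      rw [div_le_iff₀ (by positivity)]
      refine hup.trans ?_
      have hn1' : (1 : ℝ) ≤ n := by exact_mod_cast hn1
      have e1 : (48 / ρ + 12 / n + 4 / R ^ 2 * (S ξ + T * X ξ)) * (n : ℝ) ^ 2 =
          12 * (4 * n / ρ + 1) * n + 4 * n ^ 2 / R ^ 2 * (S ξ + T * X ξ) := by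
        field_simp
        ring
      rw [e1]
      have e2 : 0 ≤ 4 * n / ρ + 1 := by positivity
      linarith [mul_nonneg e2 (sub_nonneg.2 hn1')]
    have hSR : 4 / R ^ 2 * S ξ ≤ 4 / R₁ ^ 2 * S ξ + ε / 6 := by
      have e : 4 / R ^ 2 * S ξ = 4 / R₁ ^ 2 * S ξ + ((R₁ / R) ^ 2 - 1) * (4 / R₁ ^ 2 * S ξ) := by
        field_simp
        ring
      rw [e]
      have e3 : 0 ≤ (R₁ / R) ^ 2 - 1 := by
        have : 1 ≤ R₁ / R := by
          rw [one_le_div hR]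
          linarith
        nlinarith
      linarith [mul_le_mul_of_nonneg_left (hlow'.trans hC') e3]
    have hXR : 4 / R ^ 2 * (T * X ξ) ≤ ε / 6 + (ε / 12 + ε / 12) := by
      have e4 : X ξ ≤ tX + (32 * A ^ 2 * (4 + 9 * L) * (1 + 9 * L) * δ + Real.exp (12 * A) / L) := by
        have : c₁ * (32 * a * b) = 32 * A ^ 2 * (4 + 9 * L) * (1 + 9 * L) * δ := by
          rw [hc₁, ha, hb]
          field_simp
        linarith
      have := mul_le_mul_of_nonneg_left e4 (by positivity : 0 ≤ 4 * T / R ^ 2)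
      rw [mul_add, mul_add] at this
      have e5 : 4 / R ^ 2 * (T * X ξ) = 4 * T / R ^ 2 * X ξ := by ring
      linarith
    have hp4 : 0 ≤ 4 / R₁ ^ 2 := by positivity
    have h5 := mul_le_mul_of_nonneg_left h1a.le hp4
    have h6 := mul_le_mul_of_nonneg_left h1b.le hp4
    rw [mul_neg, mul_sub] at h5
    rw [mul_sub] at h6
    rw [mul_add] at hup'
    rw [abs_le]
    constructor <;> linarith
  refine (measureReal_mono hsub).trans ((measureReal_union_le _ _).trans ?_)
  have m1 : Real.exp (-cS * n) ≤ Real.exp (-min cS cX * n) :=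
    Real.exp_le_exp.2 (by nlinarith [min_le_left cS cX])
  have m2 : Real.exp (-cX * n) ≤ Real.exp (-min cS cX * n) :=
    Real.exp_le_exp.2 (by nlinarith [min_le_right cS cX])
  linarith

end ModelConcentration

/-! ### Stereographic charts of spherical caps -/

/-- The Euclidean plane. -/
abbrev E2 := EuclideanSpace ℝ (Fin 2)

/-- The inverse stereographic chart centred at `x`, rescaled by `c`. -/
noncomputable def capChart (c : ℝ) (x : Sphere2) (u : E2) : Sphere2 :=
  (stereographic' 2 (-x)).symm (c • u)

section CapChart

variable (c : ℝ) (x : Sphere2)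

lemma exists_capChart_eq : ∃ ι : E2 →ₗᵢ[ℝ] E3, (∀ u, ⟪ι u, (x : E3)⟫ = 0) ∧
    ∀ u, (capChart c x u : E3) =
      (4 + c ^ 2 * ‖u‖ ^ 2)⁻¹ • ((4 * c) • ι u + (4 - c ^ 2 * ‖u‖ ^ 2) • (x : E3)) := by
  set U : (ℝ ∙ ((-x : Sphere2) : E3))ᗮ ≃ₗᵢ[ℝ] E2 :=
    (OrthonormalBasis.fromOrthogonalSpanSingleton (𝕜 := ℝ) 2
      (ne_zero_of_mem_unit_sphere (-x))).repr with hU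
  refine ⟨(Submodule.subtypeₗᵢ _).comp U.symm.toLinearIsometry, fun u => ?_, fun u => ?_⟩
  · have h := (U.symm u).2
    rw [Submodule.mem_orthogonal_singleton_iff_inner_left] at h
    have h' : ⟪((U.symm u : (ℝ ∙ ((-x : Sphere2) : E3))ᗮ) : E3), -(x : E3)⟫ = 0 := h
    rw [inner_neg_right, neg_eq_zero] at h'
    exact h'
  · have h := stereographic'_symm_apply (n := 2) (-x) (c • u)
    have hn : ‖(U.symm (c • u) : E3)‖ ^ 2 = c ^ 2 * ‖u‖ ^ 2 := by
      rw [Submodule.norm_coe, LinearIsometryEquiv.norm_map, norm_smul, mul_pow, Real.norm_eq_abs,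
        sq_abs]
    change (capChart c x u : E3) = _ at h
    rw [h]
    change (‖(U.symm (c • u) : E3)‖ ^ 2 + 4)⁻¹ • (4 : ℝ) • (U.symm (c • u) : E3) +
      (‖(U.symm (c • u) : E3)‖ ^ 2 + 4)⁻¹ • (‖(U.symm (c • u) : E3)‖ ^ 2 - 4) • (-(x : E3)) = _
    rw [← smul_add, hn, map_smul, Submodule.coe_smul, smul_smul, smul_neg, ← neg_smul, add_comm _ (4 : ℝ),
      neg_sub]
    rfl

lemma inner_capChart (u v : E2) : ⟪(capChart c x u : E3), (capChart c x v : E3)⟫ =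
    1 - 8 * c ^ 2 * ‖u - v‖ ^ 2 / ((4 + c ^ 2 * ‖u‖ ^ 2) * (4 + c ^ 2 * ‖v‖ ^ 2)) := by
  obtain ⟨ι, h0, h⟩ := exists_capChart_eq c x
  have h0' : ∀ u, ⟪(x : E3), ι u⟫ = 0 := fun u => by rw [real_inner_comm]; exact h0 u
  have hu : 0 < 4 + c ^ 2 * ‖u‖ ^ 2 := by positivity
  have hv : 0 < 4 + c ^ 2 * ‖v‖ ^ 2 := by positivity
  have hxx : ⟪(x : E3), (x : E3)⟫ = 1 := by
    rw [real_inner_self_eq_norm_sq, norm_sphere, one_pow]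
  rw [h, h, real_inner_smul_left, real_inner_smul_right, inner_add_left, inner_add_right,
    inner_add_right]
  simp only [real_inner_smul_left, real_inner_smul_right, h0, h0', hxx, LinearIsometry.inner_map_map]
  rw [@norm_sub_sq_real]
  field_simp
  ring

lemma capChart_zero : capChart c x 0 = x := by
  obtain ⟨ι, h0, h⟩ := exists_capChart_eq c x
  ext1
  rw [h]
  simp [smul_smul]

lemma dist_capChart_sq (u v : E2) : dist (capChart c x u) (capChart c x v) ^ 2 =
    16 * c ^ 2 * ‖u - v‖ ^ 2 / ((4 + c ^ 2 * ‖u‖ ^ 2) * (4 + c ^ 2 * ‖v‖ ^ 2)) := by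
  rw [Subtype.dist_eq, dist_eq_norm, @norm_sub_sq_real, inner_capChart, norm_sphere, norm_sphere]
  ring

lemma dist_capChart_le (hc : 0 ≤ c) (u v : E2) :
    dist (capChart c x u) (capChart c x v) ≤ c * ‖u - v‖ := by
  refine abs_le_of_sq_le_sq' ?_ (by positivity) |>.2
  rw [dist_capChart_sq, div_le_iff₀ (by positivity), mul_pow]
  have h1 : 16 ≤ (4 + c ^ 2 * ‖u‖ ^ 2) * (4 + c ^ 2 * ‖v‖ ^ 2) := by
    have : 0 ≤ c ^ 2 * ‖u‖ ^ 2 := by positivity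
    have : 0 ≤ c ^ 2 * ‖v‖ ^ 2 := by positivity
    nlinarith
  nlinarith [mul_le_mul_of_nonneg_left h1 (by positivity : 0 ≤ c ^ 2 * ‖u - v‖ ^ 2)]

variable {c}

lemma isOpenEmbedding_capChart (hc : c ≠ 0) : Topology.IsOpenEmbedding (capChart c x) := by
  have h1 : Topology.IsOpenEmbedding (stereographic' 2 (-x)).symm :=
    (stereographic' 2 (-x)).symm.isOpenEmbedding (by simp)
  exact h1.comp (Homeomorph.smulOfNeZero c hc).isOpenEmbedding

lemma range_capChart (hc : c ≠ 0) : Set.range (capChart c x) = {-x}ᶜ := by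
  have h2 : Set.range (stereographic' 2 (-x)).symm = {-x}ᶜ := by
    rw [← Set.image_univ, ← stereographic'_target (n := 2) (-x),
      ← stereographic'_source (n := 2) (-x)]
    exact (stereographic' 2 (-x)).symm_image_target_eq_source
  rw [← h2]
  exact (Homeomorph.smulOfNeZero c hc).surjective.range_comp _

/-- The scale for which the cap of radius `R / n` corresponds to the disc of radius `R`. -/
noncomputable def capScale (n : ℕ) (R : ℝ) : ℝ := 2 / √(4 * n ^ 2 - R ^ 2)

lemma capScale_pos {n : ℕ} {R : ℝ} (hR : 0 ≤ R) (hn : R < 2 * n) : 0 < capScale n R := by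
  have : 0 < 4 * (n : ℝ) ^ 2 - R ^ 2 := by nlinarith
  unfold capScale
  positivity

lemma capScale_sq {n : ℕ} {R : ℝ} (hR : 0 ≤ R) (hn : R < 2 * n) :
    capScale n R ^ 2 = 4 / (4 * n ^ 2 - R ^ 2) := by
  have : 0 < 4 * (n : ℝ) ^ 2 - R ^ 2 := by nlinarith
  rw [capScale, div_pow, Real.sq_sqrt this.le]
  norm_num

lemma capChart_preimage_closedBall {n : ℕ} {R : ℝ} (hR : 0 ≤ R) (hn : R < 2 * n) :
    capChart (capScale n R) x ⁻¹' Metric.closedBall x (R / n) = Metric.closedBall 0 R := by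
  have hn0 : (0 : ℝ) < n := by linarith
  have hk : 0 < 4 * (n : ℝ) ^ 2 - R ^ 2 := by nlinarith
  ext u
  rw [Set.mem_preimage, Metric.mem_closedBall, mem_closedBall_zero_iff]
  have h := dist_capChart_sq (capScale n R) x u 0
  rw [capChart_zero, capScale_sq hR hn, sub_zero, norm_zero] at h
  have h2 : dist (capChart (capScale n R) x u) x ^ 2 =
      4 * ‖u‖ ^ 2 / (4 * n ^ 2 - R ^ 2 + ‖u‖ ^ 2) := by
    rw [h]
    field_simp
    ring
  rw [← abs_of_nonneg (dist_nonneg (x := capChart (capScale n R) x u) (y := x)),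
    ← abs_of_nonneg (by positivity : 0 ≤ R / n), ← sq_le_sq, h2, div_pow,
    div_le_div_iff₀ (by positivity) (by positivity)]
  rw [← abs_of_nonneg (norm_nonneg u), ← abs_of_nonneg hR, ← sq_le_sq, abs_of_nonneg (norm_nonneg u),
    abs_of_nonneg hR]
  constructor <;> intro h <;> nlinarith

lemma closedBall_subset_range_capChart {n : ℕ} {R : ℝ} (hR : 0 ≤ R) (hn : R < 2 * n) :
    Metric.closedBall x (R / n) ⊆ Set.range (capChart (capScale n R) x) := by
  have hn0 : (0 : ℝ) < n := by linarith
  rw [range_capChart x (capScale_pos hR hn).ne']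
  intro y hy h
  rw [Set.mem_singleton_iff] at h
  rw [h, Metric.mem_closedBall, Subtype.dist_eq, dist_eq_norm] at hy
  have : ((-x : Sphere2) : E3) - x = (-2 : ℝ) • (x : E3) := by
    change -(x : E3) - x = _
    module
  rw [this, norm_smul, norm_sphere, le_div_iff₀ hn0] at hy
  norm_num at hy
  linarith

lemma softCount_comp {X Y : Type*} [TopologicalSpace X] [TopologicalSpace Y] (T : ℕ) (s₀ : ℝ)
    {f : Y → ℝ} {D : Set Y} {f' : X → ℝ} {D' : Set X}
    (h : ∀ s, (compsIn f' s D').encard = (compsIn f s D).encard) :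
    softCount T s₀ f' D' = softCount T s₀ f D := by
  simp only [softCount, compLevel, h]

lemma capCount_eq_capChart {n : ℕ} {R s : ℝ} {p : Poly3} (hR : 0 ≤ R) (hn : R < 2 * n) (T : ℕ) :
    capCount n R T s p x =
      softCount T s (fun u => ev p (capChart (capScale n R) x u)) (Metric.closedBall 0 R) := by
  unfold capCount
  refine (softCount_comp T s fun s => ?_).symm
  rw [← capChart_preimage_closedBall x hR hn]
  exact encard_compsIn_comp (continuous_ev_sphere p)
    (isOpenEmbedding_capChart x (capScale_pos hR hn).ne') Metric.isClosed_closedBall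
    (closedBall_subset_range_capChart x hR hn)

lemma tendsto_natCast_sq_mul_capScale_sq {R : ℝ} (hR : 0 ≤ R) :
    Filter.Tendsto (fun n : ℕ => (n : ℝ) ^ 2 * capScale n R ^ 2) Filter.atTop (nhds 1) := by
  have h1 : Filter.Tendsto (fun n : ℕ => 1 + R ^ 2 / (4 * (n : ℝ) ^ 2 - R ^ 2)) Filter.atTop
      (nhds (1 + 0)) := by
    refine tendsto_const_nhds.add (Filter.Tendsto.div_atTop tendsto_const_nhds ?_)
    refine Filter.tendsto_atTop_add_const_right _ (-R ^ 2) ?_ |>.congr fun n => by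
      rw [← sub_eq_add_neg]
    exact Filter.Tendsto.const_mul_atTop (by norm_num)
      ((Filter.tendsto_pow_atTop two_ne_zero).comp tendsto_natCast_atTop_atTop)
  rw [add_zero] at h1
  refine h1.congr' ?_
  obtain ⟨N, hN⟩ := exists_nat_gt R
  filter_upwards [Filter.eventually_ge_atTop (N + 1)] with n hn
  have hn' : R < 2 * n := by
    have : ((N + 1 : ℕ) : ℝ) ≤ n := by exact_mod_cast hn
    push_cast at this
    linarith
  have hk : 0 < 4 * (n : ℝ) ^ 2 - R ^ 2 := by nlinarith
  rw [capScale_sq hR hn']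
  field_simp
  ring

lemma tendsto_capScale {R : ℝ} (hR : 0 ≤ R) :
    Filter.Tendsto (fun n : ℕ => capScale n R ^ 2) Filter.atTop (nhds 0) := by
  have h1 : Filter.Tendsto (fun n : ℕ => (n : ℝ) ^ 2 * capScale n R ^ 2 * (1 / (n : ℝ)) ^ 2)
      Filter.atTop (nhds (1 * 0 ^ 2)) :=
    (tendsto_natCast_sq_mul_capScale_sq hR).mul (tendsto_one_div_atTop_nhds_zero_nat.pow 2)
  rw [show (1 : ℝ) * 0 ^ 2 = 0 by norm_num] at h1
  refine h1.congr' ?_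
  filter_upwards [Filter.eventually_ge_atTop 1] with n hn
  have : (n : ℝ) ≠ 0 := by positivity
  field_simp

end CapChart

/-! ### Interpolation from a finite net -/

lemma exists_partition_subordinate {W : Type*} [PseudoMetricSpace W] {D : Set W} (hD : IsCompact D)
    {δ : ℝ} (hδ : 0 < δ) : ∃ (m : ℕ) (g : Fin m → W) (φ : Fin m → W → ℝ), (∀ i, g i ∈ D) ∧
      (∀ i, Continuous (φ i)) ∧ (∀ i w, 0 ≤ φ i w) ∧ (∀ w ∈ D, ∑ i, φ i w = 1) ∧
      ∀ i w, φ i w ≠ 0 → dist w (g i) < δ := by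
  obtain ⟨t, htD, htf, ht⟩ := hD.finite_cover_balls (half_pos hδ)
  obtain ⟨m, g, -, rfl⟩ := htf.fin_param
  obtain ⟨b, hb⟩ : ∃ b : Fin m → W → ℝ, b = fun i w => max 0 (δ - dist w (g i)) := ⟨_, rfl⟩
  have hb0 : ∀ i w, 0 ≤ b i w := fun i w => by rw [hb]; exact le_max_left _ _
  have hbc : ∀ i, Continuous (b i) := fun i => by rw [hb]; fun_prop
  refine ⟨m, g, fun i w => b i w / max (δ / 2) (∑ j, b j w), fun i => htD ⟨i, rfl⟩, fun i => ?_,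
    fun i w => div_nonneg (hb0 i w) (by positivity), fun w hw => ?_, fun i w h => ?_⟩
  · refine (hbc i).div (by fun_prop) fun w => ?_
    have : 0 < max (δ / 2) (∑ j, b j w) := lt_max_of_lt_left (by positivity)
    exact this.ne'
  · have h := ht hw
    simp only [Set.mem_iUnion, Set.mem_range, exists_prop, exists_exists_eq_and] at h
    obtain ⟨i, hi⟩ := h
    have hi' : dist w (g i) < δ / 2 := hi
    have h1 : δ / 2 ≤ ∑ j, b j w := by
      refine le_trans ?_ (Finset.single_le_sum (fun j _ => hb0 j w) (Finset.mem_univ i))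
      rw [hb]
      exact le_max_of_le_right (by linarith)
    rw [← Finset.sum_div, max_eq_right h1]
    exact div_self (by linarith)
  · by_contra! h'
    refine h ?_
    have : b i w = 0 := by rw [hb]; exact max_eq_left (by linarith)
    simp [this]

lemma abs_sub_sum_mul_le {ι : Type*} [Fintype ι] {φ a : ι → ℝ} {y B : ℝ} (h0 : ∀ i, 0 ≤ φ i)
    (h1 : ∑ i, φ i = 1) (hB : ∀ i, φ i ≠ 0 → |y - a i| ≤ B) : |y - ∑ i, a i * φ i| ≤ B := by
  have e : y - ∑ i, a i * φ i = ∑ i, (y - a i) * φ i := by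
    simp only [sub_mul, Finset.sum_sub_distrib, ← Finset.mul_sum, h1, mul_one]
  rw [e]
  refine (Finset.abs_sum_le_sum_abs _ _).trans ?_
  calc ∑ i, |(y - a i) * φ i| ≤ ∑ i, B * φ i := by
        refine Finset.sum_le_sum fun i _ => ?_
        rw [abs_mul, abs_of_nonneg (h0 i)]
        by_cases hi : φ i = 0
        · simp [hi]
        · exact mul_le_mul_of_nonneg_right (hB i hi) (h0 i)
    _ = B := by rw [← Finset.mul_sum, h1, mul_one]

/-! ### Finite-dimensional Gaussian vectors -/

lemma sum_sum_mul_inner {F ι : Type*} [NormedAddCommGroup F] [InnerProductSpace ℝ F]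
    [Fintype ι] (v : ι → F) (t : ι → ℝ) :
    ∑ i, ∑ j, t i * t j * ⟪v i, v j⟫ = ⟪∑ i, t i • v i, ∑ i, t i • v i⟫ := by
  rw [sum_inner]
  refine Finset.sum_congr rfl fun i _ => ?_
  rw [inner_sum]
  refine Finset.sum_congr rfl fun j _ => ?_
  rw [real_inner_smul_left, real_inner_smul_right, mul_assoc]

section GaussianVector

variable {F : Type*} [NormedAddCommGroup F] [InnerProductSpace ℝ F] [FiniteDimensional ℝ F]
  [MeasurableSpace F] [BorelSpace F] {ι : Type*} [Fintype ι]

lemma charFun_map_inner_stdGaussian (v : ι → F) (t : EuclideanSpace ℝ ι) :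
    charFun ((stdGaussian F).map fun ξ => WithLp.toLp 2 fun i => ⟪ξ, v i⟫) t =
      Complex.exp (-((∑ i, ∑ j, t i * t j * ⟪v i, v j⟫ : ℝ) : ℂ) / 2) := by
  rw [charFun_apply, integral_map (by fun_prop) (by fun_prop)]
  have e : ∀ ξ : F, ⟪(WithLp.toLp 2 fun i => ⟪ξ, v i⟫ : EuclideanSpace ℝ ι), t⟫ =
      ⟪ξ, ∑ i, t i • v i⟫ := fun ξ => by
    simp [PiLp.inner_apply, inner_sum, inner_smul_right]
  simp only [e]
  rw [← charFun_apply, charFun_stdGaussian]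
  congr 2
  rw [← Complex.ofReal_pow, ← real_inner_self_eq_norm_sq, sum_sum_mul_inner]

end GaussianVector

/-! ### Convergence of the mean local count -/

section NetCount

variable {m : ℕ}

/-- The count of a function interpolated from its values on a finite net. -/
noncomputable def netCount {W : Type*} [TopologicalSpace W] (T : ℕ) (s : ℝ) (D : Set W)
    (φ : Fin m → W → ℝ) (a : EuclideanSpace ℝ (Fin m)) : ℝ :=
  softCount T s (fun w => ∑ i, a i * φ i w) D

lemma norm_netCount_le {W : Type*} [TopologicalSpace W] (T : ℕ) {s : ℝ} (hs : 0 < s) (D : Set W)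
    (φ : Fin m → W → ℝ) (a : EuclideanSpace ℝ (Fin m)) : ‖netCount T s D φ a‖ ≤ T := by
  rw [Real.norm_eq_abs, netCount, abs_of_nonneg (softCount_nonneg T hs _ _)]
  exact softCount_le T hs _ _

lemma continuous_netCount {W : Type*} [TopologicalSpace W] [LocallyConnectedSpace W] (T : ℕ)
    {s : ℝ} (hs : 0 < s) {D : Set W} (hD : IsClosed D) {φ : Fin m → W → ℝ}
    (hφ : ∀ i, Continuous (φ i)) (h0 : ∀ i w, 0 ≤ φ i w) (h1 : ∀ w ∈ D, ∑ i, φ i w = 1) :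
    Continuous (netCount T s D φ) := by
  have : LipschitzWith (Real.toNNReal (T / s)) (netCount T s D φ) := by
    refine LipschitzWith.of_dist_le_mul fun a b => ?_
    rw [Real.coe_toNNReal _ (by positivity), Real.dist_eq, dist_eq_norm]
    refine abs_softCount_sub_le T hs (by fun_prop) (by fun_prop) hD (norm_nonneg _) fun w hw => ?_
    rw [← Finset.sum_sub_distrib]
    calc |∑ i, (a i * φ i w - b i * φ i w)| ≤ ∑ i, |a i * φ i w - b i * φ i w| :=
          Finset.abs_sum_le_sum_abs _ _
      _ ≤ ∑ i, ‖a - b‖ * φ i w := by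
          refine Finset.sum_le_sum fun i _ => ?_
          rw [← sub_mul, abs_mul, abs_of_nonneg (h0 i w)]
          exact mul_le_mul_of_nonneg_right (PiLp.norm_apply_le (a - b) i) (h0 i w)
      _ = ‖a - b‖ := by rw [← Finset.mul_sum, h1 w hw, mul_one]
  exact this.continuous

end NetCount

/-- The scaling limit of the covariance. -/
noncomputable def limitCov (u v : E2) : ℝ :=
  ∑' k : ℕ, (-(‖u - v‖ ^ 2 / 4)) ^ k / (k.factorial : ℝ) ^ 2

lemma tendsto_legendrePoly_inner_capChart {R : ℝ} (hR : 0 ≤ R) (x : Sphere2) (u v : E2) :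
    Filter.Tendsto (fun n : ℕ => (legendrePoly n).eval
      ⟪(capChart (capScale n R) x u : E3), (capChart (capScale n R) x v : E3)⟫) Filter.atTop
      (nhds (limitCov u v)) := by
  have h : ∀ n : ℕ, ⟪(capChart (capScale n R) x u : E3), (capChart (capScale n R) x v : E3)⟫ =
      1 - 2 * (4 * capScale n R ^ 2 * ‖u - v‖ ^ 2 /
        ((4 + capScale n R ^ 2 * ‖u‖ ^ 2) * (4 + capScale n R ^ 2 * ‖v‖ ^ 2))) := fun n => by
    rw [inner_capChart]; ring
  simp only [h]
  refine tendsto_legendrePoly_eval ?_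
  have h1 := tendsto_natCast_sq_mul_capScale_sq hR
  have h2 := tendsto_capScale hR
  have h3 : Filter.Tendsto (fun n : ℕ => 4 * ((n : ℝ) ^ 2 * capScale n R ^ 2) * ‖u - v‖ ^ 2 /
      ((4 + capScale n R ^ 2 * ‖u‖ ^ 2) * (4 + capScale n R ^ 2 * ‖v‖ ^ 2))) Filter.atTop
      (nhds (4 * 1 * ‖u - v‖ ^ 2 / ((4 + 0 * ‖u‖ ^ 2) * (4 + 0 * ‖v‖ ^ 2)))) :=
    ((h1.const_mul 4).mul_const _).div (((h2.mul_const _).const_add 4).mul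
      ((h2.mul_const _).const_add 4)) (by norm_num)
  have e : 4 * 1 * ‖u - v‖ ^ 2 / ((4 + 0 * ‖u‖ ^ 2) * (4 + 0 * ‖v‖ ^ 2)) = ‖u - v‖ ^ 2 / 4 := by
    ring
  rw [e] at h3
  refine h3.congr fun n => ?_
  ring

namespace HarmModel

variable {n d : ℕ} (H : HarmModel n d)

/-- The values of the harmonic at the points of a net in the chart around `x`. -/
noncomputable def netVec {m : ℕ} (c : ℝ) (g : Fin m → E2) (x : Sphere2)
    (ξ : EuclideanSpace ℝ (Fin d)) : EuclideanSpace ℝ (Fin m) :=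
  WithLp.toLp 2 fun i => ⟪ξ, H.feat (capChart c x (g i))⟫

lemma continuous_netVec {m : ℕ} (c : ℝ) (g : Fin m → E2) (x : Sphere2) :
    Continuous (H.netVec c g x) := by
  unfold netVec
  fun_prop

lemma charFun_map_netVec {m : ℕ} (c : ℝ) (g : Fin m → E2) (x : Sphere2)
    (t : EuclideanSpace ℝ (Fin m)) :
    charFun ((stdGaussian (EuclideanSpace ℝ (Fin d))).map (H.netVec c g x)) t =
      Complex.exp (-((∑ i, ∑ j, t i * t j * (legendrePoly n).eval
        ⟪(capChart c x (g i) : E3), (capChart c x (g j) : E3)⟫ : ℝ) : ℂ) / 2) := by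
  refine (charFun_map_inner_stdGaussian _ t).trans ?_
  simp only [H.inner_feat (norm_sphere _) (norm_sphere _)]

lemma map_netVec_eq {m : ℕ} (c : ℝ) (g : Fin m → E2) (x y : Sphere2) :
    (stdGaussian (EuclideanSpace ℝ (Fin d))).map (H.netVec c g x) =
      (stdGaussian (EuclideanSpace ℝ (Fin d))).map (H.netVec c g y) := by
  have := (H.continuous_netVec c g x).measurable
  have := (H.continuous_netVec c g y).measurable
  have h1 := Measure.isProbabilityMeasure_map (μ := stdGaussian (EuclideanSpace ℝ (Fin d)))
    (H.continuous_netVec c g x).aemeasurable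
  have h2 := Measure.isProbabilityMeasure_map (μ := stdGaussian (EuclideanSpace ℝ (Fin d)))
    (H.continuous_netVec c g y).aemeasurable
  refine Measure.ext_of_charFun (funext fun t => ?_)
  simp only [charFun_map_netVec, inner_capChart]

lemma abs_capCount_sub_netCount_le {m : ℕ} {R s A δ : ℝ} (hn : 1 ≤ n) (hR : 0 ≤ R)
    (hRn : R < 2 * n) (hs : 0 < s) (hA : 1 ≤ A) (hRA : R ≤ A) (hδ : 0 ≤ δ)
    (hc : n * capScale n R ≤ 2) (T : ℕ) {g : Fin m → E2} {φ : Fin m → E2 → ℝ}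
    (hg : ∀ i, g i ∈ Metric.closedBall (0 : E2) R) (hφ : ∀ i, Continuous (φ i))
    (h0 : ∀ i w, 0 ≤ φ i w) (h1 : ∀ w ∈ Metric.closedBall (0 : E2) R, ∑ i, φ i w = 1)
    (h2 : ∀ i w, φ i w ≠ 0 → dist w (g i) < δ) (ξ : EuclideanSpace ℝ (Fin d)) (x : Sphere2) :
    |capCount n R T s (H.Φ ξ) x - netCount T s (Metric.closedBall (0 : E2) R) φ
      (H.netVec (capScale n R) g x ξ)| ≤ T / s * (6 * δ * locNorm n A (H.Φ ξ) x) := by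
  have hc0 := capScale_pos hR hRn
  have hl := locNorm_nonneg n (zero_le_one.trans hA) (H.Φ ξ) (x : E3)
  rw [capCount_eq_capChart x hR hRn]
  refine abs_softCount_sub_le T hs ?_ (by fun_prop) Metric.isClosed_closedBall (by positivity)
    fun w hw => ?_
  · exact (continuous_ev_sphere _).comp (isOpenEmbedding_capChart x hc0.ne').continuous
  · refine abs_sub_sum_mul_le (fun i => h0 i w) (h1 w hw) fun i hi => ?_
    have hmem : ∀ w ∈ Metric.closedBall (0 : E2) R,
        ‖(capChart (capScale n R) x w : E3) - x‖ ≤ A / n := fun w hw => by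
      rw [← capChart_preimage_closedBall x hR hRn] at hw
      have hw' : dist (capChart (capScale n R) x w) x ≤ R / n := hw
      rw [Subtype.dist_eq, dist_eq_norm] at hw'
      exact hw'.trans (by gcongr)
    have e : (H.netVec (capScale n R) g x ξ) i = ev (H.Φ ξ) (capChart (capScale n R) x (g i)) := by
      rw [H.ev_eq_inner]; rfl
    rw [e]
    refine (abs_ev_sub_le_locNorm hn hA (H.mem ξ) (hmem w hw) (hmem _ (hg i))).trans ?_
    have hd := dist_capChart_le _ x hc0.le w (g i)
    rw [Subtype.dist_eq, dist_eq_norm] at hd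
    have hd2 : ‖w - g i‖ ≤ δ := by rw [← dist_eq_norm]; exact (h2 i w hi).le
    calc _ ≤ 3 * (n * locNorm n A (H.Φ ξ) x) * (capScale n R * δ) := by
          gcongr
          exact hd.trans (by gcongr)
      _ = n * capScale n R * (3 * (δ * locNorm n A (H.Φ ξ) x)) := by ring
      _ ≤ 2 * (3 * (δ * locNorm n A (H.Φ ξ) x)) := by gcongr
      _ = _ := by ring

lemma abs_integral_meanCapCount_sub_le {m : ℕ} {R s A δ : ℝ} (hn : 1 ≤ n) (hR : 0 ≤ R)
    (hRn : R < 2 * n) (hs : 0 < s) (hA : 1 ≤ A) (hRA : R ≤ A) (hδ : 0 ≤ δ)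
    (hc : n * capScale n R ≤ 2) (T : ℕ) {g : Fin m → E2} {φ : Fin m → E2 → ℝ}
    (hg : ∀ i, g i ∈ Metric.closedBall (0 : E2) R) (hφ : ∀ i, Continuous (φ i))
    (h0 : ∀ i w, 0 ≤ φ i w) (h1 : ∀ w ∈ Metric.closedBall (0 : E2) R, ∑ i, φ i w = 1)
    (h2 : ∀ i w, φ i w ≠ 0 → dist w (g i) < δ) (x₀ : Sphere2) :
    |∫ ξ, meanCapCount n R T s (H.Φ ξ) ∂stdGaussian (EuclideanSpace ℝ (Fin d)) -
      ∫ a, netCount T s (Metric.closedBall (0 : E2) R) φ a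
        ∂(stdGaussian (EuclideanSpace ℝ (Fin d))).map (H.netVec (capScale n R) g x₀)| ≤
      T / s * (6 * δ * Real.exp (12 * A)) := by
  obtain ⟨Θ, hΘ⟩ : ∃ Θ, Θ = netCount T s (Metric.closedBall (0 : E2) R) φ := ⟨_, rfl⟩
  have hΘc : Continuous Θ := hΘ ▸ continuous_netCount T hs Metric.isClosed_closedBall hφ h0 h1
  have hΘb : ∀ a, ‖Θ a‖ ≤ T := fun a => hΘ ▸ norm_netCount_le T hs _ _ a
  have hA0 : 0 ≤ A := zero_le_one.trans hA
  have hp := fun (ξ : EuclideanSpace ℝ (Fin d)) (x : Sphere2) =>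
    H.abs_capCount_sub_netCount_le hn hR hRn hs hA hRA hδ hc T hg hφ h0 h1 h2 ξ x
  rw [← hΘ] at hp ⊢
  have hli := H.integrable_locNorm_prod hn hA0
  have hci := H.integrable_capCount_prod hn hs R T (stdGaussian (EuclideanSpace ℝ (Fin d)))
  have hle : ∫ x : Sphere2, ∫ ξ, locNorm n A (H.Φ ξ) x
      ∂stdGaussian (EuclideanSpace ℝ (Fin d)) ∂sphMeasure ≤ Real.exp (12 * A) := by
    rw [← integral_integral_swap hli]
    exact H.integral_integral_locNorm_le hn hA0
  rw [H.integral_meanCapCount hn hs R T]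
  obtain ⟨γ, hγ⟩ : ∃ γ, γ = stdGaussian (EuclideanSpace ℝ (Fin d)) := ⟨_, rfl⟩
  have : IsProbabilityMeasure γ := hγ ▸ inferInstance
  have hmap : ∀ x, ∫ a, Θ a ∂γ.map (H.netVec (capScale n R) g x₀) =
      ∫ ξ, Θ (H.netVec (capScale n R) g x ξ) ∂γ := fun x => by
    rw [hγ, H.map_netVec_eq _ g x₀ x, integral_map (H.continuous_netVec _ _ _).aemeasurable
      hΘc.aestronglyMeasurable]
  rw [← hγ] at hli hci hle ⊢
  obtain ⟨θ, hθ⟩ : ∃ θ, θ = ∫ a, Θ a ∂γ.map (H.netVec (capScale n R) g x₀) := ⟨_, rfl⟩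
  rw [← hθ] at hmap ⊢
  have e : ∫ x, ∫ ξ, capCount n R T s (H.Φ ξ) x ∂γ ∂sphMeasure - θ =
      ∫ x, (∫ ξ, capCount n R T s (H.Φ ξ) x ∂γ - θ) ∂sphMeasure := by
    rw [integral_sub hci.integral_prod_right (integrable_const _)]; simp
  rw [e, ← Real.norm_eq_abs]
  refine (norm_integral_le_of_norm_le
    (μ := sphMeasure)
    (g := fun x : Sphere2 => ∫ ξ, T / s * (6 * δ * locNorm n A (H.Φ ξ) x) ∂γ) ?_ ?_).trans ?_
  · simp only [integral_const_mul]
    exact (hli.integral_prod_right.const_mul _).const_mul _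
  · filter_upwards [hli.prod_left_ae, hci.prod_left_ae] with x hx hx'
    have hi : Integrable (fun ξ => Θ (H.netVec (capScale n R) g x ξ)) γ :=
      Integrable.of_bound (hΘc.comp (H.continuous_netVec _ _ _)).aestronglyMeasurable T
        (Filter.Eventually.of_forall fun ξ => hΘb _)
    rw [hmap x, ← integral_sub hx' hi]
    refine norm_integral_le_of_norm_le ((hx.const_mul _).const_mul _)
      (Filter.Eventually.of_forall fun ξ => ?_)
    rw [Real.norm_eq_abs]
    exact hp ξ x
  · simp only [integral_const_mul]
    gcongr

end HarmModel

lemma exists_tendsto_integral_netVec {d : ℕ → ℕ} (M : ∀ n, HarmModel n (d n)) {R : ℝ}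
    (hR : 0 ≤ R) {m : ℕ} (g : Fin m → E2) (x : Sphere2) {Θ : EuclideanSpace ℝ (Fin m) → ℝ}
    (hΘ : Continuous Θ) {B : ℝ} (hB : ∀ a, ‖Θ a‖ ≤ B) :
    ∃ b, Filter.Tendsto (fun n => ∫ a, Θ a ∂(stdGaussian (EuclideanSpace ℝ (Fin (d n)))).map
      ((M n).netVec (capScale n R) g x)) Filter.atTop (nhds b) := by
  have hprob : ∀ n, IsProbabilityMeasure ((stdGaussian (EuclideanSpace ℝ (Fin (d n)))).map
      ((M n).netVec (capScale n R) g x)) := fun n =>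
    Measure.isProbabilityMeasure_map ((M n).continuous_netVec _ g x).aemeasurable
  have hlim : ∀ t : Fin m → ℝ, Filter.Tendsto (fun n : ℕ => ∑ i, ∑ j, t i * t j *
      (legendrePoly n).eval ⟪(capChart (capScale n R) x (g i) : E3),
        (capChart (capScale n R) x (g j) : E3)⟫) Filter.atTop
      (nhds (∑ i, ∑ j, t i * t j * limitCov (g i) (g j))) := fun t =>
    tendsto_finsetSum _ fun i _ => tendsto_finsetSum _ fun j _ =>
      (tendsto_legendrePoly_inner_capChart hR x (g i) (g j)).const_mul _
  obtain ⟨S, hS⟩ : ∃ S : Matrix (Fin m) (Fin m) ℝ,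
    S = Matrix.of fun i j => limitCov (g i) (g j) := ⟨_, rfl⟩
  have hSt : ∀ t : Fin m → ℝ, t ⬝ᵥ S.mulVec t = ∑ i, ∑ j, t i * t j * limitCov (g i) (g j) := by
    intro t
    simp only [dotProduct, Matrix.mulVec, hS, Matrix.of_apply, Finset.mul_sum]
    exact Finset.sum_congr rfl fun i _ => Finset.sum_congr rfl fun j _ => by ring
  have hpsd : S.PosSemidef := by
    refine Matrix.PosSemidef.of_dotProduct_mulVec_nonneg ?_ fun t => ?_
    · ext i j
      simp [hS, limitCov, norm_sub_rev]
    · rw [star_trivial, hSt]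
      refine ge_of_tendsto' (hlim t) fun n => ?_
      have := sum_sum_mul_inner (fun i => (M n).feat (capChart (capScale n R) x (g i))) t
      simp only [(M n).inner_feat (norm_sphere _) (norm_sphere _)] at this
      rw [this]
      exact real_inner_self_nonneg
  obtain ⟨ν, hν⟩ : ∃ ν : ProbabilityMeasure (EuclideanSpace ℝ (Fin m)),
    ν = ⟨multivariateGaussian 0 S, inferInstance⟩ := ⟨_, rfl⟩
  obtain ⟨μ, hμ⟩ : ∃ μ : ℕ → ProbabilityMeasure (EuclideanSpace ℝ (Fin m)),
    μ = fun n => ⟨_, hprob n⟩ := ⟨_, rfl⟩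
  have hconv : Filter.Tendsto μ Filter.atTop (nhds ν) := by
    refine ProbabilityMeasure.tendsto_iff_tendsto_charFun.2 fun t => ?_
    rw [hν, hμ]
    simp only [ProbabilityMeasure.coe_mk, HarmModel.charFun_map_netVec,
      charFun_multivariateGaussian hpsd]
    have h1 := hlim t
    rw [← hSt] at h1
    have h2 : Filter.Tendsto (fun r : ℝ => Complex.exp (-(r : ℂ) / 2)) (nhds (t ⬝ᵥ S.mulVec t))
        (nhds (Complex.exp (-((t ⬝ᵥ S.mulVec t : ℝ) : ℂ) / 2))) :=
      Continuous.tendsto (by fun_prop) _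
    refine (h2.comp h1).trans (le_of_eq ?_)
    congr 2
    simp [neg_div]
  have h := ProbabilityMeasure.tendsto_iff_forall_integral_tendsto.1 hconv
    (BoundedContinuousFunction.ofNormedAddCommGroup Θ hΘ B hB)
  rw [hμ] at h
  exact ⟨_, h⟩

theorem exists_tendsto_integral_meanCapCount {d : ℕ → ℕ} (M : ∀ n, HarmModel n (d n)) {R s : ℝ}
    (hR : 0 ≤ R) (hs : 0 < s) (T : ℕ) :
    ∃ b, Filter.Tendsto (fun n => ∫ ξ, meanCapCount n R T s ((M n).Φ ξ)
      ∂stdGaussian (EuclideanSpace ℝ (Fin (d n)))) Filter.atTop (nhds b) := by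
  refine cauchySeq_tendsto_of_complete (Metric.cauchySeq_iff'.2 fun ε hε => ?_)
  obtain ⟨A, hA⟩ : ∃ A, A = max R 1 := ⟨_, rfl⟩
  have hA1 : 1 ≤ A := hA ▸ le_max_right _ _
  have hRA : R ≤ A := hA ▸ le_max_left _ _
  obtain ⟨δ, hδ⟩ : ∃ δ, δ = ε / 4 / ((T + 1) / s * (6 * Real.exp (12 * A))) := ⟨_, rfl⟩
  have hδ0 : 0 < δ := by rw [hδ]; positivity
  have hδe : T / s * (6 * δ * Real.exp (12 * A)) ≤ ε / 4 := by
    calc T / s * (6 * δ * Real.exp (12 * A)) ≤ (T + 1) / s * (6 * δ * Real.exp (12 * A)) := by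
          gcongr; linarith
      _ = ε / 4 := by rw [hδ]; field_simp
  obtain ⟨m, g, φ, hg, hφ, h0, h1, h2⟩ := exists_partition_subordinate
    (isCompact_closedBall (0 : E2) R) hδ0
  obtain ⟨x⟩ : Nonempty Sphere2 := inferInstance
  obtain ⟨b, hb⟩ := exists_tendsto_integral_netVec M hR g x (B := T)
    (continuous_netCount T hs Metric.isClosed_closedBall hφ h0 h1) (norm_netCount_le T hs _ _)
  have hev : ∀ᶠ n : ℕ in Filter.atTop, (n : ℝ) ^ 2 * capScale n R ^ 2 < 4 :=
    (tendsto_natCast_sq_mul_capScale_sq hR).eventually_lt_const (by norm_num)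
  have hev2 : ∀ᶠ n : ℕ in Filter.atTop, R < 2 * (n : ℝ) := by
    filter_upwards [tendsto_natCast_atTop_atTop.eventually_gt_atTop R,
      Filter.eventually_ge_atTop 0] with n hn _
    have : (0 : ℝ) ≤ n := Nat.cast_nonneg n
    linarith
  have hb' := Metric.tendsto_nhds.1 hb (ε / 4) (by positivity)
  obtain ⟨N, hN⟩ := Filter.eventually_atTop.1
    (((hev.and hev2).and hb').and (Filter.eventually_ge_atTop 1))
  have key : ∀ n ≥ N, |∫ ξ, meanCapCount n R T s ((M n).Φ ξ)
      ∂stdGaussian (EuclideanSpace ℝ (Fin (d n))) - b| < ε / 2 := fun n hn => by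
    obtain ⟨⟨⟨h3, h4⟩, h5⟩, h6⟩ := hN n hn
    have h7 := (M n).abs_integral_meanCapCount_sub_le h6 hR h4 hs hA1 hRA hδ0.le
      (abs_le_of_sq_le_sq' (by rw [mul_pow]; linarith) zero_le_two).2 T hg hφ h0 h1 h2 x
    rw [Real.dist_eq] at h5
    have h8 := abs_add_le (∫ ξ, meanCapCount n R T s ((M n).Φ ξ)
      ∂stdGaussian (EuclideanSpace ℝ (Fin (d n))) -
      ∫ a, netCount T s (Metric.closedBall (0 : E2) R) φ a
        ∂(stdGaussian (EuclideanSpace ℝ (Fin (d n)))).map ((M n).netVec (capScale n R) g x))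
      (∫ a, netCount T s (Metric.closedBall (0 : E2) R) φ a
        ∂(stdGaussian (EuclideanSpace ℝ (Fin (d n)))).map ((M n).netVec (capScale n R) g x) - b)
    rw [sub_add_sub_cancel] at h8
    linarith
  refine ⟨N, fun n hn => ?_⟩
  have k1 := key n hn
  have k2 := key N le_rfl
  rw [abs_sub_comm] at k2
  rw [Real.dist_eq]
  have := abs_sub_le (∫ ξ, meanCapCount n R T s ((M n).Φ ξ)
      ∂stdGaussian (EuclideanSpace ℝ (Fin (d n)))) b (∫ ξ, meanCapCount N R T s ((M N).Φ ξ)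
      ∂stdGaussian (EuclideanSpace ℝ (Fin (d N))))
  linarith

/-! ### Conditioning a Gaussian vector on one coordinate -/

section GaussianCoordinate

variable {F : Type*} [NormedAddCommGroup F] [InnerProductSpace ℝ F] [FiniteDimensional ℝ F]
  [MeasurableSpace F] [BorelSpace F]

lemma map_reflection_stdGaussian {u : F} (hu : ‖u‖ = 1) :
    (stdGaussian F).map (fun ξ => ξ - (2 * ⟪ξ, u⟫) • u) = stdGaussian F := by
  have := Measure.isProbabilityMeasure_map (μ := stdGaussian F)
    (f := fun ξ : F => ξ - (2 * ⟪ξ, u⟫) • u) (by fun_prop)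
  refine Measure.ext_of_charFun (funext fun w => ?_)
  rw [charFun_apply, integral_map (by fun_prop) (by fun_prop)]
  have e : ∀ ξ : F, ⟪ξ - (2 * ⟪ξ, u⟫) • u, w⟫ = ⟪ξ, w - (2 * ⟪u, w⟫) • u⟫ := fun ξ => by
    rw [inner_sub_left, inner_sub_right, real_inner_smul_left, real_inner_smul_right]; ring
  simp only [e]
  rw [← charFun_apply, charFun_stdGaussian, charFun_stdGaussian]
  congr 3
  norm_cast
  rw [norm_sub_sq_real, real_inner_smul_right, norm_smul, hu, mul_one, Real.norm_eq_abs, sq_abs,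
    real_inner_comm u w]
  ring

lemma map_proj_add_stdGaussian {u : F} (hu : ‖u‖ = 1) :
    ((stdGaussian F).prod (gaussianReal 0 1)).map
      (fun q : F × ℝ => q.1 - ⟪q.1, u⟫ • u + q.2 • u) = stdGaussian F := by
  have := Measure.isProbabilityMeasure_map (μ := (stdGaussian F).prod (gaussianReal 0 1))
    (f := fun q : F × ℝ => q.1 - ⟪q.1, u⟫ • u + q.2 • u) (by fun_prop)
  refine Measure.ext_of_charFun (funext fun w => ?_)
  rw [charFun_apply, integral_map (by fun_prop) (by fun_prop)]
  have e : ∀ q : F × ℝ, Complex.exp (⟪q.1 - ⟪q.1, u⟫ • u + q.2 • u, w⟫ * Complex.I) =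
      Complex.exp (⟪q.1, w - ⟪u, w⟫ • u⟫ * Complex.I) *
        Complex.exp (⟪q.2, ⟪u, w⟫⟫ * Complex.I) := fun q => by
    rw [← Complex.exp_add, ← add_mul]
    congr 2
    norm_cast
    rw [inner_add_left, inner_sub_left, inner_sub_right, real_inner_smul_left,
      real_inner_smul_left, real_inner_smul_right]
    simp [mul_comm]
  simp only [e]
  rw [integral_prod_mul (f := fun ξ : F => Complex.exp (⟪ξ, w - ⟪u, w⟫ • u⟫ * Complex.I))
    (g := fun t : ℝ => Complex.exp (⟪t, ⟪u, w⟫⟫ * Complex.I)), ← charFun_apply, ← charFun_apply,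
    charFun_stdGaussian, charFun_stdGaussian, charFun_gaussianReal, ← Complex.exp_add]
  congr 1
  have : ‖w - ⟪u, w⟫ • u‖ ^ 2 = ‖w‖ ^ 2 - ⟪u, w⟫ ^ 2 := by
    rw [norm_sub_sq_real, real_inner_smul_right, norm_smul, hu, mul_one, Real.norm_eq_abs, sq_abs,
      real_inner_comm u w]
    ring
  rw [← Complex.ofReal_pow, this]
  push_cast
  ring

end GaussianCoordinate

lemma gaussianReal_Ici_pos (K : ℝ) : 0 < (gaussianReal 0 1).real (Set.Ici K) := by
  refine ENNReal.toReal_pos (fun h => ?_) (measure_ne_top _ _)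
  have := gaussianReal_absolutelyContinuous' 0 one_ne_zero h
  simp at this

/-! ### The zonal function is negative on a suitable circle -/

lemma tsum_neg_four_pow_lt : ∑' k : ℕ, (-(4 : ℝ)) ^ k / (k.factorial : ℝ) ^ 2 < -(1 / 5) := by
  obtain ⟨f, hf⟩ : ∃ f : ℕ → ℝ, f = fun k => 4 ^ (k + 1) / ((k + 1).factorial : ℝ) ^ 2 :=
    ⟨_, rfl⟩
  have hs : Summable fun k : ℕ => (-(4 : ℝ)) ^ k / (k.factorial : ℝ) ^ 2 := by
    refine Summable.of_norm_bounded (Real.summable_pow_div_factorial 4) fun k => ?_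
    rw [norm_div, norm_pow, norm_neg, norm_pow]
    have h1 : (1 : ℝ) ≤ k.factorial := by exact_mod_cast Nat.one_le_iff_ne_zero.2 k.factorial_ne_zero
    simp only [Real.norm_ofNat, RCLike.norm_natCast]
    gcongr
    nlinarith
  have hfa : Antitone f := by
    refine antitone_nat_of_succ_le fun k => ?_
    rw [hf]
    simp only [Nat.factorial_succ (k + 1)]
    have h1 : (0 : ℝ) < ((k + 1).factorial : ℝ) := by positivity
    push_cast
    rw [div_le_div_iff₀ (by positivity) (by positivity)]
    have h2 : (2 : ℝ) ^ 2 ≤ ((k : ℝ) + 1 + 1) ^ 2 := by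
      have : (0 : ℝ) ≤ k := Nat.cast_nonneg k
      gcongr; linarith
    calc _ = 2 ^ 2 * ((4 : ℝ) ^ (k + 1) * ((k + 1).factorial : ℝ) ^ 2) := by ring
      _ ≤ ((k : ℝ) + 1 + 1) ^ 2 * (4 ^ (k + 1) * ((k + 1).factorial : ℝ) ^ 2) := by gcongr
      _ = _ := by ring
  have e : ∀ k : ℕ, (-(4 : ℝ)) ^ (k + 1) / ((k + 1).factorial : ℝ) ^ 2 = -((-1) ^ k * f k) :=
    fun k => by rw [hf, neg_pow]; ring
  have h2 := (summable_nat_add_iff 1).2 hs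
  have h3 := hs.tsum_eq_zero_add
  simp only [e] at h2 h3
  have h4 := (h2.neg.hasSum.tendsto_sum_nat)
  simp only [neg_neg] at h4
  have h5 := hfa.alternating_series_le_tendsto h4 2
  rw [tsum_neg] at h3
  obtain ⟨L, hL⟩ : ∃ L, L = ∑' k : ℕ, (-1) ^ k * f k := ⟨_, rfl⟩
  rw [← hL] at h3 h5
  rw [h3]
  simp only [Finset.sum_range_succ, Finset.sum_range_zero, hf, Nat.factorial] at h5
  norm_num at h5 ⊢
  linarith

lemma eventually_legendrePoly_lt : ∀ᶠ n : ℕ in Filter.atTop,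
    (legendrePoly n).eval (1 - 2 * (4 / (n : ℝ) ^ 2)) < -(1 / 5) := by
  have h : Filter.Tendsto (fun n : ℕ => (n : ℝ) ^ 2 * (4 / (n : ℝ) ^ 2)) Filter.atTop
      (nhds 4) := by
    refine tendsto_const_nhds.congr' ?_
    filter_upwards [Filter.eventually_ge_atTop 1] with n hn
    have : (0 : ℝ) < n := by exact_mod_cast hn
    field_simp
  exact (tendsto_legendrePoly_eval h).eventually_lt_const tsum_neg_four_pow_lt

/-! ### A cap contains a nodal component with positive probability -/

lemma one_le_capCount {n : ℕ} {R s : ℝ} {p : Poly3} {x : Sphere2} (hR : 0 ≤ R) (hs : 0 < s)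
    (hx : s < ev p x) (h : ∀ y : Sphere2, dist y x = R / n → ev p y ≤ -s) :
    1 ≤ capCount n R 1 s p x := by
  have h1 : ((1 : ℕ) : ℝ) ≤ softCount 1 s (fun y : Sphere2 => ev p y)
      (Metric.closedBall x (R / n)) := by
    refine le_softCount le_rfl hs ?_
    rw [Nat.cast_one, Set.one_le_encard_iff_nonempty]
    have hxs : x ∈ {y : Sphere2 | -s < ev p y} := by
      have : -s < ev p x := by linarith
      exact this
    refine ⟨connectedComponentIn {y : Sphere2 | -s < ev p y} x, ?_, x, hx,
      mem_connectedComponentIn hxs, rfl⟩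
    refine isPreconnected_connectedComponentIn.subset_of_disjoint_frontier
      ⟨x, mem_connectedComponentIn hxs, Metric.mem_closedBall_self (by positivity)⟩ ?_
    refine Set.disjoint_left.2 fun y hy hy' => ?_
    have h2 : dist y x = R / n := Metric.frontier_closedBall_subset_sphere hy'
    have h3 : y ∈ {y : Sphere2 | -s < ev p y} := connectedComponentIn_subset _ _ hy
    exact absurd (h y h2) (not_le.2 h3)
  simpa [capCount] using h1

lemma inner_eq_of_dist {x y : Sphere2} : ⟪(y : E3), (x : E3)⟫ = 1 - dist y x ^ 2 / 2 := by
  rw [Subtype.dist_eq, dist_eq_norm, norm_sub_sq_real, norm_sphere, norm_sphere]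
  ring

namespace HarmModel

variable {n d : ℕ} (H : HarmModel n d)

lemma le_capCount_proj_add (hn : 1 ≤ n)
    (hP : (legendrePoly n).eval (1 - 2 * (4 / (n : ℝ) ^ 2)) < -(1 / 5)) {B : ℝ} (hB : 0 < B)
    (x : Sphere2) (ξ : EuclideanSpace ℝ (Fin d)) {t : ℝ} (ht : 5 * (B + 1) ≤ t) :
    1 - (locNorm n 4 (H.Φ ξ) x +
      locNorm n 4 (H.Φ (ξ - (2 * ⟪ξ, H.feat x⟫) • H.feat x)) x) / (2 * B) ≤
      capCount n 4 1 1 (H.Φ (ξ - ⟪ξ, H.feat x⟫ • H.feat x + t • H.feat x)) x := by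
  obtain ⟨l, hl⟩ : ∃ l, l = (locNorm n 4 (H.Φ ξ) x +
      locNorm n 4 (H.Φ (ξ - (2 * ⟪ξ, H.feat x⟫) • H.feat x)) x) := ⟨_, rfl⟩
  rw [← hl]
  by_cases hlB : 2 * B ≤ l
  · refine le_trans ?_ (capCount_nonneg one_pos _ _ _ _ _)
    rw [sub_nonpos, one_le_div (by positivity)]
    exact hlB
  push Not at hlB
  have hl0 : 0 ≤ l := by
    rw [hl]
    exact add_nonneg (locNorm_nonneg n (by norm_num) _ _) (locNorm_nonneg n (by norm_num) _ _)
  have hn0 : (0 : ℝ) < n := by exact_mod_cast hn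
  have hb : ∀ y : Sphere2, dist y x ≤ 4 / n →
      |ev (H.Φ (ξ - ⟪ξ, H.feat x⟫ • H.feat x)) y| < B := fun y hy => by
    rw [Subtype.dist_eq, dist_eq_norm] at hy
    have h1 := abs_ev_le_locNorm (H.mem ξ) hy
    have h2 := abs_ev_le_locNorm (H.mem (ξ - (2 * ⟪ξ, H.feat x⟫) • H.feat x)) hy
    have h3 : ev (H.Φ (ξ - ⟪ξ, H.feat x⟫ • H.feat x)) y = (ev (H.Φ ξ) y +
        ev (H.Φ (ξ - (2 * ⟪ξ, H.feat x⟫) • H.feat x)) y) / 2 := by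
      simp only [H.ev_eq_inner, inner_sub_left, real_inner_smul_left]
      ring
    rw [h3, abs_div, abs_two]
    have := abs_add_le (ev (H.Φ ξ) y) (ev (H.Φ (ξ - (2 * ⟪ξ, H.feat x⟫) • H.feat x)) y)
    linarith
  have hz : ∀ y : Sphere2, ev (H.Φ (ξ - ⟪ξ, H.feat x⟫ • H.feat x + t • H.feat x)) y =
      ev (H.Φ (ξ - ⟪ξ, H.feat x⟫ • H.feat x)) y +
        t * (legendrePoly n).eval (1 - dist y x ^ 2 / 2) := fun y => by
    rw [← inner_eq_of_dist, ← H.inner_feat (norm_sphere _) (norm_sphere _)]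
    simp only [H.ev_eq_inner, inner_add_left, real_inner_smul_left]
    rw [real_inner_comm (H.feat x) (H.feat y)]
  refine le_trans (sub_le_self _ (by positivity)) (one_le_capCount (by norm_num) one_pos ?_ ?_)
  · have := (abs_lt.1 (hb x (by rw [dist_self]; positivity))).1
    rw [hz, dist_self]
    have e : (1 : ℝ) - 0 ^ 2 / 2 = 1 := by norm_num
    rw [e, legendrePoly_eval_one]
    linarith
  · intro y hy
    have := (abs_lt.1 (hb y hy.le)).2
    have e : 1 - dist y x ^ 2 / 2 = 1 - 2 * (4 / (n : ℝ) ^ 2) := by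
      rw [hy]; field_simp; ring
    rw [hz, e]
    nlinarith

end HarmModel

namespace HarmModel

variable {n d : ℕ} (H : HarmModel n d)

lemma le_integral_capCount (hn : 1 ≤ n)
    (hP : (legendrePoly n).eval (1 - 2 * (4 / (n : ℝ) ^ 2)) < -(1 / 5)) {B : ℝ} (hB : 0 < B)
    (x : Sphere2) (hx : Integrable (fun ξ => locNorm n 4 (H.Φ ξ) x)
      (stdGaussian (EuclideanSpace ℝ (Fin d)))) :
    (1 - (∫ ξ, locNorm n 4 (H.Φ ξ) x ∂stdGaussian (EuclideanSpace ℝ (Fin d))) / B) *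
      (gaussianReal 0 1).real (Set.Ici (5 * (B + 1))) ≤
      ∫ ξ, capCount n 4 1 1 (H.Φ ξ) x ∂stdGaussian (EuclideanSpace ℝ (Fin d)) := by
  obtain ⟨γ, hγ⟩ : ∃ γ, γ = stdGaussian (EuclideanSpace ℝ (Fin d)) := ⟨_, rfl⟩
  have : IsProbabilityMeasure γ := hγ ▸ inferInstance
  obtain ⟨u, hu⟩ : ∃ u, u = H.feat x := ⟨_, rfl⟩
  have hu1 : ‖u‖ = 1 := hu ▸ H.norm_feat (norm_sphere x)
  have hr := map_reflection_stdGaussian hu1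
  have hg := map_proj_add_stdGaussian hu1
  have hcc : Continuous fun ξ => capCount n 4 1 1 (H.Φ ξ) x := H.continuous_capCount one_pos 4 1 x
  have hlc : Continuous fun ξ => locNorm n 4 (H.Φ ξ) x :=
    (continuous_locNorm_linear n 4 H.Φ).comp (continuous_id.prodMk continuous_const)
  have hp := fun ξ t (ht : 5 * (B + 1) ≤ t) => H.le_capCount_proj_add hn hP hB x ξ ht
  rw [← hγ] at hx hr hg ⊢
  rw [← hu] at hp
  have hx2 : Integrable (fun ξ => locNorm n 4 (H.Φ (ξ - (2 * ⟪ξ, u⟫) • u)) x) γ := by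
    have h := hx
    rw [← hr] at h
    exact h.comp_measurable (by fun_prop)
  have hx3 : ∫ ξ, locNorm n 4 (H.Φ (ξ - (2 * ⟪ξ, u⟫) • u)) x ∂γ =
      ∫ ξ, locNorm n 4 (H.Φ ξ) x ∂γ := by
    conv_rhs => rw [← hr]
    rw [integral_map (by fun_prop) hlc.aestronglyMeasurable]
  have hxx : Integrable (fun ξ => locNorm n 4 (H.Φ ξ) x +
      locNorm n 4 (H.Φ (ξ - (2 * ⟪ξ, u⟫) • u)) x) γ := hx.add hx2
  obtain ⟨h, hh⟩ : ∃ h : EuclideanSpace ℝ (Fin d) → ℝ, h = fun ξ => 1 - (locNorm n 4 (H.Φ ξ) x +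
      locNorm n 4 (H.Φ (ξ - (2 * ⟪ξ, u⟫) • u)) x) / (2 * B) := ⟨_, rfl⟩
  have hhi : Integrable h γ := by
    rw [hh]
    exact (integrable_const (1 : ℝ)).sub (hxx.div_const (2 * B))
  have hhe : ∫ ξ, h ξ ∂γ = 1 - (∫ ξ, locNorm n 4 (H.Φ ξ) x ∂γ) / B := by
    simp only [hh]
    rw [integral_sub (integrable_const _) (hxx.div_const _), integral_div,
      integral_add hx hx2, hx3]
    simp
    field_simp
    ring
  obtain ⟨k, hk⟩ : ∃ k : ℝ → ℝ, k = (Set.Ici (5 * (B + 1))).indicator 1 := ⟨_, rfl⟩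
  have hki : Integrable k (gaussianReal 0 1) := by
    rw [hk]
    exact (integrable_const (1 : ℝ)).indicator measurableSet_Ici
  have hke : ∫ t, k t ∂gaussianReal 0 1 = (gaussianReal 0 1).real (Set.Ici (5 * (B + 1))) := by
    rw [hk]; exact integral_indicator_one measurableSet_Ici
  rw [← hhe, ← hke, ← integral_prod_mul (f := h) (g := k)]
  have hmap : ∫ ξ, capCount n 4 1 1 (H.Φ ξ) x ∂γ = ∫ q : EuclideanSpace ℝ (Fin d) × ℝ,
      capCount n 4 1 1 (H.Φ (q.1 - ⟪q.1, u⟫ • u + q.2 • u)) x ∂γ.prod (gaussianReal 0 1) := by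
    conv_lhs => rw [← hg]
    rw [integral_map (by fun_prop) hcc.aestronglyMeasurable]
  rw [hmap]
  refine integral_mono (hhi.mul_prod hki) ?_ fun q => ?_
  · have hc : Continuous fun q : EuclideanSpace ℝ (Fin d) × ℝ =>
        q.1 - ⟪q.1, u⟫ • u + q.2 • u := by fun_prop
    refine Integrable.of_bound (hcc.comp hc).aestronglyMeasurable 1
      (Filter.Eventually.of_forall fun q => ?_)
    rw [Real.norm_eq_abs, abs_of_nonneg (capCount_nonneg one_pos _ _ _ _ _)]
    exact (capCount_le one_pos _ _ _ _ _).trans (by simp)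
  · by_cases ht : 5 * (B + 1) ≤ q.2
    · have : k q.2 = 1 := by rw [hk]; exact Set.indicator_of_mem ht 1
      simp only [this, mul_one, hh]
      exact hp q.1 q.2 ht
    · have : k q.2 = 0 := by rw [hk]; exact Set.indicator_of_notMem ht 1
      simp only [this, mul_zero]
      exact capCount_nonneg one_pos _ _ _ _ _

lemma le_integral_meanCapCount (hn : 1 ≤ n)
    (hP : (legendrePoly n).eval (1 - 2 * (4 / (n : ℝ) ^ 2)) < -(1 / 5)) {B : ℝ} (hB : 0 < B) :
    (1 - Real.exp 48 / B) * (gaussianReal 0 1).real (Set.Ici (5 * (B + 1))) ≤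
      ∫ ξ, meanCapCount n 4 1 1 (H.Φ ξ) ∂stdGaussian (EuclideanSpace ℝ (Fin d)) := by
  have h4 : (0 : ℝ) ≤ 4 := by norm_num
  have hli := H.integrable_locNorm_prod hn h4
  have hle : ∫ x : Sphere2, ∫ ξ, locNorm n 4 (H.Φ ξ) x
      ∂stdGaussian (EuclideanSpace ℝ (Fin d)) ∂sphMeasure ≤ Real.exp 48 := by
    rw [← integral_integral_swap hli]
    refine (H.integral_integral_locNorm_le hn h4).trans (le_of_eq ?_)
    norm_num
  rw [H.integral_meanCapCount hn one_pos]
  obtain ⟨q, hq⟩ : ∃ q, q = (gaussianReal 0 1).real (Set.Ici (5 * (B + 1))) := ⟨_, rfl⟩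
  have hq0 : 0 < q := hq ▸ gaussianReal_Ici_pos _
  rw [← hq]
  have hi := hli.integral_prod_right
  calc (1 - Real.exp 48 / B) * q ≤ (1 - (∫ x : Sphere2, ∫ ξ, locNorm n 4 (H.Φ ξ) x
          ∂stdGaussian (EuclideanSpace ℝ (Fin d)) ∂sphMeasure) / B) * q := by gcongr
    _ = ∫ x : Sphere2, (1 - (∫ ξ, locNorm n 4 (H.Φ ξ) x
          ∂stdGaussian (EuclideanSpace ℝ (Fin d))) / B) * q ∂sphMeasure := by
        rw [integral_mul_const, integral_sub (integrable_const _) (hi.div_const _), integral_div]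
        simp
    _ ≤ _ := by
        refine integral_mono_ae (((integrable_const _).sub (hi.div_const _)).mul_const _)
          (H.integrable_capCount_prod hn one_pos 4 1 _).integral_prod_right ?_
        filter_upwards [hli.prod_left_ae] with x hx
        rw [hq]
        exact H.le_integral_capCount hn hP hB x hx

end HarmModel

lemma exists_posCount_lower_bound : ∃ κ : ℝ, 0 < κ ∧ ∃ n₀ : ℕ, ∀ n d (H : HarmModel n d), n₀ ≤ n →
    κ ≤ (stdGaussian (EuclideanSpace ℝ (Fin d))).real
      {ξ | κ ≤ (posCount (H.Φ ξ) : ℝ) / n ^ 2} := by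
  obtain ⟨q, hq⟩ : ∃ q, q = (gaussianReal 0 1).real
    (Set.Ici (5 * (2 * Real.exp 48 + 1))) := ⟨_, rfl⟩
  have hq0 : 0 < q := hq ▸ gaussianReal_Ici_pos _
  obtain ⟨n₀, hn₀⟩ := Filter.eventually_atTop.1
    (eventually_legendrePoly_lt.and (Filter.eventually_ge_atTop 1))
  refine ⟨q / 16, by positivity, n₀, fun n d H hn => ?_⟩
  obtain ⟨hP, hn1⟩ := hn₀ n hn
  have hn0 : (0 : ℝ) < n := by exact_mod_cast hn1
  have h1 := H.le_integral_meanCapCount hn1 hP (B := 2 * Real.exp 48) (by positivity)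
  rw [← hq] at h1
  have e : 1 - Real.exp 48 / (2 * Real.exp 48) = 1 / 2 := by
    have := Real.exp_pos 48
    field_simp; norm_num
  rw [e] at h1
  have h2 := H.lipschitzWith_meanCapCount hn1 one_pos (R := 4) (by norm_num) 1
  obtain ⟨γ, hγ⟩ : ∃ γ, γ = stdGaussian (EuclideanSpace ℝ (Fin d)) := ⟨_, rfl⟩
  have : IsProbabilityMeasure γ := hγ ▸ inferInstance
  rw [← hγ] at h1 ⊢
  obtain ⟨E, hE⟩ : ∃ E : Set (EuclideanSpace ℝ (Fin d)),
    E = {ξ | q / 4 ≤ meanCapCount n 4 1 1 (H.Φ ξ)} := ⟨_, rfl⟩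
  have hEm : MeasurableSet E := hE ▸ measurableSet_le measurable_const h2.continuous.measurable
  have hEi : Integrable (E.indicator (1 : EuclideanSpace ℝ (Fin d) → ℝ)) γ :=
    (integrable_const (1 : ℝ)).indicator hEm
  have h3 : ∫ ξ, meanCapCount n 4 1 1 (H.Φ ξ) ∂γ ≤ q / 4 + γ.real E := by
    calc _ ≤ ∫ ξ, (q / 4 + E.indicator 1 ξ) ∂γ := by
          refine integral_mono ?_ ?_ fun ξ => ?_
          · refine Integrable.of_bound h2.continuous.aestronglyMeasurable 1
              (Filter.Eventually.of_forall fun ξ => ?_)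
            rw [Real.norm_eq_abs, abs_of_nonneg (meanCapCount_nonneg one_pos _ _ _ _)]
            exact (meanCapCount_le hn1 (H.mem ξ) one_pos _ _).trans (by simp)
          · exact (integrable_const _).add hEi
          · by_cases hξ : ξ ∈ E
            · simp only [Set.indicator_of_mem hξ, Pi.one_apply]
              have := meanCapCount_le hn1 (H.mem ξ) one_pos 4 1
              push_cast at this
              linarith
            · simp only [Set.indicator_of_notMem hξ, add_zero]
              rw [hE] at hξ
              exact (not_le.1 hξ).le
      _ = q / 4 + γ.real E := by
          rw [integral_add (integrable_const _) hEi,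
            integral_indicator_one hEm]
          simp
  have h4 : E ⊆ {ξ | q / 16 ≤ (posCount (H.Φ ξ) : ℝ) / n ^ 2} := fun ξ hξ => by
    rw [hE] at hξ
    have h5 : q / 4 ≤ meanCapCount n 4 1 1 (H.Φ ξ) := hξ
    have h6 := meanCapCount_le_posCount hn1 (H.mem ξ) one_pos (R := 4) (by norm_num) 1
    have h7 : q / 16 ≤ (posCount (H.Φ ξ) : ℝ) / n ^ 2 := by
      have : (posCount (H.Φ ξ) : ℝ) * ((4 / n) ^ 2 / 4) =
        4 * ((posCount (H.Φ ξ) : ℝ) / n ^ 2) := by ring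
      linarith
    exact h7
  have h8 := measureReal_mono (μ := γ) h4
  linarith

/-! ### The limiting density of positive nodal domains -/

lemma exists_mem_of_measureReal_add_lt {α : Type*} [MeasurableSpace α] {μ : Measure α}
    [IsProbabilityMeasure μ] {A B : Set α} (h : μ.real A + μ.real B < 1) :
    ∃ x, x ∉ A ∧ x ∉ B := by
  by_contra! h'
  have : A ∪ B = Set.univ := Set.eq_univ_of_forall fun x => by
    by_cases hx : x ∈ A
    · exact Or.inl hx
    · exact Or.inr (h' x hx)
  have h2 := measureReal_union_le (μ := μ) A B
  rw [this, probReal_univ] at h2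
  linarith

lemma exists_limit_of_concentration {α : ℕ → Type} [∀ n, MeasurableSpace (α n)]
    {μ : ∀ n, Measure (α n)} [∀ n, IsProbabilityMeasure (μ n)] {Y : ∀ n, α n → ℝ} {K : ℝ}
    (h : ∀ ε : ℝ, 0 < ε → ∃ w c : ℝ, 0 < c ∧ ∃ n₀ : ℕ, ∀ n ≥ n₀,
      (μ n).real {x | ε < |Y n x - w|} ≤ K * Real.exp (-c * n)) :
    ∃ a : ℝ, ∀ ε : ℝ, 0 < ε → ∃ c : ℝ, 0 < c ∧ ∃ n₀ : ℕ, ∀ n ≥ n₀,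
      (μ n).real {x | ε < |Y n x - a|} ≤ K * Real.exp (-c * n) := by
  choose! w c hc n₀ hw using h
  have hsmall : ∀ ε, 0 < ε → ∀ᶠ n in Filter.atTop,
      (μ n).real {x | ε < |Y n x - w ε|} < 1 / 2 := fun ε hε => by
    have h1 : Filter.Tendsto (fun n : ℕ => K * Real.exp (-c ε * n)) Filter.atTop (nhds (K * 0)) := by
      refine (Real.tendsto_exp_atBot.comp ?_).const_mul K
      exact tendsto_natCast_atTop_atTop.const_mul_atTop_of_neg (neg_neg_of_pos (hc ε hε))
    rw [mul_zero] at h1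
    filter_upwards [h1.eventually_lt_const one_half_pos, Filter.eventually_ge_atTop (n₀ ε)]
      with n hn hn'
    exact (hw ε hε n hn').trans_lt hn
  have hclose : ∀ ε δ, 0 < ε → 0 < δ → |w ε - w δ| ≤ ε + δ := fun ε δ hε hδ => by
    obtain ⟨n, h1, h2⟩ := ((hsmall ε hε).and (hsmall δ hδ)).exists
    obtain ⟨x, hx1, hx2⟩ := exists_mem_of_measureReal_add_lt (by linarith :
      (μ n).real {x | ε < |Y n x - w ε|} + (μ n).real {x | δ < |Y n x - w δ|} < 1)
    have h3 : |Y n x - w ε| ≤ ε := not_lt.1 hx1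
    have h4 : |Y n x - w δ| ≤ δ := not_lt.1 hx2
    have := abs_sub_le (w ε) (Y n x) (w δ)
    rw [abs_sub_comm (w ε) (Y n x)] at this
    linarith
  obtain ⟨u, hu⟩ : ∃ u : ℕ → ℝ, u = fun k : ℕ => 1 / ((k : ℝ) + 1) := ⟨_, rfl⟩
  have hu0 : ∀ k, 0 < u k := fun k => by rw [hu]; positivity
  have hut : Filter.Tendsto u Filter.atTop (nhds 0) := hu ▸ tendsto_one_div_add_atTop_nhds_zero_nat
  have hcau : CauchySeq fun k => w (u k) := by
    refine Metric.cauchySeq_iff'.2 fun ε hε => ?_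
    obtain ⟨N, hN⟩ := Filter.eventually_atTop.1 (hut.eventually_lt_const (half_pos hε))
    refine ⟨N, fun k hk => (hclose _ _ (hu0 k) (hu0 N)).trans_lt ?_⟩
    linarith [hN k hk, hN N le_rfl]
  obtain ⟨a, ha⟩ := cauchySeq_tendsto_of_complete hcau
  have hwa : ∀ ε, 0 < ε → |w ε - a| ≤ ε := fun ε hε => by
    have h1 : Filter.Tendsto (fun k => |w ε - w (u k)|) Filter.atTop (nhds |w ε - a|) :=
      (tendsto_const_nhds.sub ha).abs
    have h2 : Filter.Tendsto (fun k => ε + u k) Filter.atTop (nhds (ε + 0)) :=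
      tendsto_const_nhds.add hut
    rw [add_zero] at h2
    exact le_of_tendsto_of_tendsto' h1 h2 fun k => hclose _ _ hε (hu0 k)
  refine ⟨a, fun ε hε => ⟨c (ε / 2), hc _ (half_pos hε), n₀ (ε / 2), fun n hn => ?_⟩⟩
  refine (measureReal_mono fun x hx => ?_).trans (hw _ (half_pos hε) n hn)
  have h1 : ε < |Y n x - a| := hx
  have h2 := abs_sub_le (Y n x) (w (ε / 2)) a
  have h3 := hwa _ (half_pos hε)
  have h4 : ε / 2 < |Y n x - w (ε / 2)| := by linarith
  exact h4

theorem exists_posCount_limit {d : ℕ → ℕ} (M : ∀ n, HarmModel n (d n)) :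
    ∃ a : ℝ, 0 < a ∧ ∀ ε : ℝ, 0 < ε → ∃ c : ℝ, 0 < c ∧ ∃ n₀ : ℕ, ∀ n ≥ n₀,
      (stdGaussian (EuclideanSpace ℝ (Fin (d n)))).real
        {ξ | ε < |(posCount ((M n).Φ ξ) : ℝ) / n ^ 2 - a|} ≤ 4 * Real.exp (-c * n) := by
  obtain ⟨a, ha⟩ := exists_limit_of_concentration
    (μ := fun n => stdGaussian (EuclideanSpace ℝ (Fin (d n))))
    (Y := fun n ξ => (posCount ((M n).Φ ξ) : ℝ) / n ^ 2) (K := 4) fun ε hε => by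
      obtain ⟨R, hR, T, s, hs, c, hc, n₀, hn₀, h⟩ := exists_posCount_concentration (half_pos hε)
      obtain ⟨b, hb⟩ := exists_tendsto_integral_meanCapCount M hR.le hs T
      have hb' := Metric.tendsto_nhds.1 (hb.const_mul (4 / R ^ 2)) (ε / 2) (half_pos hε)
      obtain ⟨N, hN⟩ := Filter.eventually_atTop.1 hb'
      refine ⟨4 / R ^ 2 * b, c, hc, max n₀ N, fun n hn => ?_⟩
      refine (measureReal_mono fun ξ hξ => ?_).trans (h n (d n) (M n) ((le_max_left _ _).trans hn))
      have h1 := hN n ((le_max_right _ _).trans hn)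
      rw [Real.dist_eq] at h1
      have h2 : ε < |(posCount ((M n).Φ ξ) : ℝ) / n ^ 2 - 4 / R ^ 2 * b| := hξ
      have h3 := abs_sub_le ((posCount ((M n).Φ ξ) : ℝ) / n ^ 2)
        (4 / R ^ 2 * ∫ ξ, meanCapCount n R T s ((M n).Φ ξ)
          ∂stdGaussian (EuclideanSpace ℝ (Fin (d n)))) (4 / R ^ 2 * b)
      have h4 : ε / 2 < |(posCount ((M n).Φ ξ) : ℝ) / n ^ 2 -
        4 / R ^ 2 * ∫ ξ, meanCapCount n R T s ((M n).Φ ξ)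
          ∂stdGaussian (EuclideanSpace ℝ (Fin (d n)))| := by linarith
      exact h4
  refine ⟨a, ?_, ha⟩
  obtain ⟨κ, hκ, n₁, h1⟩ := exists_posCount_lower_bound
  obtain ⟨c, hc, n₂, h2⟩ := ha (κ / 2) (half_pos hκ)
  have h3 : Filter.Tendsto (fun n : ℕ => 4 * Real.exp (-c * n)) Filter.atTop (nhds (4 * 0)) := by
    refine (Real.tendsto_exp_atBot.comp ?_).const_mul 4
    exact tendsto_natCast_atTop_atTop.const_mul_atTop_of_neg (neg_neg_of_pos hc)
  rw [mul_zero] at h3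
  obtain ⟨n, h4, h5⟩ := ((h3.eventually_lt_const hκ).and
    (Filter.eventually_ge_atTop (max n₁ n₂))).exists
  have h6 := h1 n (d n) (M n) ((le_max_left _ _).trans h5)
  have h7 := h2 n ((le_max_right _ _).trans h5)
  by_contra! h8
  have h9 : {ξ | κ ≤ (posCount ((M n).Φ ξ) : ℝ) / n ^ 2} ⊆
      {ξ | κ / 2 < |(posCount ((M n).Φ ξ) : ℝ) / n ^ 2 - a|} := fun ξ hξ => by
    have h10 : κ ≤ (posCount ((M n).Φ ξ) : ℝ) / n ^ 2 := hξ
    have h11 : κ / 2 < |(posCount ((M n).Φ ξ) : ℝ) / n ^ 2 - a| :=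
      lt_of_lt_of_le (by linarith) (le_abs_self _)
    exact h11
  have := measureReal_mono (μ := stdGaussian (EuclideanSpace ℝ (Fin (d n)))) h9
  linarith

/-! ### Realization of the random field by a Gaussian vector -/

lemma linearCombination_eq_sum_equiv {α κ V : Type*} [Fintype κ] [AddCommMonoid V] [Module ℝ V]
    (c : α →₀ ℝ) (e : κ ≃ c.support) (g : α → V) :
    Finsupp.linearCombination ℝ g c = ∑ i, c (e i) • g (e i) := by
  rw [Finsupp.linearCombination_apply, Finsupp.sum, ← Finset.sum_coe_sort]
  exact (e.sum_comp fun i : c.support => c i • g i).symm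

lemma map_linearCombination_gaussian {Ω : Type*} [MeasurableSpace Ω] {P : Measure Ω} {n d : ℕ}
    (H : HarmModel n d) {f : Sphere2 → Ω → ℝ}
    (hgauss : ∀ (k : ℕ) (c : Fin k → ℝ) (x : Fin k → Sphere2),
      Measure.map (fun ω => ∑ i, c i * f (x i) ω) P = gaussianReal 0
        (∑ i, ∑ j, c i * c j *
          (legendrePoly n).eval ⟪(x i : EuclideanSpace ℝ (Fin 3)), x j⟫).toNNReal)
    (c : Sphere2 →₀ ℝ) :
    P.map (Finsupp.linearCombination ℝ f c) = gaussianReal 0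
      (‖Finsupp.linearCombination ℝ (fun x : Sphere2 => H.feat x) c‖ ^ 2).toNNReal := by
  obtain ⟨e⟩ : Nonempty (Fin c.support.card ≃ c.support) := ⟨c.support.equivFin.symm⟩
  have h := hgauss _ (fun i => c (e i)) (fun i => e i)
  have e1 : Finsupp.linearCombination ℝ f c = fun ω => ∑ i, c (e i) * f (e i) ω := by
    rw [linearCombination_eq_sum_equiv c e]; ext ω; simp
  have e2 : ‖Finsupp.linearCombination ℝ (fun x : Sphere2 => H.feat x) c‖ ^ 2 =
      ∑ i, ∑ j, c (e i) * c (e j) *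
        (legendrePoly n).eval ⟪((e i : Sphere2) : E3), ((e j : Sphere2) : E3)⟫ := by
    rw [linearCombination_eq_sum_equiv c e, ← real_inner_self_eq_norm_sq, ← sum_sum_mul_inner]
    simp only [H.inner_feat (norm_sphere _) (norm_sphere _)]
  rw [e1, e2]
  exact h

lemma HarmModel.surjective_linearCombination_feat {n d : ℕ} (H : HarmModel n d) :
    Function.Surjective (Finsupp.linearCombination ℝ fun x : Sphere2 => H.feat x) := by
  rw [← LinearMap.range_eq_top, Finsupp.range_linearCombination,
    ← Submodule.orthogonal_eq_bot_iff, Submodule.eq_bot_iff]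
  intro ξ hξ
  refine H.eq_zero_of_inner_feat fun x => ?_
  rw [real_inner_comm]
  exact (Submodule.mem_orthogonal _ _).1 hξ _ (Submodule.subset_span ⟨x, rfl⟩)

theorem HarmModel.exists_realization {Ω : Type*} [MeasurableSpace Ω] {P : Measure Ω}
    [IsProbabilityMeasure P] {n d : ℕ} (H : HarmModel n d) {f : Sphere2 → Ω → ℝ}
    (hmeas : ∀ x, Measurable (f x))
    (hgauss : ∀ (k : ℕ) (c : Fin k → ℝ) (x : Fin k → Sphere2),
      Measure.map (fun ω => ∑ i, c i * f (x i) ω) P = gaussianReal 0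
        (∑ i, ∑ j, c i * c j *
          (legendrePoly n).eval ⟪(x i : EuclideanSpace ℝ (Fin 3)), x j⟫).toNNReal)
    (hcont : ∀ᵐ ω ∂P, Continuous fun x : Sphere2 => f x ω) :
    ∃ ξ : Ω → EuclideanSpace ℝ (Fin d), Measurable ξ ∧ P.map ξ = stdGaussian _ ∧
      ∀ᵐ ω ∂P, ∀ x : Sphere2, f x ω = ev (H.Φ (ξ ω)) x := by
  obtain ⟨σ, hσ⟩ := LinearMap.exists_rightInverse_of_surjective _
    (LinearMap.range_eq_top.2 H.surjective_linearCombination_feat)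
  obtain ⟨L, hL⟩ : ∃ L, L = Finsupp.linearCombination ℝ f := ⟨_, rfl⟩
  have hlaw := map_linearCombination_gaussian H hgauss
  rw [← hL] at hlaw
  have hLm : ∀ c, Measurable (L c) := fun c => by
    have h : L c = fun ω => ∑ x ∈ c.support, (c x • f x) ω := by
      ext ω
      rw [hL, Finsupp.linearCombination_apply, Finsupp.sum, Finset.sum_apply]
    rw [h]
    exact Finset.measurable_sum _ fun x _ => (hmeas x).const_smul (c x)
  obtain ⟨ξ, hξ⟩ : ∃ ξ : Ω → EuclideanSpace ℝ (Fin d), ξ = fun ω => WithLp.toLp 2 fun j =>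
    L (σ (EuclideanSpace.single j 1)) ω := ⟨_, rfl⟩
  have hξm : Measurable ξ := by
    rw [hξ]
    exact (WithLp.measurable_toLp 2 _).comp (measurable_pi_lambda _ fun j => hLm _)
  have hinner : ∀ ω v, ⟪ξ ω, v⟫ = L (σ v) ω := fun ω v => by
    have h : v = ∑ j, v j • EuclideanSpace.single j (1 : ℝ) := by
      ext i; simp [Finset.sum_apply, Pi.single_apply]
    conv_rhs => rw [h]
    simp [hξ, PiLp.inner_apply, map_sum]
  refine ⟨ξ, hξm, ?_, ?_⟩
  · have := Measure.isProbabilityMeasure_map (μ := P) hξm.aemeasurable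
    refine Measure.ext_of_charFun (funext fun t => ?_)
    rw [charFun_apply, integral_map hξm.aemeasurable (by fun_prop), charFun_stdGaussian]
    simp only [hinner]
    have h := hlaw (σ t)
    have hσt : Finsupp.linearCombination ℝ (fun x : Sphere2 => H.feat x) (σ t) = t :=
      LinearMap.congr_fun hσ t
    rw [hσt] at h
    have h2 : ∫ ω, Complex.exp (L (σ t) ω * Complex.I) ∂P =
        charFun (P.map (L (σ t))) 1 := by
      rw [charFun_apply, integral_map (hLm _).aemeasurable (by fun_prop)]
      simp
    rw [h2, h, charFun_gaussianReal, Real.coe_toNNReal _ (by positivity)]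
    congr 1
    push_cast
    ring
  · have hx : ∀ x : Sphere2, ∀ᵐ ω ∂P, f x ω = ev (H.Φ (ξ ω)) x := fun x => by
      have h := hlaw (Finsupp.single x 1 - σ (H.feat x))
      have hz : Finsupp.linearCombination ℝ (fun x : Sphere2 => H.feat x)
          (Finsupp.single x 1 - σ (H.feat x)) = 0 := by
        have := LinearMap.congr_fun hσ (H.feat x)
        rw [map_sub, Finsupp.linearCombination_single, one_smul, sub_eq_zero]
        exact this.symm
      rw [hz] at h
      simp only [norm_zero, ne_eq, OfNat.ofNat_ne_zero, not_false_eq_true, zero_pow,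
        Real.toNNReal_zero, gaussianReal_zero_var] at h
      have h1 : ∀ᵐ y ∂P.map (L (Finsupp.single x 1 - σ (H.feat x))), y = 0 := by
        rw [h, ae_dirac_eq]; rfl
      filter_upwards [ae_of_ae_map (hLm _).aemeasurable h1] with ω hω
      rw [map_sub, Pi.sub_apply, sub_eq_zero] at hω
      rw [H.ev_eq_inner, hinner, ← hω, hL, Finsupp.linearCombination_single, one_smul]
    obtain ⟨S, hSc, hSd⟩ := TopologicalSpace.exists_countable_dense Sphere2
    have hS : ∀ᵐ ω ∂P, ∀ x ∈ S, f x ω = ev (H.Φ (ξ ω)) x :=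
      (ae_ball_iff hSc).2 fun x _ => hx x
    filter_upwards [hS, hcont] with ω h1 h2 x
    exact congrFun (h2.ext_on hSd (continuous_ev_sphere _) h1) x

/-! ### The concentration theorem -/

lemma HarmModel.sphereNodalCount_eq {n d : ℕ} (hn : 1 ≤ n) (H : HarmModel n d)
    (η : EuclideanSpace ℝ (Fin d)) :
    sphereNodalCount (fun x : Sphere2 => ev (H.Φ η) x) =
      posCount (H.Φ η) + posCount (H.Φ (-η)) := by
  have hneg : -(fun y : Sphere2 => ev (H.Φ η) y) = fun y : Sphere2 => ev (H.Φ (-η)) y := by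
    ext y
    simp [H.ev_eq_inner]
  rw [sphereNodalCount, posCount, posCount, ← hneg]
  refine card_connectedComponents_ne_zero (continuous_ev_sphere _)
    (finite_compsIn_zero hn (H.mem η) _) ?_
  rw [hneg]
  exact finite_compsIn_zero hn (H.mem _) _

lemma stdGaussian_preimage_neg_le {d : ℕ} (B : Set (EuclideanSpace ℝ (Fin d))) :
    stdGaussian (EuclideanSpace ℝ (Fin d)) ((fun η => -η) ⁻¹' B) ≤
      stdGaussian (EuclideanSpace ℝ (Fin d)) B := by
  have h : (stdGaussian (EuclideanSpace ℝ (Fin d))).map (fun η => -η) = stdGaussian _ :=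
    stdGaussian_map (LinearIsometryEquiv.neg ℝ)
  calc _ ≤ ((stdGaussian (EuclideanSpace ℝ (Fin d))).map (fun η => -η)) B :=
        Measure.le_map_apply measurable_neg.aemeasurable B
    _ = _ := by rw [h]

theorem HarmModel.measure_sphereNodalCount_le {Ω : Type*} [MeasurableSpace Ω] {P : Measure Ω}
    [IsProbabilityMeasure P] {n d : ℕ} (hn : 1 ≤ n) (H : HarmModel n d) {f : Sphere2 → Ω → ℝ}
    (hmeas : ∀ x, Measurable (f x))
    (hgauss : ∀ (k : ℕ) (c : Fin k → ℝ) (x : Fin k → Sphere2),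
      Measure.map (fun ω => ∑ i, c i * f (x i) ω) P = gaussianReal 0
        (∑ i, ∑ j, c i * c j *
          (legendrePoly n).eval ⟪(x i : EuclideanSpace ℝ (Fin 3)), x j⟫).toNNReal)
    (hcont : ∀ᵐ ω ∂P, Continuous fun x : Sphere2 => f x ω) (a ε : ℝ) :
    P {ω | ε < |(sphereNodalCount (fun x => f x ω) : ℝ) / (n : ℝ) ^ 2 - 2 * a|} ≤
      2 * stdGaussian (EuclideanSpace ℝ (Fin d))
        {η | ε / 2 < |(posCount (H.Φ η) : ℝ) / (n : ℝ) ^ 2 - a|} := by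
  obtain ⟨ξ, hξm, hξ, hf⟩ := H.exists_realization hmeas hgauss hcont
  obtain ⟨B, hB⟩ : ∃ B : Set (EuclideanSpace ℝ (Fin d)),
    B = {η | ε / 2 < |(posCount (H.Φ η) : ℝ) / (n : ℝ) ^ 2 - a|} := ⟨_, rfl⟩
  have hsub : {ω | ε < |(sphereNodalCount (fun x => f x ω) : ℝ) / (n : ℝ) ^ 2 - 2 * a|} ≤ᵐ[P]
      ξ ⁻¹' (B ∪ (fun η => -η) ⁻¹' B) := by
    filter_upwards [hf] with ω hω h
    have h1 : ε < |(sphereNodalCount (fun x => f x ω) : ℝ) / (n : ℝ) ^ 2 - 2 * a| := h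
    have h2 : (fun x => f x ω) = fun x : Sphere2 => ev (H.Φ (ξ ω)) x := funext hω
    rw [h2, H.sphereNodalCount_eq hn] at h1
    change ξ ω ∈ B ∨ -ξ ω ∈ B
    by_contra! hc
    have h3 : |(posCount (H.Φ (ξ ω)) : ℝ) / (n : ℝ) ^ 2 - a| ≤ ε / 2 := by
      by_contra! h4
      exact hc.1 (by rw [hB]; exact h4)
    have h4 : |(posCount (H.Φ (-ξ ω)) : ℝ) / (n : ℝ) ^ 2 - a| ≤ ε / 2 := by
      by_contra! h4
      exact hc.2 (by rw [hB]; exact h4)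
    have h5 := abs_add_le ((posCount (H.Φ (ξ ω)) : ℝ) / (n : ℝ) ^ 2 - a)
      ((posCount (H.Φ (-ξ ω)) : ℝ) / (n : ℝ) ^ 2 - a)
    have h6 : ((posCount (H.Φ (ξ ω)) + posCount (H.Φ (-ξ ω)) : ℕ) : ℝ) / (n : ℝ) ^ 2 - 2 * a =
        ((posCount (H.Φ (ξ ω)) : ℝ) / (n : ℝ) ^ 2 - a) +
          ((posCount (H.Φ (-ξ ω)) : ℝ) / (n : ℝ) ^ 2 - a) := by
      push_cast; ring
    rw [h6] at h1
    linarith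
  rw [← hB]
  calc _ ≤ P (ξ ⁻¹' (B ∪ (fun η => -η) ⁻¹' B)) := measure_mono_ae hsub
    _ ≤ P.map ξ (B ∪ (fun η => -η) ⁻¹' B) := Measure.le_map_apply hξm.aemeasurable _
    _ ≤ stdGaussian _ B + stdGaussian _ ((fun η => -η) ⁻¹' B) := by
        rw [hξ]; exact measure_union_le _ _
    _ ≤ 2 * stdGaussian _ B := by
        rw [two_mul]; exact add_le_add le_rfl (stdGaussian_preimage_neg_le B)

/-- **Nazarov–Sodin concentration for random spherical harmonics.** Let `f n` be the
random spherical harmonic of degree `n`: a centered Gaussian field on `S²` with a.s.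
continuous sample paths and covariance `E[fₙ(x)fₙ(y)] = Pₙ(⟨x, y⟩)`, `Pₙ` the `n`-th
Legendre polynomial.  Then there is `a > 0` such that for every `ε > 0` there are
`C(ε), c(ε) > 0` with `P(|N(fₙ)/n² − a| > ε) ≤ C(ε) e^{−c(ε) n}` for every `n`, where
`N(fₙ)` is the number of nodal domains. -/
theorem nazarov_sodin_spherical_harmonics
    {Ω : Type*} [MeasurableSpace Ω] (P : Measure Ω) [IsProbabilityMeasure P]
    (f : ℕ → Sphere2 → Ω → ℝ)
    (hmeas : ∀ n x, Measurable (f n x))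
    (hgauss : ∀ (n k : ℕ) (c : Fin k → ℝ) (x : Fin k → Sphere2),
      Measure.map (fun ω => ∑ i, c i * f n (x i) ω) P =
        gaussianReal 0 (∑ i, ∑ j, c i * c j *
          (legendrePoly n).eval ⟪(x i : EuclideanSpace ℝ (Fin 3)),
            (x j : EuclideanSpace ℝ (Fin 3))⟫).toNNReal)
    (hcont : ∀ n, ∀ᵐ ω ∂P, Continuous (fun x : Sphere2 => f n x ω)) :
    ∃ a : ℝ, 0 < a ∧ ∀ ε : ℝ, 0 < ε → ∃ C : ℝ, 0 < C ∧ ∃ c : ℝ, 0 < c ∧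
      ∀ n : ℕ,
        P {ω | ε < |(sphereNodalCount (fun x => f n x ω) : ℝ) / (n : ℝ) ^ 2 - a|} ≤
          ENNReal.ofReal (C * Real.exp (-c * n)) := by
  choose d hd using exists_harmModel
  obtain ⟨M⟩ : Nonempty (∀ n, HarmModel n (d n)) := ⟨fun n => (hd n).some⟩
  obtain ⟨a, ha, hlim⟩ := exists_posCount_limit M
  refine ⟨2 * a, by positivity, fun ε hε => ?_⟩
  obtain ⟨c, hc, n₀, hn₀⟩ := hlim (ε / 2) (half_pos hε)
  refine ⟨8 + Real.exp (c * max n₀ 1), by positivity, c, hc, fun n => ?_⟩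
  rcases le_or_gt (max n₀ 1) n with hn | hn
  · refine ((M n).measure_sphereNodalCount_le ((le_max_right _ _).trans hn) (hmeas n) (hgauss n)
      (hcont n) a ε).trans ?_
    have h := hn₀ n ((le_max_left _ _).trans hn)
    have h2 : (2 : ENNReal) = ENNReal.ofReal 2 := (ENNReal.ofReal_ofNat 2).symm
    rw [← ofReal_measureReal]
    refine (mul_le_mul_left (h2.le) _).trans ?_
    rw [← ENNReal.ofReal_mul zero_le_two]
    refine ENNReal.ofReal_le_ofReal ?_
    have h1 : 0 ≤ Real.exp (c * max n₀ 1) * Real.exp (-c * n) := by positivity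
    linarith
  · refine prob_le_one.trans ?_
    rw [← ENNReal.ofReal_one]
    refine ENNReal.ofReal_le_ofReal ?_
    have h1 : (n : ℝ) ≤ ((max n₀ 1 : ℕ) : ℝ) := by exact_mod_cast hn.le
    have h2 : 1 ≤ Real.exp (c * max n₀ 1) * Real.exp (-c * n) := by
      rw [← Real.exp_add]
      refine Real.one_le_exp ?_
      nlinarith
    have h3 := Real.exp_pos (-c * n)
    linarith
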